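/- (Adaptive posterior concentration with a prior on the network width.) Assume data are generated as in the nonparametric Gaussian regression model (Y | X ∼ N(f_0(X), σ_0²)) or the nonparametric logistic regression model (Y | X ∼ Bernoulli(φ(f_0(X)))), with f_0 following the hierarchical composition structure H(N, P). For ν ∈ [0,1), put a prior on the width r ∈ ℕ given by Π_r(r) ∝ exp(−(log n)^5 · r²), and given r consider the DNN model with architecture (L_n, (d, r, …, r, 1)) where L_n = ⌈C̃_L log n⌉; conditionally on r, let Π_θ on ℝ^{T_n(r)} satisfy Assumption 1 (and Π_{σ²} satisfy Assumption 2 in the Gaussian case). Then, for ε_n = max_{(β',d') ∈ P} n^{−β'/(2β'+d')} (log n)^γ with γ > 5/2 and any M_n → ∞: in the Gaussian regression case, Π_n( (θ, σ²) : ‖T_F ∘ f_{θ,ρν} − f_0‖_{2,P_X} + |σ² − σ_0²| > M_n ε_n | D^{(n)} ) → 0 in P_0^n-probability, and in the logistic case Π_n( θ : ‖φ ∘ T_F ∘ f_{θ,ρν} − φ ∘ f_0‖_{2,P_X} > M_n ε_n | D^{(n)} ) → 0 in P_0^n-probability; the prior on r does not depend on P, so the rate is attained adaptively. -/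

import Mathlib

open MeasureTheory ProbabilityTheory Filter
open scoped ENNReal NNReal

noncomputable section

/-- Leaky-ReLU activation. -/
def lrelu (ν x : ℝ) : ℝ := max x (ν * x)

/-- A fully connected Leaky-ReLU network with input dimension `d` and hidden width `r`:
a first affine layer `ℝ^d → ℝ^r`, a list of inner affine layers `ℝ^r → ℝ^r`, and an
output affine layer `ℝ^r → ℝ`.  Each affine layer except the last is followed by the
componentwise Leaky-ReLU activation.  The number of hidden layers (the depth) is
`hid.length + 1`. -/
structure LNet (d r : ℕ) where
  W0 : Fin r → Fin d → ℝ
  b0 : Fin r → ℝ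
  hid : List ((Fin r → Fin r → ℝ) × (Fin r → ℝ))
  Wout : Fin r → ℝ
  bout : ℝ

/-- Evaluation of a Leaky-ReLU network. -/
def LNet.eval (ν : ℝ) {d r : ℕ} (net : LNet d r) (x : Fin d → ℝ) : ℝ :=
  let h := net.hid.foldl
    (fun (h : Fin r → ℝ) p => fun i => lrelu ν ((∑ j, p.1 i j * h j) + p.2 i))
    (fun i => lrelu ν ((∑ j, net.W0 i j * x j) + net.b0 i))
  (∑ i, net.Wout i * h i) + net.bout

/-- All weights and biases of the network are bounded by `B` in absolute value. -/
def LNet.bounded {d r : ℕ} (net : LNet d r) (B : ℝ) : Prop :=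
  (∀ i j, |net.W0 i j| ≤ B) ∧ (∀ i, |net.b0 i| ≤ B) ∧
  (∀ p ∈ net.hid, (∀ i j, |p.1 i j| ≤ B) ∧ (∀ i, |p.2 i| ≤ B)) ∧
  (∀ i, |net.Wout i| ≤ B) ∧ |net.bout| ≤ B

/-- Membership in the class `F_{ρν}^{DNN}(L, r, B)` of Leaky-ReLU networks with
architecture `(L, (d, r, …, r, 1))` and all parameters bounded by `B`. -/
def memDNN (ν : ℝ) (d L r : ℕ) (B : ℝ) (f : (Fin d → ℝ) → ℝ) : Prop :=
  ∃ net : LNet d r, net.hid.length + 1 = L ∧ net.bounded B ∧ ∀ x, f x = net.eval ν x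

/-- The cube `[−a,a]^d`. -/
def cube (a : ℝ) (d : ℕ) : Set (Fin d → ℝ) := {x | ∀ i, x i ∈ Set.Icc (-a) a}

/-- Partial derivative of `f : ℝ^d → ℝ` in coordinate `i`. -/
def pder {d : ℕ} (i : Fin d) (f : (Fin d → ℝ) → ℝ) : (Fin d → ℝ) → ℝ :=
  fun x => fderiv ℝ f x (Pi.single i 1)

/-- Multi-index partial derivative `∂^α f = ∂_1^{α 1} ⋯ ∂_d^{α d} f`. -/
def pderm {d : ℕ} (α : Fin d → ℕ) (f : (Fin d → ℝ) → ℝ) : (Fin d → ℝ) → ℝ :=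
  (List.finRange d).foldr (fun i g => (pder i)^[α i] g) f

/-- Membership in the Hölder ball `H_d^β(K)` on `[−a,a]^d`: `f` is `⌊β⌋`-times
continuously differentiable and there are bounds `S α` on `|∂^α f|` over the cube for all
multi-indices with `|α|₁ < β`, and Hölder constants `H α` for `∂^α f` (with exponent
`β − ⌊β⌋`, with respect to the sup-norm) for all multi-indices with `|α|₁ = ⌊β⌋`, whose
total sum is at most `K`. -/
def memHolder (a : ℝ) (d : ℕ) (β K : ℝ) (f : (Fin d → ℝ) → ℝ) : Prop :=
  ContDiff ℝ (⌊β⌋₊ : ℕ∞) f ∧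
  ∃ S H : (Fin d → Fin (⌊β⌋₊ + 1)) → ℝ,
    (∀ α : Fin d → Fin (⌊β⌋₊ + 1), ((∑ i, (α i : ℕ) : ℕ) : ℝ) < β →
      ∀ x ∈ cube a d, |pderm (fun i => (α i : ℕ)) f x| ≤ S α) ∧
    (∀ α : Fin d → Fin (⌊β⌋₊ + 1), (∑ i, (α i : ℕ)) = ⌊β⌋₊ →
      ∀ x₁ ∈ cube a d, ∀ x₂ ∈ cube a d, x₁ ≠ x₂ →
        |pderm (fun i => (α i : ℕ)) f x₁ - pderm (fun i => (α i : ℕ)) f x₂| ≤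
          H α * ‖x₁ - x₂‖ ^ (β - (⌊β⌋₊ : ℝ))) ∧
    (∑ α ∈ Finset.univ.filter
        (fun α : Fin d → Fin (⌊β⌋₊ + 1) => ((∑ i, (α i : ℕ) : ℕ) : ℝ) < β), S α) +
      (∑ α ∈ Finset.univ.filter
        (fun α : Fin d → Fin (⌊β⌋₊ + 1) => (∑ i, (α i : ℕ)) = ⌊β⌋₊), H α) ≤ K

/-- `f : ℝ^d → ℝ` follows the hierarchical composition structure `H(N, P)` (with constants
`K, F, C_Lip` and `N_q := 1`): there are functions `f_{l,i}` (`0 ≤ l ≤ q`, `0 ≤ i < N_l`)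
such that each `f_{0,i}` is a coordinate projection, each `f_{l,i}` (`1 ≤ l ≤ q`) is
obtained by applying a `C_Lip`-Lipschitz function `g_{l,i} ∈ H_{d_{l,i}}^{β_{l,i}}(K)` with
`(β_{l,i}, d_{l,i}) ∈ P`, `Σᵢ d_{l,i} = N_{l−1}` and `‖g_{l,i}‖_∞ ≤ F` to consecutive
blocks of the previous level, and `f = f_{q,1}`. -/
def followsHCS (a : ℝ) (d q : ℕ) (N : ℕ → ℕ) (P : Finset (ℝ × ℕ)) (K F CLip : ℝ)
    (f : (Fin d → ℝ) → ℝ) : Prop :=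
  0 < q ∧ N q = 1 ∧
  ∃ (fl : ℕ → ℕ → (Fin d → ℝ) → ℝ)
    (βh : ℕ → ℕ → ℝ) (dh : ℕ → ℕ → ℕ)
    (g : (l : ℕ) → (i : ℕ) → (Fin (dh l i) → ℝ) → ℝ),
    (∀ i < N 0, ∃ j : Fin d, ∀ x, fl 0 i x = x j) ∧
    (∀ l, 1 ≤ l → l ≤ q → ∀ i < N l,
      (βh l i, dh l i) ∈ P ∧
      (∀ y z : Fin (dh l i) → ℝ,
        |g l i y - g l i z| ≤ CLip * Real.sqrt (∑ j, (y j - z j) ^ 2)) ∧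
      memHolder (max a (2 * F)) (dh l i) (βh l i) K (g l i) ∧
      (∀ y, |g l i y| ≤ F) ∧
      (∀ x, fl l i x =
        g l i (fun j => fl (l - 1) ((∑ i' ∈ Finset.range i, dh l i') + j) x))) ∧
    (∀ l, 1 ≤ l → l ≤ q → (∑ i ∈ Finset.range (N l), dh l i) = N (l - 1)) ∧
    (∀ x, f x = fl q 0 x)

/-- `max_{(β',d') ∈ P} n^{−β'/(2β'+d')}`, the hierarchical-composition approximation rate. -/
def maxRate (P : Finset (ℝ × ℕ)) (hP : P.Nonempty) (n : ℕ) : ℝ :=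
  P.sup' hP fun p => (n : ℝ) ^ (-(p.1 / (2 * p.1 + p.2)))

/-- `max_{(β',d') ∈ P} n^{d'/(2(2β'+d'))}`, which governs the network width. -/
def maxWidthExp (P : Finset (ℝ × ℕ)) (hP : P.Nonempty) (n : ℕ) : ℝ :=
  P.sup' hP fun p => (n : ℝ) ^ ((p.2 : ℝ) / (2 * (2 * p.1 + p.2)))

/-- Index type for the parameters `θ` of a DNN with architecture `(L, (d, r, …, r, 1))`:
first-layer weights and biases, the `L−1` inner-layer weight matrices and bias vectors,
and the output-layer weights and bias.  Its cardinality is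
`T = (d+1)r + (L−1)(r+1)r + (r+1)`. -/
abbrev ParamIdx (d r L : ℕ) : Type :=
  (Fin r × Fin d) ⊕ Fin r ⊕ (Fin (L - 1) × Fin r × Fin r) ⊕ (Fin (L - 1) × Fin r) ⊕
    Fin r ⊕ Unit

/-- The Leaky-ReLU network with architecture `(L, (d, r, …, r, 1))` determined by the
parameter vector `θ`. -/
def netOfParams (ν : ℝ) (d r L : ℕ) (θ : ParamIdx d r L → ℝ) (x : Fin d → ℝ) : ℝ :=
  let h0 : Fin r → ℝ := fun i =>
    lrelu ν ((∑ j, θ (Sum.inl (i, j)) * x j) + θ (Sum.inr (Sum.inl i)))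
  let h : Fin r → ℝ := (List.finRange (L - 1)).foldl
    (fun h l => fun i =>
      lrelu ν ((∑ j, θ (Sum.inr (Sum.inr (Sum.inl (l, i, j)))) * h j) +
        θ (Sum.inr (Sum.inr (Sum.inr (Sum.inl (l, i))))))) h0
  (∑ i, θ (Sum.inr (Sum.inr (Sum.inr (Sum.inr (Sum.inl i))))) * h i) +
    θ (Sum.inr (Sum.inr (Sum.inr (Sum.inr (Sum.inr ())))))

/-- Truncation operator `T_F(x) = min(max(x, −F), F)`. -/
def trunc (F x : ℝ) : ℝ := min (max x (-F)) F

/-- The Gaussian density with mean `m` and variance `s`, evaluated at `y`. -/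
def gpdf (m s y : ℝ) : ℝ :=
  (Real.sqrt (2 * Real.pi * s))⁻¹ * Real.exp (-((y - m) ^ 2) / (2 * s))

/-- The joint law of `(X, Y)` where `X ∼ P_X` and `Y | X ∼ N(f₀(X), v)`. -/
def gaussRegLaw (d : ℕ) (PX : Measure (Fin d → ℝ)) (f₀ : (Fin d → ℝ) → ℝ) (v : ℝ≥0) :
    Measure ((Fin d → ℝ) × ℝ) :=
  PX.bind fun x => (gaussianReal (f₀ x) v).map fun y => (x, y)

/-- Posterior mass of the set `A` under prior `prior` and likelihood `lik`. -/
def postMass {α : Type*} [MeasurableSpace α] (prior : Measure α) (lik : α → ℝ)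
    (A : Set α) : ℝ≥0∞ :=
  (∫⁻ p in A, ENNReal.ofReal (lik p) ∂prior) / ∫⁻ p, ENNReal.ofReal (lik p) ∂prior

/-- The `L²(P_X)` distance `‖g − h‖_{2,P_X}`. -/
def l2dist (d : ℕ) (PX : Measure (Fin d → ℝ)) (g h : (Fin d → ℝ) → ℝ) : ℝ :=
  Real.sqrt (∫ x, (g x - h x) ^ 2 ∂PX)

/-- The Gaussian regression likelihood of `(θ, σ²)` given the data `D`. -/
def gaussLik (ν F : ℝ) (d r L : ℕ) {n : ℕ} (D : Fin n → (Fin d → ℝ) × ℝ)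
    (p : (ParamIdx d r L → ℝ) × ℝ) : ℝ :=
  ∏ i, gpdf (trunc F (netOfParams ν d r L p.1 (D i).1)) p.2 (D i).2

/-- The sigmoid function `φ(z) = (1 + e^{−z})⁻¹`. -/
def sigmoid (z : ℝ) : ℝ := (1 + Real.exp (-z))⁻¹

/-- The Bernoulli distribution on `ℝ` with success probability `p` (mass `p` at `1` and
`1 − p` at `0`). -/
def bern (p : ℝ) : Measure ℝ :=
  ENNReal.ofReal p • Measure.dirac 1 + ENNReal.ofReal (1 - p) • Measure.dirac 0

/-- The joint law of `(X, Y)` where `X ∼ P_X` and `Y | X ∼ Bernoulli(φ(f₀(X)))`. -/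
def logisticLaw (d : ℕ) (PX : Measure (Fin d → ℝ)) (f₀ : (Fin d → ℝ) → ℝ) :
    Measure ((Fin d → ℝ) × ℝ) :=
  PX.bind fun x => (bern (sigmoid (f₀ x))).map fun y => (x, y)

/-- The logistic-regression (Bernoulli) likelihood of `θ` given the data `D`. -/
def bernLik (ν F : ℝ) (d r L : ℕ) {n : ℕ} (D : Fin n → (Fin d → ℝ) × ℝ)
    (θ : ParamIdx d r L → ℝ) : ℝ :=
  ∏ i, sigmoid (trunc F (netOfParams ν d r L θ (D i).1)) ^ (D i).2 *
    (1 - sigmoid (trunc F (netOfParams ν d r L θ (D i).1))) ^ (1 - (D i).2)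

/-- The depth `L_n = ⌈C̃_L log n⌉` of the Bayesian model. -/
def Ldepth (CL : ℝ) (n : ℕ) : ℕ := ⌈CL * Real.log n⌉₊

/-- The width `⌈C̃_r · max_{(β',d') ∈ P} n^{d'/(2(2β'+d'))}⌉` used in the hierarchical
approximation lemma. -/
def rwidthH (Cr : ℝ) (P : Finset (ℝ × ℕ)) (hP : P.Nonempty) (n : ℕ) : ℕ :=
  ⌈Cr * maxWidthExp P hP n⌉₊

/-- The (unnormalized) prior weight `Π_r(r) ∝ exp(−(log n)^5 r²)` on the width `r ≥ 1`.
Since the posterior is a ratio, the normalizing constant cancels. -/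
def widthWeight (n r : ℕ) : ℝ≥0∞ :=
  if r = 0 then 0 else ENNReal.ofReal (Real.exp (-(Real.log n) ^ 5 * (r : ℝ) ^ 2))

set_option linter.all false


/-- evaluation map at a finite set of points -/
def evZ {σ : Type*} (Z : Finset (σ → ℝ)) : MvPolynomial σ ℝ →ₗ[ℝ] (Z → ℝ) where
  toFun p := fun z => MvPolynomial.eval z.1 p
  map_add' p q := by ext z; simp
  map_smul' c p := by ext z; simp [MvPolynomial.smul_eval]

lemma evZ_surj {σ : Type*} [Fintype σ] (Z : Finset (σ → ℝ)) :
    Function.Surjective (evZ Z) := by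
  classical
  intro v
  let P : (σ → ℝ) → MvPolynomial σ ℝ := fun z0 =>
    ∏ z ∈ Z.erase z0, ∑ i, (MvPolynomial.X i - MvPolynomial.C (z i)) ^ 2
  have hP : ∀ z0 z1 : σ → ℝ, MvPolynomial.eval z1 (P z0)
      = ∏ z ∈ Z.erase z0, ∑ i, (z1 i - z i) ^ 2 := by
    intro z0 z1
    simp [P, MvPolynomial.eval_prod, MvPolynomial.eval_sum]
  have h0 : ∀ z0 ∈ Z, ∀ z1 ∈ Z, z1 ≠ z0 → MvPolynomial.eval z1 (P z0) = 0 := by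
    intro z0 _ z1 h1 hne
    rw [hP]
    apply Finset.prod_eq_zero (Finset.mem_erase.2 ⟨hne, h1⟩)
    simp
  have h1 : ∀ z0 ∈ Z, MvPolynomial.eval z0 (P z0) ≠ 0 := by
    intro z0 _
    rw [hP]
    apply Finset.prod_ne_zero_iff.2
    intro z hz
    have hne : z0 ≠ z := (Finset.ne_of_mem_erase hz).symm
    obtain ⟨i, hi⟩ := Function.ne_iff.1 hne
    have : 0 < ∑ i, (z0 i - z i) ^ 2 := by
      apply Finset.sum_pos'
      · intro i _; positivity
      · exact ⟨i, Finset.mem_univ _, by have := sub_ne_zero.2 hi; positivity⟩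
    exact this.ne'
  refine ⟨∑ z0 : Z, MvPolynomial.C (v z0 / MvPolynomial.eval z0.1 (P z0.1)) * P z0.1, ?_⟩
  ext z1
  show MvPolynomial.eval z1.1 _ = _
  rw [MvPolynomial.eval_sum]
  rw [Finset.sum_eq_single z1]
  · simp only [map_mul, MvPolynomial.eval_C]
    field_simp [h1 z1.1 z1.2]
  · intro b _ hb
    simp only [map_mul, MvPolynomial.eval_C]
    rw [h0 b.1 b.2 z1.1 z1.2 (fun h => hb (Subtype.ext h.symm))]
    simp
  · simp

lemma card_zeros_le {σ : Type*} [Fintype σ] [DecidableEq σ] (Z : Finset (σ → ℝ)) (D : ℕ)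
    (q : σ → MvPolynomial σ ℝ) (hq : ∀ i, (q i).totalDegree < D)
    (hZ : ∀ z ∈ Z, ∀ i, z i ^ D = MvPolynomial.eval z (q i)) :
    Z.card ≤ D ^ Fintype.card σ := by
  classical
  let b : (σ → Fin D) → (Z → ℝ) := fun m =>
    evZ Z (MvPolynomial.monomial (Finsupp.equivFunOnFinite.symm fun i => (m i : ℕ)) 1)
  let W := Submodule.span ℝ (Set.range b)
  have key : ∀ n : ℕ, ∀ p : MvPolynomial σ ℝ, p.totalDegree < n → evZ Z p ∈ W := by
    intro n
    induction n with
    | zero => intro p hp; omega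
    | succ n ih =>
      intro p hp
      rw [p.as_sum, map_sum]
      apply Submodule.sum_mem
      intro m hm
      have hdeg : m.sum (fun _ e => e) ≤ n :=
        le_trans (MvPolynomial.le_totalDegree hm) (by omega)
      have hc : (MvPolynomial.monomial m (p.coeff m) : MvPolynomial σ ℝ)
          = p.coeff m • MvPolynomial.monomial m 1 := by
        simp [MvPolynomial.smul_monomial]
      rw [hc, map_smul]
      apply Submodule.smul_mem
      by_cases hbox : ∀ i, m i < D
      · apply Submodule.subset_span
        refine ⟨fun i => ⟨m i, hbox i⟩, ?_⟩
        simp only [b]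
        congr 2
        ext i; simp
      · push Not at hbox
        obtain ⟨i, hi⟩ := hbox
        set m' : σ →₀ ℕ := m - Finsupp.single i D with hm'
        have hmm : m = m' + Finsupp.single i D := by
          ext j
          by_cases hj : j = i
          · subst hj; simp [hm']; omega
          · simp [hm', Finsupp.single_apply, Ne.symm hj]
        have hev : evZ Z (MvPolynomial.monomial m 1) = evZ Z (MvPolynomial.monomial m' 1 * q i) := by
          ext z
          show MvPolynomial.eval z.1 _ = MvPolynomial.eval z.1 _
          rw [map_mul, ← hZ z.1 z.2 i]
          have : (MvPolynomial.monomial m 1 : MvPolynomial σ ℝ)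
              = MvPolynomial.monomial m' 1 * MvPolynomial.X i ^ D := by
            rw [MvPolynomial.X_pow_eq_monomial, MvPolynomial.monomial_mul, ← hmm]; simp
          rw [this]; simp
        rw [hev]
        apply ih
        have h1 := MvPolynomial.totalDegree_mul (MvPolynomial.monomial m' (1:ℝ)) (q i)
        have h2 := MvPolynomial.totalDegree_monomial_le m' (1:ℝ)
        have h3 : m.sum (fun _ e => e) = m'.sum (fun _ e => e) + D := by
          conv_lhs => rw [hmm]
          rw [Finsupp.sum_add_index' (by simp) (by simp)]
          simp
        have := hq i
        change _ ≤ m'.sum (fun _ e => e) at h2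
        omega
  have htop : W = ⊤ := by
    rw [eq_top_iff]
    rintro v -
    obtain ⟨p, rfl⟩ := evZ_surj Z v
    exact key (p.totalDegree + 1) p (by omega)
  have h1 := finrank_range_le_card (R := ℝ) b
  rw [Set.finrank] at h1
  change Module.finrank ℝ W ≤ _ at h1
  rw [htop, finrank_top, Module.finrank_fintype_fun_eq_card] at h1
  simpa using h1

lemma hasDerivAt_eval_update {σ : Type*} [DecidableEq σ] (p : MvPolynomial σ ℝ) (z : σ → ℝ) (i : σ) :
    ∀ t : ℝ, HasDerivAt (fun t : ℝ => MvPolynomial.eval (Function.update z i t) p)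
      (MvPolynomial.eval (Function.update z i t) (MvPolynomial.pderiv i p)) t := by
  intro t
  induction p using MvPolynomial.induction_on with
  | C a => simpa using hasDerivAt_const t a
  | add p q hp hq => simpa using hp.fun_add hq
  | mul_X p j hp =>
    have hX : HasDerivAt (fun t : ℝ => Function.update z i t j)
        (if j = i then 1 else 0) t := by
      by_cases h : j = i
      · subst h; simpa using hasDerivAt_id' t
      · simpa [h] using hasDerivAt_const t (z j)
    have := hp.fun_mul hX
    simp only [map_mul, MvPolynomial.eval_X]
    refine this.congr_deriv ?_
    rw [Derivation.leibniz]
    simp only [smul_eq_mul, map_add, map_mul, MvPolynomial.eval_X, MvPolynomial.pderiv_X]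
    by_cases h : j = i
    · subst h; simp; ring
    · simp [h, Pi.single_apply, Ne.symm h]; ring

/-- pderiv lowers the degree -/
lemma totalDegree_pderiv_le {σ : Type*} [DecidableEq σ] (p : MvPolynomial σ ℝ) (i : σ) :
    (MvPolynomial.pderiv i p).totalDegree ≤ p.totalDegree := by
  rw [p.as_sum, map_sum]
  refine (MvPolynomial.totalDegree_finsetSum _ _).trans ?_
  apply Finset.sup_le
  intro m hm
  rw [MvPolynomial.pderiv_monomial]
  refine (MvPolynomial.totalDegree_monomial_le _ _).trans ?_
  rw [← p.as_sum]
  refine le_trans ?_ (MvPolynomial.le_totalDegree hm)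
  have hle : m - Finsupp.single i 1 ≤ m := tsub_le_self
  exact Finsupp.degree_mono hle



lemma eval_growth {σ : Type*} [Fintype σ] (p : MvPolynomial σ ℝ) (D : ℕ) (hD : p.totalDegree ≤ D) :
    ∃ C : ℝ, 0 ≤ C ∧ ∀ z : σ → ℝ, 1 ≤ ‖z‖ → |MvPolynomial.eval z p| ≤ C * ‖z‖ ^ D := by
  classical
  refine ⟨∑ m ∈ p.support, |p.coeff m|, by positivity, ?_⟩
  intro z hz
  rw [MvPolynomial.eval_eq, Finset.sum_mul]
  refine (Finset.abs_sum_le_sum_abs _ _).trans (Finset.sum_le_sum ?_)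
  intro m hm
  rw [abs_mul]
  gcongr
  rw [Finset.abs_prod]
  calc ∏ i ∈ m.support, |z i ^ m i| ≤ ∏ i ∈ m.support, ‖z‖ ^ m i := by
        apply Finset.prod_le_prod
        · intro i _; positivity
        · intro i _
          rw [abs_pow]
          gcongr
          exact norm_le_pi_norm z i
    _ = ‖z‖ ^ (∑ i ∈ m.support, m i) := by rw [Finset.prod_pow_eq_pow_sum]
    _ ≤ ‖z‖ ^ D := pow_le_pow_right₀ hz (le_trans (MvPolynomial.le_totalDegree hm) hD)

lemma sum_pow_ge_norm {σ : Type*} [Fintype σ] (z : σ → ℝ) (hz : 1 ≤ ‖z‖) (k : ℕ) :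
    ‖z‖ ^ (2 * k) ≤ ∑ i, z i ^ (2 * k) := by
  by_contra hcon
  push Not at hcon
  have : ‖z‖ < ‖z‖ := by
    rw [pi_norm_lt_iff (by linarith)]
    intro i
    by_contra h
    push Not at h
    have h1 : z i ^ (2 * k) ≤ ∑ i, z i ^ (2 * k) :=
      Finset.single_le_sum (f := fun i => z i ^ (2 * k))
        (fun i _ => by rw [pow_mul]; positivity) (Finset.mem_univ i)
    have h2 : ‖z‖ ^ (2 * k) ≤ ‖z i‖ ^ (2 * k) := by gcongr
    rw [Real.norm_eq_abs (z i), pow_mul |z i|, sq_abs, ← pow_mul] at h2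
    linarith
  exact lt_irrefl _ this

theorem sign_pattern_strict {σ ι : Type*} [Fintype σ] [Fintype ι]
    (p : ι → MvPolynomial σ ℝ) (D : ℕ) (hD : ∀ i, (p i).totalDegree ≤ D)
    (Θ : Finset (σ → ℝ)) (hne : ∀ θ ∈ Θ, ∀ i, MvPolynomial.eval θ (p i) ≠ 0)
    (hinj : ∀ θ ∈ Θ, ∀ θ' ∈ Θ, (∀ i, 0 < MvPolynomial.eval θ (p i) ↔ 0 < MvPolynomial.eval θ' (p i))
      → θ = θ') :
    Θ.card ≤ (2 * Fintype.card ι * D + 1) ^ Fintype.card σ := by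
  classical
  set G : MvPolynomial σ ℝ := ∏ i, (p i) ^ 2 with hG
  set k := Fintype.card ι * D + 1 with hk
  have hGdeg : G.totalDegree ≤ 2 * (Fintype.card ι * D) := by
    rw [hG]
    refine (MvPolynomial.totalDegree_finset_prod _ _).trans ?_
    calc ∑ i, ((p i) ^ 2).totalDegree ≤ ∑ i : ι, 2 * D := by
          apply Finset.sum_le_sum
          intro i _
          refine (MvPolynomial.totalDegree_pow _ _).trans ?_
          have := hD i
          omega
      _ = _ := by simp; ring
  have hGev : ∀ z, MvPolynomial.eval z G = ∏ i, (MvPolynomial.eval z (p i)) ^ 2 := by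
    intro z; simp [hG, MvPolynomial.eval_prod]
  have hGpos : ∀ θ ∈ Θ, 0 < MvPolynomial.eval θ G := by
    intro θ hθ
    rw [hGev]
    apply Finset.prod_pos
    intro i _
    have := hne θ hθ i
    positivity
  -- choose t
  obtain ⟨t, ht0, ht⟩ : ∃ t : ℝ, 0 < t ∧ ∀ θ ∈ Θ,
      t * ∑ i, θ i ^ (2 * k) < MvPolynomial.eval θ G := by
    have h1 : ∀ᶠ t : ℝ in nhdsWithin 0 (Set.Ioi 0), ∀ θ ∈ Θ,
        t * ∑ i, θ i ^ (2 * k) < MvPolynomial.eval θ G := by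
      rw [Filter.eventually_all_finset]
      intro θ hθ
      have hc : Tendsto (fun t : ℝ => t * ∑ i, θ i ^ (2 * k)) (nhdsWithin 0 (Set.Ioi 0)) (nhds 0) := by
        have : Continuous (fun t : ℝ => t * ∑ i, θ i ^ (2 * k)) := by fun_prop
        have h := this.tendsto 0
        simp only [zero_mul] at h
        exact h.mono_left nhdsWithin_le_nhds
      exact hc.eventually_lt_const (hGpos θ hθ)
    obtain ⟨t, h2, h3⟩ := (h1.and self_mem_nhdsWithin).exists
    exact ⟨t, h3, h2⟩
  set f : MvPolynomial σ ℝ := MvPolynomial.C t * ∑ i, MvPolynomial.X i ^ (2 * k) - G with hf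
  have hfev : ∀ z, MvPolynomial.eval z f = t * ∑ i, z i ^ (2 * k) - MvPolynomial.eval z G := by
    intro z; simp [hf]
  have hcont : ∀ q : MvPolynomial σ ℝ, Continuous fun z => MvPolynomial.eval z q :=
    fun q => MvPolynomial.continuous_eval q
  obtain ⟨C, hC0, hC⟩ := eval_growth G _ hGdeg
  -- large z
  obtain ⟨R, hR1, hR⟩ : ∃ R : ℝ, 1 ≤ R ∧ ∀ z : σ → ℝ, R ≤ ‖z‖ → 0 < MvPolynomial.eval z f := by
    refine ⟨1 + C / t, by have : 0 ≤ C / t := by positivity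
                          linarith, ?_⟩
    intro z hz
    have hct : 0 ≤ C / t := by positivity
    have hz1 : 1 ≤ ‖z‖ := by linarith
    rw [hfev]
    have h1 := sum_pow_ge_norm z hz1 k
    have h2 := (le_abs_self _).trans (hC z hz1)
    have h3 : C * ‖z‖ ^ (2 * (Fintype.card ι * D)) < t * ‖z‖ ^ (2 * k) := by
      have h4 : 2 * k = 2 * (Fintype.card ι * D) + 2 := by rw [hk]; ring
      rw [h4, pow_add]
      have h5 : C < t * ‖z‖ ^ 2 := by
        have : C / t < ‖z‖ := by linarith
        rw [div_lt_iff₀ ht0] at this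
        nlinarith
      have h6 : 0 < ‖z‖ ^ (2 * (Fintype.card ι * D)) := by positivity
      nlinarith
    nlinarith
  -- minimisers
  have hmin : ∀ θ ∈ Θ, ∃ z : σ → ℝ, (∀ i, 0 < MvPolynomial.eval z (p i) * MvPolynomial.eval θ (p i)) ∧
      ∀ i, MvPolynomial.eval z (MvPolynomial.pderiv i f) = 0 := by
    intro θ hθ
    have hfθ : MvPolynomial.eval θ f < 0 := by rw [hfev]; linarith [ht θ hθ]
    let Kθ : Set (σ → ℝ) := {z | ∀ i, 0 ≤ MvPolynomial.eval z (p i) * MvPolynomial.eval θ (p i)}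
    have hKc : IsClosed Kθ := by
      have : Kθ = ⋂ i, {z | 0 ≤ MvPolynomial.eval z (p i) * MvPolynomial.eval θ (p i)} := by
        ext z; simp [Kθ]
      rw [this]
      apply isClosed_iInter
      intro i
      exact isClosed_le continuous_const ((hcont _).mul continuous_const)
    have hcomp : IsCompact (Metric.closedBall (0 : σ → ℝ) R ∩ Kθ) :=
      (isCompact_closedBall _ _).inter_right hKc
    have hθR : ‖θ‖ < R := by
      by_contra h
      push Not at h
      linarith [hR θ h]
    have hθmem : θ ∈ Metric.closedBall (0 : σ → ℝ) R ∩ Kθ :=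
      ⟨by simpa using hθR.le, fun i => mul_self_nonneg _⟩
    obtain ⟨z, hzmem, hzmin⟩ := hcomp.exists_isMinOn ⟨θ, hθmem⟩ (hcont f).continuousOn
    have hfz : MvPolynomial.eval z f < 0 := lt_of_le_of_lt (hzmin hθmem) hfθ
    have hzR : ‖z‖ < R := by
      by_contra h
      push Not at h
      linarith [hR z h]
    have hGz : 0 < MvPolynomial.eval z G := by
      rw [hfev] at hfz
      have : 0 ≤ t * ∑ i, z i ^ (2 * k) := by
        apply mul_nonneg ht0.le
        apply Finset.sum_nonneg
        intro i _; rw [pow_mul]; positivity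
      linarith
    have hstrict : ∀ i, 0 < MvPolynomial.eval z (p i) * MvPolynomial.eval θ (p i) := by
      intro i
      refine lt_of_le_of_ne (hzmem.2 i) ?_
      intro h
      have h1 : MvPolynomial.eval z (p i) = 0 := by
        rcases mul_eq_zero.1 h.symm with h | h
        · exact h
        · exact absurd h (hne θ hθ i)
      rw [hGev, Finset.prod_eq_zero (Finset.mem_univ i) (by rw [h1]; simp)] at hGz
      exact lt_irrefl _ hGz
    refine ⟨z, hstrict, ?_⟩
    intro i
    have hloc : IsLocalMin (fun z => MvPolynomial.eval z f) z := by
      have h1 : ∀ᶠ w in nhds z, ‖w‖ < R := continuous_norm.continuousAt.eventually_lt_const hzR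
      have h2 : ∀ᶠ w in nhds z, ∀ i, 0 < MvPolynomial.eval w (p i) * MvPolynomial.eval θ (p i) := by
        rw [Filter.eventually_all]
        intro i
        exact ((hcont (p i)).mul continuous_const).continuousAt.eventually_const_lt (hstrict i)
      filter_upwards [h1, h2] with w hw1 hw2
      exact hzmin ⟨by simpa using hw1.le, fun i => (hw2 i).le⟩
    have hcu : ContinuousAt (fun s : ℝ => Function.update z i s) (z i) :=
      (continuous_const.update i continuous_id).continuousAt
    have hloc2 : IsLocalMin (fun s : ℝ => MvPolynomial.eval (Function.update z i s) f) (z i) := by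
      have hz' : Function.update z i (z i) = z := Function.update_eq_self i z
      have : Tendsto (fun s : ℝ => Function.update z i s) (nhds (z i)) (nhds z) := by
        have := hcu.tendsto
        rwa [hz'] at this
      have h3 := this.eventually hloc
      show ∀ᶠ s in nhds (z i), MvPolynomial.eval (Function.update z i (z i)) f ≤
        MvPolynomial.eval (Function.update z i s) f
      rw [hz']
      exact h3
    have := hloc2.hasDerivAt_eq_zero (hasDerivAt_eval_update f z i (z i))
    rwa [Function.update_eq_self] at this
  choose! z hz1 hz2 using hmin
  have hinjz : Set.InjOn z Θ := by
    intro θ hθ θ' hθ' h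
    apply hinj θ hθ θ' hθ'
    intro i
    have a1 := hz1 θ hθ i
    have a2 := hz1 θ' hθ' i
    rw [h] at a1
    constructor
    · intro h0
      have : 0 < MvPolynomial.eval (z θ') (p i) := pos_of_mul_pos_left a1 h0.le
      exact pos_of_mul_pos_right a2 this.le
    · intro h0
      have : 0 < MvPolynomial.eval (z θ') (p i) := pos_of_mul_pos_left a2 h0.le
      exact pos_of_mul_pos_right a1 this.le
  rw [← Finset.card_image_of_injOn hinjz]
  have h2k : 2 * Fintype.card ι * D + 1 = 2 * k - 1 := by rw [hk]; ring_nf; omega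
  rw [h2k]
  apply card_zeros_le _ _ (fun i => MvPolynomial.C (1 / (t * (2 * k))) * MvPolynomial.pderiv i G)
  · intro i
    have h1 := MvPolynomial.totalDegree_mul (MvPolynomial.C (1 / (t * (2 * (k:ℝ))))) (MvPolynomial.pderiv i G)
    have h2 := totalDegree_pderiv_le G i
    rw [MvPolynomial.totalDegree_C] at h1
    have : 2 * k = 2 * (Fintype.card ι * D) + 2 := by rw [hk]; ring
    omega
  · intro w hw i
    obtain ⟨θ, hθ, rfl⟩ := Finset.mem_image.1 hw
    have h := hz2 θ hθ i
    rw [hf] at h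
    have hkp : (0:ℝ) < k := by rw [hk]; positivity
    simp only [map_sub, map_mul, Derivation.leibniz, map_sum, MvPolynomial.pderiv_C, smul_zero,
      add_zero, smul_eq_mul, MvPolynomial.eval_C, Derivation.leibniz_pow, MvPolynomial.pderiv_X,
      Pi.single_apply, map_nsmul, MvPolynomial.eval_X, map_pow, nsmul_eq_mul, mul_ite, mul_one,
      mul_zero, smul_ite, apply_ite, map_zero, map_one, Finset.sum_ite_eq', Finset.mem_univ, if_true, map_natCast, Finset.sum_ite_eq] at h
    rw [MvPolynomial.eval_mul, MvPolynomial.eval_C]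
    push_cast at h
    field_simp
    linarith

theorem sign_pattern_bound {σ ι : Type*} [Fintype σ] [Fintype ι]
    (p : ι → MvPolynomial σ ℝ) (D : ℕ) (hD : ∀ i, (p i).totalDegree ≤ D)
    (Θ : Finset (σ → ℝ))
    (hinj : ∀ θ ∈ Θ, ∀ θ' ∈ Θ, (∀ i, 0 < MvPolynomial.eval θ (p i) ↔ 0 < MvPolynomial.eval θ' (p i))
      → θ = θ') :
    Θ.card ≤ (2 * Fintype.card ι * D + 1) ^ Fintype.card σ := by
  classical
  obtain ⟨e, he0, he⟩ : ∃ e : ℝ, 0 < e ∧ ∀ θ ∈ Θ, ∀ i, 0 < MvPolynomial.eval θ (p i) →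
      e < MvPolynomial.eval θ (p i) := by
    have h1 : ∀ᶠ t : ℝ in nhdsWithin 0 (Set.Ioi 0), ∀ θ ∈ Θ, ∀ i, 0 < MvPolynomial.eval θ (p i) →
      t < MvPolynomial.eval θ (p i) := by
      rw [Filter.eventually_all_finset]
      intro θ hθ
      rw [Filter.eventually_all]
      intro i
      by_cases h : 0 < MvPolynomial.eval θ (p i)
      · have : Tendsto (fun t : ℝ => t) (nhdsWithin 0 (Set.Ioi 0)) (nhds 0) :=
          tendsto_id.mono_left nhdsWithin_le_nhds
        filter_upwards [this.eventually_lt_const h] with t ht _ using ht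
      · exact Eventually.of_forall fun t h' => absurd h' h
    obtain ⟨t, h2, h3⟩ := (h1.and self_mem_nhdsWithin).exists
    exact ⟨t, h3, h2⟩
  have hiff : ∀ θ ∈ Θ, ∀ i, 0 < MvPolynomial.eval θ (p i - MvPolynomial.C e) ↔
      0 < MvPolynomial.eval θ (p i) := by
    intro θ hθ i
    simp only [map_sub, MvPolynomial.eval_C]
    constructor
    · intro h; linarith
    · intro h; linarith [he θ hθ i h]
  apply sign_pattern_strict (fun i => p i - MvPolynomial.C e) D
  · intro i
    refine (MvPolynomial.totalDegree_sub _ _).trans ?_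
    simp [hD i]
  · intro θ hθ i
    by_cases h : 0 < MvPolynomial.eval θ (p i)
    · exact ((hiff θ hθ i).2 h).ne'
    · simp only [map_sub, MvPolynomial.eval_C]
      intro h2; linarith
  · intro θ hθ θ' hθ' h
    apply hinj θ hθ θ' hθ'
    intro i
    rw [← hiff θ hθ i, ← hiff θ' hθ' i]
    exact h i



lemma lrelu_pos {ν x : ℝ} (hν1 : ν < 1) (hx : 0 < x) : lrelu ν x = x := by
  unfold lrelu; apply max_eq_left; nlinarith
lemma lrelu_nonpos {ν x : ℝ} (hν1 : ν < 1) (hx : ¬ 0 < x) : lrelu ν x = ν * x := by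
  unfold lrelu; apply max_eq_right; nlinarith

lemma card_image_pattern_le {σ ι : Type*} [Fintype σ] [Fintype ι] [DecidableEq ι]
    (p : ι → MvPolynomial σ ℝ) (D : ℕ) (hD : ∀ i, (p i).totalDegree ≤ D) (Θ : Finset (σ → ℝ)) :
    (Θ.image (fun θ (i : ι) => decide (0 < MvPolynomial.eval θ (p i)))).card ≤
      (2 * Fintype.card ι * D + 1) ^ Fintype.card σ := by
  classical
  set s : (σ → ℝ) → ι → Bool := fun θ i => decide (0 < MvPolynomial.eval θ (p i)) with hs
  have hsec : ∀ y ∈ Θ.image s, ∃ θ ∈ Θ, s θ = y := by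
    intro y hy; simpa using hy
  choose! g hg1 hg2 using hsec
  have hinj : Set.InjOn g (Θ.image s) := by
    intro y hy y' hy' h
    rw [← hg2 y hy, ← hg2 y' hy', h]
  rw [← Finset.card_image_of_injOn hinj]
  apply sign_pattern_bound p D hD
  intro θ hθ θ' hθ' h
  obtain ⟨y, hy, rfl⟩ := Finset.mem_image.1 hθ
  obtain ⟨y', hy', rfl⟩ := Finset.mem_image.1 hθ'
  have : y = y' := by
    rw [← hg2 y hy, ← hg2 y' hy']
    funext i
    simp only [hs]
    exact decide_eq_decide.2 (h i)
  rw [this]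

lemma fold_pattern {σ Λ : Type*} [Fintype σ] {N r : ℕ} (ν : ℝ) (hν1 : ν < 1)
    (W : Λ → Fin r → Fin r → σ) (b : Λ → Fin r → σ) (wo : Fin r → σ) (bo : σ)
    (u : Fin N → ℝ) (l : List Λ) :
    ∀ (D : ℕ) (H : (σ → ℝ) → Fin N → Fin r → ℝ) (Θ : Finset (σ → ℝ))
      (p : Fin N → Fin r → MvPolynomial σ ℝ) (_ : ∀ k i, (p k i).totalDegree ≤ D)
      (_ : ∀ θ ∈ Θ, ∀ k i, H θ k i = MvPolynomial.eval θ (p k i))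
      (_ : ∀ θ ∈ Θ, ∀ θ' ∈ Θ, (∀ k, u k < (∑ i, θ (wo i) * (l.foldl (fun (h : Fin r → ℝ) l => fun i =>
          lrelu ν ((∑ j, θ (W l i j) * h j) + θ (b l i))) (H θ k)) i) + θ bo ↔
          u k < (∑ i, θ' (wo i) * (l.foldl (fun (h : Fin r → ℝ) l => fun i =>
          lrelu ν ((∑ j, θ' (W l i j) * h j) + θ' (b l i))) (H θ' k)) i) + θ' bo) → θ = θ'),
      Θ.card ≤ ((2 * (N * (r + 1)) * (D + l.length + 1) + 1) ^ Fintype.card σ) ^ (l.length + 1) := by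
  classical
  have degstep : ∀ (D : ℕ) (p : Fin r → MvPolynomial σ ℝ) (hp : ∀ i, (p i).totalDegree ≤ D)
      (w : Fin r → σ) (c : MvPolynomial σ ℝ) (hc : c.totalDegree ≤ D + 1),
      (∑ j, MvPolynomial.X (w j) * p j + c).totalDegree ≤ D + 1 := by
    intro D p hp w c hc
    refine (MvPolynomial.totalDegree_add _ _).trans (max_le ?_ hc)
    refine (MvPolynomial.totalDegree_finsetSum _ _).trans ?_
    apply Finset.sup_le
    intro j _
    refine (MvPolynomial.totalDegree_mul _ _).trans ?_
    rw [MvPolynomial.totalDegree_X]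
    have := hp j
    omega
  induction l with
  | nil =>
    intro D H Θ p hp hH hinj
    simp only [List.foldl_nil, List.length_nil] at *
    have hq : ∀ k, (∑ i, MvPolynomial.X (wo i) * p k i + (MvPolynomial.X bo - MvPolynomial.C (u k))).totalDegree ≤ D + 1 := by
      intro k
      apply degstep D (p k) (hp k)
      refine (MvPolynomial.totalDegree_sub _ _).trans (max_le ?_ ?_)
      · rw [MvPolynomial.totalDegree_X]; omega
      · rw [MvPolynomial.totalDegree_C]; omega
    have h1 := sign_pattern_bound (fun k : Fin N => ∑ i, MvPolynomial.X (wo i) * p k i +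
      (MvPolynomial.X bo - MvPolynomial.C (u k))) (D + 1) hq Θ ?_
    · refine h1.trans ?_
      rw [zero_add, pow_one, Fintype.card_fin]
      gcongr
      · exact Nat.le_mul_of_pos_right _ (by omega)
    · intro θ hθ θ' hθ' h
      apply hinj θ hθ θ' hθ'
      intro k
      have := h k
      simp only [map_add, map_sum, map_mul, map_sub, MvPolynomial.eval_X, MvPolynomial.eval_C] at this
      simp only [hH θ hθ, hH θ' hθ']
      rw [← sub_pos, ← sub_pos (a := _ + θ' bo), add_sub_assoc, add_sub_assoc]
      exact this
  | cons a l ih =>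
    intro D H Θ p hp hH hinj
    set q : Fin N × Fin r → MvPolynomial σ ℝ := fun ki =>
      ∑ j, MvPolynomial.X (W a ki.2 j) * p ki.1 j + MvPolynomial.X (b a ki.2) with hqdef
    have hq : ∀ ki, (q ki).totalDegree ≤ D + 1 := by
      intro ki
      apply degstep D (p ki.1) (hp ki.1)
      rw [MvPolynomial.totalDegree_X]; omega
    have himg := card_image_pattern_le q (D + 1) hq Θ
    set s : (σ → ℝ) → Fin N × Fin r → Bool := fun θ i => decide (0 < MvPolynomial.eval θ (q i)) with hs
    set C := (2 * (N * (r + 1)) * (D + (a :: l).length + 1) + 1) ^ Fintype.card σ with hC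
    have hfib : ∀ y ∈ Θ.image s, (Θ.filter fun θ => s θ = y).card ≤ C ^ (l.length + 1) := by
      intro y hy
      have := ih (D + 1) (fun θ k i => lrelu ν ((∑ j, θ (W a i j) * H θ k j) + θ (b a i)))
        (Θ.filter fun θ => s θ = y)
        (fun k i => if y (k, i) then q (k, i) else MvPolynomial.C ν * q (k, i)) ?_ ?_ ?_
      · refine this.trans (le_of_eq ?_)
        rw [hC]
        simp only [List.length_cons]
        ring_nf
      · intro k i
        split_ifs
        · exact hq _
        · refine (MvPolynomial.totalDegree_mul _ _).trans ?_
          rw [MvPolynomial.totalDegree_C, zero_add]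
          exact hq _
      · intro θ hθ k i
        rw [Finset.mem_filter] at hθ
        have hsy : decide (0 < MvPolynomial.eval θ (q (k, i))) = y (k, i) := congrFun hθ.2 (k, i)
        have hev : MvPolynomial.eval θ (q (k, i)) = (∑ j, θ (W a i j) * H θ k j) + θ (b a i) := by
          simp [hqdef, hH θ hθ.1]
        rw [← hsy, ← hev]
        by_cases h : 0 < MvPolynomial.eval θ (q (k, i))
        · rw [lrelu_pos hν1 h]; simp [h]
        · rw [lrelu_nonpos hν1 h]; simp [h]
      · intro θ hθ θ' hθ' h
        rw [Finset.mem_filter] at hθ hθ'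
        exact hinj θ hθ.1 θ' hθ'.1 h
    have h1 := Finset.card_le_mul_card_image (f := s) Θ _ hfib
    refine h1.trans ?_
    have h2 : (Θ.image s).card ≤ C := by
      refine himg.trans ?_
      rw [hC, Fintype.card_prod, Fintype.card_fin, Fintype.card_fin]
      gcongr
      · omega
      · simp
    calc _ ≤ C ^ (l.length + 1) * C := by gcongr
      _ = C ^ ((a :: l).length + 1) := by rw [List.length_cons]; ring

theorem net_pattern_bound (ν : ℝ) (hν1 : ν < 1) (d r L N : ℕ)
    (x : Fin N → Fin d → ℝ) (u : Fin N → ℝ)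
    (Θ : Finset (ParamIdx d r L → ℝ))
    (hinj : ∀ θ ∈ Θ, ∀ θ' ∈ Θ, (∀ k, u k < netOfParams ν d r L θ (x k) ↔ 
      u k < netOfParams ν d r L θ' (x k)) → θ = θ') :
    Θ.card ≤ ((2 * (N * (r + 1)) * (L + 2) + 1) ^ Fintype.card (ParamIdx d r L)) ^ (L + 2) := by
  classical
  -- the first layer pattern
  set q : Fin N × Fin r → MvPolynomial (ParamIdx d r L) ℝ := fun ki =>
      ∑ j, MvPolynomial.X (Sum.inl (ki.2, j)) * MvPolynomial.C (x ki.1 j) + MvPolynomial.X (Sum.inr (Sum.inl ki.2)) with hqdef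
  have hq : ∀ ki, (q ki).totalDegree ≤ 1 := by
    intro ki
    refine (MvPolynomial.totalDegree_add _ _).trans (max_le ?_ ?_)
    · refine (MvPolynomial.totalDegree_finsetSum _ _).trans ?_
      apply Finset.sup_le
      intro j _
      refine (MvPolynomial.totalDegree_mul _ _).trans ?_
      rw [MvPolynomial.totalDegree_X, MvPolynomial.totalDegree_C]
    · rw [MvPolynomial.totalDegree_X]
  have himg := card_image_pattern_le q 1 hq Θ
  set s : (ParamIdx d r L → ℝ) → Fin N × Fin r → Bool := fun θ i => decide (0 < MvPolynomial.eval θ (q i)) with hs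
  set C := (2 * (N * (r + 1)) * (L + 2) + 1) ^ Fintype.card (ParamIdx d r L) with hC
  have hC1 : 1 ≤ C := Nat.one_le_pow _ _ (by omega)
  have hfib : ∀ y ∈ Θ.image s, (Θ.filter fun θ => s θ = y).card ≤ C ^ (L + 1) := by
    intro y hy
    have := fold_pattern ν hν1 (σ := ParamIdx d r L)
      (fun l i j => Sum.inr (Sum.inr (Sum.inl (l, i, j))))
      (fun l i => Sum.inr (Sum.inr (Sum.inr (Sum.inl (l, i)))))
      (fun i => Sum.inr (Sum.inr (Sum.inr (Sum.inr (Sum.inl i)))))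
      (Sum.inr (Sum.inr (Sum.inr (Sum.inr (Sum.inr ()))))) u (List.finRange (L - 1)) 1
      (fun θ k i => lrelu ν ((∑ j, θ (Sum.inl (i, j)) * x k j) + θ (Sum.inr (Sum.inl i))))
      (Θ.filter fun θ => s θ = y)
      (fun k i => if y (k, i) then q (k, i) else MvPolynomial.C ν * q (k, i)) ?_ ?_ ?_
    · refine this.trans ?_
      rw [hC, List.length_finRange]
      calc _ ≤ ((2 * (N * (r + 1)) * (L + 2) + 1) ^ Fintype.card (ParamIdx d r L)) ^ (L - 1 + 1) := by
            have hle : 1 + (L - 1) + 1 ≤ L + 2 := by omega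
            exact Nat.pow_le_pow_left (Nat.pow_le_pow_left (Nat.succ_le_succ
              (Nat.mul_le_mul_left _ hle)) _) _
        _ ≤ _ := Nat.pow_le_pow_right hC1 (by omega)
    · intro k i
      split_ifs
      · exact hq _
      · refine (MvPolynomial.totalDegree_mul _ _).trans ?_
        rw [MvPolynomial.totalDegree_C, zero_add]
        exact hq _
    · intro θ hθ k i
      rw [Finset.mem_filter] at hθ
      have hsy : decide (0 < MvPolynomial.eval θ (q (k, i))) = y (k, i) := congrFun hθ.2 (k, i)
      have hev : MvPolynomial.eval θ (q (k, i)) = (∑ j, θ (Sum.inl (i, j)) * x k j) + θ (Sum.inr (Sum.inl i)) := by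
        simp [hqdef]
      rw [← hsy, ← hev]
      by_cases h : 0 < MvPolynomial.eval θ (q (k, i))
      · rw [lrelu_pos hν1 h]; simp [h]
      · rw [lrelu_nonpos hν1 h]; simp [h]
    · intro θ hθ θ' hθ' h
      rw [Finset.mem_filter] at hθ hθ'
      exact hinj θ hθ.1 θ' hθ'.1 h
  have h1 := Finset.card_le_mul_card_image (f := s) Θ _ hfib
  refine h1.trans ?_
  have h2 : (Θ.image s).card ≤ C := by
    refine himg.trans ?_
    rw [hC, Fintype.card_prod, Fintype.card_fin, Fintype.card_fin]
    gcongr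
    · omega
    · omega
  calc _ ≤ C ^ (L + 1) * C := by gcongr
    _ = C ^ (L + 2) := by ring



lemma greedy_points {X κ : Type*} [MeasurableSpace X] (PX : Measure X) [IsProbabilityMeasure PX]
    (A : κ → Set X) (hA : ∀ q, MeasurableSet (A q)) (η : ℝ) (hη0 : 0 ≤ η) (N : ℕ) :
    ∀ Q : Finset κ, (∀ q ∈ Q, η ≤ PX.real (A q)) → (Q.card : ℝ) * (Real.exp (-η)) ^ N < 1 →
      ∃ x : Fin N → X, ∀ q ∈ Q, ∃ k, x k ∈ A q := by
  classical
  induction N with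
  | zero =>
    intro Q _ hlt
    have : Q.card = 0 := by
      have : (Q.card : ℝ) < 1 := by simpa using hlt
      exact_mod_cast Nat.lt_one_iff.1 (by exact_mod_cast this)
    rw [Finset.card_eq_zero] at this
    subst this
    exact ⟨Fin.elim0, by simp⟩
  | succ N ih =>
    intro Q hQ hlt
    have hintg : ∀ q, Integrable ((A q).indicator (fun _ => (1:ℝ))) PX := fun q =>
      (integrable_const (1:ℝ)).indicator (hA q)
    obtain ⟨x0, hx0⟩ := exists_integral_le (μ := PX)
      (f := fun x => ∑ q ∈ Q, (A q).indicator (fun _ => (1:ℝ)) x)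
      (integrable_finset_sum _ fun q _ => hintg q)
    rw [integral_finset_sum _ (fun q _ => hintg q)] at hx0
    have h1 : η * Q.card ≤ ∑ q ∈ Q, (A q).indicator (fun _ => (1:ℝ)) x0 := by
      refine le_trans ?_ hx0
      calc η * Q.card = ∑ q ∈ Q, η := by simp; ring
        _ ≤ _ := by
          apply Finset.sum_le_sum
          intro q hq
          rw [integral_indicator_const _ (hA q)]
          simpa using hQ q hq
    have h2 : ∑ q ∈ Q, (A q).indicator (fun _ => (1:ℝ)) x0 = ((Q.filter fun q => x0 ∈ A q).card : ℝ) := by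
      rw [Finset.card_filter]; push_cast; rfl
    have h3 : (Q.filter fun q => x0 ∈ A q).card + (Q.filter fun q => ¬ x0 ∈ A q).card = Q.card :=
      Finset.card_filter_add_card_filter_not _
    have h3' : ((Q.filter fun q => x0 ∈ A q).card : ℝ) + (Q.filter fun q => ¬ x0 ∈ A q).card = Q.card := by
      exact_mod_cast h3
    have h4 : ((Q.filter fun q => ¬ x0 ∈ A q).card : ℝ) ≤ Real.exp (-η) * Q.card := by
      have h5 : 1 - η ≤ Real.exp (-η) := by linarith [Real.add_one_le_exp (-η)]
      have : (0:ℝ) ≤ Q.card := by positivity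
      nlinarith
    obtain ⟨x, hx⟩ := ih (Q.filter fun q => ¬ x0 ∈ A q)
      (fun q hq => hQ q (Finset.mem_filter.1 hq).1) (by
        have he : 0 < (Real.exp (-η)) ^ N := by positivity
        calc _ ≤ (Real.exp (-η) * Q.card) * (Real.exp (-η)) ^ N := by gcongr
          _ = Q.card * (Real.exp (-η)) ^ (N+1) := by ring
          _ < 1 := hlt)
    refine ⟨Fin.cons x0 x, ?_⟩
    intro q hq
    by_cases h : x0 ∈ A q
    · exact ⟨0, by simpa using h⟩
    · obtain ⟨k, hk⟩ := hx q (Finset.mem_filter.2 ⟨hq, h⟩)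
      exact ⟨k.succ, by simpa using hk⟩

lemma trunc_abs_le {F x : ℝ} (hF : 0 ≤ F) : |trunc F x| ≤ F := by
  unfold trunc
  rw [abs_le]
  constructor
  · exact le_min (le_max_right _ _) (by linarith)
  · exact min_le_right _ _

lemma continuous_lrelu (ν : ℝ) : Continuous (lrelu ν) := by unfold lrelu; fun_prop
lemma continuous_trunc (F : ℝ) : Continuous (trunc F) := by unfold trunc; fun_prop

lemma continuous_netOfParams (ν : ℝ) (d r L : ℕ) :
    Continuous (fun q : (ParamIdx d r L → ℝ) × (Fin d → ℝ) => netOfParams ν d r L q.1 q.2) := by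
  unfold netOfParams
  have hfold : ∀ (l : List (Fin (L - 1))) (h : (ParamIdx d r L → ℝ) × (Fin d → ℝ) → Fin r → ℝ), Continuous h →
      Continuous (fun q => l.foldl (fun (h : Fin r → ℝ) l => fun i =>
      lrelu ν ((∑ j, q.1 (Sum.inr (Sum.inr (Sum.inl (l, i, j)))) * h j) +
        q.1 (Sum.inr (Sum.inr (Sum.inr (Sum.inl (l, i))))))) (h q)) := by
    intro l
    induction l with
    | nil => intro h hh; simpa using hh
    | cons a l ih =>
      intro h hh
      simp only [List.foldl_cons]
      apply ih (fun q => fun i =>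
      lrelu ν ((∑ j, q.1 (Sum.inr (Sum.inr (Sum.inl (a, i, j)))) * h q j) +
        q.1 (Sum.inr (Sum.inr (Sum.inr (Sum.inl (a, i)))))))
      apply continuous_pi
      intro i
      apply (continuous_lrelu ν).comp
      fun_prop
  have h0 := hfold (List.finRange (L - 1)) (fun q => fun i =>
    lrelu ν ((∑ j, q.1 (Sum.inl (i, j)) * q.2 j) + q.1 (Sum.inr (Sum.inl i)))) (by
      apply continuous_pi
      intro i
      apply (continuous_lrelu ν).comp
      fun_prop)
  refine Continuous.add (continuous_finset_sum _ fun i _ => Continuous.mul (by fun_prop) ?_) (by fun_prop)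
  exact (continuous_apply i).comp h0

lemma measurable_netOfParams_right (ν : ℝ) (d r L : ℕ) (θ) :
    Measurable (fun x : Fin d → ℝ => netOfParams ν d r L θ x) :=
  ((continuous_netOfParams ν d r L).comp (by fun_prop : Continuous fun x : Fin d → ℝ => (θ, x))).measurable

lemma sep_measure {X : Type*} [MeasurableSpace X] (PX : Measure X) [IsProbabilityMeasure PX]
    (f g : X → ℝ) (hf : Measurable f) (hg : Measurable g) (F ε : ℝ) (hF : 0 < F) (hε : 0 < ε)
    (hfF : ∀ x, |f x| ≤ F) (hgF : ∀ x, |g x| ≤ F)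
    (hsep : ε < Real.sqrt (∫ x, (f x - g x) ^ 2 ∂PX)) :
    3 * ε ^ 2 / (16 * F ^ 2) ≤ PX.real {x | ε / 2 < |f x - g x|} := by
  set A := {x | ε / 2 < |f x - g x|} with hA
  have hAm : MeasurableSet A := measurableSet_lt measurable_const (hf.sub hg).abs
  have h1 : ε ^ 2 < ∫ x, (f x - g x) ^ 2 ∂PX := (Real.lt_sqrt hε.le).1 hsep
  have hb : ∀ x, (f x - g x) ^ 2 ≤ 4 * F ^ 2 := by
    intro x
    have a1 := abs_le.1 (hfF x); have a2 := abs_le.1 (hgF x)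
    nlinarith
  have h2 : ∫ x, (f x - g x) ^ 2 ∂PX ≤ ∫ x, (ε ^ 2 / 4 + A.indicator (fun _ => 4 * F ^ 2) x) ∂PX := by
    apply integral_mono_of_nonneg
    · exact Eventually.of_forall fun x => by positivity
    · exact (integrable_const _).add ((integrable_const _).indicator hAm)
    · refine Eventually.of_forall fun x => ?_
      by_cases hx : x ∈ A
      · simp only [Set.indicator_of_mem hx]
        have := hb x
        nlinarith [sq_nonneg ε]
      · simp only [Set.indicator_of_notMem hx]
        have : |f x - g x| ≤ ε / 2 := by simpa [hA] using hx
        rw [← sq_abs]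
        nlinarith [abs_nonneg (f x - g x)]
  rw [integral_add (integrable_const _) ((integrable_const _).indicator hAm),
    integral_indicator_const _ hAm] at h2
  simp only [integral_const, probReal_univ, smul_eq_mul, one_mul] at h2
  rw [div_le_iff₀ (by positivity)]
  nlinarith

/-- an ε-separated family of networks is not too large -/
lemma separated_card (ν : ℝ) (hν1 : ν < 1) (d r L N : ℕ) (F ε : ℝ) (hF : 0 < F) (hε : 0 < ε)
    (PX : Measure (Fin d → ℝ)) [IsProbabilityMeasure PX]
    (Θ : Finset (ParamIdx d r L → ℝ))
    (hsep : ∀ θ ∈ Θ, ∀ θ' ∈ Θ, θ ≠ θ' → ε < l2dist d PX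
      (fun x => trunc F (netOfParams ν d r L θ x)) (fun x => trunc F (netOfParams ν d r L θ' x)))
    (hN : (Θ.card : ℝ) ^ 2 * (Real.exp (-(3 * ε ^ 2 / (16 * F ^ 2)))) ^ N < 1) :
    Θ.card ≤ ((2 * ((N * (⌈4 * F / ε⌉₊ + 1)) * (r + 1)) * (L + 2) + 1) ^ Fintype.card (ParamIdx d r L)) ^ (L + 2) := by
  classical
  set G := ⌈4 * F / ε⌉₊ + 1 with hG
  have hmeas : ∀ θ, Measurable fun x => trunc F (netOfParams ν d r L θ x) := fun θ =>
    (continuous_trunc F).measurable.comp (measurable_netOfParams_right ν d r L θ)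
  obtain ⟨x, hx⟩ := greedy_points PX
    (fun q : (ParamIdx d r L → ℝ) × (ParamIdx d r L → ℝ) => {x | ε / 2 <
      |trunc F (netOfParams ν d r L q.1 x) - trunc F (netOfParams ν d r L q.2 x)|})
    (fun q => measurableSet_lt measurable_const ((hmeas q.1).sub (hmeas q.2)).abs)
    (3 * ε ^ 2 / (16 * F ^ 2)) (by positivity) N Θ.offDiag (by
      intro q hq
      rw [Finset.mem_offDiag] at hq
      exact sep_measure PX _ _ (hmeas q.1) (hmeas q.2) F ε hF hε
        (fun x => trunc_abs_le hF.le) (fun x => trunc_abs_le hF.le)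
        (hsep _ hq.1 _ hq.2.1 hq.2.2)) (by
      refine lt_of_le_of_lt ?_ hN
      gcongr
      rw [Finset.offDiag_card]
      have : Θ.card * Θ.card - Θ.card ≤ Θ.card ^ 2 := by rw [sq]; omega
      exact_mod_cast this)
  apply net_pattern_bound ν hν1 d r L (N * G)
    (fun k => x (finProdFinEquiv.symm k).1)
    (fun k => -F + ((finProdFinEquiv.symm k).2 : ℕ) * (ε / 2))
  intro θ hθ θ' hθ' h
  by_contra hne
  have key : ∀ θ1 θ2 : ParamIdx d r L → ℝ,
      (∀ k : Fin N, ∀ j : Fin G, (-F + (j : ℕ) * (ε / 2) < netOfParams ν d r L θ1 (x k) ↔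
       -F + (j : ℕ) * (ε / 2) < netOfParams ν d r L θ2 (x k))) →
      ∀ k, trunc F (netOfParams ν d r L θ2 (x k)) ≤ trunc F (netOfParams ν d r L θ1 (x k)) + ε / 2 := by
    intro θ1 θ2 h k
    by_contra hcon
    push Not at hcon
    set v := trunc F (netOfParams ν d r L θ1 (x k)) with hv
    set w := trunc F (netOfParams ν d r L θ2 (x k)) with hw
    have hv1 := abs_le.1 (trunc_abs_le hF.le : |v| ≤ F)
    have hw1 := abs_le.1 (trunc_abs_le hF.le : |w| ≤ F)
    set j := ⌈(v + F) / (ε / 2)⌉₊ with hj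
    have hjG : j < G := by
      rw [hG]
      apply Nat.lt_succ_of_le
      apply Nat.ceil_mono
      rw [div_le_div_iff₀ (by positivity) hε]
      nlinarith
    have hj1 : (v + F) / (ε / 2) ≤ j := Nat.le_ceil _
    have hj2 : (j : ℝ) < (v + F) / (ε / 2) + 1 := Nat.ceil_lt_add_one (by
      apply div_nonneg <;> linarith)
    rw [div_le_iff₀ (by positivity)] at hj1
    have hj2' : (j : ℝ) * (ε / 2) < v + F + ε / 2 := by
      have := mul_lt_mul_of_pos_right hj2 (by positivity : 0 < ε / 2)
      rw [add_mul, div_mul_cancel₀ _ (by positivity)] at this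
      linarith
    set u := -F + (j : ℝ) * (ε / 2) with hu
    have huv : v ≤ u := by linarith
    have huw : u < w := by linarith
    have h1 := h k ⟨j, hjG⟩
    simp only [← hu] at h1
    have hw2 : u < netOfParams ν d r L θ2 (x k) := by
      rw [hw] at huw
      unfold trunc at huw
      have := (lt_min_iff.1 huw).1
      rcases lt_max_iff.1 this with h | h
      · exact h
      · linarith
    have hv2 := h1.2 hw2
    have : u < v := by
      rw [hv]; unfold trunc
      apply lt_min
      · exact lt_max_of_lt_left hv2
      · linarith
    linarith
  have h' : ∀ k : Fin N, ∀ j : Fin G, (-F + (j : ℕ) * (ε / 2) < netOfParams ν d r L θ (x k) ↔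
       -F + (j : ℕ) * (ε / 2) < netOfParams ν d r L θ' (x k)) := by
    intro k j
    have := h (finProdFinEquiv (k, j))
    simpa using this
  obtain ⟨k, hk⟩ := hx (θ, θ') (Finset.mem_offDiag.2 ⟨hθ, hθ', hne⟩)
  have k1 := key θ θ' h' k
  have k2 := key θ' θ (fun k j => (h' k j).symm) k
  simp only [Set.mem_setOf_eq] at hk
  have : |trunc F (netOfParams ν d r L θ (x k)) - trunc F (netOfParams ν d r L θ' (x k))| ≤ ε / 2 :=
    abs_le.2 ⟨by linarith, by linarith⟩
  linarith

/-- existence of a cover from a packing bound -/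
lemma exists_cover {α : Type*} (dist' : α → α → ℝ) (ε : ℝ) (hself : ∀ x, dist' x x ≤ ε) (hsymm : ∀ x y, dist' x y = dist' y x) (B : ℕ)
    (hB : ∀ S : Finset α, (∀ x ∈ S, ∀ y ∈ S, x ≠ y → ε < dist' x y) → S.card ≤ B + 1 → S.card ≤ B) :
    ∃ J : Finset α, J.card ≤ B ∧ ∀ x, ∃ y ∈ J, dist' x y ≤ ε := by
  classical
  by_contra hcon
  push Not at hcon
  have : ∀ n ≤ B + 1, ∃ S : Finset α, S.card = n ∧ ∀ x ∈ S, ∀ y ∈ S, x ≠ y → ε < dist' x y := by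
    intro n
    induction n with
    | zero => intro _; exact ⟨∅, by simp⟩
    | succ n ih =>
      intro hn
      obtain ⟨S, hS, hsep⟩ := ih (by omega)
      obtain ⟨x, hx⟩ := hcon S (by omega)
      have hxS : x ∉ S := fun h => by linarith [hx x h, hself x]
      refine ⟨insert x S, by rw [Finset.card_insert_of_notMem hxS, hS], ?_⟩
      intro y hy z hz hyz
      rw [Finset.mem_insert] at hy hz
      rcases hy with rfl | hy <;> rcases hz with rfl | hz
      · exact absurd rfl hyz
      · exact hx z hz
      · rw [hsymm]; exact hx y hy
      · exact hsep y hy z hz hyz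
  obtain ⟨S, hS, hsep⟩ := this (B + 1) le_rfl
  have := hB S hsep (by omega)
  omega

theorem net_cover (ν : ℝ) (hν1 : ν < 1) (d r L N B : ℕ) (F ε : ℝ) (hF : 0 < F) (hε : 0 < ε)
    (PX : Measure (Fin d → ℝ)) [IsProbabilityMeasure PX]
    (hN : ((B : ℝ) + 1) ^ 2 * (Real.exp (-(3 * ε ^ 2 / (16 * F ^ 2)))) ^ N < 1)
    (hB : ((2 * ((N * (⌈4 * F / ε⌉₊ + 1)) * (r + 1)) * (L + 2) + 1) ^ Fintype.card (ParamIdx d r L)) ^ (L + 2) ≤ B) :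
    ∃ J : Finset (ParamIdx d r L → ℝ), J.card ≤ B ∧ ∀ θ, ∃ θ' ∈ J, l2dist d PX
      (fun x => trunc F (netOfParams ν d r L θ x)) (fun x => trunc F (netOfParams ν d r L θ' x)) ≤ ε := by
  apply exists_cover (fun θ θ' => l2dist d PX
      (fun x => trunc F (netOfParams ν d r L θ x)) (fun x => trunc F (netOfParams ν d r L θ' x)))
  · intro θ; simp [l2dist, hε.le]
  · intro θ θ'
    unfold l2dist
    congr 1
    apply integral_congr_ae
    exact Eventually.of_forall fun x => by ring
  · intro S hsep hS
    refine (separated_card ν hν1 d r L N F ε hF hε PX S hsep ?_).trans hB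
    refine lt_of_le_of_lt ?_ hN
    gcongr
    exact_mod_cast hS



lemma lintegral_pi_prod {Z : Type*} [MeasurableSpace Z] (μ : Measure Z) [IsProbabilityMeasure μ]
    (n : ℕ) (f : Z → ℝ≥0∞) (hf : Measurable f) :
    ∫⁻ D, ∏ i, f (D i) ∂(Measure.pi fun _ : Fin n => μ) = (∫⁻ z, f z ∂μ) ^ n := by
  induction n with
  | zero => simp
  | succ n ih =>
    have h := (measurePreserving_piFinSuccAbove (fun _ : Fin (n+1) => μ) 0).symm
    rw [← h.lintegral_comp_emb (MeasurableEquiv.measurableEmbedding _)]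
    simp only [MeasurableEquiv.piFinSuccAbove_symm_apply, Fin.prod_univ_succ]
    simp only [Fin.insertNthEquiv, Equiv.coe_fn_mk, Fin.insertNth_zero, Fin.cons_zero, Fin.cons_succ, cast_eq]
    rw [lintegral_prod_mul (f := f) (g := fun D : Fin n → Z => ∏ i, f (D i)) hf.aemeasurable (Measurable.aemeasurable (Finset.measurable_prod _ fun i _ => hf.comp (measurable_pi_apply i))), ih, pow_succ, mul_comm]

lemma cs_inv {α : Type*} [MeasurableSpace α] (μ : Measure α) [IsFiniteMeasure μ] (g : α → ℝ≥0∞) (hg : Measurable g)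
    (h0 : ∀ᵐ p ∂μ, g p ≠ 0) (ht : ∀ᵐ p ∂μ, g p ≠ ∞) :
    (μ Set.univ) ^ 2 ≤ (∫⁻ p, g p ∂μ) * ∫⁻ p, (g p)⁻¹ ∂μ := by
  have h := ENNReal.lintegral_mul_le_Lp_mul_Lq μ (p := 2) (q := 2) Real.HolderConjugate.two_two
    (f := fun p => (g p) ^ (1/2 : ℝ)) (g := fun p => (g p)⁻¹ ^ (1/2:ℝ)) (by fun_prop) (by fun_prop)
  have h1 : ∫⁻ p, ((fun p => (g p) ^ (1/2 : ℝ)) * (fun p => (g p)⁻¹ ^ (1/2:ℝ))) p ∂μ = μ Set.univ := by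
    rw [← setLIntegral_one, Measure.restrict_univ]
    apply lintegral_congr_ae
    filter_upwards [h0, ht] with p h0 ht
    simp only [Pi.mul_apply]
    rw [← ENNReal.mul_rpow_of_nonneg _ _ (by norm_num), ENNReal.mul_inv_cancel h0 ht, ENNReal.one_rpow]
  rw [h1] at h
  have h2 : ∀ x : ℝ≥0∞, (x ^ (1/2:ℝ)) ^ (2:ℝ) = x := by
    intro x; rw [← ENNReal.rpow_mul]; norm_num
  simp only [h2] at h
  calc (μ Set.univ) ^ 2 ≤ ((∫⁻ p, g p ∂μ) ^ (1/2:ℝ) * (∫⁻ p, (g p)⁻¹ ∂μ) ^ (1/2:ℝ)) ^ 2 := by gcongr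
    _ = _ := by
      rw [mul_pow, ← ENNReal.rpow_natCast, ← ENNReal.rpow_natCast]
      push_cast
      rw [h2, h2]

set_option maxHeartbeats 2000000 in
theorem post_bound {Z ι : Type*} [MeasurableSpace Z] (μ0 : Measure Z) [IsProbabilityMeasure μ0] (n : ℕ)
    (A : ℕ → Type) [∀ r, MeasurableSpace (A r)] (Pr : ∀ r, Measure (A r)) [∀ r, IsProbabilityMeasure (Pr r)]
    (w : ℕ → ℝ≥0∞) (ρ : ∀ r, A r → Z → ℝ≥0∞) (hρ : ∀ r, Measurable (Function.uncurry (ρ r)))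
    (Bad : ∀ r, Set (A r))
    (J : Finset ι) (T : ι → Z → ℝ≥0∞) (hT : ∀ j ∈ J, Measurable (T j)) (hTtop : ∀ j ∈ J, ∀ z, T j z ≠ ∞)
    (R : ℕ) (e W2 δ b χ h : ℝ≥0∞)
    (hT1 : ∀ j ∈ J, ∫⁻ z, T j z ∂μ0 ≤ e)
    (hT2 : ∀ r ≤ R, w r ≠ 0 → ∀ p ∈ Bad r, (∃ j ∈ J, ∫⁻ z, ρ r p z * (T j z)⁻¹ ∂μ0 ≤ e) ∨ ∀ z, ρ r p z = 0)
    (hn : n ≠ 0)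
    (hρ1 : ∀ r p, ∫⁻ z, ρ r p z ∂μ0 ≤ 1)
    (hw : ∑' r, w r ≤ 1) (hW2 : ∑' r, (if r ≤ R then 0 else w r) ≤ W2)
    (r0 : ℕ) (B : Set (A r0)) (hB : MeasurableSet B) (hB0 : ∀ p ∈ B, ∀ z, ρ r0 p z ≠ 0 ∧ ρ r0 p z ≠ ∞)
    (hχ : ∀ p ∈ B, ∫⁻ z, (ρ r0 p z)⁻¹ ∂μ0 ≤ χ)
    (hb : b ≤ Pr r0 B) (hb0 : b ≠ 0) (hχ0 : χ ≠ 0) (hχt : χ ≠ ∞) (hh0 : h ≠ 0) (hht : h ≠ ∞)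
    (hw0 : w r0 ≠ 0) (hwt : w r0 ≠ ∞) (hδ : δ ≠ 0) (hδt : δ ≠ ∞) :
    Measure.pi (fun _ : Fin n => μ0) {D | δ < (∑' r, w r * ∫⁻ p in Bad r, ∏ i, ρ r p (D i) ∂(Pr r)) /
        (∑' r, w r * ∫⁻ p, ∏ i, ρ r p (D i) ∂(Pr r))} ≤
      J.card * e ^ n + h⁻¹ + (e ^ n + W2) * (h * χ ^ n / (δ * w r0 * b)) := by
  classical
  set Q := Measure.pi (fun _ : Fin n => μ0) with hQ
  have hbt : b ≠ ∞ := ne_top_of_le_ne_top (measure_ne_top _ _) hb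
  -- measurability
  have hm : ∀ r, Measurable (fun q : A r × (Fin n → Z) => ∏ i, ρ r q.1 (q.2 i)) := by
    intro r
    apply Finset.measurable_prod
    intro i _
    exact (hρ r).comp (measurable_fst.prodMk ((measurable_pi_apply i).comp measurable_snd))
  have hmp : ∀ r p, Measurable (ρ r p) := fun r p => (hρ r).comp measurable_prodMk_left
  -- tests
  set E1 : Set (Fin n → Z) := ⋃ j ∈ J, {D | 1 ≤ ∏ i, T j (D i)} with hE1
  have hE1m : MeasurableSet E1 := by
    apply Finset.measurableSet_biUnion
    intro j hj
    have := hT j hj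
    exact measurableSet_le measurable_const (by fun_prop)
  have hE1b : Q E1 ≤ J.card * e ^ n := by
    refine (measure_biUnion_finset_le _ _).trans ?_
    calc ∑ j ∈ J, Q {D | 1 ≤ ∏ i, T j (D i)} ≤ ∑ j ∈ J, e ^ n := by
          apply Finset.sum_le_sum
          intro j hj
          have hTj := hT j hj
          have := mul_meas_ge_le_lintegral (μ := Q) (f := fun D : Fin n → Z => ∏ i, T j (D i)) (by fun_prop) 1
          rw [one_mul] at this
          refine this.trans ?_
          rw [hQ, lintegral_pi_prod _ _ _ (hT j hj)]
          gcongr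
          exact hT1 j hj
      _ = _ := by simp
  -- denominators
  set I' : (Fin n → Z) → ℝ≥0∞ := fun D => ∫⁻ p in B, ∏ i, (ρ r0 p (D i))⁻¹ ∂(Pr r0) with hI'
  have hmi : Measurable (fun q : A r0 × (Fin n → Z) => ∏ i, (ρ r0 q.1 (q.2 i))⁻¹) := by
    apply Finset.measurable_prod
    intro i _
    exact ((hρ r0).comp (measurable_fst.prodMk ((measurable_pi_apply i).comp measurable_snd))).inv
  have hI'm : Measurable I' := by
    apply Measurable.lintegral_prod_left' (f := fun q : A r0 × (Fin n → Z) => ∏ i, (ρ r0 q.1 (q.2 i))⁻¹) hmi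
  have hI'i : ∫⁻ D, I' D ∂Q ≤ χ ^ n * Pr r0 B := by
    rw [hI']
    rw [lintegral_lintegral_swap (f := fun (D : Fin n → Z) (p : A r0) => ∏ i, (ρ r0 p (D i))⁻¹) (hmi.comp measurable_swap).aemeasurable]
    calc ∫⁻ p in B, ∫⁻ D, ∏ i, (ρ r0 p (D i))⁻¹ ∂Q ∂(Pr r0) ≤ ∫⁻ p in B, χ ^ n ∂(Pr r0) := by
          apply setLIntegral_mono measurable_const
          intro p hp
          rw [hQ, lintegral_pi_prod μ0 n (fun z => (ρ r0 p z)⁻¹) (hmp r0 p).inv]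
          gcongr
          exact hχ p hp
      _ = _ := by simp
  have hBt : Pr r0 B ≠ ∞ := measure_ne_top _ _
  have hBn : Pr r0 B ≠ 0 := fun h => hb0 (le_antisymm (h ▸ hb) bot_le)
  have hχn0 : χ ^ n ≠ 0 := pow_ne_zero _ hχ0
  have hχnt : χ ^ n ≠ ∞ := ENNReal.pow_ne_top hχt
  set E2 : Set (Fin n → Z) := {D | h * (χ ^ n * Pr r0 B) ≤ I' D} with hE2
  have hE2b : Q E2 ≤ h⁻¹ := by
    have h1 := mul_meas_ge_le_lintegral (μ := Q) hI'm (h * (χ ^ n * Pr r0 B))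
    have h2 := h1.trans hI'i
    have hc0 : χ ^ n * Pr r0 B ≠ 0 := mul_ne_zero hχn0 hBn
    have hct : χ ^ n * Pr r0 B ≠ ∞ := ENNReal.mul_ne_top hχnt hBt
    rw [mul_assoc, mul_comm (χ ^ n * Pr r0 B), ← mul_assoc] at h2
    have h3 : h * Q E2 ≤ 1 := by
      rw [← ENNReal.mul_le_mul_iff_left hc0 hct, one_mul]; exact h2
    exact ENNReal.le_inv_iff_mul_le.2 (by rwa [mul_comm])
  have hden : ∀ D, D ∉ E2 → w r0 * b / (h * χ ^ n) ≤ ∑' r, w r * ∫⁻ p, ∏ i, ρ r p (D i) ∂(Pr r) := by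
    intro D hD
    refine le_trans ?_ (ENNReal.le_tsum r0)
    rw [mul_div_assoc]
    gcongr
    refine le_trans ?_ (setLIntegral_le_lintegral B _)
    have hcs := cs_inv ((Pr r0).restrict B) (fun p => ∏ i, ρ r0 p (D i))
      ((hm r0).comp measurable_prodMk_right) (by
        rw [ae_restrict_iff' hB]
        refine Eventually.of_forall fun p hp => ?_
        rw [Finset.prod_ne_zero_iff]
        exact fun i _ => (hB0 p hp _).1) (by
        rw [ae_restrict_iff' hB]
        refine Eventually.of_forall fun p hp => ?_
        exact ENNReal.prod_ne_top fun i _ => (hB0 p hp _).2)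
    have hinv : ∫⁻ p in B, (∏ i, ρ r0 p (D i))⁻¹ ∂(Pr r0) = I' D := by
      rw [hI']
      apply setLIntegral_congr_fun hB
      intro p hp
      simp only
      rw [ENNReal.prod_inv_distrib]
      intro i _ j _ _
      exact Or.inl (hB0 p hp _).1
    rw [hinv, Measure.restrict_apply_univ] at hcs
    have hI'lt : I' D ≤ h * (χ ^ n * Pr r0 B) := by
      rw [hE2, Set.mem_setOf_eq, not_le] at hD
      exact hD.le
    have h4 : (Pr r0 B) * (Pr r0 B) ≤ ((∫⁻ p in B, ∏ i, ρ r0 p (D i) ∂(Pr r0)) * (h * χ ^ n)) * Pr r0 B := by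
      rw [← sq]
      refine hcs.trans ?_
      calc _ ≤ (∫⁻ p in B, ∏ i, ρ r0 p (D i) ∂(Pr r0)) * (h * (χ ^ n * Pr r0 B)) := by gcongr
        _ = _ := by ring
    rw [ENNReal.mul_le_mul_iff_left hBn hBt] at h4
    rw [ENNReal.div_le_iff (mul_ne_zero hh0 hχn0) (ENNReal.mul_ne_top hht hχnt)]
    exact hb.trans h4
  -- numerators
  set Nm : (Fin n → Z) → ℝ≥0∞ := fun D => ∑' r, w r * ∫⁻ p in Bad r, ∏ i, ρ r p (D i) ∂(Pr r) with hNm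
  have hNmm : Measurable Nm := by
    rw [hNm]
    apply Measurable.tsum
    intro r
    apply Measurable.const_mul
    exact Measurable.lintegral_prod_left' (f := fun q : A r × (Fin n → Z) => ∏ i, ρ r q.1 (q.2 i)) (hm r)
  have hNi : ∫⁻ D, E1ᶜ.indicator Nm D ∂Q ≤ e ^ n + W2 := by
    rw [lintegral_indicator hE1m.compl, hNm]
    rw [lintegral_tsum (by
      intro r
      apply Measurable.aemeasurable
      apply Measurable.const_mul
      exact Measurable.lintegral_prod_left' (f := fun q : A r × (Fin n → Z) => ∏ i, ρ r q.1 (q.2 i)) (hm r))]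
    have hr : ∀ r, ∫⁻ D in E1ᶜ, w r * ∫⁻ p in Bad r, ∏ i, ρ r p (D i) ∂(Pr r) ∂Q ≤
        w r * e ^ n + (if r ≤ R then 0 else w r) := by
      intro r
      rw [lintegral_const_mul _ (Measurable.lintegral_prod_left' (f := fun q : A r × (Fin n → Z) => ∏ i, ρ r q.1 (q.2 i)) (hm r))]
      rw [lintegral_lintegral_swap (f := fun (D : Fin n → Z) (p : A r) => ∏ i, ρ r p (D i)) ((hm r).comp measurable_swap).aemeasurable]
      have hgen : ∀ c : ℝ≥0∞, (∀ p ∈ Bad r, ∫⁻ D in E1ᶜ, ∏ i, ρ r p (D i) ∂Q ≤ c) →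
          ∫⁻ p in Bad r, ∫⁻ D in E1ᶜ, ∏ i, ρ r p (D i) ∂Q ∂(Pr r) ≤ c := by
        intro c hc
        calc _ ≤ ∫⁻ p in Bad r, c ∂(Pr r) := setLIntegral_mono measurable_const hc
          _ = c * Pr r (Bad r) := by simp
          _ ≤ c * 1 := by gcongr; exact prob_le_one
          _ = c := mul_one _
      by_cases hwr : w r = 0
      · simp [hwr]
      split_ifs with hrR
      · rw [add_zero]
        gcongr
        apply hgen
        intro p hp
        rcases hT2 r hrR hwr p hp with ⟨j, hj, hje⟩ | hz
        · calc ∫⁻ D in E1ᶜ, ∏ i, ρ r p (D i) ∂Q ≤ ∫⁻ D in E1ᶜ, ∏ i, (ρ r p (D i) * (T j (D i))⁻¹) ∂Q := by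
                apply setLIntegral_mono
                · exact Finset.measurable_prod _ fun i _ => (((hmp r p).mul (hT j hj).inv).comp (measurable_pi_apply i))
                intro D hD
                have hlt : ∏ i, T j (D i) < 1 := by
                  rw [hE1] at hD
                  simp only [Set.mem_compl_iff, Set.mem_iUnion, not_exists, Set.mem_setOf_eq, not_le] at hD
                  exact hD j hj
                rw [Finset.prod_mul_distrib, ← ENNReal.prod_inv_distrib (fun i _ k _ _ => Or.inr (hTtop j hj _))]
                calc _ = (∏ i, ρ r p (D i)) * 1 := (mul_one _).symm
                  _ ≤ _ := by
                    gcongr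
                    exact ENNReal.one_le_inv.2 hlt.le
            _ ≤ ∫⁻ D, ∏ i, (ρ r p (D i) * (T j (D i))⁻¹) ∂Q := setLIntegral_le_lintegral _ _
            _ = (∫⁻ z, ρ r p z * (T j z)⁻¹ ∂μ0) ^ n := by
                rw [hQ, lintegral_pi_prod μ0 n (fun z => ρ r p z * (T j z)⁻¹) ((hmp r p).mul (hT j hj).inv)]
            _ ≤ e ^ n := by gcongr
        · have : ∀ D : Fin n → Z, ∏ i, ρ r p (D i) = 0 := by
            intro D
            simp [hz, hn]
          simp [this]
      · calc _ ≤ w r * 1 := by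
              gcongr
              apply hgen
              intro p hp
              refine (setLIntegral_le_lintegral _ _).trans ?_
              rw [hQ, lintegral_pi_prod μ0 n (fun z => ρ r p z) (hmp r p)]
              exact pow_le_one' (hρ1 r p) n
          _ = w r := mul_one _
          _ ≤ _ := le_add_self
    calc _ ≤ ∑' r, (w r * e ^ n + (if r ≤ R then 0 else w r)) := ENNReal.tsum_le_tsum hr
      _ = (∑' r, w r) * e ^ n + ∑' r, (if r ≤ R then 0 else w r) := by
        rw [ENNReal.tsum_add, ENNReal.tsum_mul_right]
      _ ≤ 1 * e ^ n + W2 := by gcongr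
      _ = _ := by rw [one_mul]
  set c := δ * (w r0 * b / (h * χ ^ n)) with hc
  have hhχ0 : h * χ ^ n ≠ 0 := mul_ne_zero hh0 hχn0
  have hhχt : h * χ ^ n ≠ ∞ := ENNReal.mul_ne_top hht hχnt
  have hc0 : c ≠ 0 := mul_ne_zero hδ (ENNReal.div_ne_zero.2 ⟨mul_ne_zero hw0 hb0, hhχt⟩)
  have hct : c ≠ ∞ := ENNReal.mul_ne_top hδt (ENNReal.div_ne_top (ENNReal.mul_ne_top hwt hbt) hhχ0)
  have hE3 : Q {D | c ≤ E1ᶜ.indicator Nm D} ≤ (e ^ n + W2) * (h * χ ^ n / (δ * w r0 * b)) := by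
    have h1 := meas_ge_le_lintegral_div (μ := Q) (hNmm.indicator hE1m.compl).aemeasurable hc0 hct
    refine h1.trans ?_
    rw [ENNReal.div_eq_inv_mul, mul_comm]
    gcongr
    apply le_of_eq
    rw [hc, ENNReal.mul_inv (Or.inl hδ) (Or.inl hδt), ENNReal.inv_div (Or.inl hhχt) (Or.inl hhχ0),
      div_eq_mul_inv, div_eq_mul_inv, mul_assoc δ, ENNReal.mul_inv (Or.inl hδ) (Or.inl hδt)]
    ring
  calc _ ≤ Q (E1 ∪ E2 ∪ {D | c ≤ E1ᶜ.indicator Nm D}) := by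
        apply measure_mono
        intro D hD
        by_cases h1 : D ∈ E1
        · exact Or.inl (Or.inl h1)
        by_cases h2 : D ∈ E2
        · exact Or.inl (Or.inr h2)
        right
        simp only [Set.mem_setOf_eq] at hD ⊢
        rw [Set.indicator_of_mem (by simpa using h1)]
        have hd := hden D h2
        have : δ * (∑' r, w r * ∫⁻ p, ∏ i, ρ r p (D i) ∂(Pr r)) ≤ Nm D := ENNReal.mul_le_of_le_div hD.le
        exact le_trans (by rw [hc]; gcongr) this
    _ ≤ Q (E1 ∪ E2) + Q {D | c ≤ E1ᶜ.indicator Nm D} := measure_union_le _ _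
    _ ≤ (Q E1 + Q E2) + Q {D | c ≤ E1ᶜ.indicator Nm D} := by gcongr; exact measure_union_le _ _
    _ ≤ _ := by gcongr



lemma gpdf_nonneg (m s y : ℝ) : 0 ≤ gpdf m s y := by unfold gpdf; positivity
lemma gpdf_pos (m s y : ℝ) (hs : 0 < s) : 0 < gpdf m s y := by unfold gpdf; positivity
lemma gpdf_of_nonpos (m s y : ℝ) (hs : s ≤ 0) : gpdf m s y = 0 := by
  unfold gpdf
  rw [Real.sqrt_eq_zero_of_nonpos (by nlinarith [Real.pi_pos])]
  simp

lemma gpdf_eq (m s : ℝ) (hs : 0 ≤ s) : gpdf m s = gaussianPDFReal m (Real.toNNReal s) := by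
  ext y
  rw [gaussianPDFReal_def]
  simp [gpdf, hs]

lemma measurable_gpdf : Measurable (fun q : ℝ × ℝ × ℝ => gpdf q.1 q.2.1 q.2.2) := by
  unfold gpdf; fun_prop

lemma lintegral_gpdf (m s : ℝ) (hs : 0 < s) : ∫⁻ y, ENNReal.ofReal (gpdf m s y) = 1 := by
  rw [gpdf_eq _ _ hs.le]
  exact lintegral_gaussianPDFReal_eq_one m (by simpa using hs)

lemma gpdf_tilt (m v α β y : ℝ) (hv : 0 < v) (hα : 2 * α * v < 1) :
    gpdf m v y * Real.exp (α * (y - m) ^ 2 + β * (y - m)) =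
      ((Real.sqrt (1 - 2 * α * v))⁻¹ * Real.exp (β ^ 2 * v / (2 * (1 - 2 * α * v)))) *
      gpdf (m + β * (v / (1 - 2 * α * v))) (v / (1 - 2 * α * v)) y := by
  have hc : 0 < 1 - 2 * α * v := by linarith
  unfold gpdf
  have h1 : Real.sqrt (2 * Real.pi * (v / (1 - 2 * α * v))) = Real.sqrt (2 * Real.pi * v) / Real.sqrt (1 - 2 * α * v) := by
    rw [← Real.sqrt_div (by positivity)]
    congr 1; ring
  rw [h1]
  have h2 : Real.exp (-(y - m) ^ 2 / (2 * v)) * Real.exp (α * (y - m) ^ 2 + β * (y - m)) =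
      Real.exp (β ^ 2 * v / (2 * (1 - 2 * α * v))) *
      Real.exp (-(y - (m + β * (v / (1 - 2 * α * v)))) ^ 2 / (2 * (v / (1 - 2 * α * v)))) := by
    rw [← Real.exp_add, ← Real.exp_add]
    congr 1
    generalize hcc : 1 - 2 * α * v = c at *
    have : α = (1 - c) / (2 * v) := by field_simp; linarith
    subst this
    field_simp
    ring
  have h3 : Real.sqrt (1 - 2 * α * v) ≠ 0 := (Real.sqrt_pos.2 hc).ne'
  have h4 : Real.sqrt (2 * Real.pi * v) ≠ 0 := (Real.sqrt_pos.2 (by positivity)).ne'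
  rw [mul_assoc, h2, inv_div]
  generalize Real.sqrt (1 - 2 * α * v) = c at *
  generalize Real.exp (β ^ 2 * v / (2 * (1 - 2 * α * v))) = c1 at *
  field_simp

lemma lintegral_gpdf_tilt (m v α β : ℝ) (hv : 0 < v) (hα : 2 * α * v < 1) :
    ∫⁻ y, ENNReal.ofReal (gpdf m v y * Real.exp (α * (y - m) ^ 2 + β * (y - m))) =
      ENNReal.ofReal ((Real.sqrt (1 - 2 * α * v))⁻¹ * Real.exp (β ^ 2 * v / (2 * (1 - 2 * α * v)))) := by
  have hc : 0 < 1 - 2 * α * v := by linarith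
  simp_rw [gpdf_tilt m v α β _ hv hα]
  have h0 : 0 ≤ (Real.sqrt (1 - 2 * α * v))⁻¹ * Real.exp (β ^ 2 * v / (2 * (1 - 2 * α * v))) := by positivity
  simp_rw [ENNReal.ofReal_mul h0]
  rw [lintegral_const_mul' _ _ ENNReal.ofReal_ne_top, lintegral_gpdf _ _ (by positivity), mul_one]

lemma gaussian_density_eq (m s : ℝ) (hs : 0 < s) :
    gaussianReal m (Real.toNNReal s) = volume.withDensity fun y => ENNReal.ofReal (gpdf m s y) := by
  rw [gaussianReal_of_var_ne_zero _ (by simpa using hs), gpdf_eq _ _ hs.le]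
  simp only [gaussianPDF_def]

lemma measurable_dens {d : ℕ} (f₀ : (Fin d → ℝ) → ℝ) (hf : Measurable f₀) (s : ℝ) :
    Measurable (fun q : (Fin d → ℝ) × ℝ => ENNReal.ofReal (gpdf (f₀ q.1) s q.2)) := by
  apply Measurable.ennreal_ofReal
  exact measurable_gpdf.comp (by fun_prop : Measurable fun q : (Fin d → ℝ) × ℝ => (f₀ q.1, s, q.2))

lemma lintegral_pair {Z : Type*} [MeasurableSpace Z] (PX : Measure Z) [IsProbabilityMeasure PX]
    (μ : Z → Measure ℝ) (hμ : ∀ t : Set (Z × ℝ), MeasurableSet t → Measurable fun x => μ x {y | (x, y) ∈ t})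
    (G : Z × ℝ → ℝ≥0∞) (hG : Measurable G) :
    ∫⁻ z, G z ∂(PX.bind fun x => (μ x).map fun y => (x, y)) = ∫⁻ x, (∫⁻ y, G (x, y) ∂(μ x)) ∂PX := by
  have hker : Measurable (fun x => (μ x).map fun y => (x, y)) := by
    apply Measure.measurable_of_measurable_coe
    intro t ht
    have : ∀ x, ((μ x).map fun y => (x, y)) t = μ x {y | (x, y) ∈ t} := by
      intro x
      rw [Measure.map_apply measurable_prodMk_left ht]
      simp only [Set.preimage]
    simp_rw [this]
    exact hμ t ht
  rw [Measure.lintegral_bind hker.aemeasurable hG.aemeasurable]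
  apply lintegral_congr
  intro x
  rw [lintegral_map hG measurable_prodMk_left]

lemma lintegral_gaussRegLaw (d : ℕ) (PX : Measure (Fin d → ℝ)) [IsProbabilityMeasure PX]
    (f₀ : (Fin d → ℝ) → ℝ) (hf : Measurable f₀) (s : ℝ) (hs : 0 < s)
    (G : (Fin d → ℝ) × ℝ → ℝ≥0∞) (hG : Measurable G) :
    ∫⁻ z, G z ∂(gaussRegLaw d PX f₀ (Real.toNNReal s)) =
      ∫⁻ x, (∫⁻ y : ℝ, ENNReal.ofReal (gpdf (f₀ x) s y) * G (x, y)) ∂PX := by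
  have hm2 := measurable_dens f₀ hf s
  unfold gaussRegLaw
  rw [lintegral_pair PX (fun x => gaussianReal (f₀ x) (Real.toNNReal s)) ?_ G hG]
  · apply lintegral_congr
    intro x
    rw [gaussian_density_eq _ _ hs]
    have hmx : Measurable fun y => ENNReal.ofReal (gpdf (f₀ x) s y) := by
      unfold gpdf; fun_prop
    have hgx : Measurable fun y => G (x, y) := by fun_prop
    rw [lintegral_withDensity_eq_lintegral_mul _ hmx hgx]
    simp only [Pi.mul_apply]
  · intro t ht
    have : ∀ x, gaussianReal (f₀ x) (Real.toNNReal s) {y | (x, y) ∈ t} =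
        ∫⁻ y, t.indicator (fun q => ENNReal.ofReal (gpdf (f₀ q.1) s q.2)) (x, y) := by
      intro x
      have htx : MeasurableSet {y : ℝ | (x, y) ∈ t} := measurable_prodMk_left ht
      rw [gaussian_density_eq _ _ hs, withDensity_apply _ htx, ← lintegral_indicator htx]
      apply lintegral_congr
      intro y
      by_cases hy : (x, y) ∈ t
      · rw [Set.indicator_of_mem hy, Set.indicator_of_mem (by simpa using hy)]
      · rw [Set.indicator_of_notMem hy, Set.indicator_of_notMem (by simpa using hy)]
    simp_rw [this]
    exact Measurable.lintegral_prod_right' (hm2.indicator ht)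

/-- likelihood ratio of the Gaussian model -/
def gratio {d : ℕ} (f₀ : (Fin d → ℝ) → ℝ) (s0 : ℝ) (h : (Fin d → ℝ) → ℝ) (v : ℝ) (z : (Fin d → ℝ) × ℝ) : ℝ≥0∞ :=
  ENNReal.ofReal (gpdf (h z.1) v z.2 / gpdf (f₀ z.1) s0 z.2)

lemma measurable_gratio {d : ℕ} (f₀ : (Fin d → ℝ) → ℝ) (hf : Measurable f₀) (s0 : ℝ) (h : (Fin d → ℝ) → ℝ) (hh : Measurable h) (v : ℝ) :
    Measurable (gratio f₀ s0 h v) := by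
  unfold gratio gpdf; fun_prop

lemma lintegral_gratio_mul {d : ℕ} (PX : Measure (Fin d → ℝ)) [IsProbabilityMeasure PX]
    (f₀ : (Fin d → ℝ) → ℝ) (hf : Measurable f₀) (s : ℝ) (hs : 0 < s)
    (h : (Fin d → ℝ) → ℝ) (hh : Measurable h) (v : ℝ)
    (G : (Fin d → ℝ) × ℝ → ℝ≥0∞) (hG : Measurable G) :
    ∫⁻ z, gratio f₀ s h v z * G z ∂(gaussRegLaw d PX f₀ (Real.toNNReal s)) =
      ∫⁻ x, (∫⁻ y : ℝ, ENNReal.ofReal (gpdf (h x) v y) * G (x, y)) ∂PX := by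
  rw [lintegral_gaussRegLaw d PX f₀ hf s hs (fun z => gratio f₀ s h v z * G z) ((measurable_gratio f₀ hf s h hh v).mul hG)]
  apply lintegral_congr; intro x
  apply lintegral_congr; intro y
  rw [← mul_assoc]
  congr 1
  unfold gratio
  simp only
  rw [← ENNReal.ofReal_mul (gpdf_nonneg _ _ _)]
  congr 1
  have := (gpdf_pos (f₀ x) s y hs).ne'
  field_simp

lemma lintegral_gratio_le {d : ℕ} (PX : Measure (Fin d → ℝ)) [IsProbabilityMeasure PX]
    (f₀ : (Fin d → ℝ) → ℝ) (hf : Measurable f₀) (s : ℝ) (hs : 0 < s)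
    (h : (Fin d → ℝ) → ℝ) (hh : Measurable h) (v : ℝ) :
    ∫⁻ z, gratio f₀ s h v z ∂(gaussRegLaw d PX f₀ (Real.toNNReal s)) ≤ 1 := by
  have := lintegral_gratio_mul PX f₀ hf s hs h hh v (fun _ => 1) measurable_const
  simp only [mul_one] at this
  rw [this]
  rcases le_or_gt v 0 with hv | hv
  · simp [gpdf_of_nonpos _ _ _ hv]
  · simp [lintegral_gpdf _ _ hv]

/-- conditional exponential moment of a quadratic exponent -/
lemma lintegral_quad {d : ℕ} (PX : Measure (Fin d → ℝ)) (h : (Fin d → ℝ) → ℝ) (v : ℝ) (hv : 0 < v)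
    (ψ : (Fin d → ℝ) × ℝ → ℝ) (α : ℝ) (hα : 2 * α * v < 1) (β c : (Fin d → ℝ) → ℝ)
    (hψ : ∀ x y, ψ (x, y) = α * (y - h x) ^ 2 + β x * (y - h x) + c x) :
    ∫⁻ x, (∫⁻ y : ℝ, ENNReal.ofReal (gpdf (h x) v y) * ENNReal.ofReal (Real.exp (ψ (x, y)))) ∂PX =
      ∫⁻ x, ENNReal.ofReal ((Real.sqrt (1 - 2 * α * v))⁻¹ * Real.exp (β x ^ 2 * v / (2 * (1 - 2 * α * v)) + c x)) ∂PX := by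
  apply lintegral_congr; intro x
  have : ∀ y, ENNReal.ofReal (gpdf (h x) v y) * ENNReal.ofReal (Real.exp (ψ (x, y))) =
      ENNReal.ofReal (Real.exp (c x)) * ENNReal.ofReal (gpdf (h x) v y * Real.exp (α * (y - h x) ^ 2 + β x * (y - h x))) := by
    intro y
    rw [← ENNReal.ofReal_mul (gpdf_nonneg _ _ _), ← ENNReal.ofReal_mul (Real.exp_nonneg _), hψ, Real.exp_add]
    congr 1; ring
  simp_rw [this]
  rw [lintegral_const_mul' _ _ ENNReal.ofReal_ne_top, lintegral_gpdf_tilt _ _ _ _ hv hα,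
    ← ENNReal.ofReal_mul (Real.exp_nonneg _), Real.exp_add]
  congr 1; ring

lemma ofReal_exp_inv (t : ℝ) : (ENNReal.ofReal (Real.exp t))⁻¹ = ENNReal.ofReal (Real.exp (-t)) := by
  rw [Real.exp_neg, ENNReal.ofReal_inv_of_pos (Real.exp_pos _)]

lemma inv_sqrt_le_exp {c t : ℝ} (hc : 0 < c) (h : Real.exp (-2 * t) ≤ c) : (Real.sqrt c)⁻¹ ≤ Real.exp t := by
  rw [inv_le_comm₀ (Real.sqrt_pos.2 hc) (Real.exp_pos _), ← Real.exp_neg]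
  apply Real.le_sqrt_of_sq_le
  rw [← Real.exp_nat_mul]
  convert h using 2
  push_cast; ring

lemma exp_quad_le {u : ℝ} (hu : u ≤ 1) : Real.exp u ≤ 1 + u + u ^ 2 := by
  rcases le_or_gt (-1) u with h | h
  · have := Real.abs_exp_sub_one_sub_id_le (abs_le.2 ⟨h, hu⟩)
    have := abs_le.1 this
    linarith
  · have h1 : Real.exp u ≤ 1 := Real.exp_le_one_iff.2 (by linarith)
    nlinarith

/-- (1-u)^{-1/2} ≤ exp(u/2+u²/2) -/
lemma inv_sqrt_one_sub {u : ℝ} (h0 : 0 ≤ u) (h1 : u ≤ 1/2) : (Real.sqrt (1 - u))⁻¹ ≤ Real.exp (u / 2 + u ^ 2 / 2) := by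
  apply inv_sqrt_le_exp (by linarith)
  have := Real.quadratic_le_exp_of_nonneg (x := u + u^2) (by positivity)
  have e : Real.exp (-2 * (u / 2 + u ^ 2 / 2)) = (Real.exp (u + u^2))⁻¹ := by rw [← Real.exp_neg]; congr 1; ring
  rw [e, inv_le_comm₀ (Real.exp_pos _) (by linarith)]
  refine le_trans ?_ this
  rw [inv_le_iff_one_le_mul₀ (by linarith)]
  nlinarith [mul_nonneg (mul_nonneg h0 h0) (by nlinarith : 0 ≤ 1 - u - 2 * u^2), pow_nonneg h0 4, pow_nonneg h0 5, mul_nonneg (pow_nonneg h0 4) (by linarith : 0 ≤ 1 - u)]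

/-- (1+u)^{-1/2} ≤ exp(-u/2+u²/2) -/
lemma inv_sqrt_one_add {u : ℝ} (h0 : 0 ≤ u) : (Real.sqrt (1 + u))⁻¹ ≤ Real.exp (-u / 2 + u ^ 2 / 2) := by
  apply inv_sqrt_le_exp (by linarith)
  rcases le_or_gt u 1 with h | h
  · have := exp_quad_le (u := u - u^2) (by nlinarith)
    have e : -2 * (-u / 2 + u ^ 2 / 2) = u - u ^ 2 := by ring
    rw [e]
    refine this.trans ?_
    nlinarith [pow_nonneg h0 3]
  · have : Real.exp (-2 * (-u / 2 + u ^ 2 / 2)) ≤ 1 := Real.exp_le_one_iff.2 (by nlinarith)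
    linarith



lemma lint_exp {X : Type*} [MeasurableSpace X] (PX : Measure X) [IsProbabilityMeasure PX] (u A B : X → ℝ)
    (hA : Measurable A) (hB : Measurable B) (hu : ∀ x, u x ≤ -A x + B x)
    (hA0 : ∀ x, 0 ≤ A x) (hA1 : ∀ x, A x ≤ 1/2) (hB0 : ∀ x, 0 ≤ B x) (hB1 : ∀ x, B x ≤ 1) :
    ∫⁻ x, ENNReal.ofReal (Real.exp (u x)) ∂PX ≤ ENNReal.ofReal (Real.exp (-(∫ x, A x ∂PX)/2 + 2 * ∫ x, B x ∂PX)) := by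
  have hAi : Integrable A PX := Integrable.of_bound hA.aestronglyMeasurable (1/2) (Eventually.of_forall fun x => by
    rw [Real.norm_eq_abs, abs_of_nonneg (hA0 x)]; exact hA1 x)
  have hBi : Integrable B PX := Integrable.of_bound hB.aestronglyMeasurable 1 (Eventually.of_forall fun x => by
    rw [Real.norm_eq_abs, abs_of_nonneg (hB0 x)]; exact hB1 x)
  have hpt : ∀ x, Real.exp (u x) ≤ 1 + (-(A x / 2) + 2 * B x) := by
    intro x
    have h1 : Real.exp (u x) ≤ Real.exp (-A x + B x) := Real.exp_le_exp.2 (hu x)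
    have h2 := exp_quad_le (u := -A x + B x) (by linarith [hA0 x, hB1 x])
    nlinarith [hA0 x, hB0 x, hA1 x, hB1 x, mul_nonneg (hA0 x) (hB0 x), mul_nonneg (hA0 x) (sub_nonneg.2 (hA1 x)), mul_nonneg (hB0 x) (sub_nonneg.2 (hB1 x))]
  have hI : Integrable (fun x => 1 + (-(A x / 2) + 2 * B x)) PX :=
    (integrable_const _).add (((hAi.div_const 2).neg).add (hBi.const_mul 2))
  calc _ ≤ ∫⁻ x, ENNReal.ofReal (1 + (-(A x / 2) + 2 * B x)) ∂PX := by
        apply lintegral_mono; intro x; exact ENNReal.ofReal_le_ofReal (hpt x)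
    _ = ENNReal.ofReal (∫ x, (1 + (-(A x / 2) + 2 * B x)) ∂PX) := by
        rw [ofReal_integral_eq_lintegral_ofReal hI]
        exact Eventually.of_forall fun x => (Real.exp_nonneg _).trans (hpt x)
    _ ≤ _ := by
        apply ENNReal.ofReal_le_ofReal
        have : ∫ x, (1 + (-(A x / 2) + 2 * B x)) ∂PX = 1 + (-(∫ x, A x ∂PX)/2 + 2 * ∫ x, B x ∂PX) := by
          rw [integral_add (f := fun _ => (1:ℝ)) (g := fun x => -(A x / 2) + 2 * B x) (integrable_const _) (((hAi.div_const 2).neg).add (hBi.const_mul 2)),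
            integral_add (f := fun x => -(A x / 2)) (g := fun x => 2 * B x) ((hAi.div_const 2).neg) (hBi.const_mul 2), integral_neg, integral_div, integral_const_mul]
          simp; ring
        rw [this]
        linarith [Real.add_one_le_exp (-(∫ x, A x ∂PX)/2 + 2 * ∫ x, B x ∂PX)]

lemma reg_type1 {X : Type*} [MeasurableSpace X] (PX : Measure X) [IsProbabilityMeasure PX] (D : X → ℝ)
    (hD : Measurable D) (F lam v : ℝ) (hF : ∀ x, |D x| ≤ 2 * F) (hl : 0 < lam) (hv : 0 ≤ v) (hlv : lam * v ≤ 1/2)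
    (hlF : lam * (16 * F ^ 2) ≤ 1) :
    ∫⁻ x, ENNReal.ofReal (Real.exp ((lam * D x) ^ 2 * v / 2 - lam * D x ^ 2 / 2)) ∂PX ≤
      ENNReal.ofReal (Real.exp (-(lam * (∫ x, D x ^ 2 ∂PX) / 8))) := by
  have hb : ∀ x, D x ^ 2 ≤ 4 * F ^ 2 := by
    intro x; have := abs_le.1 (hF x); nlinarith
  have := lint_exp PX (fun x => (lam * D x) ^ 2 * v / 2 - lam * D x ^ 2 / 2) (fun x => lam / 4 * D x ^ 2) (fun _ => 0)
    (by fun_prop) measurable_const (by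
      intro x
      have h := mul_le_mul_of_nonneg_left hlv (mul_nonneg hl.le (sq_nonneg (D x)))
      nlinarith) (fun x => by positivity) (fun x => by
        have := mul_le_mul_of_nonneg_left (hb x) hl.le
        nlinarith) (fun _ => le_rfl) (fun _ => by norm_num)
  refine this.trans (le_of_eq ?_)
  rw [integral_const_mul]
  congr 2
  simp; ring

lemma reg_type2 {X : Type*} [MeasurableSpace X] (PX : Measure X) [IsProbabilityMeasure PX] (D E : X → ℝ)
    (hD : Measurable D) (hE : Measurable E) (F lam v : ℝ) (hF : ∀ x, |D x| ≤ 2 * F) (hFE : ∀ x, |E x| ≤ 2 * F)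
    (hl : 0 < lam) (hv : 0 ≤ v) (hlv : lam * v ≤ 1/2)
    (hlF : lam * (16 * F ^ 2) ≤ 1) :
    ∫⁻ x, ENNReal.ofReal (Real.exp ((lam * D x) ^ 2 * v / 2 - lam * D x ^ 2 / 2 - lam * E x * D x)) ∂PX ≤
      ENNReal.ofReal (Real.exp (-(lam * (∫ x, D x ^ 2 ∂PX) / 16) + 4 * lam * ∫ x, E x ^ 2 ∂PX)) := by
  have hb : ∀ x, D x ^ 2 ≤ 4 * F ^ 2 := by
    intro x; have := abs_le.1 (hF x); nlinarith
  have hb' : ∀ x, E x ^ 2 ≤ 4 * F ^ 2 := by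
    intro x; have := abs_le.1 (hFE x); nlinarith
  have := lint_exp PX (fun x => (lam * D x) ^ 2 * v / 2 - lam * D x ^ 2 / 2 - lam * E x * D x)
    (fun x => lam / 8 * D x ^ 2) (fun x => 2 * lam * E x ^ 2)
    (by fun_prop) (by fun_prop) (by
      intro x
      have h := mul_le_mul_of_nonneg_left hlv (mul_nonneg hl.le (sq_nonneg (D x)))
      have h2 := mul_nonneg hl.le (sq_nonneg (D x + 4 * E x))
      nlinarith) (fun x => by positivity) (fun x => by
        have := mul_le_mul_of_nonneg_left (hb x) hl.le
        nlinarith) (fun x => by positivity) (fun x => by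
        have := mul_le_mul_of_nonneg_left (hb' x) hl.le
        nlinarith)
  refine this.trans (le_of_eq ?_)
  rw [integral_const_mul, integral_const_mul]
  congr 2
  ring

lemma sq_dist_lower {X : Type*} [MeasurableSpace X] (PX : Measure X) [IsProbabilityMeasure PX] (h g0 g1 : X → ℝ)
    (hh : Measurable h) (hg0 : Measurable g0) (hg1 : Measurable g1) (F η : ℝ) (hF : ∀ x, |h x| ≤ F) (hF0 : ∀ x, |g0 x| ≤ F)
    (hF1 : ∀ x, |g1 x| ≤ F) (h1 : η ^ 2 < ∫ x, (h x - g0 x) ^ 2 ∂PX) (h2 : ∫ x, (h x - g1 x) ^ 2 ∂PX ≤ (η / 16) ^ 2) :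
    3 / 4 * η ^ 2 ≤ ∫ x, (g1 x - g0 x) ^ 2 ∂PX := by
  have hintg : ∀ a b : X → ℝ, Measurable a → Measurable b → (∀ x, |a x| ≤ F) → (∀ x, |b x| ≤ F) →
      Integrable (fun x => (a x - b x) ^ 2) PX := by
    intro a b ha hb haF hbF
    apply Integrable.of_bound (by fun_prop) (4 * F ^ 2) (Eventually.of_forall fun x => ?_)
    rw [Real.norm_eq_abs, abs_of_nonneg (sq_nonneg _)]
    have := abs_le.1 (haF x); have := abs_le.1 (hbF x); nlinarith
  have : ∫ x, (h x - g0 x) ^ 2 ∂PX ≤ ∫ x, (9/8 * (g1 x - g0 x) ^ 2 + 9 * (h x - g1 x) ^ 2) ∂PX := by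
    apply integral_mono (hintg _ _ hh hg0 hF hF0)
      (((hintg _ _ hg1 hg0 hF1 hF0).const_mul _).add ((hintg _ _ hh hg1 hF hF1).const_mul _))
    intro x
    show (h x - g0 x) ^ 2 ≤ 9/8 * (g1 x - g0 x) ^ 2 + 9 * (h x - g1 x) ^ 2
    nlinarith [sq_nonneg ((g1 x - g0 x) - 8 * (h x - g1 x))]
  rw [integral_add ((hintg _ _ hg1 hg0 hF1 hF0).const_mul _) ((hintg _ _ hh hg1 hF hF1).const_mul _),
    integral_const_mul, integral_const_mul] at this
  nlinarith

set_option maxHeartbeats 2000000 in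
theorem gauss_tests (d : ℕ) (PX : Measure (Fin d → ℝ)) [IsProbabilityMeasure PX] (f₀ : (Fin d → ℝ) → ℝ) (hf : Measurable f₀)
    (F : ℝ) (hF1 : 1 ≤ F) (hfF : ∀ x, |f₀ x| ≤ F) (s : ℝ) (hs : 0 < s) :
    ∃ c η0 : ℝ, 0 < c ∧ 0 < η0 ∧ η0 ≤ 1 ∧ ∀ η : ℝ, 0 < η → η ≤ η0 →
      (∃ T : (Fin d → ℝ) × ℝ → ℝ, Measurable T ∧
        ∫⁻ z, ENNReal.ofReal (Real.exp (T z)) ∂(gaussRegLaw d PX f₀ (Real.toNNReal s)) ≤ ENNReal.ofReal (Real.exp (-(c * η ^ 2))) ∧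
        ∀ h : (Fin d → ℝ) → ℝ, Measurable h → (∀ x, |h x| ≤ F) → ∀ v, s + η ≤ v →
          ∫⁻ z, gratio f₀ s h v z * (ENNReal.ofReal (Real.exp (T z)))⁻¹ ∂(gaussRegLaw d PX f₀ (Real.toNNReal s)) ≤ ENNReal.ofReal (Real.exp (-(c * η ^ 2)))) ∧
      (∃ T : (Fin d → ℝ) × ℝ → ℝ, Measurable T ∧
        ∫⁻ z, ENNReal.ofReal (Real.exp (T z)) ∂(gaussRegLaw d PX f₀ (Real.toNNReal s)) ≤ ENNReal.ofReal (Real.exp (-(c * η ^ 2))) ∧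
        ∀ h : (Fin d → ℝ) → ℝ, Measurable h → (∀ x, |h x| ≤ F) → ∀ v, 0 < v → v ≤ s - η → ∫ x, (h x - f₀ x) ^ 2 ∂PX ≤ η ^ 2 →
          ∫⁻ z, gratio f₀ s h v z * (ENNReal.ofReal (Real.exp (T z)))⁻¹ ∂(gaussRegLaw d PX f₀ (Real.toNNReal s)) ≤ ENNReal.ofReal (Real.exp (-(c * η ^ 2)))) ∧
      (∀ g1 : (Fin d → ℝ) → ℝ, Measurable g1 → (∀ x, |g1 x| ≤ F) → 3 / 4 * η ^ 2 ≤ ∫ x, (g1 x - f₀ x) ^ 2 ∂PX →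
       ∃ T : (Fin d → ℝ) × ℝ → ℝ, Measurable T ∧
        ∫⁻ z, ENNReal.ofReal (Real.exp (T z)) ∂(gaussRegLaw d PX f₀ (Real.toNNReal s)) ≤ ENNReal.ofReal (Real.exp (-(c * η ^ 2))) ∧
        ∀ h : (Fin d → ℝ) → ℝ, Measurable h → (∀ x, |h x| ≤ F) → ∀ v, 0 < v → v ≤ s + 1 → ∫ x, (h x - g1 x) ^ 2 ∂PX ≤ (η / 16) ^ 2 →
          ∫⁻ z, gratio f₀ s h v z * (ENNReal.ofReal (Real.exp (T z)))⁻¹ ∂(gaussRegLaw d PX f₀ (Real.toNNReal s)) ≤ ENNReal.ofReal (Real.exp (-(c * η ^ 2)))) := by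
  set lam := 1 / (2 * (s + 1) + 16 * F ^ 2) with hlam
  have hden : 0 < 2 * (s + 1) + 16 * F ^ 2 := by positivity
  have hl : 0 < lam := by positivity
  have hl1 : lam * (s + 1) ≤ 1 / 2 := by
    rw [hlam, div_mul_eq_mul_div, div_le_iff₀ hden]; nlinarith [sq_nonneg F]
  have hl2 : lam * (16 * F ^ 2) ≤ 1 := by
    rw [hlam, div_mul_eq_mul_div, div_le_iff₀ hden]; nlinarith [sq_nonneg F]
  set κ := 1 / (16 * (s + 1) ^ 2) with hκ
  have hκ0 : 0 < κ := by positivity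
  have hκs : κ * (s + 1) ^ 2 = 1 / 16 := by rw [hκ]; field_simp
  have hκ1 : κ ≤ 1 / 16 := by nlinarith [hκs, sq_nonneg s]
  refine ⟨min (lam / 32) (κ / 4), 1 / (64 * F ^ 2), by positivity, by positivity, ?_, ?_⟩
  · rw [div_le_one (by positivity)]; nlinarith
  intro η hη hη0
  have hη1 : η * F ^ 2 ≤ 1 / 64 := by
    rw [le_div_iff₀ (by positivity)] at hη0; nlinarith
  have hη2 : η ≤ 1 / 64 := by nlinarith [mul_le_mul_of_nonneg_left (one_le_pow₀ hF1 : 1 ≤ F ^ 2) hη.le]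
  set μ := gaussRegLaw d PX f₀ (Real.toNNReal s) with hμ
  set c := min (lam / 32) (κ / 4) with hc
  have hcl : c ≤ lam / 32 := min_le_left _ _
  have hck : c ≤ κ / 4 := min_le_right _ _
  -- type one errors as quadratic exponents
  have type1 : ∀ T : (Fin d → ℝ) × ℝ → ℝ, Measurable T →
      ∫⁻ z, ENNReal.ofReal (Real.exp (T z)) ∂μ = ∫⁻ x, (∫⁻ y : ℝ, ENNReal.ofReal (gpdf (f₀ x) s y) * ENNReal.ofReal (Real.exp (T (x, y)))) ∂PX := by
    intro T hT
    exact lintegral_gaussRegLaw d PX f₀ hf s hs (fun z => ENNReal.ofReal (Real.exp (T z))) (by fun_prop)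
  have type2 : ∀ T : (Fin d → ℝ) × ℝ → ℝ, Measurable T → ∀ h : (Fin d → ℝ) → ℝ, Measurable h → ∀ v,
      ∫⁻ z, gratio f₀ s h v z * (ENNReal.ofReal (Real.exp (T z)))⁻¹ ∂μ = ∫⁻ x, (∫⁻ y : ℝ, ENNReal.ofReal (gpdf (h x) v y) * ENNReal.ofReal (Real.exp ((fun z => -T z) (x, y)))) ∂PX := by
    intro T hT h hh v
    simp_rw [ofReal_exp_inv]
    exact lintegral_gratio_mul PX f₀ hf s hs h hh v (fun z => ENNReal.ofReal (Real.exp (-T z))) (by fun_prop)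
  have hκη : 0 < κ * η := by positivity
  have hκηs : (κ * η) * s ≤ 1 / 64 := by
    nlinarith [mul_pos hκ0 hs]
  have hκss : κ * s ^ 2 ≤ 1 / 16 := by nlinarith [mul_pos hκ0 hs]
  have hηη : 0 < κ * η ^ 2 := by positivity
  refine ⟨⟨fun z => κ * η * ((z.2 - f₀ z.1) ^ 2 - (s + η / 2)), by fun_prop, ?_, ?_⟩,
    ⟨fun z => κ * η * ((s - η / 2) - (z.2 - f₀ z.1) ^ 2), by fun_prop, ?_, ?_⟩, ?_⟩
  · rw [type1 _ (by fun_prop), lintegral_quad PX f₀ s hs (fun z => κ * η * ((z.2 - f₀ z.1) ^ 2 - (s + η / 2))) (κ * η) (by nlinarith) (fun _ => 0) (fun _ => -(κ * η * (s + η / 2)))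
      (by intro x y; simp only; ring)]
    simp only [lintegral_const, measure_univ, mul_one]
    apply ENNReal.ofReal_le_ofReal
    have h1 := inv_sqrt_one_sub (u := 2 * (κ * η) * s) (by positivity) (by nlinarith)
    calc _ ≤ Real.exp ((2 * (κ * η) * s) / 2 + (2 * (κ * η) * s) ^ 2 / 2) * Real.exp (0 ^ 2 * s / (2 * (1 - 2 * (κ * η) * s)) + -(κ * η * (s + η / 2))) := by gcongr
      _ ≤ _ := by
        rw [← Real.exp_add]
        apply Real.exp_le_exp.2
        have e2 := mul_le_mul_of_nonneg_left hκss hηη.le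
        have e3 := mul_le_mul_of_nonneg_right hck (sq_nonneg η)
        simp only [ne_eq, OfNat.ofNat_ne_zero, not_false_eq_true, zero_pow, zero_mul, zero_div]
        nlinarith
  · intro h hh hhF v hv
    have hv0 : 0 < v := by linarith
    rw [type2 _ (by fun_prop) h hh v, lintegral_quad PX h v hv0 (fun z => -(κ * η * ((z.2 - f₀ z.1) ^ 2 - (s + η / 2)))) (-(κ * η)) (by nlinarith)
      (fun x => -(2 * κ * η * (h x - f₀ x))) (fun x => κ * η * (s + η / 2) - κ * η * (h x - f₀ x) ^ 2)
      (by intro x y; simp only; ring)]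
    have hcv : 0 < 1 + 2 * (κ * η) * v := by positivity
    calc _ ≤ ∫⁻ x, ENNReal.ofReal (Real.exp (-(c * η ^ 2))) ∂PX := by
          apply lintegral_mono
          intro x
          apply ENNReal.ofReal_le_ofReal
          have e0 : 1 - 2 * -(κ * η) * v = 1 + 2 * (κ * η) * v := by ring
          rw [e0]
          have h1 : (Real.sqrt (1 + 2 * (κ * η) * v))⁻¹ ≤ (Real.sqrt (1 + 2 * (κ * η) * (s + η)))⁻¹ := by gcongr
          have h2 := inv_sqrt_one_add (u := 2 * (κ * η) * (s + η)) (by positivity)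
          have h3 : (-(2 * κ * η * (h x - f₀ x))) ^ 2 * v / (2 * (1 + 2 * (κ * η) * v)) ≤ κ * η * (h x - f₀ x) ^ 2 := by
            rw [div_le_iff₀ (by positivity)]
            have : 0 ≤ κ * η * (h x - f₀ x) ^ 2 := by positivity
            nlinarith
          calc _ ≤ Real.exp (-(2 * (κ * η) * (s + η)) / 2 + (2 * (κ * η) * (s + η)) ^ 2 / 2) * Real.exp (κ * η * (s + η / 2)) := by
                gcongr
                · exact h1.trans h2
                · linarith
            _ ≤ _ := by
              rw [← Real.exp_add]
              apply Real.exp_le_exp.2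
              have e2 : κ * (s + η) ^ 2 ≤ 1 / 16 := by
                rw [← hκs]; gcongr; linarith
              have e4 := mul_le_mul_of_nonneg_left e2 hηη.le
              have e3 := mul_le_mul_of_nonneg_right hck (sq_nonneg η)
              nlinarith
      _ = _ := by simp
  · rw [type1 _ (by fun_prop), lintegral_quad PX f₀ s hs (fun z => κ * η * ((s - η / 2) - (z.2 - f₀ z.1) ^ 2)) (-(κ * η)) (by nlinarith) (fun _ => 0) (fun _ => (κ * η * (s - η / 2)))
      (by intro x y; simp only; ring)]
    simp only [lintegral_const, measure_univ, mul_one]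
    apply ENNReal.ofReal_le_ofReal
    have h1 := inv_sqrt_one_add (u := 2 * (κ * η) * s) (by positivity)
    have e0 : 1 - 2 * -(κ * η) * s = 1 + 2 * (κ * η) * s := by ring
    rw [e0]
    calc _ ≤ Real.exp (-(2 * (κ * η) * s) / 2 + (2 * (κ * η) * s) ^ 2 / 2) * Real.exp (0 ^ 2 * s / (2 * (1 + 2 * (κ * η) * s)) + (κ * η * (s - η / 2))) := by gcongr
      _ ≤ _ := by
        rw [← Real.exp_add]
        apply Real.exp_le_exp.2
        have e2 := mul_le_mul_of_nonneg_left hκss hηη.le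
        have e3 := mul_le_mul_of_nonneg_right hck (sq_nonneg η)
        simp only [ne_eq, OfNat.ofNat_ne_zero, not_false_eq_true, zero_pow, zero_mul, zero_div]
        nlinarith
  · intro h hh hhF v hv0 hv hdist
    have hvs : v ≤ s := by linarith
    have hκηv : (κ * η) * v ≤ 1 / 64 := le_trans (by gcongr) hκηs
    rw [type2 _ (by fun_prop) h hh v, lintegral_quad PX h v hv0 (fun z => -(κ * η * ((s - η / 2) - (z.2 - f₀ z.1) ^ 2))) ((κ * η)) (by nlinarith)
      (fun x => (2 * κ * η * (h x - f₀ x))) (fun x => κ * η * (h x - f₀ x) ^ 2 - κ * η * (s - η / 2))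
      (by intro x y; simp only; ring)]
    have hcv : 1 / 2 ≤ 1 - 2 * (κ * η) * v := by nlinarith
    have hb : ∀ x, (h x - f₀ x) ^ 2 ≤ 4 * F ^ 2 := by
      intro x; have := abs_le.1 (hhF x); have := abs_le.1 (hfF x); nlinarith
    have hle : ∀ x, (Real.sqrt (1 - 2 * (κ * η) * v))⁻¹ * Real.exp ((2 * κ * η * (h x - f₀ x)) ^ 2 * v / (2 * (1 - 2 * (κ * η) * v)) + (κ * η * (h x - f₀ x) ^ 2 - κ * η * (s - η / 2)))
        ≤ Real.exp (2 * (κ * η) * v / 2 + (2 * (κ * η) * v) ^ 2 / 2 - κ * η * (s - η / 2)) * Real.exp (-(0:ℝ) + 2 * (κ * η) * (h x - f₀ x) ^ 2) := by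
      intro x
      have h1 := inv_sqrt_one_sub (u := 2 * (κ * η) * v) (by positivity) (by nlinarith)
      have h3 : (2 * κ * η * (h x - f₀ x)) ^ 2 * v / (2 * (1 - 2 * (κ * η) * v)) ≤ κ * η * (h x - f₀ x) ^ 2 := by
        rw [div_le_iff₀ (by linarith)]
        have : 0 ≤ κ * η * (h x - f₀ x) ^ 2 := by positivity
        have := mul_le_mul_of_nonneg_left hκηv this
        nlinarith
      calc _ ≤ Real.exp (2 * (κ * η) * v / 2 + (2 * (κ * η) * v) ^ 2 / 2) * Real.exp (κ * η * (h x - f₀ x) ^ 2 + (κ * η * (h x - f₀ x) ^ 2 - κ * η * (s - η / 2))) := by gcongr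
        _ = _ := by
          rw [← Real.exp_add, ← Real.exp_add]; congr 1; ring
    calc _ ≤ ∫⁻ x, ENNReal.ofReal (Real.exp (2 * (κ * η) * v / 2 + (2 * (κ * η) * v) ^ 2 / 2 - κ * η * (s - η / 2))) * ENNReal.ofReal (Real.exp (-(0:ℝ) + 2 * (κ * η) * (h x - f₀ x) ^ 2)) ∂PX := by
          apply lintegral_mono
          intro x
          simp only
          rw [← ENNReal.ofReal_mul (Real.exp_nonneg _)]
          exact ENNReal.ofReal_le_ofReal (hle x)
      _ ≤ ENNReal.ofReal (Real.exp (2 * (κ * η) * v / 2 + (2 * (κ * η) * v) ^ 2 / 2 - κ * η * (s - η / 2))) * ENNReal.ofReal (Real.exp (-(∫ x, (0:ℝ) ∂PX)/2 + 2 * ∫ x, 2 * (κ * η) * (h x - f₀ x) ^ 2 ∂PX)) := by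
          rw [lintegral_const_mul' _ _ ENNReal.ofReal_ne_top]
          gcongr
          apply lint_exp PX _ (fun _ => (0:ℝ)) (fun x => 2 * (κ * η) * (h x - f₀ x) ^ 2) measurable_const (by fun_prop) (fun x => le_rfl)
            (fun _ => le_rfl) (fun _ => by norm_num) (fun _ => by positivity)
          intro x
          have := mul_le_mul_of_nonneg_left (hb x) hκη.le
          nlinarith
      _ ≤ _ := by
          rw [← ENNReal.ofReal_mul (Real.exp_nonneg _), ← Real.exp_add, integral_const_mul]
          apply ENNReal.ofReal_le_ofReal
          apply Real.exp_le_exp.2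
          have e5 := mul_le_mul_of_nonneg_left hdist hκη.le
          have e2 : κ * v ^ 2 ≤ 1 / 16 := le_trans (by gcongr) hκss
          have e4 := mul_le_mul_of_nonneg_left e2 hηη.le
          have e3 := mul_le_mul_of_nonneg_right hck (sq_nonneg η)
          have e6 := mul_le_mul_of_nonneg_left hη2 hηη.le
          have e7 := mul_le_mul_of_nonneg_left hv hκη.le
          simp only [integral_zero]
          nlinarith
  · intro g1 hg1 hg1F hsep
    have hDF : ∀ x, |g1 x - f₀ x| ≤ 2 * F := by
      intro x; have := abs_le.1 (hg1F x); have := abs_le.1 (hfF x); exact abs_le.2 ⟨by linarith, by linarith⟩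
    refine ⟨fun z => lam * (z.2 - (f₀ z.1 + g1 z.1) / 2) * (g1 z.1 - f₀ z.1), by fun_prop, ?_, ?_⟩
    · rw [type1 _ (by fun_prop), lintegral_quad PX f₀ s hs (fun z => lam * (z.2 - (f₀ z.1 + g1 z.1) / 2) * (g1 z.1 - f₀ z.1)) 0 (by norm_num) (fun x => lam * (g1 x - f₀ x))
        (fun x => - (lam * (g1 x - f₀ x) ^ 2 / 2)) (by intro x y; simp only; ring)]
      have := reg_type1 PX (fun x => g1 x - f₀ x) (by fun_prop) F lam s hDF hl hs.le (by nlinarith) hl2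
      simp only [mul_zero, zero_mul, sub_zero, Real.sqrt_one, inv_one, one_mul, mul_one, ← sub_eq_add_neg]
      refine this.trans ?_
      apply ENNReal.ofReal_le_ofReal
      apply Real.exp_le_exp.2
      have := mul_le_mul_of_nonneg_left hsep hl.le
      have e3 := mul_le_mul_of_nonneg_right hcl (sq_nonneg η)
      nlinarith [mul_pos hl (pow_pos hη 2)]
    · intro h hh hhF v hv0 hv hdist
      have hEF : ∀ x, |h x - g1 x| ≤ 2 * F := by
        intro x; have := abs_le.1 (hg1F x); have := abs_le.1 (hhF x); exact abs_le.2 ⟨by linarith, by linarith⟩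
      rw [type2 _ (by fun_prop) h hh v, lintegral_quad PX h v hv0 (fun z => -(lam * (z.2 - (f₀ z.1 + g1 z.1) / 2) * (g1 z.1 - f₀ z.1))) 0 (by norm_num) (fun x => -(lam * (g1 x - f₀ x)))
        (fun x => - (lam * (g1 x - f₀ x) ^ 2 / 2) - lam * (h x - g1 x) * (g1 x - f₀ x)) (by intro x y; simp only; ring)]
      have := reg_type2 PX (fun x => g1 x - f₀ x) (fun x => h x - g1 x) (by fun_prop) (by fun_prop) F lam v hDF hEF hl hv0.le (by nlinarith) hl2
      have e9 : ∀ x, (Real.sqrt (1 - 2 * 0 * v))⁻¹ * Real.exp ((-(lam * (g1 x - f₀ x))) ^ 2 * v / (2 * (1 - 2 * 0 * v)) + (-(lam * (g1 x - f₀ x) ^ 2 / 2) - lam * (h x - g1 x) * (g1 x - f₀ x)))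
         = Real.exp ((lam * (g1 x - f₀ x)) ^ 2 * v / 2 - lam * (g1 x - f₀ x) ^ 2 / 2 - lam * (h x - g1 x) * (g1 x - f₀ x)) := by
        intro x
        simp only [mul_zero, zero_mul, sub_zero, Real.sqrt_one, inv_one, one_mul, mul_one]
        congr 1; ring
      simp_rw [e9]
      refine this.trans ?_
      apply ENNReal.ofReal_le_ofReal
      apply Real.exp_le_exp.2
      have := mul_le_mul_of_nonneg_left hsep hl.le
      have := mul_le_mul_of_nonneg_left hdist hl.le
      have e3 := mul_le_mul_of_nonneg_right hcl (sq_nonneg η)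
      nlinarith [mul_pos hl (pow_pos hη 2)]



/-- one ReLU layer with weights bounded by `B` -/
def IsLayer (B : ℝ) {ι κ : Type} [Fintype ι] (g : (ι → ℝ) → κ → ℝ) : Prop :=
  ∃ (A : κ → ι → ℝ) (b : κ → ℝ), (∀ k i, |A k i| ≤ B) ∧ (∀ k, |b k| ≤ B) ∧
    ∀ v k, g v k = max 0 ((∑ i, A k i * v i) + b k)

/-- `t+1` ReLU layers with weights bounded by `B`, inner widths bounded by `W` -/
def NN (B : ℝ) (W : ℕ) {ι : Type} [Fintype ι] :
    ℕ → ∀ {κ : Type}, ((ι → ℝ) → κ → ℝ) → Prop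
  | 0, _, f => IsLayer B f
  | t + 1, κ, f => ∃ (μ : Type) (_ : Fintype μ) (f1 : (ι → ℝ) → μ → ℝ) (g : (μ → ℝ) → κ → ℝ),
      Fintype.card μ ≤ W ∧ NN B W t f1 ∧ IsLayer B g ∧ ∀ v, f v = g (f1 v)

theorem IsLayer.mono {B B' : ℝ} (h : B ≤ B') {ι κ : Type} [Fintype ι] {g : (ι → ℝ) → κ → ℝ}
    (hg : IsLayer B g) : IsLayer B' g := by
  obtain ⟨A, b, h1, h2, h3⟩ := hg
  exact ⟨A, b, fun k i => (h1 k i).trans h, fun k => (h2 k).trans h, h3⟩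

theorem IsLayer.nonneg {B : ℝ} {ι κ : Type} [Fintype ι] {g : (ι → ℝ) → κ → ℝ}
    (hg : IsLayer B g) (v k) : 0 ≤ g v k := by
  obtain ⟨A, b, h1, h2, h3⟩ := hg
  rw [h3]; exact le_max_left _ _

theorem IsLayer.continuous {B : ℝ} {ι κ : Type} [Fintype ι] {g : (ι → ℝ) → κ → ℝ}
    (hg : IsLayer B g) : Continuous g := by
  obtain ⟨A, b, h1, h2, h3⟩ := hg
  have : g = fun v k => max 0 ((∑ i, A k i * v i) + b k) := by
    funext v k; exact h3 v k
  rw [this]; fun_prop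

theorem NN.mono {B B' : ℝ} (h : B ≤ B') {W W' : ℕ} (hW : W ≤ W') {ι : Type} [Fintype ι] :
    ∀ {t : ℕ} {κ : Type} {f : (ι → ℝ) → κ → ℝ}, NN B W t f → NN B' W' t f := by
  intro t
  induction t with
  | zero => intro κ f hf; exact IsLayer.mono h hf
  | succ t ih =>
    intro κ f hf
    obtain ⟨μ, i, f1, g, h1, h2, h3, h4⟩ := hf
    exact ⟨μ, i, f1, g, h1.trans hW, ih h2, h3.mono h, h4⟩

theorem NN.nonneg {B : ℝ} {W : ℕ} {ι : Type} [Fintype ι] :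
    ∀ {t : ℕ} {κ : Type} {f : (ι → ℝ) → κ → ℝ}, NN B W t f → ∀ v k, 0 ≤ f v k := by
  intro t
  cases t with
  | zero => intro κ f hf; exact IsLayer.nonneg hf
  | succ t =>
    intro κ f hf v k
    obtain ⟨μ, i, f1, g, h1, h2, h3, h4⟩ := hf
    rw [h4]; exact h3.nonneg _ _

theorem NN.continuous {B : ℝ} {W : ℕ} {ι : Type} [Fintype ι] :
    ∀ {t : ℕ} {κ : Type} {f : (ι → ℝ) → κ → ℝ}, NN B W t f → Continuous f := by
  intro t
  induction t with
  | zero => intro κ f hf; exact IsLayer.continuous hf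
  | succ t ih =>
    intro κ f hf
    obtain ⟨μ, i, f1, g, h1, h2, h3, h4⟩ := hf
    have : f = g ∘ f1 := by funext v; exact h4 v
    rw [this]; exact h3.continuous.comp (ih h2)

theorem NN.comp {B : ℝ} {W : ℕ} {ι κ : Type} [Fintype ι] [Fintype κ] {t : ℕ}
    {f : (ι → ℝ) → κ → ℝ} (hf : NN B W t f) (hκ : Fintype.card κ ≤ W) :
    ∀ {s : ℕ} {μ : Type} {g : (κ → ℝ) → μ → ℝ}, NN B W s g →
      NN B W (t + s + 1) (fun v => g (f v)) := by
  intro s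
  induction s with
  | zero => intro μ g hg; exact ⟨κ, inferInstance, f, g, hκ, hf, hg, fun _ => rfl⟩
  | succ s ih =>
    intro μ g hg
    obtain ⟨η, i, g1, g2, h1, h2, h3, h4⟩ := hg
    exact ⟨η, i, fun v => g1 (f v), g2, h1, ih h2, h3, fun v => h4 _⟩

theorem IsLayer.id' {B : ℝ} (hB : 1 ≤ B) {κ : Type} [Fintype κ] :
    IsLayer B (fun (v : κ → ℝ) k => max 0 (v k)) := by
  classical
  refine ⟨fun k i => if i = k then 1 else 0, fun _ => 0, ?_, ?_, ?_⟩
  · intro k i; dsimp only; split_ifs <;> simp <;> linarith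
  · intro k; simp; linarith
  · intro v k; simp

theorem NN.pad1 {B : ℝ} (hB : 1 ≤ B) {W : ℕ} {ι κ : Type} [Fintype ι] [Fintype κ] {t : ℕ}
    {f : (ι → ℝ) → κ → ℝ} (hf : NN B W t f) (hκ : Fintype.card κ ≤ W) : NN B W (t + 1) f :=
  ⟨κ, inferInstance, f, _, hκ, hf, IsLayer.id' hB, fun v => by
    funext k; simp [hf.nonneg v k]⟩

theorem NN.pad {B : ℝ} (hB : 1 ≤ B) {W : ℕ} {ι κ : Type} [Fintype ι] [Fintype κ] {t s : ℕ}
    {f : (ι → ℝ) → κ → ℝ} (hf : NN B W t f) (hκ : Fintype.card κ ≤ W) (hs : t ≤ s) :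
    NN B W s f := by
  induction s, hs using Nat.le_induction with
  | base => exact hf
  | succ n hn ih => exact ih.pad1 hB hκ

theorem IsLayer.reindex {B : ℝ} {ι κ κ' : Type} [Fintype ι] {g : (ι → ℝ) → κ → ℝ}
    (hg : IsLayer B g) (σ : κ' → κ) : IsLayer B (fun v k => g v (σ k)) := by
  obtain ⟨A, b, h1, h2, h3⟩ := hg
  exact ⟨fun k => A (σ k), fun k => b (σ k), fun k i => h1 _ i, fun k => h2 _, fun v k => h3 _ _⟩

theorem NN.reindex {B : ℝ} {W : ℕ} {ι κ κ' : Type} [Fintype ι] {t : ℕ} {g : (ι → ℝ) → κ → ℝ}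
    (hg : NN B W t g) (σ : κ' → κ) : NN B W t (fun v k => g v (σ k)) := by
  cases t with
  | zero => exact IsLayer.reindex hg σ
  | succ t =>
    obtain ⟨μ, i, f1, g1, h1, h2, h3, h4⟩ := hg
    exact ⟨μ, i, f1, _, h1, h2, h3.reindex σ, fun v => by funext k; exact congrFun (h4 v) _⟩

theorem NN.congr {B : ℝ} {W : ℕ} {ι κ : Type} [Fintype ι] {t : ℕ} {f g : (ι → ℝ) → κ → ℝ}
    (hg : NN B W t g) (h : ∀ v k, f v k = g v k) : NN B W t f := by
  have : f = g := by funext v k; exact h v k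
  rwa [this]

/-- block-diagonal layers -/
theorem IsLayer.sigma {B : ℝ} (hB : 0 ≤ B) {I : Type} [Fintype I] {μ κ : I → Type}
    [∀ i, Fintype (μ i)] {g : ∀ i, (μ i → ℝ) → κ i → ℝ} (hg : ∀ i, IsLayer B (g i)) :
    IsLayer B (fun (v : (Σ i, μ i) → ℝ) (p : Σ i, κ i) => g p.1 (fun m => v ⟨p.1, m⟩) p.2) := by
  classical
  choose A b h1 h2 h3 using hg
  refine ⟨fun p r => if h : r.1 = p.1 then A p.1 p.2 (h ▸ r.2) else 0, fun p => b p.1 p.2, ?_, ?_, ?_⟩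
  · rintro ⟨i, k⟩ ⟨j, m⟩
    by_cases h : j = i
    · subst h; simpa using h1 _ _ _
    · simpa [h] using hB
  · intro p; exact h2 _ _
  · rintro v ⟨i, k⟩
    simp only [h3, Fintype.sum_sigma]
    congr 2
    rw [Finset.sum_eq_single i]
    · simp
    · intro j _ hj; simp [hj]
    · simp

theorem NN.sigma {B : ℝ} (hB : 0 ≤ B) {W : ℕ} {ι : Type} [Fintype ι] {I : Type} [Fintype I] :
    ∀ {t : ℕ} {κ : I → Type} {f : ∀ i, (ι → ℝ) → κ i → ℝ}, (∀ i, NN B W t (f i)) →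
    NN B (Fintype.card I * W) t (fun v (p : Σ i, κ i) => f p.1 v p.2) := by
  intro t
  induction t with
  | zero =>
    intro κ f hf
    have hf' : ∀ i, IsLayer B (f i) := hf
    choose A b h1 h2 h3 using hf'
    exact ⟨fun p => A p.1 p.2, fun p => b p.1 p.2, fun p i => h1 _ _ _, fun p => h2 _ _,
      fun v p => h3 _ _ _⟩
  | succ t ih =>
    intro κ f hf
    have hf' : ∀ i, ∃ (μ : Type) (_ : Fintype μ) (f1 : (ι → ℝ) → μ → ℝ) (g : (μ → ℝ) → κ i → ℝ),
      Fintype.card μ ≤ W ∧ NN B W t f1 ∧ IsLayer B g ∧ ∀ v, f i v = g (f1 v) := hf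
    choose μ inst f1 g h1 h2 h3 h4 using hf'
    refine ⟨Σ i, μ i, inferInstance, fun v p => f1 p.1 v p.2, _, ?_, ih h2, IsLayer.sigma hB h3, ?_⟩
    · rw [Fintype.card_sigma]
      calc ∑ i, Fintype.card (μ i) ≤ ∑ i : I, W := Finset.sum_le_sum fun i _ => h1 i
        _ = _ := by simp
    · intro v; funext p; simp [h4]

theorem IsLayer.sum {B : ℝ} (hB : 0 ≤ B) {μ μ' κ κ' : Type} [Fintype μ] [Fintype μ']
    {g : (μ → ℝ) → κ → ℝ} {g' : (μ' → ℝ) → κ' → ℝ} (hg : IsLayer B g) (hg' : IsLayer B g') :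
    IsLayer B (fun (v : (μ ⊕ μ') → ℝ) => Sum.elim (g fun m => v (Sum.inl m)) (g' fun m => v (Sum.inr m))) := by
  obtain ⟨A, b, h1, h2, h3⟩ := hg
  obtain ⟨A', b', h1', h2', h3'⟩ := hg'
  refine ⟨Sum.elim (fun k => Sum.elim (A k) 0) (fun k => Sum.elim 0 (A' k)), Sum.elim b b', ?_, ?_, ?_⟩
  · rintro (k | k) (i | i) <;> simp [h1, h1', hB]
  · rintro (k | k) <;> simp [h2, h2']
  · rintro v (k | k) <;> simp [h3, h3']

theorem NN.sum {B : ℝ} (hB : 0 ≤ B) {W W' : ℕ} {ι : Type} [Fintype ι] :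
    ∀ {t : ℕ} {κ κ' : Type} {f : (ι → ℝ) → κ → ℝ} {f' : (ι → ℝ) → κ' → ℝ}, NN B W t f → NN B W' t f' →
    NN B (W + W') t (fun v => Sum.elim (f v) (f' v)) := by
  intro t
  induction t with
  | zero =>
    rintro κ κ' f f' ⟨A, b, h1, h2, h3⟩ ⟨A', b', h1', h2', h3'⟩
    exact ⟨Sum.elim A A', Sum.elim b b', by rintro (k | k) i <;> simp [h1, h1'],
      by rintro (k | k) <;> simp [h2, h2'], by rintro v (k | k) <;> simp [h3, h3']⟩
  | succ t ih =>
    rintro κ κ' f f' ⟨μ, i, f1, g, h1, h2, h3, h4⟩ ⟨μ', i', f1', g', h1', h2', h3', h4'⟩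
    refine ⟨μ ⊕ μ', inferInstance, _, _, ?_, ih h2 h2', IsLayer.sum hB h3 h3', ?_⟩
    · simp; omega
    · intro v; funext p; rcases p with p | p <;> simp [h4, h4']

theorem NN.layer_scale {κ₀ : ℝ} (hκ : 1 ≤ κ₀) {W : ℕ} {ι κ : Type} [Fintype ι] [Fintype κ]
    (hW : Fintype.card κ ≤ W) (m : ℕ) {f : (ι → ℝ) → κ → ℝ} (hf : IsLayer (κ₀ ^ m) f) :
    NN κ₀ W m f := by
  classical
  have key : ∀ j : ℕ, NN κ₀ W j (fun v k => κ₀ ^ j * ((κ₀ ^ m)⁻¹ * f v k)) := by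
    have hpos : 0 < κ₀ ^ m := by positivity
    intro j
    induction j with
    | zero =>
      obtain ⟨A, b, h1, h2, h3⟩ := hf
      refine ⟨fun k i => (κ₀ ^ m)⁻¹ * A k i, fun k => (κ₀ ^ m)⁻¹ * b k, ?_, ?_, ?_⟩
      · intro k i; rw [abs_mul, abs_of_pos (inv_pos.2 hpos)]
        calc _ ≤ (κ₀ ^ m)⁻¹ * κ₀ ^ m := by gcongr; exact h1 k i
          _ = 1 := inv_mul_cancel₀ hpos.ne'
          _ ≤ _ := hκ
      · intro k; rw [abs_mul, abs_of_pos (inv_pos.2 hpos)]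
        calc _ ≤ (κ₀ ^ m)⁻¹ * κ₀ ^ m := by gcongr; exact h2 k
          _ = 1 := inv_mul_cancel₀ hpos.ne'
          _ ≤ _ := hκ
      · intro v k
        dsimp only
        rw [h3, pow_zero, one_mul, mul_max_of_nonneg _ _ (inv_pos.2 hpos).le, mul_zero, mul_add, Finset.mul_sum]
        simp only [mul_assoc]
    | succ j ih =>
      refine ⟨κ, inferInstance, _, fun v k => max 0 (κ₀ * v k), hW, ih, ?_, ?_⟩
      · refine ⟨fun k i => if i = k then κ₀ else 0, fun _ => 0, ?_, ?_, ?_⟩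
        · intro k i; dsimp only; split_ifs <;> [exact (abs_of_nonneg (by linarith)).le; (simp; linarith)]
        · intro k; simp; linarith
        · intro v k; simp
      · intro v; funext k
        have := hf.nonneg v k
        dsimp only
        rw [max_eq_right (by positivity)]; ring
  refine (key m).congr fun v k => ?_
  have hpos : 0 < κ₀ ^ m := by positivity
  field_simp

theorem NN.reduce {κ₀ : ℝ} (hκ : 1 ≤ κ₀) {W : ℕ} (m : ℕ) {ι : Type} [Fintype ι] :
    ∀ {t : ℕ} {κ : Type} [Fintype κ] {f : (ι → ℝ) → κ → ℝ}, Fintype.card κ ≤ W →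
    NN (κ₀ ^ m) W t f → NN κ₀ W ((t + 1) * (m + 1) - 1) f := by
  intro t
  induction t with
  | zero =>
    intro κ _ f hW hf
    have := NN.layer_scale hκ hW m hf
    simpa using this
  | succ t ih =>
    intro κ _ f hW hf
    obtain ⟨μ, i, f1, g, h1, h2, h3, h4⟩ := hf
    have e1 := ih h1 h2
    have e2 := NN.layer_scale hκ hW m h3
    have e3 := e1.comp h1 e2
    have : (t + 1 + 1) * (m + 1) - 1 = (t + 1) * (m + 1) - 1 + m + 1 := by
      have : 1 ≤ (t + 1) * (m + 1) := Nat.one_le_iff_ne_zero.2 (by positivity)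
      have h2 : (t + 1 + 1) * (m + 1) = (t + 1) * (m + 1) + (m + 1) := by ring
      omega
    rw [this]
    exact e3.congr fun v k => by rw [h4]


/-- iterated partial derivatives along a list -/
def pdl {D : ℕ} (l : List (Fin D)) (g : (Fin D → ℝ) → ℝ) : (Fin D → ℝ) → ℝ := l.foldr pder g

theorem contDiff_pder {D : ℕ} (i : Fin D) (k : ℕ) {g : (Fin D → ℝ) → ℝ}
    (hg : ContDiff ℝ ((k + 1 : ℕ) : ℕ∞) g) : ContDiff ℝ (k : ℕ∞) (pder i g) := by
  unfold pder
  refine ContDiff.clm_apply (hg.fderiv_right ?_) contDiff_const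
  norm_cast

theorem contDiff_pdl {D : ℕ} (l : List (Fin D)) : ∀ (k : ℕ) {g : (Fin D → ℝ) → ℝ},
    ContDiff ℝ ((k + l.length : ℕ) : ℕ∞) g → ContDiff ℝ (k : ℕ∞) (pdl l g) := by
  induction l with
  | nil => intro k g hg; simpa [pdl] using hg
  | cons i l ih =>
    intro k g hg
    have : ContDiff ℝ ((k + 1 : ℕ) : ℕ∞) (pdl l g) := ih (k + 1) (by
      convert hg using 3; simp; ring)
    exact contDiff_pder i k this

theorem pder_comm {D : ℕ} (i j : Fin D) {g : (Fin D → ℝ) → ℝ}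
    (hg : ContDiff ℝ ((2 : ℕ) : ℕ∞) g) : pder i (pder j g) = pder j (pder i g) := by
  funext x
  have hd : Differentiable ℝ (fderiv ℝ g) :=
    (hg.fderiv_right (m := 1) (by norm_cast)).differentiable (by norm_num)
  have h1 : ∀ a b : Fin D, pder a (pder b g) x = fderiv ℝ (fderiv ℝ g) x (Pi.single a 1) (Pi.single b 1) := by
    intro a b
    unfold pder
    rw [fderiv_clm_apply (hd x) (differentiableAt_const _)]
    simp
  rw [h1, h1]
  have hs : IsSymmSndFDerivAt ℝ g x := (hg.contDiffAt).isSymmSndFDerivAt (by simp)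
  exact hs _ _

theorem pdl_perm {D : ℕ} {l l' : List (Fin D)} (h : l.Perm l') {g : (Fin D → ℝ) → ℝ} :
    ContDiff ℝ (l.length : ℕ∞) g → pdl l g = pdl l' g := by
  induction h with
  | nil => intro _; rfl
  | cons x h ih =>
    intro hg
    have := ih (hg.of_le (by simp))
    show pder x (pdl _ g) = pder x (pdl _ g)
    rw [this]
  | swap x y l =>
    intro hg
    show pder y (pder x (pdl l g)) = pder x (pder y (pdl l g))
    apply pder_comm
    apply contDiff_pdl
    convert hg using 3; simp; ring
  | trans h1 h2 ih1 ih2 =>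
    intro hg
    rw [ih1 hg, ih2 (by rwa [← h1.length_eq])]

theorem pderm_eq {D : ℕ} (α : Fin D → ℕ) (g : (Fin D → ℝ) → ℝ) :
    pderm α g = pdl ((List.finRange D).flatMap fun i => List.replicate (α i) i) g := by
  unfold pderm
  induction List.finRange D with
  | nil => rfl
  | cons i l ih =>
    rw [List.foldr_cons, ih, List.flatMap_cons]
    unfold pdl
    rw [List.foldr_append]
    generalize (List.foldr pder g _) = G
    induction α i with
    | zero => rfl
    | succ m ihm => rw [Function.iterate_succ_apply', ihm, List.replicate_succ]; rfl

theorem pdl_eq_pderm {D : ℕ} (l : List (Fin D)) {g : (Fin D → ℝ) → ℝ}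
    (hg : ContDiff ℝ (l.length : ℕ∞) g) : pdl l g = pderm (fun i => l.count i) g := by
  rw [pderm_eq]
  apply pdl_perm _ hg
  rw [List.perm_iff_count]
  intro a
  rw [List.count_flatMap]
  have : (List.map (List.count a ∘ fun i => List.replicate (List.count i l) i) (List.finRange D))
      = List.map (fun i => if i = a then l.count a else 0) (List.finRange D) := by
    apply List.map_congr_left
    intro i _
    simp only [Function.comp, List.count_replicate]
    by_cases h : i = a <;> simp [h]
  rw [this, ← List.ofFn_eq_map, List.sum_ofFn]
  simp

/-- value of a letter -/
def letter {D : ℕ} (h : Fin D → ℝ) : Option (Fin D) → ℝ := fun o => o.elim 1 h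

def deg1 {D : ℕ} : Option (Fin D) → ℕ := fun o => o.elim 0 fun _ => 1

theorem letter_smul {D : ℕ} (h : Fin D → ℝ) (t : ℝ) {k : ℕ} (w : Fin k → Option (Fin D)) :
    ∏ j, letter (t • h) (w j) = t ^ (∑ j, deg1 (w j)) * ∏ j, letter h (w j) := by
  rw [← Finset.prod_pow_eq_pow_sum, ← Finset.prod_mul_distrib]
  refine Finset.prod_congr rfl fun j _ => ?_
  cases w j <;> simp [letter, deg1]

theorem cube_convex {A : ℝ} {D : ℕ} {x y : Fin D → ℝ} (hx : x ∈ cube A D) (hy : y ∈ cube A D)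
    {t : ℝ} (ht : t ∈ Set.Icc (0:ℝ) 1) : x + t • (y - x) ∈ cube A D := by
  intro i
  have h1 := hx i; have h2 := hy i
  simp only [Set.mem_Icc, Pi.add_apply, Pi.smul_apply, Pi.sub_apply, smul_eq_mul] at *
  constructor <;> nlinarith [h1.1, h1.2, h2.1, h2.2, ht.1, ht.2, mul_nonneg ht.1 (sub_nonneg.2 h2.1), mul_nonneg ht.1 (sub_nonneg.2 h2.2), mul_nonneg (sub_nonneg.2 ht.2) (sub_nonneg.2 h1.1), mul_nonneg (sub_nonneg.2 ht.2) (sub_nonneg.2 h1.2)]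

theorem cube_compact (A : ℝ) (D : ℕ) : IsCompact (cube A D) := by
  have : cube A D = Set.pi Set.univ fun _ => Set.Icc (-A) A := by
    ext x; simp [cube, Set.mem_pi, Pi.le_def, forall_and]
  rw [this]; exact isCompact_univ_pi fun _ => isCompact_Icc

theorem pder_sum {D : ℕ} (g : (Fin D → ℝ) → ℝ) (x h : Fin D → ℝ) :
    fderiv ℝ g x h = ∑ i, h i * pder i g x := by
  conv_lhs => rw [← Finset.univ_sum_single h]
  rw [map_sum]
  refine Finset.sum_congr rfl fun i _ => ?_
  have : Pi.single (M := fun _ => ℝ) i (h i) = h i • Pi.single i 1 := by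
    rw [← Pi.single_smul]; simp
  rw [this, map_smul]; rfl

theorem taylor_words {D : ℕ} (A s Hc : ℝ) (hs : 0 ≤ s) (hH : 0 ≤ Hc) : ∀ (k : ℕ) (g : (Fin D → ℝ) → ℝ),
    ContDiff ℝ (k : ℕ∞) g →
    (∀ l : List (Fin D), l.length = k → ∀ x ∈ cube A D, ∀ y ∈ cube A D,
      |pdl l g x - pdl l g y| ≤ Hc * ‖x - y‖ ^ s) →
    ∃ C : ℝ, 0 ≤ C ∧ ∀ x0 ∈ cube A D, ∃ c : (Fin k → Option (Fin D)) → ℝ, (∀ w, |c w| ≤ C) ∧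
      ∀ x ∈ cube A D, |g x - ∑ w, c w * ∏ j, letter (x - x0) (w j)| ≤ C * ‖x - x0‖ ^ ((k : ℝ) + s) := by
  intro k
  induction k with
  | zero =>
    intro g hg hl
    obtain ⟨S, hS⟩ := (cube_compact A D).exists_bound_of_continuousOn hg.continuous.continuousOn
    refine ⟨max Hc S, le_max_of_le_left hH, fun x0 hx0 => ⟨fun _ => g x0, fun w => ?_, fun x hx => ?_⟩⟩
    · exact (hS x0 hx0).trans (le_max_right _ _)
    · have := hl [] rfl x hx x0 hx0
      simp only [pdl, List.foldr_nil] at this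
      simp only [Finset.univ_unique, Finset.sum_const, Finset.card_singleton, Finset.univ_eq_empty, Finset.prod_empty, mul_one, one_smul, Nat.cast_zero, zero_add]
      exact this.trans (by gcongr; exact le_max_left _ _)
  | succ k ih =>
    intro g hg hl
    have hi : ∀ i, ∃ C : ℝ, 0 ≤ C ∧ ∀ x0 ∈ cube A D, ∃ c : (Fin k → Option (Fin D)) → ℝ, (∀ w, |c w| ≤ C) ∧
      ∀ x ∈ cube A D, |pder i g x - ∑ w, c w * ∏ j, letter (x - x0) (w j)| ≤ C * ‖x - x0‖ ^ ((k : ℝ) + s) := by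
      intro i
      apply ih (pder i g) (contDiff_pder i k hg)
      intro l hlk x hx y hy
      have := hl (l ++ [i]) (by simp [hlk]) x hx y hy
      simpa [pdl] using this
    choose C hC0 hC using hi
    obtain ⟨S, hS⟩ := (cube_compact A D).exists_bound_of_continuousOn hg.continuous.continuousOn
    have hsum0 : 0 ≤ ∑ i, C i := Finset.sum_nonneg fun i _ => hC0 i
    refine ⟨max 0 S + ∑ i, C i, by positivity, fun x0 hx0 => ?_⟩
    choose c hc1 hc2 using fun i => hC i x0 hx0
    classical
    let e : (Fin k → Option (Fin D)) → ℕ := fun w => ∑ j, deg1 (w j)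
    let c' : (Fin (k+1) → Option (Fin D)) → ℝ := fun w =>
      (w 0).elim (if Fin.tail w = (fun _ => none) then g x0 else 0)
        (fun i => c i (Fin.tail w) / (e (Fin.tail w) + 1))
    have hform : ∀ h : Fin D → ℝ, ∑ w, c' w * ∏ j, letter h (w j) =
        g x0 + ∑ i, h i * ∑ w, c i w / (e w + 1) * ∏ j, letter h (w j) := by
      intro h
      rw [← (Fin.consEquiv (fun _ => Option (Fin D))).sum_comp, Fintype.sum_prod_type, Fintype.sum_option]
      congr 1
      · rw [Finset.sum_eq_single (fun _ => none)]
        · simp [c', Fin.consEquiv, Fin.prod_univ_succ, letter]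
        · intro w _ hw; simp [c', Fin.consEquiv, hw]
        · simp
      · refine Finset.sum_congr rfl fun i _ => ?_
        rw [Finset.mul_sum]
        refine Finset.sum_congr rfl fun w _ => ?_
        simp only [c', Fin.consEquiv, Fin.prod_univ_succ, Equiv.coe_fn_mk, Fin.cons_zero, Fin.tail_cons, Option.elim_some, Fin.cons_succ]
        rw [show letter h (some i) = h i from rfl]; ring
    refine ⟨c', fun w => ?_, fun x hx => ?_⟩
    · have h0 : 0 ≤ max 0 S := le_max_left _ _
      simp only [c']
      cases w 0 with
      | none =>
        simp only [Option.elim_none]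
        split_ifs
        · have := hS x0 hx0; rw [Real.norm_eq_abs] at this
          linarith [le_max_right 0 S]
        · simp; linarith
      | some i =>
        simp only [Option.elim_some]
        rw [abs_div, abs_of_pos (by positivity : (0:ℝ) < (e (Fin.tail w) : ℝ) + 1)]
        have h1 := hc1 i (Fin.tail w)
        have h2 : C i ≤ ∑ i, C i := Finset.single_le_sum (fun i _ => hC0 i) (Finset.mem_univ i)
        have h3 : |c i (Fin.tail w)| / ((e (Fin.tail w) : ℝ) + 1) ≤ |c i (Fin.tail w)| :=
          div_le_self (abs_nonneg _) (by linarith [Nat.cast_nonneg (α := ℝ) (e (Fin.tail w))])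
        linarith
    · rw [hform]
      set h := x - x0 with hh
      have hk : (0:ℝ) ≤ (k:ℝ) + s := by positivity
      let φ : ℝ → ℝ := fun t => g (x0 + t • h) - (g x0 + ∑ i, h i * ∑ w, c i w / (e w + 1) * (t ^ (e w + 1) * ∏ j, letter h (w j)))
      let φ' : ℝ → ℝ := fun t => ∑ i, h i * (pder i g (x0 + t • h) - ∑ w, c i w * (t ^ e w * ∏ j, letter h (w j)))
      have hd : ∀ t ∈ Set.Icc (0:ℝ) 1, HasDerivWithinAt φ (φ' t) (Set.Icc 0 1) t := by
        intro t _
        apply HasDerivAt.hasDerivWithinAt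
        have hgd : Differentiable ℝ g := hg.differentiable (by simp)
        have e1 : HasDerivAt (fun t : ℝ => g (x0 + t • h)) (fderiv ℝ g (x0 + t • h) h) t := by
          have e0 : HasDerivAt (fun t : ℝ => x0 + t • h) h t := by
            simpa using ((hasDerivAt_id t).smul_const h).const_add x0
          exact (hgd _).hasFDerivAt.comp_hasDerivAt t e0
        have e2 : HasDerivAt (fun t : ℝ => g x0 + ∑ i, h i * ∑ w, c i w / (e w + 1) * (t ^ (e w + 1) * ∏ j, letter h (w j)))
            (∑ i, h i * ∑ w, c i w * (t ^ e w * ∏ j, letter h (w j))) t := by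
          apply HasDerivAt.const_add
          apply HasDerivAt.fun_sum
          intro i _
          apply HasDerivAt.const_mul
          apply HasDerivAt.fun_sum
          intro w _
          have e3 := (((hasDerivAt_pow (e w + 1) t).mul_const (∏ j, letter h (w j))).const_mul (c i w / (e w + 1)))
          refine e3.congr_deriv ?_
          have : ((e w : ℝ) + 1) ≠ 0 := by positivity
          rw [Nat.add_sub_cancel, Nat.cast_add_one]
          generalize (e w : ℝ) = E at this ⊢
          generalize (∏ j, letter h (w j)) = Q
          field_simp
        have e4 := e1.sub e2
        refine e4.congr_deriv ?_
        rw [pder_sum]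
        simp only [φ', mul_sub, Finset.sum_sub_distrib]
      have hb : ∀ t ∈ Set.Ico (0:ℝ) 1, ‖φ' t‖ ≤ (∑ i, C i) * ‖h‖ ^ ((k:ℝ) + s) * ‖h‖ := by
        intro t ht
        have hin : x0 + t • h ∈ cube A D := cube_convex hx0 hx ⟨ht.1, ht.2.le⟩
        rw [Finset.sum_mul, Finset.sum_mul]
        refine (norm_sum_le _ _).trans (Finset.sum_le_sum fun i _ => ?_)
        rw [norm_mul, mul_comm]
        have h1 := hc2 i _ hin
        simp only [add_sub_cancel_left, letter_smul] at h1
        have h2 : ‖t • h‖ ≤ ‖h‖ := by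
          rw [norm_smul, Real.norm_eq_abs, abs_of_nonneg ht.1]
          exact mul_le_of_le_one_left (norm_nonneg _) ht.2.le
        rw [Real.norm_eq_abs]
        gcongr
        · exact mul_nonneg (hC0 i) (by positivity)
        · refine h1.trans ?_
          gcongr
          exact hC0 i
        · exact norm_le_pi_norm h i
      have := norm_image_sub_le_of_norm_deriv_le_segment_01' hd hb
      have e1 : φ 1 = g x - (g x0 + ∑ i, h i * ∑ w, c i w / (e w + 1) * ∏ j, letter h (w j)) := by
        simp [φ, hh]
      have e0 : φ 0 = 0 := by simp [φ]
      rw [e0, sub_zero, e1, Real.norm_eq_abs] at this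
      refine this.trans ?_
      have e5 : ‖h‖ ^ (((k + 1 : ℕ) : ℝ) + s) = ‖h‖ ^ ((k:ℝ) + s) * ‖h‖ := by
        rw [← Real.rpow_add_one' (norm_nonneg _) (by positivity)]
        congr 1; push_cast; ring
      rw [e5, ← mul_assoc]
      gcongr
      exact le_add_of_nonneg_left (le_max_left _ _)

theorem memHolder_taylor {D : ℕ} {A β K : ℝ} (hβ : 0 < β) {g : (Fin D → ℝ) → ℝ}
    (hg : memHolder A D β K g) :
    ∃ C : ℝ, 0 ≤ C ∧ ∀ x0 ∈ cube A D, ∃ c : (Fin ⌊β⌋₊ → Option (Fin D)) → ℝ, (∀ w, |c w| ≤ C) ∧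
      ∀ x ∈ cube A D, |g x - ∑ w, c w * ∏ j, letter (x - x0) (w j)| ≤ C * ‖x - x0‖ ^ β := by
  obtain ⟨h1, S, H, h2, h3, h4⟩ := hg
  have hfl : (⌊β⌋₊ : ℝ) ≤ β := Nat.floor_le hβ.le
  have hex : ∀ α, 0 ≤ ∑ α, |H α| := fun _ : ℕ => Finset.sum_nonneg fun α _ => abs_nonneg _
  obtain ⟨C, hC0, hC⟩ := taylor_words A (β - ⌊β⌋₊) (∑ α, |H α|) (by linarith) (hex 0) ⌊β⌋₊ g h1 (by
    intro l hl x hx y hy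
    rcases eq_or_ne x y with rfl | hxy
    · simp; exact mul_nonneg (hex 0) (by positivity)
    have hcnt : ∀ i, l.count i < ⌊β⌋₊ + 1 := fun i => by
      have := List.count_le_length (a := i) (l := l); omega
    let α : Fin D → Fin (⌊β⌋₊ + 1) := fun i => ⟨l.count i, hcnt i⟩
    have hα : (∑ i, (α i : ℕ)) = ⌊β⌋₊ := by
      simp only [α]
      rw [← hl]
      have := Multiset.sum_count_eq_card (s := (Finset.univ : Finset (Fin D))) (m := (l : Multiset (Fin D))) (by simp)
      simpa using this
    rw [pdl_eq_pderm l (by rw [hl]; exact h1)]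
    refine (h3 α hα x hx y hy hxy).trans ?_
    gcongr
    exact (le_abs_self _).trans (Finset.single_le_sum (f := fun α => |H α|) (fun _ _ => abs_nonneg _) (Finset.mem_univ α)))
  refine ⟨C, hC0, fun x0 hx0 => ?_⟩
  obtain ⟨c, hc1, hc2⟩ := hC x0 hx0
  refine ⟨c, hc1, fun x hx => ?_⟩
  have := hc2 x hx
  rwa [add_sub_cancel] at this


def fstep (M : ℕ) (v : ℝ) : ℝ := Int.fract (M * v)
def digit (M m : ℕ) (v : ℝ) : ℕ := ⌊(M : ℝ) * (fstep M)^[m] v⌋₊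

def GoodD (M K : ℕ) (Λ v : ℝ) : Prop :=
  0 ≤ v ∧ v < 1 ∧ ∀ z : ℤ, Λ⁻¹ ≤ |v - z / (M : ℝ) ^ K|

theorem GoodD.step {M K : ℕ} {Λ v : ℝ} (hM : 1 ≤ M) (hΛ : 0 < Λ) (h : GoodD M (K + 1) Λ v) :
    GoodD M K Λ (fstep M v) := by
  refine ⟨Int.fract_nonneg _, Int.fract_lt_one _, fun z => ?_⟩
  have hM' : (1:ℝ) ≤ M := by exact_mod_cast hM
  have := h.2.2 (⌊(M:ℝ) * v⌋ * M ^ K + z)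
  have e : fstep M v - z / (M:ℝ) ^ K = M * (v - ((⌊(M:ℝ) * v⌋ * M ^ K + z : ℤ) : ℝ) / (M:ℝ) ^ (K + 1)) := by
    unfold fstep Int.fract
    push_cast
    have : (M:ℝ) ≠ 0 := by positivity
    field_simp
    ring
  rw [e, abs_mul, abs_of_pos (by positivity : (0:ℝ) < M)]
  calc Λ⁻¹ ≤ _ := this
    _ ≤ _ := le_mul_of_one_le_left (abs_nonneg _) hM'

theorem GoodD.mono {M K K' : ℕ} {Λ v : ℝ} (hM : 1 ≤ M) (hK : K ≤ K') (h : GoodD M K' Λ v) :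
    GoodD M K Λ v := by
  refine ⟨h.1, h.2.1, fun z => ?_⟩
  have := h.2.2 (z * M ^ (K' - K))
  have hM' : (M:ℝ) ≠ 0 := by positivity
  have e : ((z * M ^ (K' - K) : ℤ) : ℝ) / (M:ℝ) ^ K' = z / (M:ℝ) ^ K := by
    obtain ⟨c, rfl⟩ := Nat.exists_eq_add_of_le hK
    push_cast
    rw [Nat.add_sub_cancel_left, pow_add]
    field_simp
  rwa [e] at this

/-- soft step -/
def sstep (M : ℕ) (Λ v : ℝ) (j : ℕ) : ℝ :=
  max 0 (Λ * v - Λ * (j / M)) - max 0 (Λ * v - Λ * (j / M) - 1)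

theorem sstep_eq {M : ℕ} {Λ v : ℝ} (hM : 1 ≤ M) (hΛ : 0 < Λ) (h : GoodD M 1 Λ v) (j : ℕ) :
    sstep M Λ v j = if j ≤ ⌊(M:ℝ) * v⌋₊ then 1 else 0 := by
  have hM' : (0:ℝ) < M := by positivity
  have h1 := h.2.2 j
  simp only [pow_one, Int.cast_natCast] at h1
  have h2 : 1 ≤ |Λ * v - Λ * (j / M)| := by
    rw [← mul_sub, abs_mul, abs_of_pos hΛ]
    calc (1:ℝ) = Λ * Λ⁻¹ := (mul_inv_cancel₀ hΛ.ne').symm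
      _ ≤ _ := by gcongr
  have h3 : (j ≤ ⌊(M:ℝ) * v⌋₊) ↔ (0 ≤ Λ * v - Λ * (j / M)) := by
    rw [Nat.le_floor_iff (mul_nonneg hM'.le h.1), ← mul_sub, mul_nonneg_iff_of_pos_left hΛ, sub_nonneg,
      div_le_iff₀ hM', mul_comm]
  unfold sstep
  simp only [h3]
  split_ifs with h4
  · rw [abs_of_nonneg h4] at h2
    rw [max_eq_right h4, max_eq_right (by linarith)]; ring
  · rw [max_eq_left (by linarith), max_eq_left (by linarith)]; ring

theorem floor_lt_of_good {M : ℕ} {v : ℝ} (hM : 1 ≤ M) (h0 : 0 ≤ v) (h1 : v < 1) : ⌊(M:ℝ) * v⌋₊ < M := by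
  rw [Nat.floor_lt (by positivity)]
  have : (0:ℝ) < M := by positivity
  nlinarith

theorem sstep_onehot {M : ℕ} {Λ v : ℝ} (hM : 1 ≤ M) (hΛ : 0 < Λ) (h : GoodD M 1 Λ v) (j : ℕ) :
    sstep M Λ v j - sstep M Λ v (j + 1) = if digit M 0 v = j then 1 else 0 := by
  rw [sstep_eq hM hΛ h, sstep_eq hM hΛ h]
  simp only [digit, Function.iterate_zero, id]
  by_cases h1 : ⌊(M:ℝ) * v⌋₊ = j
  · simp [h1]
  · by_cases h2 : j ≤ ⌊(M:ℝ) * v⌋₊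
    · have : j + 1 ≤ ⌊(M:ℝ) * v⌋₊ := by omega
      simp [h1, h2, this]
    · have : ¬ (j + 1 ≤ ⌊(M:ℝ) * v⌋₊) := by omega
      simp [h1, h2, this]

theorem sstep_sum {M : ℕ} {Λ v : ℝ} (hM : 1 ≤ M) (hΛ : 0 < Λ) (h : GoodD M 1 Λ v) :
    ∑ j : Fin M, sstep M Λ v j = ⌊(M:ℝ) * v⌋₊ + 1 := by
  simp only [sstep_eq hM hΛ h]
  rw [Fin.sum_univ_eq_sum_range (fun j => if j ≤ ⌊(M:ℝ) * v⌋₊ then (1:ℝ) else 0)]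
  rw [Finset.sum_ite]
  have : (Finset.range M).filter (fun j => j ≤ ⌊(M:ℝ) * v⌋₊) = Finset.range (⌊(M:ℝ) * v⌋₊ + 1) := by
    ext j; simp only [Finset.mem_filter, Finset.mem_range]
    have := floor_lt_of_good hM h.1 h.2.1
    omega
  rw [this]; simp

theorem sstep_fract {M : ℕ} {Λ v : ℝ} (hM : 1 ≤ M) (hΛ : 0 < Λ) (h : GoodD M 1 Λ v) :
    M * v + 1 - ∑ j : Fin M, sstep M Λ v j = fstep M v := by
  rw [sstep_sum hM hΛ h]
  have h0 : 0 ≤ (M:ℝ) * v := mul_nonneg (by positivity) h.1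
  unfold fstep Int.fract
  rw [← natCast_floor_eq_intCast_floor h0]
  push_cast; ring

/-- first layer of thresholds -/
def thr (M : ℕ) (Λ : ℝ) (v : Unit → ℝ) : Option (Fin (M + 1) × Bool) → ℝ := fun o =>
  o.elim (max 0 (v ())) fun p => if p.2 then max 0 (Λ * v () - Λ * ((p.1 : ℕ) / M))
    else max 0 (Λ * v () - Λ * ((p.1 : ℕ) / M) - 1)

theorem thr_layer {M : ℕ} {Λ B : ℝ} (hM : 1 ≤ M) (hΛ : 0 < Λ) (hB : 2 * Λ + 1 ≤ B) : IsLayer B (thr M Λ) := by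
  have hj : ∀ j : Fin (M+1), 0 ≤ Λ * ((j : ℕ) / M : ℝ) ∧ Λ * ((j : ℕ) / M : ℝ) ≤ Λ := by
    intro j
    refine ⟨by positivity, ?_⟩
    have : ((j:ℕ):ℝ) ≤ M := by exact_mod_cast Nat.lt_succ_iff.1 j.2
    have h2 : ((j : ℕ) / M : ℝ) ≤ 1 := div_le_one_of_le₀ this (by positivity)
    nlinarith
  refine ⟨fun o _ => o.elim 1 fun _ => Λ, fun o => o.elim 0 fun p => if p.2 then -(Λ * ((p.1 : ℕ) / M))
    else -(Λ * ((p.1 : ℕ) / M)) - 1, ?_, ?_, ?_⟩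
  · rintro (_ | ⟨j, b⟩) _
    · simp; linarith
    · simp; rw [abs_of_pos hΛ]; linarith
  · rintro (_ | ⟨j, b⟩)
    · simp; linarith
    · have := hj j
      cases b <;> simp only [Option.elim_some, if_true, Bool.false_eq_true, if_false] <;> rw [abs_le] <;> constructor <;> linarith
  · rintro v (_ | ⟨j, b⟩)
    · simp [thr]
    · cases b
      · simp [thr]; congr 1; ring
      · simp [thr]; congr 1

theorem sstep_thr {M : ℕ} {Λ : ℝ} (v : Unit → ℝ) (j : Fin (M+1)) :
    thr M Λ v (some (j, true)) - thr M Λ v (some (j, false)) = sstep M Λ (v ()) j := by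
  simp [thr, sstep]

theorem step_net {M : ℕ} {Λ B : ℝ} (hM : 1 ≤ M) (hΛ : 0 < Λ) (hB : 2 * Λ + 1 ≤ B) (hB2 : (M:ℝ) ≤ B) :
    ∃ f : (Unit → ℝ) → Unit → ℝ, NN B (2 * M + 3) 1 f ∧
      ∀ v, GoodD M 1 Λ (v ()) → f v () = fstep M (v ()) := by
  have hM' : (1:ℝ) ≤ M := by exact_mod_cast hM
  let g : (Option (Fin (M+1) × Bool) → ℝ) → Unit → ℝ := fun w _ =>
    max 0 (M * w none + 1 - ∑ j : Fin M, (w (some (j.castSucc, true)) - w (some (j.castSucc, false))))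
  have hg : IsLayer B g := by
    refine ⟨fun _ o => o.elim (M:ℝ) fun p => if p.1 = Fin.last M then 0 else if p.2 then -1 else 1, fun _ => 1, ?_, ?_, ?_⟩
    · rintro _ (_ | ⟨j, b⟩)
      · simpa using hB2
      · simp only [Option.elim_some]; split_ifs <;> simp <;> linarith
    · simp; linarith
    · intro w k
      simp only [g, Fintype.sum_option, Option.elim_none, Option.elim_some, Fintype.sum_prod_type,
        Fintype.sum_bool, Fin.sum_univ_castSucc]
      congr 1
      have : ∀ j : Fin M, j.castSucc ≠ Fin.last M := fun j => (Fin.castSucc_lt_last j).ne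
      simp only [this, if_false, if_true, Bool.false_eq_true, zero_mul, add_zero, Finset.sum_sub_distrib,
        Finset.sum_add_distrib]
      simp
      ring
  refine ⟨fun v => g (thr M Λ v), ⟨_, inferInstance, thr M Λ, g, ?_, thr_layer hM hΛ hB, hg, fun _ => rfl⟩, ?_⟩
  · simp; omega
  · intro v hv
    simp only [g, sstep_thr]
    have : thr M Λ v none = v () := by simp [thr, hv.1]
    rw [this]
    simp only [Fin.val_castSucc]
    rw [sstep_fract hM hΛ hv]
    exact max_eq_right (Int.fract_nonneg _)

theorem onehot_net {M : ℕ} {Λ B : ℝ} (hM : 1 ≤ M) (hΛ : 0 < Λ) (hB : 2 * Λ + 1 ≤ B) :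
    ∃ f : (Unit → ℝ) → Fin M → ℝ, NN B (2 * M + 3) 1 f ∧
      ∀ v, GoodD M 1 Λ (v ()) → ∀ j, f v j = if digit M 0 (v ()) = j then 1 else 0 := by
  let g : (Option (Fin (M+1) × Bool) → ℝ) → Fin M → ℝ := fun w j =>
    max 0 (w (some (j.castSucc, true)) - w (some (j.castSucc, false)) -
      (w (some (j.succ, true)) - w (some (j.succ, false))))
  have hg : IsLayer B g := by
    refine ⟨fun j o => (if o = some (j.castSucc, true) then 1 else 0) - (if o = some (j.castSucc, false) then 1 else 0)
      - ((if o = some (j.succ, true) then 1 else 0) - (if o = some (j.succ, false) then 1 else 0)), fun _ => 0, ?_, ?_, ?_⟩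
    · intro j o
      have hne : j.castSucc ≠ j.succ := (Fin.castSucc_lt_succ).ne
      have : |(if o = some (j.castSucc, true) then (1:ℝ) else 0) - (if o = some (j.castSucc, false) then 1 else 0)
      - ((if o = some (j.succ, true) then 1 else 0) - (if o = some (j.succ, false) then 1 else 0))| ≤ 1 := by
        split_ifs <;> simp_all
      linarith
    · intro k; simp; linarith
    · intro w k
      simp only [g, sub_mul, Finset.sum_sub_distrib, ite_mul, one_mul, zero_mul, Finset.sum_ite_eq', Finset.mem_univ, if_true, add_zero]
  refine ⟨fun v => g (thr M Λ v), ⟨_, inferInstance, thr M Λ, g, ?_, thr_layer hM hΛ hB, hg, fun _ => rfl⟩, ?_⟩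
  · simp; omega
  · intro v hv j
    simp only [g, sstep_thr, Fin.val_castSucc, Fin.val_succ]
    rw [sstep_onehot hM hΛ hv]
    split_ifs <;> simp

theorem digit_succ (M m : ℕ) (v : ℝ) : digit M (m + 1) v = digit M m (fstep M v) := by
  simp [digit, Function.iterate_succ_apply]

theorem digit_net {M : ℕ} {Λ B : ℝ} (hM : 1 ≤ M) (hΛ : 0 < Λ) (hB : 2 * Λ + 1 ≤ B) (hB2 : (M:ℝ) ≤ B) (m : ℕ) :
    ∃ f : (Unit → ℝ) → Fin M → ℝ, NN B (2 * M + 3) (2 * m + 1) f ∧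
      ∀ v, GoodD M (m + 1) Λ (v ()) → ∀ j, f v j = if digit M m (v ()) = j then 1 else 0 := by
  induction m with
  | zero => simpa using onehot_net hM hΛ hB
  | succ m ih =>
    obtain ⟨f, hf, hf2⟩ := ih
    obtain ⟨g, hg, hg2⟩ := step_net hM hΛ hB hB2
    refine ⟨fun v => f (g v), ?_, fun v hv j => ?_⟩
    · have := hg.comp (by simp; ) hf
      convert this using 1; ring
    · have e := hg2 v (hv.mono hM (by omega))
      have := hf2 (g v) (by rw [e]; exact hv.step hM hΛ) j
      rw [e, ← digit_succ] at this
      exact this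

theorem digits_net {M : ℕ} {Λ B : ℝ} (hM : 1 ≤ M) (hΛ : 0 < Λ) (hB : 2 * Λ + 1 ≤ B) (hB2 : (M:ℝ) ≤ B)
    {ι : Type} [Fintype ι] [DecidableEq ι] (D K : ℕ) (σ : Fin D → ι) (h : ℝ) (hh : 0 ≤ h) (hh1 : h ≤ 1) (s : Fin D → ℝ)
    (hs : ∀ i, |s i| ≤ 1) :
    ∃ f : (ι → ℝ) → ((Fin D × Fin K) × Fin M) → ℝ, NN B (D * K * (2 * M + 3)) (2 * K) f ∧
      ∀ u, (∀ i, GoodD M K Λ ((1 - h) * u (σ i) + s i)) → ∀ i m j, f u ((i, m), j) =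
        if digit M m ((1 - h) * u (σ i) + s i) = j then 1 else 0 := by
  have hB1 : 1 ≤ B := by linarith
  have key : ∀ p : Fin D × Fin K, ∃ f : (ι → ℝ) → Fin M → ℝ, NN B (2 * M + 3) (2 * K) f ∧
      ∀ u, GoodD M K Λ ((1 - h) * u (σ p.1) + s p.1) → ∀ j, f u j =
        if digit M p.2 ((1 - h) * u (σ p.1) + s p.1) = j then 1 else 0 := by
    rintro ⟨i, m⟩
    obtain ⟨f, hf, hf2⟩ := digit_net hM hΛ hB hB2 (m : ℕ)
    let g : (ι → ℝ) → Unit → ℝ := fun u _ => max 0 ((1 - h) * u (σ i) + s i)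
    have hg : NN B (2 * M + 3) 0 g := by
      refine ⟨fun _ o => if o = σ i then 1 - h else 0, fun _ => s i, ?_, ?_, ?_⟩
      · intro _ o; dsimp only; split_ifs
        · rw [abs_of_nonneg (by linarith)]; linarith
        · simp; linarith
      · intro _; exact (hs i).trans hB1
      · intro v k; simp [g]
    refine ⟨fun u => f (g u), ?_, ?_⟩
    · have := hg.comp (by simp) hf
      refine this.pad hB1 (by simp; omega) (by have := m.2; omega)
    · intro u hu j
      have e : g u () = (1 - h) * u (σ i) + s i := max_eq_right hu.1
      have hm := m.2
      have := hf2 (g u) (by rw [e]; exact hu.mono hM (by omega)) j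
      rw [e] at this
      exact this
  choose f hf hf2 using key
  have := NN.sigma (by linarith : 0 ≤ B) hf
  refine ⟨_, ((this.reindex (fun p : (Fin D × Fin K) × Fin M => ⟨p.1, p.2⟩)).mono le_rfl (by simp)), ?_⟩
  intro u hu i m j
  exact hf2 (i, m) u (hu i) j

/-- truncated expansions -/
def trd (M a K : ℕ) (v : ℝ) : ℝ := ∑ m ∈ Finset.range K, (digit M (a + m) v : ℝ) / (M : ℝ) ^ (a + m + 1)

theorem expansion {M : ℕ} (hM : 1 ≤ M) (K : ℕ) : ∀ v, 0 ≤ v →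
    v = trd M 0 K v + (fstep M)^[K] v / (M : ℝ) ^ K := by
  have hM' : (M:ℝ) ≠ 0 := by positivity
  intro v hv
  induction K with
  | zero => simp [trd]
  | succ K ih =>
    rw [trd, Finset.sum_range_succ, ← trd]
    set y := (fstep M)^[K] v with hy
    have hy0 : 0 ≤ y := by
      rw [hy]; cases K with
      | zero => simpa
      | succ K => rw [Function.iterate_succ_apply']; exact Int.fract_nonneg _
    have e : (fstep M)^[K+1] v = M * y - digit M K v := by
      rw [Function.iterate_succ_apply', ← hy]
      unfold fstep Int.fract digit
      rw [← hy, natCast_floor_eq_intCast_floor (by positivity)]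
    rw [e]
    simp only [zero_add]
    have e2 : y / (M:ℝ) ^ K = (digit M K v : ℝ) / (M:ℝ) ^ (K + 1) + (M * y - digit M K v) / (M:ℝ) ^ (K + 1) := by
      rw [← add_div, pow_succ]
      field_simp
      ring
    linarith


abbrev Dg (D K M : ℕ) : Type := (Fin D × Fin K) × Fin M

def oneHot {D K M : ℕ} (dg : Fin D → Fin K → Fin M) : Dg D K M → ℝ :=
  fun p => if dg p.1.1 p.1.2 = p.2 then 1 else 0

theorem lookup_net {D K M : ℕ} {B C : ℝ} (hB : 1 ≤ B) (hC : 0 ≤ C) (hCB : C ≤ B) (hDB : (D:ℝ) ≤ B)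
    (m0 m1 : Fin K) (c : (Fin D → Fin M) → (Fin D → Fin M) → ℝ) (hc0 : ∀ a b, 0 ≤ c a b) (hc : ∀ a b, c a b ≤ C) :
    ∃ f : (Dg D K M → ℝ) → Unit → ℝ, NN B (2 * M ^ D) 2 f ∧
      ∀ dg : Fin D → Fin K → Fin M, f (oneHot dg) () = c (fun i => dg i m0) (fun i => dg i m1) := by
  classical
  let mb : Bool → Fin K := fun b => if b then m0 else m1
  let f1 : (Dg D K M → ℝ) → (Bool × (Fin D → Fin M)) → ℝ := fun o p =>
    max 0 ((∑ i, o ((i, mb p.1), p.2 i)) - (D - 1))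
  let f2 : ((Bool × (Fin D → Fin M)) → ℝ) → (Fin D → Fin M) → ℝ := fun u b =>
    max 0 ((∑ a, c a b * u (true, a)) + C * u (false, b) - C)
  let f3 : ((Fin D → Fin M) → ℝ) → Unit → ℝ := fun u _ => max 0 (∑ b, u b)
  have h1 : IsLayer B f1 := by
    refine ⟨fun p q => if q.1.2 = mb p.1 ∧ q.2 = p.2 q.1.1 then 1 else 0, fun _ => -(D - 1), ?_, ?_, ?_⟩
    · intro p q; dsimp only; split_ifs <;> simp <;> linarith
    · intro p; rw [abs_le]; constructor <;> linarith [Nat.cast_nonneg (α := ℝ) D]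
    · intro o p
      simp only [f1, Fintype.sum_prod_type, sub_eq_add_neg]
      congr 2
      refine Finset.sum_congr rfl fun i _ => ?_
      rw [Finset.sum_eq_single (mb p.1)]
      · simp
      · intro m _ hm; simp [hm]
      · simp
  have h2 : IsLayer B f2 := by
    refine ⟨fun b p => if p.1 then c p.2 b else if p.2 = b then C else 0, fun _ => -C, ?_, ?_, ?_⟩
    · intro p q; dsimp only; split_ifs
      · rw [abs_of_nonneg (hc0 _ _)]; linarith [hc q.2 p]
      · rwa [abs_of_nonneg hC]
      · simp; linarith
    · intro p; rwa [abs_neg, abs_of_nonneg hC]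
    · intro u b
      simp only [f2, Fintype.sum_prod_type, Fintype.sum_bool, sub_eq_add_neg]
      congr 2
      simp
  have h3 : IsLayer B f3 := by
    refine ⟨fun _ _ => 1, fun _ => 0, ?_, ?_, ?_⟩
    · intro _ _; simpa using hB
    · intro _; simp; linarith
    · intro u b; simp [f3]
  refine ⟨fun o => f3 (f2 (f1 o)), ⟨_, inferInstance, fun o => f2 (f1 o), f3, ?_, ⟨_, inferInstance, f1, f2, ?_, h1, h2, fun _ => rfl⟩, h3, fun _ => rfl⟩, ?_⟩
  · simp; omega
  · simp
  · intro dg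
    have e1 : ∀ p, f1 (oneHot dg) p = if (fun i => dg i (mb p.1)) = p.2 then 1 else 0 := by
      intro p
      simp only [f1, oneHot]
      split_ifs with h
      · have : ∀ i, dg i (mb p.1) = p.2 i := fun i => congrFun h i
        simp [this]
      · apply max_eq_left
        obtain ⟨i, hi⟩ := Function.ne_iff.1 h
        have : ∑ i, (if dg i (mb p.1) = p.2 i then (1:ℝ) else 0) ≤ ∑ i' : Fin D, (if i' = i then 0 else 1) := by
          refine Finset.sum_le_sum fun i' _ => ?_
          by_cases h' : i' = i
          · subst h'; rw [if_neg hi, if_pos rfl]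
          · rw [if_neg h']; split_ifs <;> norm_num
        have e : ∑ i' : Fin D, (if i' = i then (0:ℝ) else 1) = D - 1 := by
          have : ∀ i' : Fin D, (if i' = i then (0:ℝ) else 1) = 1 - if i' = i then 1 else 0 := by
            intro i'; split_ifs <;> norm_num
          simp [this]
        linarith
    have e2 : ∀ b, f2 (f1 (oneHot dg)) b = if (fun i => dg i m1) = b then c (fun i => dg i m0) b else 0 := by
      intro b
      simp only [f2, e1, mb, if_true, Bool.false_eq_true, if_false, mul_ite, mul_one, mul_zero, Finset.sum_ite_eq, Finset.mem_univ]
      split_ifs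
      · rw [add_sub_cancel_right, max_eq_right (hc0 _ _)]
      · apply max_eq_left; linarith [hc (fun i => dg i m0) b]
    simp only [f3, e2, Finset.sum_ite_eq, Finset.mem_univ, if_true]
    exact max_eq_right (hc0 _ _)

def wt (M : ℕ) (m j : ℕ) : ℝ := if 2 ≤ m then (j : ℝ) / (M : ℝ) ^ (m + 1) else 0

theorem wt_nonneg (M m j : ℕ) : 0 ≤ wt M m j := by unfold wt; split_ifs <;> positivity

def zval {D K M : ℕ} (dg : Fin D → Fin K → Fin M) (i : Fin D) : ℝ := ∑ m : Fin K, wt M m (dg i m)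

theorem prod_net {D K M : ℕ} {B C : ℝ} (hB : 1 ≤ B) (hC : 0 ≤ C) (hCB : C ≤ B) (l : Option (Fin D)) :
    ∃ f : (Unit ⊕ Dg D K M → ℝ) → Unit → ℝ, NN B (K * M + 1) 1 f ∧
      ∀ (P : ℝ) (dg : Fin D → Fin K → Fin M), 0 ≤ P → P ≤ C →
        f (Sum.elim (fun _ => P) (oneHot dg)) () = P * letter (zval dg) l := by
  classical
  cases l with
  | none =>
    refine ⟨fun v _ => max 0 (v (Sum.inl ())), ?_, ?_⟩
    · have : NN B (K * M + 1) 0 (fun (v : Unit ⊕ Dg D K M → ℝ) (_ : Unit) => max 0 (v (Sum.inl ()))) := by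
        exact (IsLayer.id' hB).reindex (fun _ : Unit => Sum.inl ())
      exact this.pad1 hB (by simp)
    · intro P dg h0 h1; simp [letter, h0]
  | some i =>
    let f1 : (Unit ⊕ Dg D K M → ℝ) → (Fin K × Fin M) → ℝ := fun v p =>
      max 0 (v (Sum.inl ()) + C * v (Sum.inr ((i, p.1), p.2)) - C)
    let f2 : ((Fin K × Fin M) → ℝ) → Unit → ℝ := fun u _ => max 0 (∑ p : Fin K × Fin M, wt M p.1 p.2 * u p)
    have h1 : IsLayer B f1 := by
      refine ⟨fun p => Sum.elim (fun _ => 1) (fun q => if q = ((i, p.1), p.2) then C else 0), fun _ => -C, ?_, ?_, ?_⟩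
      · rintro p (q | q)
        · simpa using hB
        · simp only [Sum.elim_inr]; split_ifs
          · rwa [abs_of_nonneg hC]
          · simp; linarith
      · intro p; rwa [abs_neg, abs_of_nonneg hC]
      · intro v p
        simp [f1, sub_eq_add_neg]
    have h2 : IsLayer B f2 := by
      refine ⟨fun _ p => wt M p.1 p.2, fun _ => 0, ?_, ?_, ?_⟩
      · intro _ p
        rw [abs_of_nonneg (wt_nonneg _ _ _)]
        refine le_trans ?_ hB
        unfold wt; split_ifs
        · have hM : 1 ≤ M := by have := p.2.2; omega
          have hM' : (1:ℝ) ≤ M := by exact_mod_cast hM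
          apply div_le_one_of_le₀ _ (by positivity)
          calc ((p.2 : ℕ) : ℝ) ≤ M := by exact_mod_cast p.2.2.le
            _ = (M:ℝ) ^ 1 := (pow_one _).symm
            _ ≤ _ := pow_le_pow_right₀ hM' (by omega)
        · norm_num
      · intro _; simp; linarith
      · intro v p; simp [f2]
    refine ⟨fun v => f2 (f1 v), ⟨_, inferInstance, f1, f2, by simp, h1, h2, fun _ => rfl⟩, ?_⟩
    intro P dg h0 hP
    have e1 : ∀ p, f1 (Sum.elim (fun _ => P) (oneHot dg)) p = if dg i p.1 = p.2 then P else 0 := by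
      intro p
      simp only [f1, Sum.elim_inl, Sum.elim_inr, oneHot]
      split_ifs
      · rw [mul_one, add_sub_cancel_right, max_eq_right h0]
      · apply max_eq_left; linarith
    have hz : 0 ≤ zval dg i := Finset.sum_nonneg fun m _ => wt_nonneg _ _ _
    simp only [f2, e1, Fintype.sum_prod_type, mul_ite, mul_zero, Finset.sum_ite_eq, Finset.mem_univ, if_true]
    rw [← Finset.sum_mul, show letter (zval dg) (some i) = zval dg i from rfl, mul_comm P]
    exact max_eq_right (mul_nonneg hz h0)

theorem zval_le {D K M : ℕ} (hM : 1 ≤ M) (dg : Fin D → Fin K → Fin M) (i : Fin D) : zval dg i ≤ 1 := by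
  have hM' : (1:ℝ) ≤ M := by exact_mod_cast hM
  have key : ∀ n : ℕ, ∀ e : ℕ → ℕ, (∀ m, e m < M) → ∑ m ∈ Finset.range n, wt M m (e m) ≤ 1 - ((M:ℝ) ^ n)⁻¹ := by
    intro n e he
    induction n with
    | zero => simp
    | succ n ih =>
      rw [Finset.sum_range_succ]
      have h1 : wt M n (e n) ≤ (M - 1 : ℝ) / (M:ℝ) ^ (n + 1) := by
        unfold wt; split_ifs
        · gcongr
          have : ((e n + 1 : ℕ):ℝ) ≤ M := by exact_mod_cast he n
          push_cast at this; linarith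
        · apply div_nonneg <;> [linarith; positivity]
      have h2 : (M - 1 : ℝ) / (M:ℝ) ^ (n + 1) = ((M:ℝ) ^ n)⁻¹ - ((M:ℝ) ^ (n+1))⁻¹ := by
        field_simp
        rw [pow_succ]; ring
      linarith
  have := key K (fun m => if h : m < K then dg i ⟨m, h⟩ else 0) (by
    intro m; split_ifs
    · exact (dg i _).2
    · omega)
  rw [← Fin.sum_univ_eq_sum_range (fun m => wt M m (if h : m < K then dg i ⟨m, h⟩ else 0))] at this
  simp only [Fin.is_lt, dite_true, Fin.eta] at this
  unfold zval
  refine this.trans (by simp)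

theorem letter_mem {D : ℕ} {z : Fin D → ℝ} (h0 : ∀ i, 0 ≤ z i) (h1 : ∀ i, z i ≤ 1) (l : Option (Fin D)) :
    0 ≤ letter z l ∧ letter z l ≤ 1 := by
  cases l <;> simp [letter, h0, h1]

theorem word_net {D K M : ℕ} (hM : 1 ≤ M) {B C : ℝ} (hB : 1 ≤ B) (hC : 0 ≤ C) (hCB : C ≤ B) (hDB : (D:ℝ) ≤ B)
    (m0 m1 : Fin K) (c : (Fin D → Fin M) → (Fin D → Fin M) → ℝ) (hc0 : ∀ a b, 0 ≤ c a b) (hc : ∀ a b, c a b ≤ C)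
    (k : ℕ) : ∀ (w : Fin k → Option (Fin D)),
    ∃ f : (Dg D K M → ℝ) → Unit → ℝ, NN B (2 * M ^ D + k * (D * K * M + K * M + 1)) (2 + 2 * k) f ∧
      ∀ dg : Fin D → Fin K → Fin M, f (oneHot dg) () =
        c (fun i => dg i m0) (fun i => dg i m1) * ∏ j, letter (zval dg) (w j) := by
  induction k with
  | zero => intro w; simpa using lookup_net hB hC hCB hDB m0 m1 c hc0 hc
  | succ k ih =>
    intro w
    obtain ⟨f, hf, hf2⟩ := ih (fun j => w j.castSucc)
    obtain ⟨g, hg, hg2⟩ := prod_net (K := K) (M := M) hB hC hCB (w (Fin.last k))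
    have hid : NN B (D * K * M) (2 + 2 * k) (fun (v : Dg D K M → ℝ) p => max 0 (v p)) := by
      have : NN B (D * K * M) 0 (fun (v : Dg D K M → ℝ) p => max 0 (v p)) := IsLayer.id' hB
      exact this.pad hB (by simp) (by omega)
    have hs := (NN.sum (by linarith : 0 ≤ B) hf hid).mono le_rfl
      (show _ ≤ 2 * M ^ D + (k + 1) * (D * K * M + K * M + 1) by rw [Nat.succ_mul k]; omega)
    refine ⟨_, (hs.comp ?_ (hg.mono le_rfl ?_)), ?_⟩
    · simp only [Fintype.card_sum, Fintype.card_unit, Fintype.card_prod, Fintype.card_fin]; rw [Nat.succ_mul k]; omega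
    · rw [Nat.succ_mul k]; omega
    · intro dg
      have e1 : (fun p => max 0 (oneHot dg p)) = oneHot dg := by
        funext p; apply max_eq_right; unfold oneHot; split_ifs <;> norm_num
      have e2 : f (oneHot dg) = fun _ => c (fun i => dg i m0) (fun i => dg i m1) * ∏ j : Fin k, letter (zval dg) (w j.castSucc) := by
        funext u; exact hf2 dg
      have hp : ∀ j, 0 ≤ letter (zval dg) (w j) ∧ letter (zval dg) (w j) ≤ 1 := fun j =>
        letter_mem (fun i => Finset.sum_nonneg fun m _ => wt_nonneg _ _ _) (zval_le hM dg) _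
      have hp0 : 0 ≤ ∏ j : Fin k, letter (zval dg) (w j.castSucc) := Finset.prod_nonneg fun j _ => (hp _).1
      have hp1 : ∏ j : Fin k, letter (zval dg) (w j.castSucc) ≤ 1 := Finset.prod_le_one (fun j _ => (hp _).1) fun j _ => (hp _).2
      rw [e1, e2, hg2 _ _ (mul_nonneg (hc0 _ _) hp0), Fin.prod_univ_castSucc, mul_assoc]
      calc _ ≤ c (fun i => dg i m0) (fun i => dg i m1) * 1 := by gcongr; exact hc0 _ _
        _ ≤ C := by rw [mul_one]; exact hc _ _

theorem clip_net {B : ℝ} (hB : 1 ≤ B) : ∃ f : (Unit → ℝ) → Unit → ℝ, NN B 1 1 f ∧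
    (∀ v, f v () ≤ 1) ∧ ∀ v, 0 ≤ v () → f v () = min (v ()) 1 := by
  let g : (Unit → ℝ) → Unit → ℝ := fun v _ => max 0 (1 - v ())
  have hg : IsLayer B g := by
    refine ⟨fun _ _ => -1, fun _ => 1, ?_, ?_, ?_⟩
    · intro _ _; simpa using hB
    · intro _; simpa using hB
    · intro v k; simp [g]; congr 1; ring
  refine ⟨fun v => g (g v), ⟨_, inferInstance, g, g, by simp, hg, hg, fun _ => rfl⟩, ?_, ?_⟩
  · intro v; simp only [g]; apply max_le (by norm_num); linarith [le_max_left 0 (1 - v ())]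
  · intro v hv
    simp only [g]
    rcases le_total (v ()) 1 with h | h
    · rw [min_eq_left h, max_eq_right (by linarith : 0 ≤ 1 - v ())]
      rw [sub_sub_cancel]; exact max_eq_right hv
    · rw [min_eq_right h, max_eq_left (by linarith : 1 - v () ≤ 0)]; norm_num

theorem poly_net {D K M : ℕ} (hM : 1 ≤ M) {B C : ℝ} (hB : 1 ≤ B) (hC : 0 ≤ C) (hCB : C ≤ B) (hDB : (D:ℝ) ≤ B)
    (m0 m1 : Fin K) (k : ℕ) (c : (Fin D → Fin M) → (Fin D → Fin M) → (Fin k → Option (Fin D)) → ℝ)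
    (hc : ∀ a b w, |c a b w| ≤ C) :
    ∃ f : (Dg D K M → ℝ) → Unit → ℝ,
      NN B (Fintype.card ((Fin k → Option (Fin D)) × Bool) * (2 * M ^ D + k * (D * K * M + K * M + 1) + 1)) (2 * k + 5) f ∧
      (∀ v, f v () ≤ 1) ∧
      ∀ dg : Fin D → Fin K → Fin M, f (oneHot dg) () =
        min (max 0 (∑ w, c (fun i => dg i m0) (fun i => dg i m1) w * ∏ j, letter (zval dg) (w j))) 1 := by
  classical
  set I := (Fin k → Option (Fin D)) × Bool
  have key : ∀ p : I, ∃ f : (Dg D K M → ℝ) → Unit → ℝ, NN B (2 * M ^ D + k * (D * K * M + K * M + 1)) (2 + 2 * k) f ∧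
      ∀ dg : Fin D → Fin K → Fin M, f (oneHot dg) () =
        max 0 ((if p.2 then 1 else -1) * c (fun i => dg i m0) (fun i => dg i m1) p.1) * ∏ j, letter (zval dg) (p.1 j) := by
    intro p
    refine word_net hM hB hC hCB hDB m0 m1 (fun a b => max 0 ((if p.2 then 1 else -1) * c a b p.1)) ?_ ?_ k p.1
    · intro a b; exact le_max_left _ _
    · intro a b
      apply max_le hC
      have := abs_le.1 (hc a b p.1)
      split_ifs <;> linarith
  choose f hf hf2 using key
  have h1 := NN.sigma (by linarith : 0 ≤ B) hf
  let g : ((Σ _ : I, Unit) → ℝ) → Unit → ℝ := fun u _ => max 0 (∑ p : Σ _ : I, Unit, (if p.1.2 then 1 else -1) * u p)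
  have hg : IsLayer B g := by
    refine ⟨fun _ p => if p.1.2 then 1 else -1, fun _ => 0, ?_, ?_, ?_⟩
    · intro _ p; dsimp only; split_ifs <;> simpa using hB
    · intro _; simp; linarith
    · intro v k; simp [g]
  obtain ⟨q, hq, hq1, hq2⟩ := clip_net hB
  have hW : 1 ≤ Fintype.card I := Fintype.card_pos
  have hcardpos : 1 ≤ Fintype.card I * (2 * M ^ D + k * (D * K * M + K * M + 1) + 1) := Nat.mul_pos hW (by omega)
  have h1' := h1.mono le_rfl (show _ ≤ Fintype.card I * (2 * M ^ D + k * (D * K * M + K * M + 1) + 1) from Nat.mul_le_mul_left _ (by omega))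
  have h2 := h1'.comp (by simp only [Fintype.card_sigma, Fintype.card_unit, Finset.sum_const, Finset.card_univ, smul_eq_mul]; exact Nat.mul_le_mul_left _ (by omega)) (show NN B _ 0 g from hg)
  have h3 := h2.comp (by simpa using hcardpos) (hq.mono le_rfl hcardpos)
  have e : 2 * k + 5 = 2 + 2 * k + 0 + 1 + 1 + 1 := by ring
  rw [e]
  refine ⟨_, h3, ?_, ?_⟩
  · intro v; exact hq1 _
  · intro dg
    rw [hq2 _ (le_max_left _ _)]
    simp only [g]
    congr 2
    rw [Fintype.sum_sigma]
    simp only [Finset.univ_unique, Finset.sum_singleton, hf2]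
    rw [Fintype.sum_prod_type]
    refine Finset.sum_congr rfl fun w _ => ?_
    simp only [Fintype.sum_bool, if_true, Bool.false_eq_true, if_false]
    generalize c _ _ w = x
    rcases le_total 0 x with h | h
    · rw [max_eq_right (by linarith : 0 ≤ 1 * x), max_eq_left (by linarith : -1 * x ≤ 0)]; ring
    · rw [max_eq_left (by linarith : 1 * x ≤ 0), max_eq_right (by linarith : 0 ≤ -1 * x)]; ring


theorem fstep_iter_mem {M : ℕ} {v : ℝ} (h0 : 0 ≤ v) (h1 : v < 1) (m : ℕ) :
    0 ≤ (fstep M)^[m] v ∧ (fstep M)^[m] v < 1 := by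
  cases m with
  | zero => exact ⟨h0, h1⟩
  | succ m =>
    rw [Function.iterate_succ_apply']
    exact ⟨Int.fract_nonneg _, Int.fract_lt_one _⟩

theorem digit_lt {M : ℕ} {v : ℝ} (hM : 1 ≤ M) (h0 : 0 ≤ v) (h1 : v < 1) (m : ℕ) : digit M m v < M := by
  have := fstep_iter_mem (M := M) h0 h1 m
  exact floor_lt_of_good hM this.1 this.2

/-- rescaled Taylor expansion -/
theorem taylor_unit {D : ℕ} {A β Kc : ℝ} (hA : 0 < A) (hβ : 0 < β) {g : (Fin D → ℝ) → ℝ}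
    (hg : memHolder A D β Kc g) :
    ∃ C : ℝ, 0 ≤ C ∧ ∀ z0 : Fin D → ℝ, (∀ i, z0 i ∈ Set.Icc (0:ℝ) 1) →
      ∃ c : (Fin ⌊β⌋₊ → Option (Fin D)) → ℝ, (∀ w, |c w| ≤ C) ∧
      ∀ z : Fin D → ℝ, (∀ i, z i ∈ Set.Icc (0:ℝ) 1) → ∀ δ : ℝ, 0 ≤ δ → (∀ i, |z i - z0 i| ≤ δ) →
        |(g (fun i => -A + 2 * A * z i) + A) / (2 * A) - ∑ w, c w * ∏ j, letter (z - z0) (w j)| ≤ C * δ ^ β := by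
  classical
  obtain ⟨C, hC0, hC⟩ := memHolder_taylor hβ hg
  set k := ⌊β⌋₊
  set Q : ℝ := max 1 (2 * A) with hQ
  have hQ1 : 1 ≤ Q := le_max_left _ _
  set C1 : ℝ := (Q ^ k * C + A) / (2 * A) with hC1
  set C2 : ℝ := C * (2 * A) ^ β / (2 * A) with hC2
  have hC1' : 0 ≤ C1 := by positivity
  have hC2' : 0 ≤ C2 := by positivity
  have hcube : ∀ z : Fin D → ℝ, (∀ i, z i ∈ Set.Icc (0:ℝ) 1) → (fun i => -A + 2 * A * z i) ∈ cube A D := by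
    intro z hz i
    have := hz i
    simp only [Set.mem_Icc] at *
    constructor <;> nlinarith [this.1, this.2]
  refine ⟨C1 + C2, by positivity, fun z0 hz0 => ?_⟩
  obtain ⟨c, hc, hc2⟩ := hC _ (hcube z0 hz0)
  refine ⟨fun w => ((2 * A) ^ (∑ j, deg1 (w j)) * c w + if w = (fun _ => none) then A else 0) / (2 * A), ?_, ?_⟩
  · intro w
    refine le_trans ?_ (le_add_of_nonneg_right hC2')
    rw [abs_div, abs_of_pos (by positivity : 0 < 2 * A), hC1]
    gcongr
    refine (abs_add_le _ _).trans ?_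
    gcongr
    · rw [abs_mul, abs_of_pos (by positivity)]
      have hdeg : ∑ j, deg1 (w j) ≤ k := by
        calc ∑ j, deg1 (w j) ≤ ∑ j : Fin k, 1 := Finset.sum_le_sum fun j _ => by cases w j <;> simp [deg1]
          _ = k := by simp
      refine mul_le_mul ?_ (hc w) (abs_nonneg _) (by positivity)
      calc (2 * A) ^ (∑ j, deg1 (w j)) ≤ Q ^ (∑ j, deg1 (w j)) := by gcongr; exact le_max_right _ _
        _ ≤ Q ^ k := pow_le_pow_right₀ hQ1 hdeg
    · split_ifs
      · rw [abs_of_pos hA]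
      · simp [hA.le]
  · intro z hz δ hδ hzδ
    have h1 := hc2 _ (hcube z hz)
    have e : (fun i => -A + 2 * A * z i) - (fun i => -A + 2 * A * z0 i) = (2 * A) • (z - z0) := by
      funext i; simp; ring
    rw [e] at h1
    simp only [letter_smul] at h1
    have e2 : ∑ w : Fin k → Option (Fin D), ((2 * A) ^ (∑ j, deg1 (w j)) * c w + if w = (fun _ => none) then A else 0) / (2 * A) * ∏ j, letter (z - z0) (w j)
        = (∑ w, c w * ((2 * A) ^ (∑ j, deg1 (w j)) * ∏ j, letter (z - z0) (w j)) + A) / (2 * A) := by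
      have : ∀ w : Fin k → Option (Fin D), ((2 * A) ^ (∑ j, deg1 (w j)) * c w + if w = (fun _ => none) then A else 0) / (2 * A) * ∏ j, letter (z - z0) (w j)
          = c w * ((2 * A) ^ (∑ j, deg1 (w j)) * ∏ j, letter (z - z0) (w j)) / (2 * A) + if w = (fun _ => none) then A / (2 * A) else 0 := by
        intro w
        split_ifs with h
        · subst h
          simp [letter, deg1]; ring
        · ring
      rw [Finset.sum_congr rfl fun w _ => this w, Finset.sum_add_distrib, ← Finset.sum_div]
      simp; ring
    rw [e2, ← sub_div, add_sub_add_right_eq_sub, abs_div, abs_of_pos (by positivity : 0 < 2 * A)]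
    have hn : ‖(2 * A) • (z - z0)‖ ≤ 2 * A * δ := by
      rw [norm_smul, Real.norm_of_nonneg (by positivity)]
      gcongr
      exact (pi_norm_le_iff_of_nonneg hδ).2 fun i => by simpa using hzδ i
    calc _ ≤ C * ‖(2 * A) • (z - z0)‖ ^ β / (2 * A) := by gcongr
      _ ≤ C * (2 * A * δ) ^ β / (2 * A) := by gcongr
      _ = C2 * δ ^ β := by rw [Real.mul_rpow (by positivity) hδ, hC2]; ring
      _ ≤ _ := by gcongr; linarith

theorem clip_lip (x y : ℝ) (hy0 : 0 ≤ y) (hy1 : y ≤ 1) : |min (max 0 x) 1 - y| ≤ |x - y| := by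
  have : y = min (max 0 y) 1 := by rw [max_eq_right hy0, min_eq_left hy1]
  rcases le_total 0 x with h | h
  · rw [max_eq_right h]
    rcases le_total x 1 with h' | h'
    · rw [min_eq_left h']
    · rw [min_eq_right h', abs_of_nonneg (by linarith), abs_of_nonneg (by linarith)]; linarith
  · rw [max_eq_left h, min_eq_left zero_le_one, abs_of_nonpos (by linarith), abs_of_nonpos (by linarith)]; linarith

theorem single_net {D : ℕ} (hD : 1 ≤ D) {A β Kc F Lc : ℝ} (hA : 0 < A) (hβ : 0 < β) (hFA : F ≤ A) (hLc : 0 ≤ Lc)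
    {g : (Fin D → ℝ) → ℝ} (hg : memHolder A D β Kc g) (hgF : ∀ y, |g y| ≤ F)
    (hgl : ∀ y z : Fin D → ℝ, ∀ δ : ℝ, 0 ≤ δ → (∀ i, |y i - z i| ≤ δ) → |g y - g z| ≤ Lc * δ) (K : ℕ) (hK : 2 ≤ K) :
    ∃ (C : ℝ) (Cw t : ℕ), 0 ≤ C ∧ ∀ (M : ℕ) (Λ : ℝ), 1 ≤ M → 0 < Λ → ∀ {ι : Type} [Fintype ι] [DecidableEq ι] (σ : Fin D → ι)
      (s : Fin D → ℝ), (∀ i, 0 ≤ s i ∧ s i ≤ ((M:ℝ) ^ K)⁻¹) → ∃ f : (ι → ℝ) → Unit → ℝ,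
        NN (2 * Λ + 1 + M + C) (Cw * M ^ D) t f ∧ (∀ v, f v () ≤ 1) ∧
        ∀ u : ι → ℝ, (∀ i, u (σ i) ∈ Set.Icc (0:ℝ) 1) →
          (∀ i, GoodD M K Λ ((1 - ((M:ℝ) ^ K)⁻¹) * u (σ i) + s i)) →
          |f u () - (g (fun i => -A + 2 * A * u (σ i)) + A) / (2 * A)| ≤ C * ((((M:ℝ) ^ 2)⁻¹) ^ β + ((M:ℝ) ^ K)⁻¹) := by
  classical
  obtain ⟨C, hC0, hC⟩ := taylor_unit hA hβ hg
  set k := ⌊β⌋₊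
  set cI := Fintype.card ((Fin k → Option (Fin D)) × Bool)
  refine ⟨C + 2 * Lc + D, D * K * 5 + cI * (2 + k * (D * K + K + 1) + 1), 2 * K + (2 * k + 5) + 1, by positivity, ?_⟩
  intro M Λ hM hΛ ι _ _ σ s hs
  set h : ℝ := ((M:ℝ) ^ K)⁻¹ with hh
  have hM' : (1:ℝ) ≤ M := by exact_mod_cast hM
  have hh0 : 0 < h := by positivity
  have hh1 : h ≤ 1 := inv_le_one_of_one_le₀ (one_le_pow₀ hM')
  set B : ℝ := 2 * Λ + 1 + M + (C + 2 * Lc + D) with hB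
  have hDn : (0:ℝ) ≤ D := Nat.cast_nonneg D
  obtain ⟨f1, hf1, hf1'⟩ := digits_net (B := B) hM hΛ (by linarith) (by linarith) D K σ h hh0.le hh1 s (by
    intro i; rw [abs_of_nonneg (hs i).1]; exact (hs i).2.trans hh1)
  let z0 : (Fin D → Fin M) → (Fin D → Fin M) → Fin D → ℝ := fun a b i => (a i : ℕ) / (M:ℝ) + (b i : ℕ) / (M:ℝ) ^ 2
  have hz0 : ∀ a b i, z0 a b i ∈ Set.Icc (0:ℝ) 1 := by
    intro a b i
    refine ⟨by positivity, ?_⟩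
    have h1 : ((a i : ℕ) : ℝ) ≤ M - 1 := by
      have : (((a i : ℕ) + 1 : ℕ) : ℝ) ≤ M := by exact_mod_cast (a i).2
      push_cast at this; linarith
    have h2 : ((b i : ℕ) : ℝ) ≤ M := by exact_mod_cast (b i).2.le
    show ((a i : ℕ) : ℝ) / (M:ℝ) + (b i : ℕ) / (M:ℝ) ^ 2 ≤ 1
    calc _ ≤ (M - 1 : ℝ) / M + M / (M:ℝ) ^ 2 := by gcongr
      _ = 1 := by field_simp; ring
  choose c hc hc2 using fun a b => hC (z0 a b) (hz0 a b)
  obtain ⟨f2, hf2, hf2a, hf2b⟩ := poly_net (K := K) hM (B := B) (C := C) (by linarith) hC0 (by linarith) (by linarith)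
    ⟨0, by omega⟩ ⟨1, by omega⟩ k c hc
  set W := (D * K * 5 + cI * (2 + k * (D * K + K + 1) + 1)) * M ^ D with hW
  have hMD : M ≤ M ^ D := Nat.le_self_pow (by omega) M
  have hMD1 : 1 ≤ M ^ D := Nat.one_le_pow _ _ hM
  have hW1 : D * K * (2 * M + 3) ≤ W := by
    rw [hW, add_mul]
    refine le_trans ?_ (Nat.le_add_right _ _)
    rw [mul_assoc (D * K)]
    exact Nat.mul_le_mul_left _ (by omega)
  have hW2 : cI * (2 * M ^ D + k * (D * K * M + K * M + 1) + 1) ≤ W := by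
    rw [hW, add_mul]
    refine le_trans ?_ (Nat.le_add_left _ _)
    rw [mul_assoc cI]
    refine Nat.mul_le_mul_left _ ?_
    have : k * (D * K * M + K * M + 1) ≤ k * (D * K + K + 1) * M ^ D := by
      rw [mul_assoc k]; refine Nat.mul_le_mul_left _ ?_
      rw [add_mul, add_mul]
      have a1 : D * K * M ≤ D * K * M ^ D := Nat.mul_le_mul_left _ hMD
      have a2 : K * M ≤ K * M ^ D := Nat.mul_le_mul_left _ hMD
      omega
    rw [add_mul, add_mul]; omega
  refine ⟨fun u => f2 (f1 u), (hf1.mono le_rfl hW1).comp ?_ (hf2.mono le_rfl hW2), fun v => hf2a _, ?_⟩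
  · refine le_trans ?_ hW1
    simp only [Fintype.card_prod, Fintype.card_fin]
    exact Nat.mul_le_mul_left _ (by omega)
  intro u hu hgood
  set y : Fin D → ℝ := fun i => (1 - h) * u (σ i) + s i with hy
  have hy01 : ∀ i, 0 ≤ y i ∧ y i < 1 := fun i => ⟨(hgood i).1, (hgood i).2.1⟩
  let dg : Fin D → Fin K → Fin M := fun i m => ⟨digit M m (y i), digit_lt hM (hy01 i).1 (hy01 i).2 m⟩
  have e1 : f1 u = oneHot dg := by
    funext ⟨⟨i, m⟩, j⟩
    rw [hf1' u hgood i m j]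
    simp only [oneHot, dg, Fin.ext_iff]
    rfl
  have hz0e : ∀ i, z0 (fun i => dg i ⟨0, by omega⟩) (fun i => dg i ⟨1, by omega⟩) i = trd M 0 2 (y i) := by
    intro i
    simp only [z0, dg, trd, Finset.sum_range_succ, Finset.sum_range_zero]
    norm_num
  set zz := z0 (fun i => dg i ⟨0, by omega⟩) (fun i => dg i ⟨1, by omega⟩) with hzz
  have hzv : ∀ i, zz i + zval dg i = trd M 0 K (y i) := by
    intro i
    rw [hz0e]
    simp only [zval, dg]
    rw [Fin.sum_univ_eq_sum_range (fun m => wt M m (digit M m (y i)))]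
    obtain ⟨K', rfl⟩ := Nat.exists_eq_add_of_le hK
    simp only [trd]
    rw [Finset.sum_range_add, Finset.sum_range_add]
    simp [Finset.sum_range_succ, wt]
  have hzvn : ∀ i, 0 ≤ zval dg i := fun i => Finset.sum_nonneg fun m _ => wt_nonneg _ _ _
  have hzz0 : ∀ i, 0 ≤ zz i := fun i => (hz0 (fun i => dg i ⟨0, by omega⟩) (fun i => dg i ⟨1, by omega⟩) i).1
  have hexp2 : ∀ i, y i - zz i ≤ ((M:ℝ) ^ 2)⁻¹ := by
    intro i
    have := expansion hM 2 (y i) (hy01 i).1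
    have h2 := fstep_iter_mem (M := M) (hy01 i).1 (hy01 i).2 2
    rw [hz0e]
    have h3 : (fstep M)^[2] (y i) / (M:ℝ) ^ 2 ≤ 1 / (M:ℝ) ^ 2 := by gcongr; exact h2.2.le
    rw [one_div] at h3
    linarith
  have hexpK : ∀ i, zz i + zval dg i ≤ y i ∧ y i - (zz i + zval dg i) ≤ h := by
    intro i
    have := expansion hM K (y i) (hy01 i).1
    have h2 := fstep_iter_mem (M := M) (hy01 i).1 (hy01 i).2 K
    rw [hzv]
    have h3 : (fstep M)^[K] (y i) / (M:ℝ) ^ K ≤ 1 / (M:ℝ) ^ K := by gcongr; exact h2.2.le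
    have h4 : 0 ≤ (fstep M)^[K] (y i) / (M:ℝ) ^ K := by have := h2.1; positivity
    rw [one_div] at h3
    constructor <;> linarith
  set zt : Fin D → ℝ := fun i => zz i + zval dg i with hzt
  have hztI : ∀ i, zt i ∈ Set.Icc (0:ℝ) 1 := fun i =>
    ⟨add_nonneg (hzz0 i) (hzvn i), (hexpK i).1.trans (hy01 i).2.le⟩
  have ez : zt - zz = zval dg := by funext i; simp [hzt]
  have ht := hc2 (fun i => dg i ⟨0, by omega⟩) (fun i => dg i ⟨1, by omega⟩) zt hztI ((M:ℝ) ^ 2)⁻¹ (by positivity) (by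
    intro i
    have h1 := hexp2 i; have h2 := (hexpK i).1; have h3 := hzvn i
    simp only [hzt]
    rw [abs_of_nonneg (by linarith)]; linarith)
  rw [← hzz, ez] at ht
  beta_reduce
  rw [e1, hf2b dg]
  have hG : ∀ x : Fin D → ℝ, 0 ≤ (g x + A) / (2 * A) ∧ (g x + A) / (2 * A) ≤ 1 := by
    intro x
    have := abs_le.1 (hgF x)
    constructor
    · apply div_nonneg <;> linarith
    · rw [div_le_one (by linarith)]; linarith
  refine (clip_lip _ _ (hG _).1 (hG _).2).trans ?_
  have hgd := hgl (fun i => -A + 2 * A * zt i) (fun i => -A + 2 * A * u (σ i)) (2 * A * (2 * h)) (by positivity) (by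
    intro i
    have e : (-A + 2 * A * zt i) - (-A + 2 * A * u (σ i)) = 2 * A * (zt i - u (σ i)) := by ring
    rw [e, abs_mul, abs_of_pos (by positivity : 0 < 2 * A)]
    gcongr
    have h1 := hexpK i
    have h2 : y i = (1 - h) * u (σ i) + s i := rfl
    have h3 := hu i; have h4 := hs i
    have h5 : zt i = zz i + zval dg i := rfl
    have h6 : h * u (σ i) ≤ h := by nlinarith [h3.2]
    have h7 : 0 ≤ h * u (σ i) := mul_nonneg hh0.le h3.1
    rw [abs_le]; constructor <;> nlinarith [h1.1, h1.2, h4.1, h4.2])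
  have hd : |(g (fun i => -A + 2 * A * zt i) + A) / (2 * A) - (g (fun i => -A + 2 * A * u (σ i)) + A) / (2 * A)| ≤ Lc * (2 * h) := by
    rw [← sub_div, add_sub_add_right_eq_sub, abs_div, abs_of_pos (by positivity : 0 < 2 * A), div_le_iff₀ (by positivity)]
    linarith
  set S := ∑ w, c (fun i => dg i ⟨0, by omega⟩) (fun i => dg i ⟨1, by omega⟩) w * ∏ j, letter (zval dg) (w j)
  rw [abs_sub_comm] at ht
  calc _ ≤ C * (((M:ℝ) ^ 2)⁻¹) ^ β + Lc * (2 * h) := (abs_sub_le _ _ _).trans (add_le_add ht hd)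
    _ ≤ _ := by
      have : 0 ≤ (((M:ℝ) ^ 2)⁻¹) ^ β := by positivity
      nlinarith [mul_nonneg hLc this, mul_nonneg hDn this, mul_nonneg hC0 hh0.le, mul_nonneg hDn hh0.le]


theorem shift_exists {X : Type*} [MeasurableSpace X] (PX : Measure X) [IsProbabilityMeasure PX] {u : X → ℝ}
    (hu : Measurable u) (hu01 : ∀ x, u x ∈ Set.Icc (0:ℝ) 1) (M K J : ℕ) (hM : 1 ≤ M) (hJ : 1 ≤ J) {Λ : ℝ}
    (hΛ : 3 * J * (M:ℝ) ^ K ≤ Λ) :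
    ∃ s : ℝ, 0 ≤ s ∧ s ≤ ((M:ℝ) ^ K)⁻¹ ∧ ∃ G : Set X, MeasurableSet G ∧ PX Gᶜ ≤ (J:ℝ≥0∞)⁻¹ ∧
      ∀ x ∈ G, GoodD M K Λ ((1 - ((M:ℝ) ^ K)⁻¹) * u x + s) := by
  classical
  have hM' : (1:ℝ) ≤ M := by exact_mod_cast hM
  have hJ' : (1:ℝ) ≤ J := by exact_mod_cast hJ
  set h : ℝ := ((M:ℝ) ^ K)⁻¹ with hh
  have hMK : 1 ≤ (M:ℝ) ^ K := one_le_pow₀ hM'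
  have hh0 : 0 < h := by positivity
  have hh1 : h ≤ 1 := inv_le_one_of_one_le₀ hMK
  have hΛ0 : 0 < Λ := lt_of_lt_of_le (by positivity) hΛ
  have hJh : 3 * J / Λ ≤ h := by
    rw [div_le_iff₀ hΛ0, hh]
    rw [inv_mul_eq_div, le_div_iff₀ (by positivity)]; exact hΛ
  let s : ℕ → ℝ := fun j => 3 * j / Λ
  let bad : ℕ → Set X := fun j => {x | ∃ z : ℤ, |(1 - h) * u x + s j - z / (M:ℝ) ^ K| < Λ⁻¹}
  have hbm : ∀ j, MeasurableSet (bad j) := by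
    intro j
    have : bad j = ⋃ z : ℤ, {x | |(1 - h) * u x + s j - z / (M:ℝ) ^ K| < Λ⁻¹} := by
      ext x; simp [bad]
    rw [this]
    refine MeasurableSet.iUnion fun z => measurableSet_lt (by fun_prop) measurable_const
  have hdisj : (↑(Finset.range J) : Set ℕ).PairwiseDisjoint bad := by
    intro i hi j hj hij
    rw [Function.onFun, Set.disjoint_left]
    rintro x ⟨z, hz⟩ ⟨z', hz'⟩
    have hi' : (i:ℝ) + 1 ≤ J := by exact_mod_cast Finset.mem_range.1 hi
    have hj' : (j:ℝ) + 1 ≤ J := by exact_mod_cast Finset.mem_range.1 hj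
    have hij1 : (1:ℝ) ≤ |(i:ℝ) - j| := by
      have : (1:ℤ) ≤ |(i:ℤ) - j| := Int.one_le_abs (by omega)
      exact_mod_cast this
    have e : ∀ w : ℤ, (w:ℝ) / (M:ℝ) ^ K = w * h := fun w => by rw [hh]; rfl
    rw [e] at hz hz'
    have h3 : |(s i - s j) - ((z:ℝ) - z') * h| < 2 * Λ⁻¹ := by
      calc |(s i - s j) - ((z:ℝ) - z') * h| = |((1 - h) * u x + s i - z * h) - ((1 - h) * u x + s j - z' * h)| := by
            congr 1; ring
        _ ≤ _ := abs_sub _ _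
        _ < _ := by linarith
    have hs : s i - s j = 3 * Λ⁻¹ * ((i:ℝ) - j) := by simp only [s]; field_simp
    have hΛi : 0 < Λ⁻¹ := by positivity
    by_cases hzz : z = z'
    · subst hzz
      rw [sub_self, zero_mul, sub_zero, hs, abs_mul, abs_of_pos (by positivity : 0 < 3 * Λ⁻¹)] at h3
      nlinarith
    · have hz1 : (1:ℝ) ≤ |(z:ℝ) - z'| := by
        have : (1:ℤ) ≤ |z - z'| := Int.one_le_abs (sub_ne_zero.2 hzz)
        exact_mod_cast this
      have h4 : h ≤ |((z:ℝ) - z') * h| := by rw [abs_mul, abs_of_pos hh0]; nlinarith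
      have h5 : |s i - s j| ≤ h - 3 * Λ⁻¹ := by
        rw [hs, abs_mul, abs_of_pos (by positivity : 0 < 3 * Λ⁻¹)]
        have : |(i:ℝ) - j| ≤ J - 1 := by
          have := Nat.cast_nonneg (α := ℝ) i; have := Nat.cast_nonneg (α := ℝ) j
          rw [abs_le]; constructor <;> linarith
        have e3 : 3 * J / Λ = 3 * Λ⁻¹ * J := by ring
        rw [e3] at hJh
        nlinarith [mul_le_mul_of_nonneg_left this (by positivity : 0 ≤ 3 * Λ⁻¹)]
      have h6 := abs_sub_abs_le_abs_sub (((z:ℝ) - z') * h) (s i - s j)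
      rw [abs_sub_comm (((z:ℝ) - z') * h)] at h6
      linarith
  have hsum : ∑ j ∈ Finset.range J, PX (bad j) ≤ 1 := by
    rw [← measure_biUnion_finset hdisj fun j _ => hbm j]
    exact prob_le_one
  obtain ⟨j, hj, hjb⟩ : ∃ j ∈ Finset.range J, PX (bad j) ≤ (J:ℝ≥0∞)⁻¹ := by
    by_contra hcon
    push Not at hcon
    have h0 : ∑ j ∈ Finset.range J, (J:ℝ≥0∞)⁻¹ < ∑ j ∈ Finset.range J, PX (bad j) := by
      refine ENNReal.sum_lt_sum_of_nonempty ⟨0, by simp; omega⟩ fun j hj => hcon j hj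
    rw [Finset.sum_const, Finset.card_range, nsmul_eq_mul, ENNReal.mul_inv_cancel (by simp; omega) (by simp)] at h0
    exact absurd h0 (not_lt.2 hsum)
  have hjJ : (j:ℝ) + 1 ≤ J := by exact_mod_cast Finset.mem_range.1 hj
  have hsj : s j < h := by
    refine lt_of_lt_of_le ?_ hJh
    simp only [s]; gcongr; exact Finset.mem_range.1 hj
  refine ⟨s j, by simp only [s]; positivity, hsj.le, (bad j)ᶜ, (hbm j).compl, by rwa [compl_compl], ?_⟩
  intro x hx
  have hsj0 : 0 ≤ s j := by simp only [s]; positivity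
  have hux := hu01 x
  refine ⟨?_, ?_, ?_⟩
  · have : 0 ≤ (1 - h) * u x := mul_nonneg (by linarith) hux.1
    linarith
  · have : (1 - h) * u x ≤ 1 - h := mul_le_of_le_one_right (by linarith) hux.2
    linarith
  · intro z
    by_contra hc
    exact hx ⟨z, not_le.1 hc⟩


theorem eventually_const_pow (C : ℝ) (k : ℕ) : ∀ᶠ n : ℕ in atTop, C * (n:ℝ) ^ k ≤ (n:ℝ) ^ (k + 1) := by
  have : ∀ᶠ n : ℕ in atTop, C ≤ (n:ℝ) := tendsto_natCast_atTop_atTop.eventually_ge_atTop C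
  filter_upwards [this] with n hn
  rw [pow_succ, mul_comm]
  gcongr

theorem single_asymp {X : Type*} [MeasurableSpace X] (PX : Measure X) [IsProbabilityMeasure PX]
    {D : ℕ} (hD : 1 ≤ D) {A β Kc F Lc : ℝ} (hA : 0 < A) (hβ : 0 < β) (hFA : F ≤ A) (hLc : 0 ≤ Lc)
    {g : (Fin D → ℝ) → ℝ} (hg : memHolder A D β Kc g) (hgF : ∀ y, |g y| ≤ F)
    (hgl : ∀ y z : Fin D → ℝ, ∀ δ : ℝ, 0 ≤ δ → (∀ i, |y i - z i| ≤ δ) → |g y - g z| ≤ Lc * δ) :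
    ∃ (C : ℝ) (Cw t p : ℕ), 0 ≤ C ∧ ∀ᶠ n : ℕ in atTop, ∀ {ι : Type} [Fintype ι] [DecidableEq ι] (σ : Fin D → ι)
      (u : X → ι → ℝ), Measurable u → (∀ x i, u x i ∈ Set.Icc (0:ℝ) 1) →
      ∃ (W : ℕ) (f : (ι → ℝ) → Unit → ℝ) (G : Set X), MeasurableSet G ∧ PX Gᶜ ≤ ENNReal.ofReal (C / n) ∧
        (W:ℝ) ≤ Cw * (n:ℝ) ^ ((D:ℝ) / (2 * (2 * β + D))) ∧
        NN ((n:ℝ) ^ p) W t f ∧ (∀ v, f v () ≤ 1) ∧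
        ∀ x ∈ G, |f (u x) () - (g (fun i => -A + 2 * A * u x (σ i)) + A) / (2 * A)| ≤ C * (n:ℝ) ^ (-(β / (2 * β + D))) := by
  have hD' : (1:ℝ) ≤ D := by exact_mod_cast hD
  set E : ℝ := 2 * (2 * β + D) with hE
  have hE0 : 2 < E := by rw [hE]; linarith
  set K := ⌈E⌉₊ with hKdef
  have hKE : E ≤ K := Nat.le_ceil E
  have hK : 2 ≤ K := by
    have : (2:ℝ) ≤ K := by linarith
    exact_mod_cast this
  obtain ⟨C, Cw, t, hC0, hC⟩ := single_net hD hA hβ hFA hLc hg hgF hgl K hK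
  refine ⟨2 * C + D, Cw * 2 ^ D, t, K + 2, by positivity, ?_⟩
  filter_upwards [eventually_const_pow (6 * 2 ^ K + 3 + C) (K + 1), eventually_ge_atTop 1] with n hn hn1
  intro ι _ _ σ u hum hu
  have hn1' : (1:ℝ) ≤ n := by exact_mod_cast hn1
  have hn0 : (0:ℝ) < n := by linarith
  set m : ℝ := (n:ℝ) ^ (1 / E) with hm
  have hm1 : 1 ≤ m := Real.one_le_rpow hn1' (by positivity)
  set M := ⌈m⌉₊ with hMdef
  have hmM : m ≤ M := Nat.le_ceil m
  have hM2 : (M:ℝ) ≤ 2 * m := by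
    have := (Nat.ceil_lt_add_one (by linarith : 0 ≤ m)).le
    linarith
  have hM : 1 ≤ M := by
    have : (1:ℝ) ≤ M := by linarith
    exact_mod_cast this
  have hmn : m ≤ n := by
    calc m ≤ (n:ℝ) ^ (1:ℝ) := Real.rpow_le_rpow_of_exponent_le hn1' (by rw [div_le_one (by linarith)]; linarith)
      _ = n := Real.rpow_one _
  have hmE : m ^ E = n := by
    rw [hm, ← Real.rpow_mul hn0.le, one_div_mul_cancel (by linarith), Real.rpow_one]
  have hMK : (n:ℝ) ≤ (M:ℝ) ^ K := by
    calc (n:ℝ) = m ^ E := hmE.symm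
      _ ≤ m ^ (K:ℝ) := Real.rpow_le_rpow_of_exponent_le hm1 hKE
      _ = m ^ K := Real.rpow_natCast _ _
      _ ≤ _ := by gcongr
  set Λ : ℝ := 3 * n * (M:ℝ) ^ K with hΛ
  have hM' : (1:ℝ) ≤ M := by exact_mod_cast hM
  have hΛ0 : 0 < Λ := by positivity
  choose s hs0 hs1 G hGm hGp hG using fun i : Fin D => shift_exists PX (u := fun x => u x (σ i))
    ((measurable_pi_apply _).comp hum) (fun x => hu x _) M K n hM hn1 (Λ := Λ) le_rfl
  obtain ⟨f, hf, hf1, hf2⟩ := hC M Λ hM hΛ0 σ s (fun i => ⟨hs0 i, hs1 i⟩)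
  refine ⟨Cw * M ^ D, f, ⋂ i, G i, MeasurableSet.iInter hGm, ?_, ?_, ?_, hf1, ?_⟩
  · rw [Set.compl_iInter]
    calc PX (⋃ i, (G i)ᶜ) ≤ ∑ i, PX (G i)ᶜ := measure_iUnion_fintype_le _ _
      _ ≤ ∑ i : Fin D, (n:ℝ≥0∞)⁻¹ := Finset.sum_le_sum fun i _ => hGp i
      _ = ENNReal.ofReal (D / n) := by
        rw [Finset.sum_const, Finset.card_univ, Fintype.card_fin, nsmul_eq_mul, ENNReal.ofReal_div_of_pos hn0]
        simp [div_eq_mul_inv]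
      _ ≤ _ := by
        apply ENNReal.ofReal_le_ofReal
        gcongr; linarith
  · push_cast
    have : (M:ℝ) ^ D ≤ 2 ^ D * (n:ℝ) ^ ((D:ℝ) / E) := by
      calc (M:ℝ) ^ D ≤ (2 * m) ^ D := by gcongr
        _ = 2 ^ D * m ^ D := mul_pow _ _ _
        _ = 2 ^ D * (n:ℝ) ^ ((D:ℝ) / E) := by
          congr 1
          rw [hm, ← Real.rpow_natCast, ← Real.rpow_mul hn0.le]; congr 1; ring
    calc (Cw:ℝ) * (M:ℝ) ^ D ≤ Cw * (2 ^ D * (n:ℝ) ^ ((D:ℝ) / E)) := by gcongr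
      _ = _ := by ring
  · refine hf.mono ?_ le_rfl
    have h1 : (M:ℝ) ≤ 2 * n := by linarith
    have h2 : (M:ℝ) ^ K ≤ 2 ^ K * (n:ℝ) ^ K := by rw [← mul_pow]; gcongr
    have h3 : (n:ℝ) ≤ (n:ℝ) ^ (K + 1) := le_self_pow₀ hn1' (by omega)
    have h4 : (1:ℝ) ≤ (n:ℝ) ^ (K + 1) := one_le_pow₀ hn1'
    calc 2 * Λ + 1 + M + C ≤ 6 * 2 ^ K * (n:ℝ) ^ (K + 1) + (n:ℝ) ^ (K+1) + 2 * (n:ℝ) ^ (K + 1) + C * (n:ℝ) ^ (K + 1) := by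
          have a1 : 2 * Λ ≤ 6 * 2 ^ K * (n:ℝ) ^ (K + 1) := by
            rw [hΛ]
            calc 2 * (3 * n * (M:ℝ) ^ K) ≤ 2 * (3 * n * (2 ^ K * (n:ℝ) ^ K)) := by gcongr
              _ = _ := by ring
          have a2 : C ≤ C * (n:ℝ) ^ (K + 1) := le_mul_of_one_le_right hC0 h4
          linarith
      _ = (6 * 2 ^ K + 3 + C) * (n:ℝ) ^ (K + 1) := by ring
      _ ≤ _ := hn
  · intro x hx
    have h1 := hf2 (u x) (fun i => hu x _) (fun i => hG i x (Set.mem_iInter.1 hx i))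
    refine h1.trans ?_
    have h2 : (((M:ℝ) ^ 2)⁻¹) ^ β ≤ (n:ℝ) ^ (-(β / (2 * β + D))) := by
      calc (((M:ℝ) ^ 2)⁻¹) ^ β ≤ ((m ^ 2)⁻¹) ^ β := by gcongr
        _ = (n:ℝ) ^ (-(β / (2 * β + D))) := by
          rw [hm, ← Real.rpow_natCast, ← Real.rpow_mul hn0.le, ← Real.rpow_neg hn0.le, ← Real.rpow_mul hn0.le]
          congr 1
          rw [hE]; push_cast; field_simp
    have h3 : ((M:ℝ) ^ K)⁻¹ ≤ (n:ℝ) ^ (-(β / (2 * β + D))) := by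
      calc ((M:ℝ) ^ K)⁻¹ ≤ (n:ℝ)⁻¹ := by gcongr
        _ = (n:ℝ) ^ (-1:ℝ) := (Real.rpow_neg_one _).symm
        _ ≤ _ := by
          apply Real.rpow_le_rpow_of_exponent_le hn1'
          rw [neg_le_neg_iff, div_le_one (by positivity)]; linarith
    calc _ ≤ C * ((n:ℝ) ^ (-(β / (2 * β + D))) + (n:ℝ) ^ (-(β / (2 * β + D)))) := by gcongr
      _ ≤ _ := by
        have : 0 ≤ (n:ℝ) ^ (-(β / (2 * β + D))) := by positivity
        nlinarith


theorem le_maxRate {P : Finset (ℝ × ℕ)} (hP : P.Nonempty) (n : ℕ) {p : ℝ × ℕ} (hp : p ∈ P) :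
    (n:ℝ) ^ (-(p.1 / (2 * p.1 + p.2))) ≤ maxRate P hP n :=
  Finset.le_sup' (fun p : ℝ × ℕ => (n : ℝ) ^ (-(p.1 / (2 * p.1 + p.2)))) hp

theorem le_maxWidth {P : Finset (ℝ × ℕ)} (hP : P.Nonempty) (n : ℕ) {p : ℝ × ℕ} (hp : p ∈ P) :
    (n:ℝ) ^ ((p.2 : ℝ) / (2 * (2 * p.1 + p.2))) ≤ maxWidthExp P hP n :=
  Finset.le_sup' (fun p : ℝ × ℕ => (n : ℝ) ^ ((p.2 : ℝ) / (2 * (2 * p.1 + p.2)))) hp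

theorem one_le_maxWidth {P : Finset (ℝ × ℕ)} (hP : P.Nonempty) (hpos : ∀ p ∈ P, 0 < p.1) {n : ℕ} (hn : 1 ≤ n) :
    1 ≤ maxWidthExp P hP n := by
  obtain ⟨p, hp⟩ := hP
  refine le_trans ?_ (le_maxWidth _ n hp)
  have := hpos p hp
  exact Real.one_le_rpow (by exact_mod_cast hn) (by positivity)

theorem maxRate_nonneg {P : Finset (ℝ × ℕ)} (hP : P.Nonempty) (n : ℕ) : 0 ≤ maxRate P hP n := by
  obtain ⟨p, hp⟩ := id hP
  exact le_trans (by positivity) (le_maxRate hP n hp)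

/-- approximability of a finite family of rescaled functions -/
def Lev {d : ℕ} (PX : Measure (Fin d → ℝ)) (P : Finset (ℝ × ℕ)) (hP : P.Nonempty) (A : ℝ) (m : ℕ)
    (φ : ℕ → (Fin d → ℝ) → ℝ) : Prop :=
  ∃ (C : ℝ) (Cw t p : ℕ), 0 ≤ C ∧ ∀ᶠ n : ℕ in atTop,
    ∃ (W : ℕ) (f : (Fin d → ℝ) → Fin m → ℝ) (G : Set (Fin d → ℝ)), MeasurableSet G ∧ PX Gᶜ ≤ ENNReal.ofReal (C / n) ∧
      (W:ℝ) ≤ Cw * maxWidthExp P hP n ∧ NN ((n:ℝ) ^ p) W t f ∧ (∀ x i, f x i ≤ 1) ∧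
      ∀ x ∈ G, ∀ i, |f x i - (φ i x + A) / (2 * A)| ≤ C * maxRate P hP n

theorem cube_measurable (a : ℝ) (d : ℕ) : MeasurableSet (cube a d) := (cube_compact a d).measurableSet

theorem lev_zero {d : ℕ} (PX : Measure (Fin d → ℝ)) [IsProbabilityMeasure PX] {P : Finset (ℝ × ℕ)} (hP : P.Nonempty)
    (hpos : ∀ p ∈ P, 0 < p.1) {a A : ℝ} (haA : a ≤ A) (hA : 1 ≤ A) (hsupp : PX (cube a d) = 1) (m : ℕ)
    (φ : ℕ → (Fin d → ℝ) → ℝ) (hφ : ∀ i < m, ∃ j : Fin d, ∀ x, φ i x = x j) : Lev PX P hP A m φ := by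
  classical
  choose j hj using fun i : Fin m => hφ i i.2
  refine ⟨0, m, 1, 1, le_rfl, ?_⟩
  filter_upwards [eventually_ge_atTop 1] with n hn
  have hn' : (1:ℝ) ≤ n := by exact_mod_cast hn
  let f1 : (Fin d → ℝ) → Fin m → ℝ := fun x i => max 0 (-(1 / (2 * A)) * x (j i) + 1 / 2)
  let f2 : (Fin m → ℝ) → Fin m → ℝ := fun v i => max 0 (-1 * v i + 1)
  have h2A : 1 / (2 * A) ≤ 1 := by rw [div_le_one (by linarith)]; linarith
  have hf1 : IsLayer ((n:ℝ) ^ 1) f1 := by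
    refine ⟨fun i k => if k = j i then -(1 / (2 * A)) else 0, fun _ => 1 / 2, ?_, ?_, ?_⟩
    · intro i k; dsimp only; rw [pow_one]; split_ifs
      · rw [abs_neg, abs_of_nonneg (by positivity)]; linarith
      · simp
    · intro i; rw [pow_one, abs_of_pos (by norm_num)]; linarith
    · intro v k; simp [f1]
  have hf2 : IsLayer ((n:ℝ) ^ 1) f2 := by
    refine ⟨fun i k => if k = i then -1 else 0, fun _ => 1, ?_, ?_, ?_⟩
    · intro i k; dsimp only; rw [pow_one]; split_ifs <;> simp [hn]
    · intro i; rw [pow_one]; simpa using hn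
    · intro v k; simp [f2]
  refine ⟨m, fun x => f2 (f1 x), cube a d, cube_measurable _ _, ?_, ?_, ⟨_, inferInstance, f1, f2, by simp, hf1, hf2, fun _ => rfl⟩, ?_, ?_⟩
  · rw [(prob_compl_eq_zero_iff (cube_measurable a d)).2 hsupp]; simp
  · have := one_le_maxWidth hP hpos hn
    nlinarith [Nat.cast_nonneg (α := ℝ) m]
  · intro x i; simp only [f2]; apply max_le (by norm_num); linarith [le_max_left 0 (-(1 / (2 * A)) * x (j i) + 1 / 2)]
  · intro x hx i
    have h := hx (j i)
    rw [hj i]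
    have h1 : |x (j i)| ≤ A := (abs_le.2 h).trans haA
    have h2 := abs_le.1 h1
    have h3 : 1 / (2 * A) * x (j i) ≤ 1 / 2 := by
      rw [one_div_mul_eq_div, div_le_iff₀ (by positivity)]; linarith
    have h4 : -(1 / 2) ≤ 1 / (2 * A) * x (j i) := by
      rw [one_div_mul_eq_div, le_div_iff₀ (by positivity)]; linarith
    simp only [f1, f2]
    rw [max_eq_right (show (0:ℝ) ≤ -(1 / (2 * A)) * x (j i) + 1 / 2 by linarith), max_eq_right (by linarith)]
    have : -1 * (-(1 / (2 * A)) * x (j i) + 1 / 2) + 1 - (x (j i) + A) / (2 * A) = 0 := by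
      field_simp; ring
    rw [this]; simp

theorem lev_succ {d : ℕ} (PX : Measure (Fin d → ℝ)) [IsProbabilityMeasure PX] {P : Finset (ℝ × ℕ)} (hP : P.Nonempty)
    (hpos : ∀ p ∈ P, 0 < p.1 ∧ 1 ≤ p.2) {A F Kc CLip : ℝ} (hA : 1 ≤ A) (hFA : F ≤ A) (hCLip : 0 ≤ CLip)
    (m m' : ℕ) (φ φ' : ℕ → (Fin d → ℝ) → ℝ) (hφ : Lev PX P hP A m φ)
    (βh : ℕ → ℝ) (dh : ℕ → ℕ) (g : (i : ℕ) → (Fin (dh i) → ℝ) → ℝ)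
    (hg : ∀ i < m', (βh i, dh i) ∈ P ∧ (∀ y z : Fin (dh i) → ℝ, |g i y - g i z| ≤ CLip * Real.sqrt (∑ j, (y j - z j) ^ 2)) ∧
      memHolder A (dh i) (βh i) Kc (g i) ∧ (∀ y, |g i y| ≤ F) ∧
      (∀ x, φ' i x = g i (fun j => φ ((∑ i' ∈ Finset.range i, dh i') + j) x)))
    (hsum : (∑ i ∈ Finset.range m', dh i) = m) : Lev PX P hP A m' φ' := by
  classical
  obtain ⟨C, Cw, t, p, hC0, hC⟩ := hφ
  have hlip : ∀ i : Fin m', ∀ y z : Fin (dh i) → ℝ, ∀ δ : ℝ, 0 ≤ δ → (∀ k, |y k - z k| ≤ δ) →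
      |g i y - g i z| ≤ (CLip * Real.sqrt (dh i)) * δ := by
    intro i y z δ hδ hyz
    refine ((hg i i.2).2.1 y z).trans ?_
    rw [mul_assoc]
    gcongr
    have : ∑ j, (y j - z j) ^ 2 ≤ (dh i) * δ ^ 2 := by
      calc ∑ j, (y j - z j) ^ 2 ≤ ∑ j : Fin (dh i), δ ^ 2 := Finset.sum_le_sum fun j _ => by
            rw [← sq_abs]; gcongr; exact hyz j
        _ = _ := by simp
    calc Real.sqrt (∑ j, (y j - z j) ^ 2) ≤ Real.sqrt ((dh i) * δ ^ 2) := Real.sqrt_le_sqrt this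
      _ = _ := by rw [Real.sqrt_mul (by positivity), Real.sqrt_sq hδ]
  choose Ci Cwi ti pi hCi0 hCi using fun i : Fin m' => single_asymp PX (hpos _ (hg i i.2).1).2 (by linarith : 0 < A)
    (hpos _ (hg i i.2).1).1 hFA (by positivity : 0 ≤ CLip * Real.sqrt (dh i)) (hg i i.2).2.2.1 (hg i i.2).2.2.2.1 (hlip i)
  set T := ∑ i, ti i with hT
  set Pp := p + ∑ i, pi i with hPp
  set CL' := ∑ i : Fin m', CLip * Real.sqrt (dh i) with hCL'
  refine ⟨C + ∑ i, Ci i + C * CL', Cw + m + m' * (∑ i, Cwi i + 1), t + T + 1, Pp, ?_, ?_⟩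
  · exact add_nonneg (add_nonneg hC0 (Finset.sum_nonneg fun i _ => hCi0 i)) (mul_nonneg hC0 (Finset.sum_nonneg fun i _ => by positivity))
  filter_upwards [hC, eventually_all.2 hCi, eventually_ge_atTop 1] with n hn hni hn1
  have hn1' : (1:ℝ) ≤ n := by exact_mod_cast hn1
  obtain ⟨W, f, G, hGm, hGp, hW, hf, hf1, hf2⟩ := hn
  have hfm : Measurable f := hf.continuous.measurable
  have hoff : ∀ (i : Fin m') (k : Fin (dh i)), (∑ i' ∈ Finset.range i, dh i') + k < m := by
    intro i k
    rw [← hsum]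
    calc (∑ i' ∈ Finset.range i, dh i') + k < (∑ i' ∈ Finset.range i, dh i') + dh i := by omega
      _ = ∑ i' ∈ Finset.range (i + 1), dh i' := (Finset.sum_range_succ _ _).symm
      _ ≤ _ := Finset.sum_le_sum_of_subset (Finset.range_mono i.2)
  choose Wi fi Gi hGim hGip hWi hfi hfi1 hfi2 using fun i : Fin m' => hni i (fun k : Fin (dh i) => (⟨_, hoff i k⟩ : Fin m)) f hfm
    (fun x k => ⟨hf.nonneg x k, hf1 x k⟩)
  set R := maxRate P hP n
  set V := maxWidthExp P hP n
  have hV1 : 1 ≤ V := one_le_maxWidth hP (fun p hp => (hpos p hp).1) hn1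
  have hR0 : 0 ≤ R := maxRate_nonneg hP n
  -- common inner width
  set Ws := ∑ i, Wi i + 1 with hWs
  have hnp : ∀ i, (n:ℝ) ^ pi i ≤ (n:ℝ) ^ Pp := fun i => pow_le_pow_right₀ hn1' (by
    have := Finset.single_le_sum (f := pi) (fun _ _ => Nat.zero_le _) (Finset.mem_univ i); omega)
  have hnp1 : 1 ≤ (n:ℝ) ^ Pp := one_le_pow₀ hn1'
  have hfi' : ∀ i, NN ((n:ℝ) ^ Pp) Ws T (fi i) := fun i =>
    ((hfi i).mono (hnp i) (show Wi i ≤ Ws by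
      have := Finset.single_le_sum (f := Wi) (fun _ _ => Nat.zero_le _) (Finset.mem_univ i); omega)).pad hnp1 (by simp; omega)
      (Finset.single_le_sum (f := ti) (fun _ _ => Nat.zero_le _) (Finset.mem_univ i))
  have hs := (NN.sigma (by linarith : 0 ≤ (n:ℝ) ^ Pp) hfi').reindex (fun i : Fin m' => (⟨i, ()⟩ : Σ _ : Fin m', Unit))
  have hfin := ((hf.mono (pow_le_pow_right₀ hn1' (by omega : p ≤ Pp)) (show W ≤ W + m + m' * Ws by omega)).comp (by simp; omega)
    (hs.mono le_rfl (show _ ≤ W + m + m' * Ws by simp)))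
  have hsumC : ∀ i, Ci i ≤ ∑ i, Ci i := fun i => Finset.single_le_sum (f := Ci) (fun i _ => hCi0 i) (Finset.mem_univ i)
  refine ⟨W + m + m' * Ws, _, G ∩ ⋂ i, Gi i, hGm.inter (MeasurableSet.iInter hGim), ?_, ?_, hfin, fun x i => hfi1 _ _, ?_⟩
  · rw [Set.compl_inter, Set.compl_iInter]
    calc PX (Gᶜ ∪ ⋃ i, (Gi i)ᶜ) ≤ PX Gᶜ + ∑ i, PX (Gi i)ᶜ := (measure_union_le _ _).trans (by gcongr; exact measure_iUnion_fintype_le _ _)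
      _ ≤ ENNReal.ofReal (C / n) + ∑ i, ENNReal.ofReal (Ci i / n) := by gcongr; exact hGip _
      _ = ENNReal.ofReal (C / n + ∑ i, Ci i / n) := by
        have : ∀ i, 0 ≤ Ci i / n := fun i => div_nonneg (hCi0 i) (by linarith)
        rw [ENNReal.ofReal_add (by positivity) (Finset.sum_nonneg fun i _ => this i), ENNReal.ofReal_sum_of_nonneg fun i _ => this i]
      _ ≤ _ := by
        apply ENNReal.ofReal_le_ofReal
        rw [← Finset.sum_div, ← add_div]
        have h0 : 0 ≤ C * CL' := mul_nonneg hC0 (Finset.sum_nonneg fun i _ => by positivity)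
        exact div_le_div_of_nonneg_right (by linarith) (by linarith)
  · have h1 : ∀ i, (Wi i : ℝ) ≤ Cwi i * V := fun i => (hWi i).trans (by gcongr; exact le_maxWidth hP n (hg i i.2).1)
    have h2 : ((∑ i, Wi i : ℕ) : ℝ) ≤ (∑ i, Cwi i : ℕ) * V := by
      push_cast; rw [Finset.sum_mul]; exact Finset.sum_le_sum fun i _ => h1 i
    rw [hWs]; push_cast at *
    have h3 : (m:ℝ) ≤ m * V := le_mul_of_one_le_right (by positivity) hV1
    have h4 : (m':ℝ) * (∑ i, (Wi i:ℝ) + 1) ≤ m' * ((∑ i, (Cwi i : ℝ)) * V + 1 * V) := by gcongr; linarith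
    linarith
  · rintro x ⟨hxG, hxGi⟩ i
    have h1 := hfi2 i x (Set.mem_iInter.1 hxGi i)
    have h2 := hlip i (fun k => -A + 2 * A * f x ⟨_, hoff i k⟩) (fun k => φ ((∑ i' ∈ Finset.range i, dh i') + k) x)
      (2 * A * (C * R)) (by positivity) (by
        intro k
        have := hf2 x hxG ⟨_, hoff i k⟩
        have e : (-A + 2 * A * f x ⟨_, hoff i k⟩) - φ ((∑ i' ∈ Finset.range i, dh i') + k) x
          = 2 * A * (f x ⟨_, hoff i k⟩ - (φ ((∑ i' ∈ Finset.range i, dh i') + k) x + A) / (2 * A)) := by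
          field_simp; ring
        rw [e, abs_mul, abs_of_pos (by positivity : 0 < 2 * A)]
        gcongr)
    rw [(hg i i.2).2.2.2.2 x]
    have h3 : |(g i (fun k => -A + 2 * A * f x ⟨_, hoff i k⟩) + A) / (2 * A) - (g i (fun k => φ ((∑ i' ∈ Finset.range i, dh i') + k) x) + A) / (2 * A)|
        ≤ CLip * Real.sqrt (dh i) * (C * R) := by
      rw [← sub_div, add_sub_add_right_eq_sub, abs_div, abs_of_pos (by positivity : 0 < 2 * A), div_le_iff₀ (by positivity)]
      linarith
    have h4 : CLip * Real.sqrt (dh i) ≤ CL' :=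
      Finset.single_le_sum (f := fun i : Fin m' => CLip * Real.sqrt (dh i)) (fun i _ => by positivity) (Finset.mem_univ i)
    have h5 := le_maxRate hP n (hg i i.2).1
    calc _ ≤ Ci i * (n:ℝ) ^ (-(βh i / (2 * βh i + dh i))) + CLip * Real.sqrt (dh i) * (C * R) :=
          (abs_sub_le _ _ _).trans (add_le_add h1 h3)
      _ ≤ (∑ i, Ci i) * R + CL' * (C * R) := by
        have := hsumC i
        have h0 := hCi0 i
        have h6 : 0 ≤ C * R := mul_nonneg hC0 hR0
        have h7 : Ci i * (n:ℝ) ^ (-(βh i / (2 * βh i + dh i))) ≤ (∑ i, Ci i) * R :=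
          mul_le_mul this h5 (by positivity) (h0.trans this)
        have h8 := mul_le_mul_of_nonneg_right h4 h6
        linarith
      _ ≤ _ := by nlinarith [mul_nonneg hC0 hR0]

theorem lev_final {a : ℝ} (ha : 1 ≤ a) {d q : ℕ} {N : ℕ → ℕ} {P : Finset (ℝ × ℕ)} (hP : P.Nonempty)
    (hpos : ∀ p ∈ P, 0 < p.1 ∧ 1 ≤ p.2) {K F CLip : ℝ} (hF : 1 ≤ F) (hCLip : 1 ≤ CLip)
    {f₀ : (Fin d → ℝ) → ℝ} (hf₀ : followsHCS a d q N P K F CLip f₀)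
    (PX : Measure (Fin d → ℝ)) [IsProbabilityMeasure PX] (hsupp : PX (cube a d) = 1) :
    Lev PX P hP (max a (2 * F)) 1 (fun _ => f₀) := by
  obtain ⟨hq, hNq, fl, βh, dh, g, h0, h1, h2, h3⟩ := hf₀
  have key : ∀ l, l ≤ q → Lev PX P hP (max a (2 * F)) (N l) (fl l) := by
    intro l
    induction l with
    | zero => intro _; exact lev_zero PX hP (fun p hp => (hpos p hp).1) (le_max_left _ _) (le_max_of_le_left ha) hsupp _ _ h0
    | succ l ih =>
      intro hl
      refine lev_succ PX hP hpos (Kc := K) (CLip := CLip) (F := F) (le_max_of_le_left ha) (le_max_of_le_right (by linarith)) (by linarith) (N l) (N (l+1)) (fl l) (fl (l + 1)) (ih (by omega)) (βh (l+1)) (dh (l+1)) (g (l+1))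
        ?_ ?_
      · exact fun i hi => h1 (l+1) (by omega) hl i hi
      · exact h2 (l+1) (by omega) hl
  have := key q le_rfl
  rw [hNq] at this
  obtain ⟨C, Cw, t, p, hC0, hC⟩ := this
  refine ⟨C, Cw, t, p, hC0, ?_⟩
  filter_upwards [hC] with n hn
  obtain ⟨W, f, G, hGm, hGp, hW, hf, hf1, hf2⟩ := hn
  refine ⟨W, f, G, hGm, hGp, hW, hf, hf1, fun x hx i => ?_⟩
  have := hf2 x hx i
  rw [h3 x]
  have hi : (i:ℕ) = 0 := by omega
  rw [hi] at this; exact this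

theorem followsHCS_bound {a : ℝ} {d q : ℕ} {N : ℕ → ℕ} {P : Finset (ℝ × ℕ)} {K F CLip : ℝ} 
    {f₀ : (Fin d → ℝ) → ℝ} (hf₀ : followsHCS a d q N P K F CLip f₀) : (∀ x, |f₀ x| ≤ F) ∧ Continuous f₀ := by
  obtain ⟨hq, hNq, fl, βh, dh, g, h0, h1, h2, h3⟩ := hf₀
  constructor
  · intro x
    rw [h3, (h1 q hq le_rfl 0 (by omega)).2.2.2.2]
    exact (h1 q hq le_rfl 0 (by omega)).2.2.2.1 _
  · have key : ∀ l, l ≤ q → ∀ i < N l, Continuous (fl l i) := by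
      intro l
      induction l with
      | zero =>
        intro _ i hi
        obtain ⟨j, hj⟩ := h0 i hi
        have : fl 0 i = fun x => x j := funext hj
        rw [this]; fun_prop
      | succ l ih =>
        intro hl i hi
        obtain ⟨_, _, hh, _, he⟩ := h1 (l+1) (by omega) hl i hi
        have : fl (l+1) i = fun x => g (l+1) i (fun j => fl l ((∑ i' ∈ Finset.range i, dh (l+1) i') + j) x) := funext he
        rw [this]
        refine hh.1.continuous.comp (continuous_pi fun j => ih (by omega) _ ?_)
        have h5 := h2 (l+1) (by omega) hl
        simp only [Nat.add_sub_cancel] at h5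
        rw [← h5]
        calc (∑ i' ∈ Finset.range i, dh (l+1) i') + j < (∑ i' ∈ Finset.range i, dh (l+1) i') + dh (l+1) i := by omega
          _ = ∑ i' ∈ Finset.range (i + 1), dh (l+1) i' := (Finset.sum_range_succ _ _).symm
          _ ≤ _ := Finset.sum_le_sum_of_subset (Finset.range_mono hi)
    have : f₀ = fl q 0 := funext h3
    rw [this]; exact key q le_rfl 0 (by omega)


theorem lrelu_pair {ν : ℝ} (h0 : 0 ≤ ν) (h1 : ν < 1) (y : ℝ) :
    (1 - ν ^ 2)⁻¹ * (lrelu ν y + ν * lrelu ν (-y)) = max 0 y := by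
  have hn : (1 - ν ^ 2) ≠ 0 := by nlinarith
  unfold lrelu
  rcases le_total 0 y with h | h
  · rw [max_eq_left (by nlinarith : ν * y ≤ y), max_eq_right (by nlinarith : -y ≤ ν * -y), max_eq_right h]
    field_simp; ring
  · rw [max_eq_right (by nlinarith : y ≤ ν * y), max_eq_left (by nlinarith : ν * -y ≤ -y), max_eq_left h]
    field_simp; ring

theorem leaky_layer {ν : ℝ} (h0 : 0 ≤ ν) (h1 : ν < 1) {B c : ℝ} (hB : 0 ≤ B) (hc : 2 * (1 - ν ^ 2)⁻¹ ≤ c)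
    {ι κ : Type} [Fintype ι] [Fintype κ] {g : (ι → ℝ) → κ → ℝ} (hg : IsLayer B g) {r' r : ℕ}
    (D : ι → Fin r' → ℝ) (hD : ∀ i, ∑ k, |D k i| ≤ c) (e : κ ⊕ κ → Fin r) (he : Function.Injective e) :
    ∃ (A' : Fin r → Fin r' → ℝ) (b' : Fin r → ℝ) (D' : κ → Fin r → ℝ), (∀ i j, |A' i j| ≤ B * c) ∧ (∀ i, |b' i| ≤ B) ∧
      (∀ i, ∑ k, |D' k i| ≤ c) ∧ ∀ (h : Fin r' → ℝ) (v : ι → ℝ), (∀ k, v k = ∑ i, D k i * h i) →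
        ∀ k, g v k = ∑ i, D' k i * lrelu ν ((∑ j, A' i j * h j) + b' i) := by
  classical
  obtain ⟨A, b, hA, hb, hg⟩ := hg
  have hn : 0 < 1 - ν ^ 2 := by nlinarith
  have hc0 : 0 ≤ c := le_trans (by positivity) hc
  let row : κ → Fin r' → ℝ := fun k j => ∑ i, A k i * D i j
  have hrow : ∀ k j, |row k j| ≤ B * c := fun k j => by
    calc |row k j| ≤ ∑ i, |A k i * D i j| := Finset.abs_sum_le_sum_abs _ _
      _ ≤ ∑ i, B * |D i j| := Finset.sum_le_sum fun i _ => by rw [abs_mul]; gcongr; exact hA k i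
      _ ≤ B * c := by rw [← Finset.mul_sum]; gcongr; exact hD j
  let A' : Fin r → Fin r' → ℝ := Function.extend e (Sum.elim row (fun k j => -row k j)) 0
  let b' : Fin r → ℝ := Function.extend e (Sum.elim b (fun k => -b k)) 0
  let D' : κ → Fin r → ℝ := fun k i => (1 - ν ^ 2)⁻¹ * ((if e (Sum.inl k) = i then 1 else 0) + ν * (if e (Sum.inr k) = i then 1 else 0))
  have ind : ∀ (u : κ → Fin r) (hu : Function.Injective u) (i : Fin r), ∑ k, (if u k = i then (1:ℝ) else 0) ≤ 1 := by
    intro u hu i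
    rw [Finset.sum_ite, Finset.sum_const_zero, add_zero, Finset.sum_const, nsmul_eq_mul, mul_one]
    have : (Finset.univ.filter fun k => u k = i).card ≤ 1 := by
      rw [Finset.card_le_one]; intro a ha b hb
      simp at ha hb; exact hu (ha.trans hb.symm)
    exact_mod_cast this
  refine ⟨A', b', D', ?_, ?_, ?_, ?_⟩
  · intro i j
    by_cases hi : ∃ s, e s = i
    · obtain ⟨s, rfl⟩ := hi
      simp only [A', he.extend_apply]
      rcases s with k | k
      · exact hrow k j
      · simp only [Sum.elim_inr, abs_neg]; exact hrow k j
    · simp only [A', Function.extend_apply' _ _ _ hi]; simp; positivity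
  · intro i
    by_cases hi : ∃ s, e s = i
    · obtain ⟨s, rfl⟩ := hi
      simp only [b', he.extend_apply]
      rcases s with k | k
      · exact hb k
      · simp only [Sum.elim_inr, abs_neg]; exact hb k
    · simp only [b', Function.extend_apply' _ _ _ hi]; simpa using hB
  · intro i
    have e1 := ind (fun k => e (Sum.inl k)) (he.comp Sum.inl_injective) i
    have e2 := ind (fun k => e (Sum.inr k)) (he.comp Sum.inr_injective) i
    have : ∀ k, |D' k i| = (1 - ν ^ 2)⁻¹ * ((if e (Sum.inl k) = i then 1 else 0) + ν * (if e (Sum.inr k) = i then 1 else 0)) :=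
      fun k => abs_of_nonneg (by positivity)
    simp only [this]
    rw [← Finset.mul_sum, Finset.sum_add_distrib, ← Finset.mul_sum]
    refine le_trans ?_ hc
    rw [mul_comm 2]
    gcongr
    nlinarith
  · intro h v hv k
    have hA1 : ∀ k, (∑ j, A' (e (Sum.inl k)) j * h j) + b' (e (Sum.inl k)) = (∑ i, A k i * v i) + b k := by
      intro k
      simp only [A', b', he.extend_apply, Sum.elim_inl]
      congr 1
      simp only [row, hv, Finset.sum_mul, Finset.mul_sum]
      rw [Finset.sum_comm]
      simp only [mul_assoc]
    have hA2 : ∀ k, (∑ j, A' (e (Sum.inr k)) j * h j) + b' (e (Sum.inr k)) = -((∑ i, A k i * v i) + b k) := by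
      intro k
      rw [← hA1 k]
      simp only [A', b', he.extend_apply, Sum.elim_inl, Sum.elim_inr, neg_mul, Finset.sum_neg_distrib]
      ring
    rw [hg, ← lrelu_pair h0 h1]
    simp only [D', mul_assoc, add_mul, ← Finset.mul_sum, Finset.sum_add_distrib, ite_mul, one_mul, zero_mul,
      Finset.sum_ite_eq, Finset.mem_univ, if_true, hA1, hA2]

/-- hidden state of a leaky network -/
def hstate (ν : ℝ) {d r : ℕ} (A0 : Fin r → Fin d → ℝ) (b0 : Fin r → ℝ) (As : ℕ → Fin r → Fin r → ℝ)
    (bs : ℕ → Fin r → ℝ) (x : Fin d → ℝ) : ℕ → Fin r → ℝ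
  | 0 => fun i => lrelu ν ((∑ j, A0 i j * x j) + b0 i)
  | l + 1 => fun i => lrelu ν ((∑ j, As l i j * hstate ν A0 b0 As bs x l j) + bs l i)

theorem hstate_congr (ν : ℝ) {d r : ℕ} (A0 : Fin r → Fin d → ℝ) (b0 : Fin r → ℝ) (As As' : ℕ → Fin r → Fin r → ℝ)
    (bs bs' : ℕ → Fin r → ℝ) (x : Fin d → ℝ) (t : ℕ) (h : ∀ l < t, As l = As' l ∧ bs l = bs' l) :
    hstate ν A0 b0 As bs x t = hstate ν A0 b0 As' bs' x t := by
  induction t with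
  | zero => rfl
  | succ t ih =>
    simp only [hstate]
    rw [ih fun l hl => h l (by omega), (h t (by omega)).1, (h t (by omega)).2]

theorem leaky_net {ν : ℝ} (h0 : 0 ≤ ν) (h1 : ν < 1) {B c : ℝ} (hB : 0 ≤ B) (hc : 2 * (1 - ν ^ 2)⁻¹ ≤ c) (hc1 : 1 ≤ c) {d r W : ℕ}
    (hW : 2 * W ≤ r) {t : ℕ} : ∀ {κ : Type} [Fintype κ] {f : (Fin d → ℝ) → κ → ℝ}, Fintype.card κ ≤ W → NN B W t f →
    ∃ (A0 : Fin r → Fin d → ℝ) (b0 : Fin r → ℝ) (As : ℕ → Fin r → Fin r → ℝ) (bs : ℕ → Fin r → ℝ) (D : κ → Fin r → ℝ),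
      (∀ i j, |A0 i j| ≤ B * c) ∧ (∀ i, |b0 i| ≤ B) ∧ (∀ l i j, |As l i j| ≤ B * c) ∧ (∀ l i, |bs l i| ≤ B) ∧
      (∀ i, ∑ k, |D k i| ≤ c) ∧ ∀ x k, f x k = ∑ i, D k i * hstate ν A0 b0 As bs x t i := by
  classical
  have emb : ∀ (κ : Type) [Fintype κ], Fintype.card κ ≤ W → ∃ e : κ ⊕ κ → Fin r, Function.Injective e := by
    intro κ _ hκ
    obtain ⟨e⟩ := Function.Embedding.nonempty_of_card_le (α := κ ⊕ κ) (β := Fin r) (by simp; omega)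
    exact ⟨e, e.injective⟩
  have hBc : 0 ≤ B * c := by positivity
  induction t with
  | zero =>
    intro κ _ f hκ hf
    obtain ⟨e, he⟩ := emb κ hκ
    obtain ⟨A', b', D', h2, h3, h4, h5⟩ := leaky_layer h0 h1 hB hc hf (fun i j : Fin d => if i = j then (1:ℝ) else 0)
      (fun i => by simpa [apply_ite abs] using hc1) e he
    exact ⟨A', b', fun _ _ _ => 0, fun _ _ => 0, D', h2, h3, fun _ _ _ => by simpa, fun _ _ => by simpa, h4, fun x k => by
      rw [h5 x x (fun k => by simp)]; rfl⟩
  | succ t ih =>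
    intro κ _ f hκ hf
    obtain ⟨μ, _, f1, g, hμ, hf1, hg, hfg⟩ := hf
    obtain ⟨e, he⟩ := emb κ hκ
    obtain ⟨A0, b0, As, bs, D, k1, k2, k3, k4, k5, k6⟩ := ih hμ hf1
    obtain ⟨A', b', D', h2, h3, h4, h5⟩ := leaky_layer h0 h1 hB hc hg D k5 e he
    refine ⟨A0, b0, Function.update As t A', Function.update bs t b', D', k1, k2, ?_, ?_, h4, ?_⟩
    · intro l i j
      by_cases hl : l = t
      · subst hl; simpa using h2 i j
      · simpa [Function.update_of_ne hl] using k3 l i j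
    · intro l i
      by_cases hl : l = t
      · subst hl; simpa using h3 i
      · simpa [Function.update_of_ne hl] using k4 l i
    · intro x k
      have hcg := hstate_congr ν A0 b0 (Function.update As t A') As (Function.update bs t b') bs x t (fun l hl => by
        rw [Function.update_of_ne (by omega), Function.update_of_ne (by omega)]; exact ⟨rfl, rfl⟩)
      simp only [hstate, hcg, Function.update_self]
      rw [hfg, h5 (hstate ν A0 b0 As bs x t) (f1 x) (k6 x)]

theorem foldl_finRange {α : Type} (step : ℕ → α → α) (s : ℕ → α) (hs : ∀ l, s (l + 1) = step l (s l)) (m : ℕ) :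
    (List.finRange m).foldl (fun h (l : Fin m) => step l h) (s 0) = s m := by
  induction m with
  | zero => rfl
  | succ m ih =>
    rw [List.finRange_succ_last, List.foldl_append, List.foldl_map]
    simp only [Fin.val_castSucc, List.foldl_cons, List.foldl_nil, Fin.val_last]
    rw [ih, hs]

theorem leaky_params {ν : ℝ} (h0 : 0 ≤ ν) (h1 : ν < 1) {B c : ℝ} (hB : 0 ≤ B) (hc : 2 * (1 - ν ^ 2)⁻¹ ≤ c) (hc1 : 1 ≤ c) {d r W L : ℕ}
    (hL : 1 ≤ L) (hW1 : 1 ≤ W)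
    (hW : 2 * W ≤ r) {f : (Fin d → ℝ) → Fin 1 → ℝ} (hf : NN B W (L - 1) f) {A : ℝ} (hA : 0 ≤ A) :
    ∃ θ : ParamIdx d r L → ℝ, (∀ i, |θ i| ≤ B * c + B + 2 * A * c + A) ∧ ∀ x, netOfParams ν d r L θ x = 2 * A * f x 0 - A := by
  obtain ⟨A0, b0, As, bs, D, k1, k2, k3, k4, k5, k6⟩ := leaky_net h0 h1 hB hc hc1 hW (by simpa using hW1) hf
  let θ : ParamIdx d r L → ℝ := Sum.elim (fun p => A0 p.1 p.2) (Sum.elim b0 (Sum.elim (fun p => As p.1 p.2.1 p.2.2)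
    (Sum.elim (fun p => bs p.1 p.2) (Sum.elim (fun i => 2 * A * D 0 i) (fun _ => -A)))))
  have p1 : 0 ≤ B * c := by positivity
  have p2 : 0 ≤ 2 * A * c := by positivity
  refine ⟨θ, ?_, ?_⟩
  · rintro (⟨i, j⟩ | i | ⟨l, i, j⟩ | ⟨l, i⟩ | i | _)
    · have := k1 i j; simp only [θ, Sum.elim_inl, Sum.elim_inr]; linarith
    · have := k2 i; simp only [θ, Sum.elim_inl, Sum.elim_inr]; linarith
    · have := k3 l i j; simp only [θ, Sum.elim_inl, Sum.elim_inr]; linarith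
    · have := k4 l i; simp only [θ, Sum.elim_inl, Sum.elim_inr]; linarith
    · have := k5 i; simp only [θ, Sum.elim_inl, Sum.elim_inr]
      simp at this
      rw [abs_mul, abs_of_nonneg (by positivity : 0 ≤ 2 * A)]
      have := mul_le_mul_of_nonneg_left this (by positivity : 0 ≤ 2 * A)
      linarith
    · simp only [θ, Sum.elim_inl, Sum.elim_inr, abs_neg, abs_of_nonneg hA]; linarith
  · intro x
    unfold netOfParams
    simp only [θ, Sum.elim_inl, Sum.elim_inr]
    have := foldl_finRange (fun l h => fun i => lrelu ν ((∑ j, As l i j * h j) + bs l i)) (hstate ν A0 b0 As bs x) (fun l => rfl) (L - 1)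
    have e0 : hstate ν A0 b0 As bs x 0 = fun i => lrelu ν ((∑ j, A0 i j * x j) + b0 i) := rfl
    rw [e0] at this
    rw [this, k6 x 0, Finset.mul_sum]
    simp only [mul_assoc]
    ring


theorem tendsto_log_nat : Tendsto (fun n : ℕ => Real.log n) atTop atTop :=
  Real.tendsto_log_atTop.comp tendsto_natCast_atTop_atTop

theorem approx_params {a : ℝ} (ha : 1 ≤ a) {d q : ℕ} {N : ℕ → ℕ} {P : Finset (ℝ × ℕ)} (hP : P.Nonempty)
    (hpos : ∀ p ∈ P, 0 < p.1 ∧ 1 ≤ p.2) {K F CLip : ℝ} (hF : 1 ≤ F) (hCLip : 1 ≤ CLip)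
    {f₀ : (Fin d → ℝ) → ℝ} (hf₀ : followsHCS a d q N P K F CLip f₀)
    (PX : Measure (Fin d → ℝ)) [IsProbabilityMeasure PX] (hsupp : PX (cube a d) = 1)
    {ν : ℝ} (hν0 : 0 ≤ ν) (hν1 : ν < 1) {CL : ℝ} (hCL : 0 < CL) :
    ∃ (C κ : ℝ) (Cw : ℕ), 0 < C ∧ 0 < κ ∧ 0 < Cw ∧ ∀ᶠ n : ℕ in atTop,
      ∃ (θ : ParamIdx d (Cw * ⌈maxWidthExp P hP n⌉₊) (Ldepth CL n) → ℝ) (G : Set (Fin d → ℝ)), MeasurableSet G ∧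
        PX Gᶜ ≤ ENNReal.ofReal (C / n) ∧ (∀ i, |θ i| ≤ κ) ∧
        ∀ x ∈ G, |netOfParams ν d (Cw * ⌈maxWidthExp P hP n⌉₊) (Ldepth CL n) θ x - f₀ x| ≤ C * maxRate P hP n := by
  obtain ⟨C, Cw, t, p, hC0, hC⟩ := lev_final ha hP hpos hF hCLip hf₀ PX hsupp
  set A := max a (2 * F) with hA
  have hA1 : 1 ≤ A := le_max_of_le_left ha
  have hn : 0 < 1 - ν ^ 2 := by nlinarith
  set c := 2 * (1 - ν ^ 2)⁻¹ + 1 with hc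
  have hc1 : 1 ≤ c := by rw [hc]; linarith [inv_pos.2 hn]
  set κ₀ := Real.exp (2 * (t + 1) * p / CL) with hκ₀
  have hκ1 : 1 ≤ κ₀ := Real.one_le_exp (by positivity)
  refine ⟨(C + 1) * (2 * A), κ₀ * c + κ₀ + 2 * A * c + A, 2 * (Cw + 1), by positivity, by positivity, by omega, ?_⟩
  have hlog : ∀ᶠ n : ℕ in atTop, 4 * (t + 1) / CL ≤ Real.log n := tendsto_log_nat.eventually_ge_atTop _
  filter_upwards [hC, hlog, eventually_ge_atTop 1] with n hn hl hn1
  obtain ⟨W, f, G, hGm, hGp, hW, hf, hf1, hf2⟩ := hn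
  have hn0 : (0:ℝ) < n := by exact_mod_cast hn1
  set m := ⌊CL * Real.log n / (t + 1)⌋₊ - 1 with hm
  have hx4 : 4 ≤ CL * Real.log n / (t + 1) := by
    rw [le_div_iff₀ (by positivity)]
    rw [div_le_iff₀ hCL] at hl; linarith
  have hfl : 4 ≤ ⌊CL * Real.log n / (t + 1)⌋₊ := Nat.le_floor (by exact_mod_cast hx4)
  have hm1 : (m:ℝ) + 1 ≤ CL * Real.log n / (t + 1) := by
    have h1 : m + 1 = ⌊CL * Real.log n / (t + 1)⌋₊ := by omega
    have h2 := Nat.floor_le (show 0 ≤ CL * Real.log n / (t + 1) by linarith)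
    rw [← h1] at h2; push_cast at h2; exact h2
  have hm2 : CL * Real.log n / (t + 1) / 2 ≤ m := by
    have h1 : m + 1 = ⌊CL * Real.log n / (t + 1)⌋₊ := by omega
    have h2 := Nat.lt_floor_add_one (CL * Real.log n / (t + 1))
    rw [← h1] at h2; push_cast at h2; linarith
  have hpow : (n:ℝ) ^ p ≤ κ₀ ^ m := by
    rw [hκ₀, ← Real.exp_nat_mul, ← Real.exp_log hn0, ← Real.exp_nat_mul]
    apply Real.exp_le_exp.2
    have e : (p:ℝ) * Real.log n = CL * Real.log n / (t + 1) / 2 * (2 * (t + 1) * p / CL) := by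
      field_simp
    rw [e]
    exact mul_le_mul_of_nonneg_right hm2 (by positivity)
  have hL : (t + 1) * (m + 1) ≤ Ldepth CL n := by
    unfold Ldepth
    have : (((t + 1) * (m + 1) : ℕ) : ℝ) ≤ ⌈CL * Real.log n⌉₊ := by
      refine le_trans ?_ (Nat.le_ceil _)
      push_cast
      rw [le_div_iff₀ (by positivity)] at hm1; linarith
    exact_mod_cast this
  have hL1 : 1 ≤ Ldepth CL n := le_trans (Nat.succ_le_of_lt (by positivity)) hL
  have hr := NN.reduce hκ1 (W := W + 1) m (by simp) (hf.mono hpow (Nat.le_succ W))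
  have hr2 := hr.pad hκ1 (by simp) (show (t + 1) * (m + 1) - 1 ≤ Ldepth CL n - 1 by omega)
  have hV := one_le_maxWidth hP (fun p hp => (hpos p hp).1) hn1
  have hWr : 2 * (W + 1) ≤ 2 * (Cw + 1) * ⌈maxWidthExp P hP n⌉₊ := by
    have h1 := Nat.le_ceil (maxWidthExp P hP n)
    have h2 : ((W + 1 : ℕ) : ℝ) ≤ ((Cw + 1) * ⌈maxWidthExp P hP n⌉₊ : ℕ) := by
      push_cast
      have := mul_le_mul_of_nonneg_left h1 (by positivity : (0:ℝ) ≤ Cw + 1)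
      linarith
    have h3 : W + 1 ≤ (Cw + 1) * ⌈maxWidthExp P hP n⌉₊ := by exact_mod_cast h2
    rw [mul_assoc 2]; omega
  obtain ⟨θ, h1, h2⟩ := leaky_params hν0 hν1 (by linarith : 0 ≤ κ₀) (show 2 * (1 - ν ^ 2)⁻¹ ≤ c by rw [hc]; linarith) hc1 hL1 (by omega) hWr hr2
    (by linarith : 0 ≤ A)
  refine ⟨θ, G, hGm, hGp.trans (ENNReal.ofReal_le_ofReal ?_), h1, ?_⟩
  · apply div_le_div_of_nonneg_right _ hn0.le
    nlinarith
  · intro x hx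
    have := hf2 x hx 0
    rw [h2]
    have e : 2 * A * f x 0 - A - f₀ x = 2 * A * (f x 0 - (f₀ x + A) / (2 * A)) := by field_simp; ring
    rw [e, abs_mul, abs_of_pos (by positivity)]
    have h3 := maxRate_nonneg hP n
    calc _ ≤ 2 * A * (C * maxRate P hP n) := by gcongr
      _ ≤ _ := by nlinarith [mul_nonneg (by linarith : 0 ≤ A) h3]


lemma lint_exp_le {X : Type*} [MeasurableSpace X] (PX : Measure X) [IsProbabilityMeasure PX] (U : X → ℝ)
    (hU : Measurable U) (b : ℝ) (h0 : ∀ x, 0 ≤ U x) (hb : ∀ x, U x ≤ b) :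
    ∫⁻ x, ENNReal.ofReal (Real.exp (U x)) ∂PX ≤ ENNReal.ofReal (Real.exp (Real.exp b * ∫ x, U x ∂PX)) := by
  have hUi : Integrable U PX := Integrable.of_bound hU.aestronglyMeasurable b (Eventually.of_forall fun x => by
    rw [Real.norm_eq_abs, abs_of_nonneg (h0 x)]; exact hb x)
  have hpt : ∀ x, Real.exp (U x) ≤ 1 + Real.exp b * U x := by
    intro x
    have h1 : 1 - U x ≤ Real.exp (-U x) := by have := Real.add_one_le_exp (-U x); linarith
    have h2 : Real.exp (U x) * Real.exp (-U x) = 1 := by rw [← Real.exp_add]; simp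
    have h3 : Real.exp (U x) * (1 - U x) ≤ 1 := (mul_le_mul_of_nonneg_left h1 (Real.exp_pos _).le).trans_eq h2
    have h4 : Real.exp (U x) * U x ≤ Real.exp b * U x := by
      gcongr; exact h0 x; exact hb x
    linarith
  calc _ ≤ ∫⁻ x, ENNReal.ofReal (1 + Real.exp b * U x) ∂PX := lintegral_mono fun x => ENNReal.ofReal_le_ofReal (hpt x)
    _ = ENNReal.ofReal (∫ x, (1 + Real.exp b * U x) ∂PX) := by
      rw [ofReal_integral_eq_lintegral_ofReal]
      · exact (integrable_const _).add (hUi.const_mul _)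
      · exact Eventually.of_forall fun x => by have := h0 x; positivity
    _ ≤ _ := by
      apply ENNReal.ofReal_le_ofReal
      rw [integral_add (f := fun _ => (1:ℝ)) (integrable_const _) (hUi.const_mul _), integral_const_mul]
      simp
      have := Real.add_one_le_exp (Real.exp b * ∫ x, U x ∂PX)
      linarith

lemma gpdf_ratio (m s k v y : ℝ) (hs : 0 < s) (hv : 0 < v) : gpdf m s y / gpdf k v y =
    Real.sqrt (v / s) * Real.exp ((1 / (2 * v) - 1 / (2 * s)) * (y - m) ^ 2 + (m - k) / v * (y - m) + (m - k) ^ 2 / (2 * v)) := by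
  unfold gpdf
  rw [mul_div_mul_comm, ← Real.exp_sub, inv_div_inv, ← Real.sqrt_div' _ (by positivity)]
  congr 2
  · field_simp
  · field_simp; ring

theorem gauss_chi (d : ℕ) (PX : Measure (Fin d → ℝ)) [IsProbabilityMeasure PX] (f₀ : (Fin d → ℝ) → ℝ) (hf : Measurable f₀)
    (F : ℝ) (hF1 : 1 ≤ F) (hfF : ∀ x, |f₀ x| ≤ F) (s : ℝ) (hs : 0 < s) :
    ∃ C : ℝ, 0 < C ∧ ∀ h : (Fin d → ℝ) → ℝ, Measurable h → (∀ x, |h x| ≤ F) → ∀ v t, s ≤ v → v ≤ s + t →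
      ∫⁻ z, (gratio f₀ s h v z)⁻¹ ∂(gaussRegLaw d PX f₀ (Real.toNNReal s)) ≤
        ENNReal.ofReal (Real.exp (C * (t ^ 2 + ∫ x, (h x - f₀ x) ^ 2 ∂PX))) := by
  set E := Real.exp (4 * F ^ 2 / s)
  refine ⟨1 / (2 * s ^ 2) + E / s, by positivity, ?_⟩
  intro h hh hhF v t hv hvt
  have hv0 : 0 < v := by linarith
  have hb : ∀ x, (f₀ x - h x) ^ 2 ≤ 4 * F ^ 2 := by
    intro x; have := abs_le.1 (hhF x); have := abs_le.1 (hfF x); nlinarith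
  have hinv : ∀ z, (gratio f₀ s h v z)⁻¹ = ENNReal.ofReal (Real.sqrt (v / s)) * ENNReal.ofReal (Real.exp
      ((1 / (2 * v) - 1 / (2 * s)) * (z.2 - f₀ z.1) ^ 2 + (f₀ z.1 - h z.1) / v * (z.2 - f₀ z.1) + (f₀ z.1 - h z.1) ^ 2 / (2 * v))) := by
    intro z
    unfold gratio
    rw [← ENNReal.ofReal_inv_of_pos (div_pos (gpdf_pos _ _ _ hv0) (gpdf_pos _ _ _ hs)), inv_div, gpdf_ratio _ _ _ _ _ hs hv0,
      ENNReal.ofReal_mul (by positivity)]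
  simp_rw [hinv]
  rw [lintegral_const_mul' _ _ ENNReal.ofReal_ne_top, lintegral_gaussRegLaw d PX f₀ hf s hs _ (by fun_prop)]
  have hsv : s / v ≤ 1 := (div_le_one hv0).2 hv
  have hα : 2 * (1 / (2 * v) - 1 / (2 * s)) * s = s / v - 1 := by field_simp
  rw [lintegral_quad PX f₀ s hs (fun z => (1 / (2 * v) - 1 / (2 * s)) * (z.2 - f₀ z.1) ^ 2 + (f₀ z.1 - h z.1) / v * (z.2 - f₀ z.1) + (f₀ z.1 - h z.1) ^ 2 / (2 * v))
    (1 / (2 * v) - 1 / (2 * s)) (by rw [hα]; linarith) (fun x => (f₀ x - h x) / v) (fun x => (f₀ x - h x) ^ 2 / (2 * v)) (fun x y => rfl)]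
  rw [hα]
  have e1 : (1:ℝ) - (s / v - 1) = 2 - s / v := by ring
  rw [e1]
  have hle : ∀ x, (Real.sqrt (2 - s / v))⁻¹ * Real.exp (((f₀ x - h x) / v) ^ 2 * s / (2 * (2 - s / v)) + (f₀ x - h x) ^ 2 / (2 * v))
      ≤ (Real.sqrt (2 - s / v))⁻¹ * Real.exp ((f₀ x - h x) ^ 2 / s) := by
    intro x
    gcongr
    have hD : 0 ≤ (f₀ x - h x) ^ 2 := sq_nonneg _
    have a1 : ((f₀ x - h x) / v) ^ 2 * s / (2 * (2 - s / v)) ≤ (f₀ x - h x) ^ 2 / (2 * s) := by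
      calc _ ≤ ((f₀ x - h x) / v) ^ 2 * s / (2 * 1) := by gcongr; linarith
        _ ≤ ((f₀ x - h x) / s) ^ 2 * s / (2 * 1) := by rw [div_pow, div_pow]; gcongr
        _ = _ := by field_simp
    have a2 : (f₀ x - h x) ^ 2 / (2 * v) ≤ (f₀ x - h x) ^ 2 / (2 * s) := by gcongr
    have a3 : (f₀ x - h x) ^ 2 / s = (f₀ x - h x) ^ 2 / (2 * s) + (f₀ x - h x) ^ 2 / (2 * s) := by field_simp; ring
    linarith
  have hsq : Real.sqrt (v / s) * (Real.sqrt (2 - s / v))⁻¹ ≤ Real.exp (1 / (2 * s ^ 2) * t ^ 2) := by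
    rw [← Real.sqrt_inv, ← Real.sqrt_mul (by positivity)]
    apply Real.sqrt_le_iff.2 ⟨(Real.exp_pos _).le, ?_⟩
    rw [← Real.exp_nat_mul]
    have h2 := Real.add_one_le_exp (((2:ℕ):ℝ) * (1 / (2 * s ^ 2) * t ^ 2))
    refine le_trans ?_ h2
    rw [← div_eq_mul_inv, div_le_iff₀ (by linarith)]
    push_cast
    have e3 : v / s = 1 + (v - s) / s := by field_simp; ring
    have e4 : s / v = 1 - (v - s) / v := by field_simp; ring
    have e5 : 2 * (1 / (2 * s ^ 2) * t ^ 2) = (t / s) ^ 2 := by field_simp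
    rw [e3, e4, e5]
    have e6 : (v - s) ^ 2 / (s * v) = (v - s) / s - (v - s) / v := by field_simp
    have e7 : (v - s) ^ 2 / (s * v) ≤ (t / s) ^ 2 := by
      rw [div_pow]
      have : (v - s) ^ 2 ≤ t ^ 2 := by nlinarith
      have : s ^ 2 ≤ s * v := by nlinarith
      gcongr
    have e8 : 0 ≤ (v - s) / v := div_nonneg (by linarith) hv0.le
    nlinarith [sq_nonneg (t / s)]
  calc _ ≤ ENNReal.ofReal (Real.sqrt (v / s)) * ∫⁻ x, ENNReal.ofReal ((Real.sqrt (2 - s / v))⁻¹) * ENNReal.ofReal (Real.exp ((f₀ x - h x) ^ 2 / s)) ∂PX := by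
        gcongr with x
        rw [← ENNReal.ofReal_mul (by positivity)]
        exact ENNReal.ofReal_le_ofReal (hle x)
    _ ≤ ENNReal.ofReal (Real.sqrt (v / s)) * (ENNReal.ofReal ((Real.sqrt (2 - s / v))⁻¹) * ENNReal.ofReal (Real.exp (E * ∫ x, (f₀ x - h x) ^ 2 / s ∂PX))) := by
        rw [lintegral_const_mul' _ _ ENNReal.ofReal_ne_top]
        gcongr
        exact lint_exp_le PX (fun x => (f₀ x - h x) ^ 2 / s) (by fun_prop) _ (fun x => by positivity) (fun x => by gcongr; exact hb x)
    _ = ENNReal.ofReal ((Real.sqrt (v / s) * (Real.sqrt (2 - s / v))⁻¹) * Real.exp (E * ∫ x, (f₀ x - h x) ^ 2 / s ∂PX)) := by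
        rw [ENNReal.ofReal_mul (by positivity), ENNReal.ofReal_mul (by positivity), mul_assoc]
    _ ≤ _ := by
        apply ENNReal.ofReal_le_ofReal
        have e9 : ∫ x, (f₀ x - h x) ^ 2 / s ∂PX = (∫ x, (h x - f₀ x) ^ 2 ∂PX) / s := by
          rw [← integral_div]; congr 1; ext x; ring
        rw [e9]
        calc _ ≤ Real.exp (1 / (2 * s ^ 2) * t ^ 2) * Real.exp (E * ((∫ x, (h x - f₀ x) ^ 2 ∂PX) / s)) := by gcongr
          _ ≤ _ := by
            rw [← Real.exp_add]
            apply Real.exp_le_exp.2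
            have i0 : 0 ≤ ∫ x, (h x - f₀ x) ^ 2 ∂PX := integral_nonneg fun x => sq_nonneg _
            have : E * ((∫ x, (h x - f₀ x) ^ 2 ∂PX) / s) = E / s * ∫ x, (h x - f₀ x) ^ 2 ∂PX := by ring
            rw [this]
            have p1 : 0 ≤ 1 / (2 * s ^ 2) * ∫ x, (h x - f₀ x) ^ 2 ∂PX := by positivity
            have p2 : 0 ≤ E / s * t ^ 2 := by positivity
            nlinarith


lemma sigmoid_pos' (z : ℝ) : 0 < sigmoid z := by unfold sigmoid; positivity
lemma sigmoid_lt_one' (z : ℝ) : sigmoid z < 1 := by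
  unfold sigmoid; apply inv_lt_one_of_one_lt₀; linarith [Real.exp_pos (-z)]
lemma sigmoid_mono' {a b : ℝ} (h : a ≤ b) : sigmoid a ≤ sigmoid b := by
  unfold sigmoid; gcongr
lemma sigmoid_neg' (z : ℝ) : sigmoid (-z) = 1 - sigmoid z := by
  unfold sigmoid; rw [neg_neg, Real.exp_neg]; have := Real.exp_pos z; field_simp; ring
lemma sigmoid_sub_le {a b : ℝ} (h : b ≤ a) : sigmoid a - sigmoid b ≤ a - b := by
  unfold sigmoid
  have ha := Real.exp_pos (-a); have hb := Real.exp_pos (-b)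
  rw [inv_sub_inv (by positivity) (by positivity), div_le_iff₀ (by positivity)]
  have h1 := Real.add_one_le_exp (-(a - b))
  have h2 : Real.exp (-a) = Real.exp (-b) * Real.exp (-(a - b)) := by rw [← Real.exp_add]; congr 1; ring
  have h3 : Real.exp (-b) - Real.exp (-a) ≤ Real.exp (-b) * (a - b) := by rw [h2]; nlinarith
  have h4 : 0 ≤ (a - b) * (1 + Real.exp (-a) + Real.exp (-a) * Real.exp (-b)) := mul_nonneg (by linarith) (by positivity)
  nlinarith
lemma sigmoid_lip (a b : ℝ) : |sigmoid a - sigmoid b| ≤ |a - b| := by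
  rcases le_total b a with h | h
  · rw [abs_of_nonneg (show 0 ≤ sigmoid a - sigmoid b by linarith [sigmoid_mono' h]), abs_of_nonneg (show 0 ≤ a - b by linarith)]; exact sigmoid_sub_le h
  · rw [abs_sub_comm, abs_sub_comm a, abs_of_nonneg (show 0 ≤ sigmoid b - sigmoid a by linarith [sigmoid_mono' h]), abs_of_nonneg (show 0 ≤ b - a by linarith)]; exact sigmoid_sub_le h
lemma continuous_sigmoid' : Continuous sigmoid := by
  unfold sigmoid; exact Continuous.inv₀ (by fun_prop) fun x => by positivity

/-- Bernoulli density -/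
def bdens (p y : ℝ) : ℝ := p ^ y * (1 - p) ^ (1 - y)
lemma bdens_pos {p : ℝ} (h0 : 0 < p) (h1 : p < 1) (y : ℝ) : 0 < bdens p y :=
  mul_pos (Real.rpow_pos_of_pos h0 _) (Real.rpow_pos_of_pos (by linarith) _)
lemma bdens_one (p : ℝ) : bdens p 1 = p := by simp [bdens]
lemma bdens_zero (p : ℝ) : bdens p 0 = 1 - p := by simp [bdens]

def bratio {d : ℕ} (p0 p1 : (Fin d → ℝ) → ℝ) (z : (Fin d → ℝ) × ℝ) : ℝ≥0∞ :=
  ENNReal.ofReal (bdens (p1 z.1) z.2 / bdens (p0 z.1) z.2)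

lemma measurable_bdens : Measurable (fun q : ℝ × ℝ => bdens q.1 q.2) := by unfold bdens; fun_prop

lemma measurable_bratio {d : ℕ} {p0 p1 : (Fin d → ℝ) → ℝ} (h0 : Measurable p0) (h1 : Measurable p1) : Measurable (bratio p0 p1) := by
  unfold bratio bdens; fun_prop

lemma lintegral_logisticLaw (d : ℕ) (PX : Measure (Fin d → ℝ)) [IsProbabilityMeasure PX]
    (f₀ : (Fin d → ℝ) → ℝ) (hf : Measurable f₀) (G : (Fin d → ℝ) × ℝ → ℝ≥0∞) (hG : Measurable G) :
    ∫⁻ z, G z ∂(logisticLaw d PX f₀) =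
      ∫⁻ x, (ENNReal.ofReal (sigmoid (f₀ x)) * G (x, 1) + ENNReal.ofReal (1 - sigmoid (f₀ x)) * G (x, 0)) ∂PX := by
  have hs : Measurable fun x => sigmoid (f₀ x) := continuous_sigmoid'.measurable.comp hf
  unfold logisticLaw
  rw [lintegral_pair PX (fun x => bern (sigmoid (f₀ x))) _ G hG]
  · congr 1; ext x
    unfold bern
    rw [lintegral_add_measure, lintegral_smul_measure, lintegral_smul_measure, lintegral_dirac' _ (by fun_prop), lintegral_dirac' _ (by fun_prop)]
    rfl
  · intro t ht
    have : (fun x => bern (sigmoid (f₀ x)) {y | (x, y) ∈ t}) = fun x => ENNReal.ofReal (sigmoid (f₀ x)) * t.indicator 1 (x, (1:ℝ)) +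
        ENNReal.ofReal (1 - sigmoid (f₀ x)) * t.indicator 1 (x, (0:ℝ)) := by
      ext x
      unfold bern
      have hm : MeasurableSet {y | (x, y) ∈ t} := ht.preimage measurable_prodMk_left
      rw [Measure.add_apply, Measure.smul_apply, Measure.smul_apply, Measure.dirac_apply' _ hm, Measure.dirac_apply' _ hm]
      rfl
    rw [this]
    have h1 : Measurable (t.indicator (1 : (Fin d → ℝ) × ℝ → ℝ≥0∞)) := measurable_one.indicator ht
    have h2 : Measurable fun x : Fin d → ℝ => t.indicator (1 : (Fin d → ℝ) × ℝ → ℝ≥0∞) (x, (1:ℝ)) := h1.comp (by fun_prop)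
    have h3 : Measurable fun x : Fin d → ℝ => t.indicator (1 : (Fin d → ℝ) × ℝ → ℝ≥0∞) (x, (0:ℝ)) := h1.comp (by fun_prop)
    fun_prop

lemma lintegral_bratio_mul {d : ℕ} (PX : Measure (Fin d → ℝ)) [IsProbabilityMeasure PX]
    (f₀ : (Fin d → ℝ) → ℝ) (hf : Measurable f₀) (p1 : (Fin d → ℝ) → ℝ) (hp1 : Measurable p1)
    (G : (Fin d → ℝ) × ℝ → ℝ≥0∞) (hG : Measurable G) :
    ∫⁻ z, bratio (fun x => sigmoid (f₀ x)) p1 z * G z ∂(logisticLaw d PX f₀) =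
      ∫⁻ x, (ENNReal.ofReal (p1 x) * G (x, 1) + ENNReal.ofReal (1 - p1 x) * G (x, 0)) ∂PX := by
  have hs : Measurable fun x => sigmoid (f₀ x) := continuous_sigmoid'.measurable.comp hf
  have hbm := measurable_bratio hs hp1
  rw [lintegral_logisticLaw d PX f₀ hf (fun z => bratio (fun x => sigmoid (f₀ x)) p1 z * G z) (by fun_prop)]
  congr 1; ext x
  have h0 := sigmoid_pos' (f₀ x)
  have h1 := sigmoid_lt_one' (f₀ x)
  simp only [bratio, bdens_one, bdens_zero, ← mul_assoc]
  rw [← ENNReal.ofReal_mul h0.le, ← ENNReal.ofReal_mul (by linarith), mul_div_cancel₀ _ h0.ne', mul_div_cancel₀ _ (by linarith)]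

lemma lintegral_bratio_le {d : ℕ} (PX : Measure (Fin d → ℝ)) [IsProbabilityMeasure PX]
    (f₀ : (Fin d → ℝ) → ℝ) (hf : Measurable f₀) (p1 : (Fin d → ℝ) → ℝ) (hp1 : Measurable p1) (h0 : ∀ x, 0 ≤ p1 x) (h1 : ∀ x, p1 x ≤ 1) :
    ∫⁻ z, bratio (fun x => sigmoid (f₀ x)) p1 z ∂(logisticLaw d PX f₀) ≤ 1 := by
  have := lintegral_bratio_mul PX f₀ hf p1 hp1 (fun _ => 1) measurable_const
  simp only [mul_one] at this
  rw [this]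
  have : ∀ x, ENNReal.ofReal (p1 x) + ENNReal.ofReal (1 - p1 x) = 1 := fun x => by
    rw [← ENNReal.ofReal_add (h0 x) (by linarith [h1 x])]; simp
  simp [this]

lemma bern_mgf {p t : ℝ} (h0 : 0 ≤ p) (h1 : p ≤ 1) (ht : |t| ≤ 1) (c : ℝ) :
    ENNReal.ofReal p * ENNReal.ofReal (Real.exp (t * (1 - p) + c)) + ENNReal.ofReal (1 - p) * ENNReal.ofReal (Real.exp (t * (0 - p) + c))
      ≤ ENNReal.ofReal (Real.exp (t ^ 2 * 2 / 2 + c)) := by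
  rw [← ENNReal.ofReal_mul h0, ← ENNReal.ofReal_mul (by linarith), ← ENNReal.ofReal_add (by positivity) (mul_nonneg (by linarith) (by positivity))]
  apply ENNReal.ofReal_le_ofReal
  rw [Real.exp_add, Real.exp_add, Real.exp_add]
  have ⟨ht1, ht2⟩ := abs_le.1 ht
  have a1 := exp_quad_le (u := t * (1 - p)) (by nlinarith)
  have a2 := exp_quad_le (u := t * (0 - p)) (by nlinarith)
  have a3 := Real.add_one_le_exp (t ^ 2 * 2 / 2)
  have b1 := mul_le_mul_of_nonneg_left a1 h0
  have b2 := mul_le_mul_of_nonneg_left a2 (by linarith : 0 ≤ 1 - p)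
  have b3 : p * (1 + t * (1 - p) + (t * (1 - p)) ^ 2) + (1 - p) * (1 + t * (0 - p) + (t * (0 - p)) ^ 2) = 1 + t ^ 2 * (p * (1 - p)) := by ring
  have b4 : t ^ 2 * (p * (1 - p)) ≤ t ^ 2 := by
    have : p * (1 - p) ≤ 1 := by nlinarith
    nlinarith [sq_nonneg t]
  have b5 : p * Real.exp (t * (1 - p)) + (1 - p) * Real.exp (t * (0 - p)) ≤ Real.exp (t ^ 2 * 2 / 2) := by linarith
  have := mul_le_mul_of_nonneg_right b5 (Real.exp_pos c).le
  linarith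

theorem bern_tests (d : ℕ) (PX : Measure (Fin d → ℝ)) [IsProbabilityMeasure PX] (f₀ : (Fin d → ℝ) → ℝ) (hf : Measurable f₀) :
    ∃ c : ℝ, 0 < c ∧ ∀ η : ℝ, 0 < η → ∀ g1 : (Fin d → ℝ) → ℝ, Measurable g1 → (∀ x, 0 ≤ g1 x) → (∀ x, g1 x ≤ 1) →
      3 / 4 * η ^ 2 ≤ ∫ x, (g1 x - sigmoid (f₀ x)) ^ 2 ∂PX →
       ∃ T : (Fin d → ℝ) × ℝ → ℝ, Measurable T ∧
        ∫⁻ z, ENNReal.ofReal (Real.exp (T z)) ∂(logisticLaw d PX f₀) ≤ ENNReal.ofReal (Real.exp (-(c * η ^ 2))) ∧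
        ∀ p1 : (Fin d → ℝ) → ℝ, Measurable p1 → (∀ x, 0 ≤ p1 x) → (∀ x, p1 x ≤ 1) → ∫ x, (p1 x - g1 x) ^ 2 ∂PX ≤ (η / 16) ^ 2 →
          ∫⁻ z, bratio (fun x => sigmoid (f₀ x)) p1 z * (ENNReal.ofReal (Real.exp (T z)))⁻¹ ∂(logisticLaw d PX f₀) ≤ ENNReal.ofReal (Real.exp (-(c * η ^ 2))) := by
  refine ⟨1 / 512, by norm_num, ?_⟩
  intro η hη g1 hg1 hg10 hg11 hsep
  have hs : Measurable fun x => sigmoid (f₀ x) := continuous_sigmoid'.measurable.comp hf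
  set p0 : (Fin d → ℝ) → ℝ := fun x => sigmoid (f₀ x) with hp0
  have h00 : ∀ x, 0 ≤ p0 x := fun x => (sigmoid_pos' _).le
  have h01 : ∀ x, p0 x ≤ 1 := fun x => (sigmoid_lt_one' _).le
  have hD1 : ∀ x, |g1 x - p0 x| ≤ 1 := fun x => abs_le.2 ⟨by linarith [hg10 x, h01 x], by linarith [hg11 x, h00 x]⟩
  have hlD : ∀ x, |1 / 16 * (g1 x - p0 x)| ≤ 1 := fun x => by
    rw [abs_mul, abs_of_pos (by norm_num : (0:ℝ) < 1 / 16)]; linarith [hD1 x]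
  refine ⟨fun z => 1 / 16 * (z.2 - (p0 z.1 + g1 z.1) / 2) * (g1 z.1 - p0 z.1), by fun_prop, ?_, ?_⟩
  · rw [lintegral_logisticLaw d PX f₀ hf _ (by fun_prop)]
    calc _ ≤ ∫⁻ x, ENNReal.ofReal (Real.exp ((1 / 16 * (g1 x - p0 x)) ^ 2 * 2 / 2 - 1 / 16 * (g1 x - p0 x) ^ 2 / 2)) ∂PX := by
          apply lintegral_mono
          intro x
          have := bern_mgf (h00 x) (h01 x) (hlD x) (-(1 / 16 * (g1 x - p0 x) ^ 2 / 2))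
          rw [← sub_eq_add_neg] at this
          refine le_trans (le_of_eq ?_) this
          dsimp only
          congr 4 <;> ring
      _ ≤ _ := reg_type1 PX (fun x => g1 x - p0 x) (by fun_prop) 1 (1 / 16) 2 (fun x => by linarith [hD1 x]) (by norm_num) (by norm_num) (by norm_num) (by norm_num)
      _ ≤ _ := by
          apply ENNReal.ofReal_le_ofReal
          apply Real.exp_le_exp.2
          nlinarith [sq_nonneg η]
  · intro p1 hp1 hp10 hp11 hdist
    have hE1 : ∀ x, |p1 x - g1 x| ≤ 1 := fun x => abs_le.2 ⟨by linarith [hg11 x, hp10 x], by linarith [hp11 x, hg10 x]⟩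
    simp_rw [ofReal_exp_inv]
    rw [lintegral_bratio_mul PX f₀ hf p1 hp1 _ (by fun_prop)]
    calc _ ≤ ∫⁻ x, ENNReal.ofReal (Real.exp ((1 / 16 * (g1 x - p0 x)) ^ 2 * 2 / 2 - 1 / 16 * (g1 x - p0 x) ^ 2 / 2 - 1 / 16 * (p1 x - g1 x) * (g1 x - p0 x))) ∂PX := by
          apply lintegral_mono
          intro x
          have := bern_mgf (t := -(1 / 16 * (g1 x - p0 x))) (hp10 x) (hp11 x) (by rw [abs_neg]; exact hlD x) (-(1 / 16 * (g1 x - p0 x) ^ 2 / 2) - 1 / 16 * (p1 x - g1 x) * (g1 x - p0 x))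
          refine le_trans (le_of_eq ?_) (this.trans (le_of_eq ?_))
          · dsimp only
            congr 4 <;> ring
          · dsimp only
            congr 2; ring
      _ ≤ _ := reg_type2 PX (fun x => g1 x - p0 x) (fun x => p1 x - g1 x) (by fun_prop) (by fun_prop) 1 (1 / 16) 2 (fun x => by linarith [hD1 x]) (fun x => by linarith [hE1 x]) (by norm_num) (by norm_num) (by norm_num) (by norm_num)
      _ ≤ _ := by
          apply ENNReal.ofReal_le_ofReal
          apply Real.exp_le_exp.2
          nlinarith [sq_nonneg η]

theorem bern_chi (d : ℕ) (PX : Measure (Fin d → ℝ)) [IsProbabilityMeasure PX] (f₀ : (Fin d → ℝ) → ℝ) (hf : Measurable f₀)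
    (F : ℝ) (hF1 : 1 ≤ F) (hfF : ∀ x, |f₀ x| ≤ F) :
    ∃ C : ℝ, 0 < C ∧ ∀ h : (Fin d → ℝ) → ℝ, Measurable h → (∀ x, |h x| ≤ F) →
      ∫⁻ z, (bratio (fun x => sigmoid (f₀ x)) (fun x => sigmoid (h x)) z)⁻¹ ∂(logisticLaw d PX f₀) ≤
        ENNReal.ofReal (Real.exp (C * ∫ x, (h x - f₀ x) ^ 2 ∂PX)) := by
  have hs : Measurable fun x => sigmoid (f₀ x) := continuous_sigmoid'.measurable.comp hf
  set b := sigmoid (-F) with hb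
  have hb0 : 0 < b := sigmoid_pos' _
  refine ⟨1 / b ^ 2, by positivity, ?_⟩
  intro h hh hhF
  have hsh : Measurable fun x => sigmoid (h x) := continuous_sigmoid'.measurable.comp hh
  have hbm := measurable_bratio hs hsh
  rw [lintegral_logisticLaw d PX f₀ hf (fun z => (bratio (fun x => sigmoid (f₀ x)) (fun x => sigmoid (h x)) z)⁻¹) (by fun_prop)]
  have hbd : ∀ x, (h x - f₀ x) ^ 2 ≤ 4 * F ^ 2 := by
    intro x; have := abs_le.1 (hhF x); have := abs_le.1 (hfF x); nlinarith
  have hintg : Integrable (fun x => (h x - f₀ x) ^ 2) PX :=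
    Integrable.of_bound (by fun_prop) (4 * F ^ 2) (Eventually.of_forall fun x => by
      rw [Real.norm_eq_abs, abs_of_nonneg (sq_nonneg _)]; exact hbd x)
  calc _ ≤ ∫⁻ x, ENNReal.ofReal (1 + 1 / b ^ 2 * (h x - f₀ x) ^ 2) ∂PX := by
        apply lintegral_mono
        intro x
        have p0 := sigmoid_pos' (f₀ x); have p1 := sigmoid_lt_one' (f₀ x)
        have q0 := sigmoid_pos' (h x); have q1 := sigmoid_lt_one' (h x)
        have qb : b ≤ sigmoid (h x) := sigmoid_mono' (by linarith [(abs_le.1 (hhF x)).1])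
        have qb2 : b ≤ 1 - sigmoid (h x) := by rw [← sigmoid_neg']; exact sigmoid_mono' (by linarith [(abs_le.1 (hhF x)).2])
        have hl := sigmoid_lip (h x) (f₀ x)
        have hl2 : (sigmoid (h x) - sigmoid (f₀ x)) ^ 2 ≤ (h x - f₀ x) ^ 2 := sq_le_sq.2 hl
        simp only [bratio, bdens_one, bdens_zero]
        set p := sigmoid (f₀ x)
        set r := sigmoid (h x)
        have hp1 : 0 < 1 - p := by linarith
        have hr1 : 0 < 1 - r := by linarith
        rw [← ENNReal.ofReal_inv_of_pos (by positivity), ← ENNReal.ofReal_inv_of_pos (by positivity),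
          ← ENNReal.ofReal_mul p0.le, ← ENNReal.ofReal_mul hp1.le, ← ENNReal.ofReal_add (by positivity) (by positivity)]
        apply ENNReal.ofReal_le_ofReal
        have e : p * (r / p)⁻¹ + (1 - p) * ((1 - r) / (1 - p))⁻¹ = 1 + 1 / (r * (1 - r)) * (r - p) ^ 2 := by
          field_simp; ring
        rw [e]
        have : b ^ 2 ≤ r * (1 - r) := by rw [sq]; gcongr
        gcongr
    _ = ENNReal.ofReal (∫ x, (1 + 1 / b ^ 2 * (h x - f₀ x) ^ 2) ∂PX) := by
      rw [ofReal_integral_eq_lintegral_ofReal]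
      · exact (integrable_const _).add (hintg.const_mul _)
      · exact Eventually.of_forall fun x => by positivity
    _ ≤ _ := by
      apply ENNReal.ofReal_le_ofReal
      rw [integral_add (f := fun _ => (1:ℝ)) (integrable_const _) (hintg.const_mul _), integral_const_mul]
      simp only [integral_const, probReal_univ, smul_eq_mul, mul_one]
      have := Real.add_one_le_exp (1 / b ^ 2 * ∫ x, (h x - f₀ x) ^ 2 ∂PX)
      linarith


lemma exp_neg_le_half_pow {l : ℝ} (hl : 1 ≤ l) (r : ℕ) : Real.exp (-(l * r)) ≤ (1 / 2) ^ r := by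
  rw [show -(l * (r:ℝ)) = r * (-l) by ring, Real.exp_nat_mul]
  gcongr
  calc Real.exp (-l) ≤ Real.exp (-1) := by gcongr
    _ ≤ 1 / 2 := by
      rw [Real.exp_neg, one_div]; apply inv_anti₀ (by norm_num); linarith [Real.add_one_le_exp 1]

lemma tsum_half : ∑' r : ℕ, (if r = 0 then (0:ℝ≥0∞) else ENNReal.ofReal ((1 / 2) ^ r)) ≤ 1 := by
  rw [tsum_eq_zero_add' ENNReal.summable]
  simp only [if_true, zero_add, Nat.succ_ne_zero, if_false]
  have : ∀ r : ℕ, ENNReal.ofReal ((1 / 2) ^ (r + 1)) = (2⁻¹ : ℝ≥0∞) ^ (r + 1) := by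
    intro r
    rw [ENNReal.ofReal_pow (by norm_num), one_div, ENNReal.ofReal_inv_of_pos (by norm_num)]
    simp
  simp only [this]
  rw [ENNReal.tsum_geometric_add_one, ENNReal.one_sub_inv_two, inv_inv]
  rw [ENNReal.inv_mul_cancel (by norm_num) (by norm_num)]

lemma widthWeight_tail {n : ℕ} (hl : 1 ≤ Real.log n) (R : ℕ) :
    ∑' r, (if r ≤ R then 0 else widthWeight n r) ≤ ENNReal.ofReal (Real.exp (-(Real.log n ^ 5 * (R:ℝ) ^ 2))) := by
  have hl5 : 1 ≤ Real.log n ^ 5 := one_le_pow₀ hl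
  calc ∑' r, (if r ≤ R then 0 else widthWeight n r) ≤
      ∑' r : ℕ, ENNReal.ofReal (Real.exp (-(Real.log n ^ 5 * (R:ℝ) ^ 2))) * (if r = 0 then (0:ℝ≥0∞) else ENNReal.ofReal ((1 / 2) ^ r)) := by
        apply ENNReal.tsum_le_tsum
        intro r
        by_cases h : r ≤ R
        · simp [h]
        · have h0 : r ≠ 0 := by omega
          simp only [h, h0, if_false, widthWeight]
          rw [← ENNReal.ofReal_mul (by positivity)]
          apply ENNReal.ofReal_le_ofReal
          calc Real.exp (-(Real.log n) ^ 5 * (r : ℝ) ^ 2) ≤ Real.exp (-(Real.log n ^ 5 * (R:ℝ) ^ 2)) * Real.exp (-(Real.log n ^ 5 * r)) := by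
                rw [← Real.exp_add]
                apply Real.exp_le_exp.2
                have : (R:ℝ) + 1 ≤ r := by exact_mod_cast (by omega : R + 1 ≤ r)
                have h2 : (R:ℝ) ^ 2 + r ≤ (r:ℝ) ^ 2 := by nlinarith [Nat.cast_nonneg (α := ℝ) R]
                nlinarith
            _ ≤ _ := by gcongr; exact exp_neg_le_half_pow hl5 r
    _ ≤ _ := by
      rw [ENNReal.tsum_mul_left]
      calc _ ≤ ENNReal.ofReal (Real.exp (-(Real.log n ^ 5 * (R:ℝ) ^ 2))) * 1 := by gcongr; exact tsum_half
        _ = _ := mul_one _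

lemma widthWeight_sum {n : ℕ} (hl : 1 ≤ Real.log n) : ∑' r, widthWeight n r ≤ 1 := by
  have := widthWeight_tail hl 0
  refine le_trans ?_ (this.trans ?_)
  · apply ENNReal.tsum_le_tsum
    intro r
    by_cases h : r = 0
    · simp [h, widthWeight]
    · simp [h]
  · simp

theorem conc {Z : Type*} [MeasurableSpace Z] (μ0 : Measure Z) [IsProbabilityMeasure μ0]
    (A : ℕ → ℕ → Type) [∀ n r, MeasurableSpace (A n r)] (Pr : ∀ n r, Measure (A n r)) [∀ n r, IsProbabilityMeasure (Pr n r)]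
    (ρ : ∀ n r, A n r → Z → ℝ≥0∞) (hρ : ∀ n r, Measurable (Function.uncurry (ρ n r)))
    (hρ1 : ∀ n r p, ∫⁻ z, ρ n r p z ∂μ0 ≤ 1)
    (Bad : ∀ n r, Set (A n r))
    (W x m : ℕ → ℝ) (hW : ∀ᶠ n in atTop, 1 ≤ W n) (γ : ℝ) (hγ : 5 / 2 < γ)
    (hx : ∀ᶠ n : ℕ in atTop, x n = W n ^ 2 * Real.log n ^ (2 * γ)) (hm : Tendsto m atTop atTop)
    (htest : ∀ K : ℝ, 0 < K → ∀ᶠ n : ℕ in atTop, ∃ (J : Finset (Z → ℝ≥0∞)) (e : ℝ≥0∞),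
      (∀ T ∈ J, Measurable T) ∧ (∀ T ∈ J, ∀ z, T z ≠ ∞) ∧ (J.card : ℝ) ≤ Real.exp (3 * x n) ∧
      e ^ n ≤ ENNReal.ofReal (Real.exp (-(m n * x n))) ∧ (∀ T ∈ J, ∫⁻ z, T z ∂μ0 ≤ e) ∧
      ∀ r : ℕ, r ≠ 0 → (r:ℝ) ≤ K * W n * Real.log n ^ (γ - 5 / 2) → ∀ p ∈ Bad n r,
        (∃ T ∈ J, ∫⁻ z, ρ n r p z * (T z)⁻¹ ∂μ0 ≤ e) ∨ ∀ z, ρ n r p z = 0)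
    (Cw : ℕ) (hCw : 0 < Cw) (C' : ℝ) (hC' : 0 < C')
    (hmass : ∀ᶠ n : ℕ in atTop, ∃ (B : Set (A n (Cw * ⌈W n⌉₊))) (χ : ℝ≥0∞), MeasurableSet B ∧
      (∀ p ∈ B, ∀ z, ρ n _ p z ≠ 0 ∧ ρ n _ p z ≠ ∞) ∧ (∀ p ∈ B, ∫⁻ z, (ρ n _ p z)⁻¹ ∂μ0 ≤ χ) ∧
      χ ≠ 0 ∧ χ ≠ ∞ ∧ χ ^ n ≤ ENNReal.ofReal (Real.exp (C' * x n)) ∧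
      ENNReal.ofReal (Real.exp (-(C' * x n))) ≤ Pr n _ B) (δ : ℝ) (hδ : 0 < δ) :
    Tendsto (fun n : ℕ => Measure.pi (fun _ : Fin n => μ0) {D | ENNReal.ofReal δ <
        (∑' r, widthWeight n r * ∫⁻ p in Bad n r, ∏ i, ρ n r p (D i) ∂(Pr n r)) /
        (∑' r, widthWeight n r * ∫⁻ p, ∏ i, ρ n r p (D i) ∂(Pr n r))}) atTop (nhds 0) := by
  set C2 : ℝ := 1 + 2 * C' + 4 * (Cw:ℝ) ^ 2 with hC2
  have hC2p : 0 < C2 := by positivity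
  obtain ⟨K, hK, hKC⟩ : ∃ K : ℝ, 1 ≤ K ∧ C2 + 1 ≤ K ^ 2 / 4 := ⟨4 * (C2 + 1), by linarith, by nlinarith⟩
  have hlog := tendsto_log_nat
  have hxt : Tendsto x atTop atTop := by
    apply tendsto_atTop_mono' atTop _ hlog
    filter_upwards [hW, hx, hlog.eventually_ge_atTop 1] with n hW hx hl
    rw [hx]
    have : Real.log n ≤ Real.log n ^ (2 * γ) := by
      conv_lhs => rw [← Real.rpow_one (Real.log n)]
      exact Real.rpow_le_rpow_of_exponent_le hl (by linarith)
    have hW2 : 1 ≤ W n ^ 2 := one_le_pow₀ hW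
    nlinarith
  have key : ∀ᶠ n : ℕ in atTop, Measure.pi (fun _ : Fin n => μ0) {D | ENNReal.ofReal δ <
        (∑' r, widthWeight n r * ∫⁻ p in Bad n r, ∏ i, ρ n r p (D i) ∂(Pr n r)) /
        (∑' r, widthWeight n r * ∫⁻ p, ∏ i, ρ n r p (D i) ∂(Pr n r))} ≤ ENNReal.ofReal ((2 + 2 / δ) * Real.exp (-x n)) := by
    filter_upwards [hW, hx, hlog.eventually_ge_atTop 1, htest K (by linarith), hmass, hm.eventually_ge_atTop (C2 + 4), eventually_ne_atTop 0, hxt.eventually_ge_atTop 0]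
      with n hW hx hl ⟨J, e, hJm, hJt, hJc, he, hT1, hT2⟩ hms hm hn hx0
    generalize hr0 : Cw * ⌈W n⌉₊ = r0 at hms
    obtain ⟨B, χ, hBm, hB0, hχ, hχ0, hχt, hχn, hb⟩ := hms
    set y := K * W n * Real.log n ^ (γ - 5 / 2) with hy
    have hlr : 1 ≤ Real.log n ^ (γ - 5 / 2) := Real.one_le_rpow hl (by linarith)
    have hy1 : 1 ≤ y := by
      rw [hy]; have : 1 ≤ K * W n := by nlinarith
      nlinarith
    set R := ⌊y⌋₊ with hR
    have hRy : (R:ℝ) ≤ y := Nat.floor_le (by linarith)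
    have hR2 : y / 2 ≤ R := by
      have h1 := Nat.lt_floor_add_one y
      have h2 : (1:ℝ) ≤ R := by exact_mod_cast (Nat.one_le_floor_iff y).2 hy1
      linarith
    have hR3 : (C2 + 1) * x n ≤ Real.log n ^ 5 * (R:ℝ) ^ 2 := by
      have h1 : (y / 2) ^ 2 ≤ (R:ℝ) ^ 2 := by gcongr
      have h2 : Real.log n ^ 5 * y ^ 2 = K ^ 2 * x n := by
        rw [hx, hy]
        have : Real.log n ^ (2 * γ) = Real.log n ^ 5 * (Real.log n ^ (γ - 5 / 2)) ^ 2 := by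
          rw [← Real.rpow_natCast (Real.log n ^ (γ - 5 / 2)), ← Real.rpow_natCast, ← Real.rpow_mul (by linarith), ← Real.rpow_add (by linarith)]
          congr 1; push_cast; ring
        rw [this]; ring
      have h3 : Real.log n ^ 5 * (y / 2) ^ 2 ≤ Real.log n ^ 5 * (R:ℝ) ^ 2 := by gcongr
      nlinarith
    have hr0' : (r0:ℝ) ≤ 2 * Cw * W n := by
      rw [← hr0]; push_cast
      have : (⌈W n⌉₊:ℝ) < W n + 1 := Nat.ceil_lt_add_one (by linarith)
      have hc : (0:ℝ) < Cw := by exact_mod_cast hCw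
      nlinarith
    have hr0n : r0 ≠ 0 := by
      rw [← hr0]; have : 0 < ⌈W n⌉₊ := Nat.ceil_pos.2 (by linarith)
      positivity
    have hw0 : ENNReal.ofReal (Real.exp (-(4 * (Cw:ℝ) ^ 2 * x n))) ≤ widthWeight n r0 := by
      simp only [widthWeight, hr0n, if_false]
      apply ENNReal.ofReal_le_ofReal
      apply Real.exp_le_exp.2
      have h1 : (r0:ℝ) ^ 2 ≤ (2 * Cw * W n) ^ 2 := by gcongr
      have h2 : Real.log n ^ 5 ≤ Real.log n ^ (2 * γ) := by
        rw [← Real.rpow_natCast]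
        exact Real.rpow_le_rpow_of_exponent_le hl (by push_cast; linarith)
      have h3 : Real.log n ^ 5 * (r0:ℝ) ^ 2 ≤ Real.log n ^ (2 * γ) * (2 * Cw * W n) ^ 2 := by gcongr
      rw [hx]
      nlinarith
    have hwt : widthWeight n r0 ≠ ∞ := by simp [widthWeight, hr0n]
    have main := post_bound μ0 n (A n) (Pr n) (widthWeight n) (ρ n) (hρ n) (Bad n) J (fun T => T) hJm hJt R e
      (ENNReal.ofReal (Real.exp (-(Real.log n ^ 5 * (R:ℝ) ^ 2)))) (ENNReal.ofReal δ) (ENNReal.ofReal (Real.exp (-(C' * x n)))) χ (ENNReal.ofReal (Real.exp (x n)))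
      hT1 (fun r hr hwr p hp => hT2 r (by rintro rfl; simp [widthWeight] at hwr) (le_trans (by exact_mod_cast hr) hRy) p hp)
      hn (hρ1 n) (widthWeight_sum hl) (widthWeight_tail hl R) r0 B hBm hB0 hχ hb
      (by simp [Real.exp_pos]) hχ0 hχt (by simp [Real.exp_pos]) ENNReal.ofReal_ne_top
      (fun h => by rw [h] at hw0; simp at hw0; linarith [Real.exp_pos (-(4 * (Cw:ℝ) ^ 2 * x n))]) hwt (by simpa using hδ) ENNReal.ofReal_ne_top
    refine main.trans ?_
    have t1 : (J.card : ℝ≥0∞) * e ^ n ≤ ENNReal.ofReal (Real.exp (-x n)) := by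
      calc (J.card : ℝ≥0∞) * e ^ n ≤ ENNReal.ofReal (Real.exp (3 * x n)) * ENNReal.ofReal (Real.exp (-(m n * x n))) := by
            gcongr
            rw [← ENNReal.ofReal_natCast]; exact ENNReal.ofReal_le_ofReal hJc
        _ = ENNReal.ofReal (Real.exp (3 * x n + -(m n * x n))) := by rw [← ENNReal.ofReal_mul (by positivity), ← Real.exp_add]
        _ ≤ _ := by
          apply ENNReal.ofReal_le_ofReal; apply Real.exp_le_exp.2; nlinarith
    have t2 : (ENNReal.ofReal (Real.exp (x n)))⁻¹ = ENNReal.ofReal (Real.exp (-x n)) := ofReal_exp_inv _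
    have t3 : e ^ n + ENNReal.ofReal (Real.exp (-(Real.log n ^ 5 * (R:ℝ) ^ 2))) ≤ ENNReal.ofReal (2 * Real.exp (-((C2 + 1) * x n))) := by
      rw [two_mul, ENNReal.ofReal_add (by positivity) (by positivity)]
      refine add_le_add (he.trans ?_) ?_
      · apply ENNReal.ofReal_le_ofReal; apply Real.exp_le_exp.2; nlinarith
      · apply ENNReal.ofReal_le_ofReal; apply Real.exp_le_exp.2; linarith
    have t4 : ENNReal.ofReal (Real.exp (x n)) * χ ^ n / (ENNReal.ofReal δ * widthWeight n r0 * ENNReal.ofReal (Real.exp (-(C' * x n)))) ≤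
        ENNReal.ofReal (Real.exp (C2 * x n) / δ) := by
      calc _ ≤ ENNReal.ofReal (Real.exp (x n)) * ENNReal.ofReal (Real.exp (C' * x n)) /
            (ENNReal.ofReal δ * ENNReal.ofReal (Real.exp (-(4 * (Cw:ℝ) ^ 2 * x n))) * ENNReal.ofReal (Real.exp (-(C' * x n)))) := by
            gcongr
        _ = ENNReal.ofReal (Real.exp (C2 * x n) / δ) := by
            rw [← ENNReal.ofReal_mul (by positivity), ← ENNReal.ofReal_mul (by positivity), ← ENNReal.ofReal_mul (by positivity), ← ENNReal.ofReal_div_of_pos (by positivity)]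
            congr 1
            rw [div_eq_div_iff (by positivity) (by positivity)]
            have : Real.exp (C2 * x n) * Real.exp (-(4 * (Cw:ℝ) ^ 2 * x n)) * Real.exp (-(C' * x n)) = Real.exp (x n) * Real.exp (C' * x n) := by
              rw [← Real.exp_add, ← Real.exp_add, ← Real.exp_add]; congr 1; rw [hC2]; ring
            rw [← this]; ring
    calc _ ≤ ENNReal.ofReal (Real.exp (-x n)) + ENNReal.ofReal (Real.exp (-x n)) +
          ENNReal.ofReal (2 * Real.exp (-((C2 + 1) * x n))) * ENNReal.ofReal (Real.exp (C2 * x n) / δ) := by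
          rw [t2]; gcongr
      _ = _ := by
        rw [← ENNReal.ofReal_mul (by positivity), ← ENNReal.ofReal_add (by positivity) (by positivity), ← ENNReal.ofReal_add (by positivity) (by positivity)]
        congr 1
        have : Real.exp (-((C2 + 1) * x n)) * Real.exp (C2 * x n) = Real.exp (-x n) := by
          rw [← Real.exp_add]; congr 1; ring
        rw [add_mul, ← this]; ring
  have hlim : Tendsto (fun n => ENNReal.ofReal ((2 + 2 / δ) * Real.exp (-x n))) atTop (nhds 0) := by
    have h1 : Tendsto (fun n => (2 + 2 / δ) * Real.exp (-x n)) atTop (nhds ((2 + 2 / δ) * 0)) :=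
      (Real.tendsto_exp_neg_atTop_nhds_zero.comp hxt).const_mul _
    have := ENNReal.tendsto_ofReal h1
    simpa using this
  exact tendsto_of_tendsto_of_tendsto_of_le_of_le' tendsto_const_nhds hlim (Eventually.of_forall fun _ => zero_le) key


lemma maxRate_mul {P : Finset (ℝ × ℕ)} (hP : P.Nonempty) (hpos : ∀ p ∈ P, 0 < p.1) {n : ℕ} (hn : 1 ≤ n) :
    (n:ℝ) * maxRate P hP n ^ 2 = maxWidthExp P hP n ^ 2 := by
  have hn0 : (0:ℝ) < n := by exact_mod_cast hn
  have key : ∀ p ∈ P, (n:ℝ) ^ (-(p.1 / (2 * p.1 + p.2))) * (n:ℝ) ^ (1 / 2 : ℝ) = (n : ℝ) ^ ((p.2 : ℝ) / (2 * (2 * p.1 + p.2))) := by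
    intro p hp
    have h1 := hpos p hp
    have h2 : (0:ℝ) ≤ p.2 := by positivity
    rw [← Real.rpow_add hn0]
    congr 1
    field_simp
    ring
  have h : maxRate P hP n * (n:ℝ) ^ (1 / 2 : ℝ) = maxWidthExp P hP n := by
    have hs : 0 < (n:ℝ) ^ (1 / 2 : ℝ) := by positivity
    apply le_antisymm
    · rw [← le_div_iff₀ hs]
      apply Finset.sup'_le
      intro p hp
      rw [le_div_iff₀ hs, key p hp]
      exact le_maxWidth hP n hp
    · apply Finset.sup'_le
      intro p hp
      rw [← key p hp]
      have := le_maxRate hP n hp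
      gcongr
  rw [← h, mul_pow, ← Real.rpow_natCast ((n:ℝ) ^ (1 / 2 : ℝ)), ← Real.rpow_mul hn0.le]
  norm_num
  ring

lemma tendsto_rate {P : Finset (ℝ × ℕ)} (hP : P.Nonempty) (hpos : ∀ p ∈ P, 0 < p.1) (γ : ℝ) :
    Tendsto (fun n : ℕ => maxRate P hP n * Real.log n ^ γ) atTop (nhds 0) := by
  have h1 : ∀ p ∈ P, Tendsto (fun n : ℕ => (n:ℝ) ^ (-(p.1 / (2 * p.1 + p.2))) * Real.log n ^ γ) atTop (nhds 0) := by
    intro p hp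
    have h1 := hpos p hp
    have hc : 0 < p.1 / (2 * p.1 + p.2) := by positivity
    have := ((isLittleO_log_rpow_rpow_atTop γ hc).tendsto_div_nhds_zero).comp tendsto_natCast_atTop_atTop
    refine this.congr' ?_
    filter_upwards [eventually_ge_atTop 1] with n hn
    have hn0 : (0:ℝ) < n := by exact_mod_cast hn
    simp only [Function.comp]
    rw [Real.rpow_neg hn0.le, div_eq_mul_inv, mul_comm]
  have h2 := tendsto_finsetSum P h1
  simp only [Finset.sum_const_zero] at h2
  refine tendsto_of_tendsto_of_tendsto_of_le_of_le' tendsto_const_nhds h2 ?_ ?_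
  · filter_upwards [tendsto_log_nat.eventually_ge_atTop 0] with n hl
    have := maxRate_nonneg hP n
    positivity
  · filter_upwards [tendsto_log_nat.eventually_ge_atTop 0] with n hl
    rw [← Finset.sum_mul]
    gcongr
    apply Finset.sup'_le
    intro p hp
    exact Finset.single_le_sum (f := fun p : ℝ × ℕ => (n:ℝ) ^ (-(p.1 / (2 * p.1 + p.2)))) (fun _ _ => by positivity) hp

lemma card_ParamIdx (d r L : ℕ) : Fintype.card (ParamIdx d r L) ≤ (d + 4) * (L + 1) * (r + 1) ^ 2 := by
  simp only [Fintype.card_sum, Fintype.card_prod, Fintype.card_fin, Fintype.card_unit]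
  have : L - 1 ≤ L := Nat.sub_le _ _
  calc r * d + (r + ((L - 1) * (r * r) + ((L - 1) * r + (r + 1)))) ≤ r * d + (r + (L * (r * r) + (L * r + (r + 1)))) := by gcongr
    _ ≤ _ := by nlinarith [Nat.zero_le (d * L * r ^2), Nat.zero_le (d*L), Nat.zero_le (d*r^2), Nat.zero_le (d*L*r), Nat.zero_le (d*r), Nat.zero_le (L*r^2), Nat.zero_le (L*r), Nat.zero_le L, Nat.zero_le d, Nat.zero_le r, Nat.zero_le (r^2)]

/-- growth: any power of log times maxWidth^2 log^3 is dominated -/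
lemma Ldepth_le {CL : ℝ} (hCL : 0 < CL) {n : ℕ} (hl : 1 ≤ Real.log n) : (Ldepth CL n : ℝ) + 2 ≤ (CL + 3) * Real.log n := by
  have h1 : (Ldepth CL n : ℝ) < CL * Real.log n + 1 := Nat.ceil_lt_add_one (by positivity)
  nlinarith


set_option maxHeartbeats 2000000 in
theorem cover_ev (ν : ℝ) (hν1 : ν < 1) (d : ℕ) {CL : ℝ} (hCL : 0 < CL) (F : ℝ) (hF : 1 ≤ F)
    (PX : Measure (Fin d → ℝ)) [IsProbabilityMeasure PX] (x : ℕ → ℝ) (hx : ∀ᶠ n : ℕ in atTop, x n ≤ n) (K : ℝ) (hK : 0 < K) :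
    ∀ᶠ n : ℕ in atTop, ∀ r : ℕ, r ≠ 0 → (r:ℝ) ^ 2 * Real.log n ^ 5 ≤ K ^ 2 * x n → ∀ η : ℝ, 1 / (n:ℝ) ≤ η →
      r + 1 ≤ n ∧
      ∃ J : Finset (ParamIdx d r (Ldepth CL n) → ℝ), (J.card : ℝ) ≤ Real.exp (x n) ∧ ∀ θ, ∃ θ' ∈ J, l2dist d PX
      (fun x => trunc F (netOfParams ν d r (Ldepth CL n) θ x)) (fun x => trunc F (netOfParams ν d r (Ldepth CL n) θ' x)) ≤ η := by
  have hnt := tendsto_natCast_atTop_atTop (R := ℝ)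
  have hlogn : ∀ᶠ n : ℕ in atTop, (CL + 3) * Real.log n ≤ n := by
    have h := (Real.isLittleO_log_id_atTop.bound (show (0:ℝ) < 1 / (CL + 3) by positivity))
    filter_upwards [hnt.eventually h, tendsto_log_nat.eventually_ge_atTop 0] with n hn hl
    simp only [id, Real.norm_eq_abs, abs_of_nonneg hl, Nat.abs_cast] at hn
    rw [div_mul_eq_mul_div, le_div_iff₀ (by positivity)] at hn
    linarith
  set C := (d + 4 : ℝ) * (CL + 3) ^ 2 * 10 * 4 * K ^ 2 with hC
  filter_upwards [hx, hlogn, tendsto_log_nat.eventually_ge_atTop (max 1 C), hnt.eventually_ge_atTop (max (max 3 (4 * F + 2)) (max (4 * K ^ 2) (22 * F ^ 2 + 1)))]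
    with n hx hLn hl hn r hr hrx η hη
  obtain ⟨hl1, hlC⟩ := max_le_iff.1 hl
  obtain ⟨⟨hn3, hnF⟩, hnK, hnF2⟩ := (max_le_iff.1 hn).imp max_le_iff.1 max_le_iff.1
  have hn0 : (0:ℝ) < n := by linarith
  have hη0 : 0 < η := lt_of_lt_of_le (by positivity) hη
  have hr1 : (1:ℝ) ≤ r := by exact_mod_cast Nat.one_le_iff_ne_zero.2 hr
  have hl5 : 1 ≤ Real.log n ^ 5 := one_le_pow₀ hl1
  have hrn2 : (r:ℝ) ^ 2 ≤ K ^ 2 * n := by nlinarith [sq_nonneg (r:ℝ)]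
  have hrn : (r:ℝ) + 1 ≤ n := by
    have : ((r:ℝ) + 1) ^ 2 ≤ (n:ℝ) ^ 2 := by nlinarith
    exact abs_le_of_sq_le_sq' this hn0.le |>.2
  refine ⟨by exact_mod_cast hrn, ?_⟩
  set L := Ldepth CL n with hL
  have hL2 : (L:ℝ) + 2 ≤ (CL + 3) * Real.log n := Ldepth_le hCL hl1
  have hLn' : (L:ℝ) + 2 ≤ n := hL2.trans hLn
  have hce : ((⌈4 * F / η⌉₊:ℝ) + 1) ≤ (n:ℝ) ^ 2 := by
    have h1 : (⌈4 * F / η⌉₊:ℝ) < 4 * F / η + 1 := Nat.ceil_lt_add_one (by positivity)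
    have h2 : 4 * F / η ≤ 4 * F * n := by
      rw [div_le_iff₀ hη0]
      have : 1 ≤ η * n := by rwa [div_le_iff₀ hn0] at hη
      nlinarith
    nlinarith
  set Bn : ℕ := ((2 * ((n ^ 4 * (⌈4 * F / η⌉₊ + 1)) * (r + 1)) * (L + 2) + 1) ^ Fintype.card (ParamIdx d r L)) ^ (L + 2) with hBn
  have hB : (Bn:ℝ) ≤ Real.exp (x n) := by
    have hin : (2 * (((n:ℝ) ^ 4 * (⌈4 * F / η⌉₊ + 1)) * (r + 1)) * (L + 2) + 1) ≤ (n:ℝ) ^ 10 := by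
      calc (2 * (((n:ℝ) ^ 4 * (⌈4 * F / η⌉₊ + 1)) * (r + 1)) * (L + 2) + 1) ≤ 2 * (((n:ℝ) ^ 4 * (n:ℝ) ^ 2) * n) * n + 1 := by gcongr
        _ ≤ (n:ℝ) ^ 8 * 3 := by
            have : 1 ≤ (n:ℝ) ^ 8 := one_le_pow₀ (by linarith)
            have e : 2 * (((n:ℝ) ^ 4 * (n:ℝ) ^ 2) * n) * n = 2 * (n:ℝ) ^ 8 := by ring
            rw [e]; linarith only [this]
        _ ≤ (n:ℝ) ^ 8 * (n:ℝ) ^ 2 := by gcongr; nlinarith only [hn3]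
        _ = _ := by ring
    have hT : (Fintype.card (ParamIdx d r L) : ℝ) ≤ (d + 4) * ((CL + 3) * Real.log n) * (4 * (r:ℝ) ^ 2) := by
      have h1 : (Fintype.card (ParamIdx d r L) : ℝ) ≤ ((d + 4) * (L + 1) * (r + 1) ^ 2 : ℕ) := by exact_mod_cast card_ParamIdx d r L
      push_cast at h1
      refine h1.trans ?_
      have h2 : ((r:ℝ) + 1) ^ 2 ≤ 4 * (r:ℝ) ^ 2 := by
        calc ((r:ℝ) + 1) ^ 2 ≤ (2 * (r:ℝ)) ^ 2 := by gcongr; linarith only [hr1]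
          _ = _ := by ring
      gcongr
      linarith
    have hnexp : (n:ℝ) = Real.exp (Real.log n) := (Real.exp_log hn0).symm
    rw [hBn]
    push_cast
    calc _ ≤ (((n:ℝ) ^ 10) ^ Fintype.card (ParamIdx d r L)) ^ (L + 2) := by gcongr
      _ = Real.exp ((L + 2 : ℝ) * (Fintype.card (ParamIdx d r L) * (10 * Real.log n))) := by
        rw [hnexp, ← Real.exp_nat_mul, ← Real.exp_nat_mul, ← Real.exp_nat_mul, Real.log_exp]; push_cast; rfl
      _ ≤ Real.exp (x n) := by
        apply Real.exp_le_exp.2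
        calc (L + 2 : ℝ) * (Fintype.card (ParamIdx d r L) * (10 * Real.log n)) ≤
            ((CL + 3) * Real.log n) * (((d + 4) * ((CL + 3) * Real.log n) * (4 * (r:ℝ) ^ 2)) * (10 * Real.log n)) := by gcongr
          _ = ((d + 4 : ℝ) * (CL + 3) ^ 2 * 10 * 4) * Real.log n ^ 3 * (r:ℝ) ^ 2 := by ring
          _ ≤ x n := by
            have hl3 : 0 < Real.log n ^ 2 := by positivity
            rw [← mul_le_mul_iff_of_pos_right hl3]
            calc _ = ((d + 4 : ℝ) * (CL + 3) ^ 2 * 10 * 4) * ((r:ℝ) ^ 2 * Real.log n ^ 5) := by ring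
              _ ≤ ((d + 4 : ℝ) * (CL + 3) ^ 2 * 10 * 4) * (K ^ 2 * x n) := by gcongr
              _ = x n * C := by rw [hC]; ring
              _ ≤ x n * Real.log n ^ 2 := by
                have hx0 : 0 ≤ x n := by
                  have : 0 < K ^ 2 * x n := lt_of_lt_of_le (by positivity) hrx
                  exact (pos_of_mul_pos_right this (by positivity)).le
                gcongr
                nlinarith only [hl1, hlC]
  have hcond : ((Bn : ℝ) + 1) ^ 2 * (Real.exp (-(3 * η ^ 2 / (16 * F ^ 2)))) ^ (n ^ 4) < 1 := by
    have hB2 : ((Bn:ℝ) + 1) ^ 2 ≤ Real.exp (4 * n) := by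
      have h1 : (Bn:ℝ) ≤ Real.exp n := hB.trans (Real.exp_le_exp.2 hx)
      have h2 : Real.exp (n:ℝ) + 1 ≤ Real.exp (2 * n) := by
        have e : Real.exp (2 * (n:ℝ)) = Real.exp n * Real.exp n := by rw [← Real.exp_add]; ring_nf
        have := Real.add_one_le_exp (n:ℝ)
        rw [e]; nlinarith
      calc ((Bn:ℝ) + 1) ^ 2 ≤ (Real.exp (2 * n)) ^ 2 := by gcongr; linarith
        _ = _ := by rw [← Real.exp_nat_mul]; congr 1; push_cast; ring
    have hexp : (Real.exp (-(3 * η ^ 2 / (16 * F ^ 2)))) ^ (n ^ 4) ≤ Real.exp (-(3 * n ^ 2 / (16 * F ^ 2))) := by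
      rw [← Real.exp_nat_mul]
      apply Real.exp_le_exp.2
      have h1 : 1 ≤ η * n := by rwa [div_le_iff₀ hn0] at hη
      have h2 : 1 ≤ (η * n) ^ 2 := one_le_pow₀ h1
      have h3 : (n:ℝ) ^ 2 ≤ (n:ℝ) ^ 4 * η ^ 2 := by nlinarith [sq_nonneg (n:ℝ)]
      push_cast
      have : 3 * (n:ℝ) ^ 2 / (16 * F ^ 2) ≤ (n:ℝ) ^ 4 * (3 * η ^ 2 / (16 * F ^ 2)) := by
        rw [← mul_div_assoc]; apply div_le_div_of_nonneg_right _ (by positivity); linarith only [h3]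
      linarith
    calc _ ≤ Real.exp (4 * n) * Real.exp (-(3 * n ^ 2 / (16 * F ^ 2))) := by gcongr
      _ = Real.exp (4 * n + -(3 * n ^ 2 / (16 * F ^ 2))) := by rw [Real.exp_add]
      _ < 1 := by
        rw [Real.exp_lt_one_iff]
        have : 4 * (n:ℝ) < 3 * n ^ 2 / (16 * F ^ 2) := by
          rw [lt_div_iff₀ (by positivity)]; nlinarith
        linarith
  obtain ⟨J, hJ, hc⟩ := net_cover ν hν1 d r L (n ^ 4) Bn F η (by linarith) hη0 PX hcond le_rfl
  exact ⟨J, le_trans (by exact_mod_cast hJ) hB, hc⟩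


lemma lrelu_lip {ν : ℝ} (h0 : 0 ≤ ν) (h1 : ν < 1) (x y : ℝ) : |lrelu ν x - lrelu ν y| ≤ |x - y| := by
  by_cases hx : 0 < x <;> by_cases hy : 0 < y
  · rw [lrelu_pos h1 hx, lrelu_pos h1 hy]
  · rw [lrelu_pos h1 hx, lrelu_nonpos h1 hy, abs_of_nonneg (by nlinarith), abs_of_nonneg (by linarith)]; nlinarith
  · rw [lrelu_nonpos h1 hx, lrelu_pos h1 hy, abs_of_nonpos (by nlinarith), abs_of_nonpos (by linarith)]; nlinarith
  · rw [lrelu_nonpos h1 hx, lrelu_nonpos h1 hy, ← mul_sub, abs_mul, abs_of_nonneg h0]; nlinarith [abs_nonneg (x - y)]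

lemma lrelu_abs {ν : ℝ} (h0 : 0 ≤ ν) (h1 : ν < 1) (x : ℝ) : |lrelu ν x| ≤ |x| := by
  have := lrelu_lip h0 h1 x 0
  simpa [lrelu] using this

lemma trunc_lip (F x y : ℝ) : |trunc F x - trunc F y| ≤ |x - y| := by
  unfold trunc
  calc _ ≤ |max x (-F) - max y (-F)| := abs_inf_sub_inf_le_abs _ _ _
    _ ≤ _ := abs_sup_sub_sup_le_abs _ _ _

lemma trunc_eq {F x : ℝ} (h : |x| ≤ F) : trunc F x = x := by
  have := abs_le.1 h
  unfold trunc
  rw [max_eq_left this.1, min_eq_left this.2]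

lemma affine_bound {k : ℕ} (w h : Fin k → ℝ) (b κ H : ℝ) (hw : ∀ j, |w j| ≤ κ) (hb : |b| ≤ κ) (hh : ∀ j, |h j| ≤ H) (hH : 1 ≤ H) :
    |(∑ j, w j * h j) + b| ≤ κ * (k + 1) * H := by
  have hκ : 0 ≤ κ := (abs_nonneg b).trans hb
  calc |(∑ j, w j * h j) + b| ≤ (∑ j, |w j * h j|) + |b| := (abs_add_le _ _).trans (by gcongr; exact Finset.abs_sum_le_sum_abs _ _)
    _ ≤ (∑ j : Fin k, κ * H) + κ := by
      gcongr with j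
      rw [abs_mul]; exact mul_le_mul (hw j) (hh j) (abs_nonneg _) hκ
    _ ≤ _ := by simp; nlinarith

lemma affine_diff {k : ℕ} (w w' h h' : Fin k → ℝ) (b b' κ H D ρ : ℝ) (hw : ∀ j, |w' j| ≤ κ) (hww : ∀ j, |w' j - w j| ≤ ρ)
    (hb : |b' - b| ≤ ρ) (hh : ∀ j, |h j| ≤ H) (hD : ∀ j, |h' j - h j| ≤ D) (hH : 1 ≤ H) (hκ : 1 ≤ κ) (hD0 : 0 ≤ D) :
    |((∑ j, w' j * h' j) + b') - ((∑ j, w j * h j) + b)| ≤ κ * (k + 1) * (D + ρ * H) := by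
  have hρ : 0 ≤ ρ := (abs_nonneg _).trans hb
  have e : ((∑ j, w' j * h' j) + b') - ((∑ j, w j * h j) + b) = (∑ j, (w' j * (h' j - h j) + (w' j - w j) * h j)) + (b' - b) := by
    have : (∑ j, (w' j * (h' j - h j) + (w' j - w j) * h j)) = (∑ j, w' j * h' j) - ∑ j, w j * h j := by
      rw [← Finset.sum_sub_distrib]; apply Finset.sum_congr rfl; intros; ring
    rw [this]; ring
  rw [e]
  calc _ ≤ (∑ j, |w' j * (h' j - h j) + (w' j - w j) * h j|) + |b' - b| := (abs_add_le _ _).trans (by gcongr; exact Finset.abs_sum_le_sum_abs _ _)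
    _ ≤ (∑ j : Fin k, (κ * D + ρ * H)) + ρ := by
      gcongr with j
      refine (abs_add_le _ _).trans ?_
      rw [abs_mul, abs_mul]
      exact add_le_add (mul_le_mul (hw j) (hD j) (abs_nonneg _) (by linarith)) (mul_le_mul (hww j) (hh j) (abs_nonneg _) hρ)
    _ ≤ _ := by
      simp
      have h1 : ρ ≤ ρ * H := by nlinarith
      have h2 : 0 ≤ ρ * H := by positivity
      have h3 : ρ * H ≤ κ * (ρ * H) := by nlinarith
      have h4 : (k:ℝ) * (ρ * H) ≤ k * (κ * (ρ * H)) := by gcongr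
      have h5 : 0 ≤ κ * D := by positivity
      nlinarith

lemma foldl_lip {ν : ℝ} (h0 : 0 ≤ ν) (h1 : ν < 1) {ι : Type*} {r : ℕ} (w w' : ι → Fin r → Fin r → ℝ) (b b' : ι → Fin r → ℝ)
    (κ ρ Q : ℝ) (hκ : 1 ≤ κ) (hw : ∀ l i j, |w l i j| ≤ κ) (hw' : ∀ l i j, |w' l i j| ≤ κ) (hb : ∀ l i, |b l i| ≤ κ)
    (hww : ∀ l i j, |w' l i j - w l i j| ≤ ρ) (hbb : ∀ l i, |b' l i - b l i| ≤ ρ) (hρ : 0 ≤ ρ) (hQ : κ * (r + 1) ≤ Q) (hQ1 : 1 ≤ Q)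
    (ls : List ι) : ∀ (h h' : Fin r → ℝ) (H D : ℝ), (∀ j, |h j| ≤ H) → (∀ j, |h' j - h j| ≤ D) → 1 ≤ H → 0 ≤ D →
      (∀ j, |ls.foldl (fun h l => fun i => lrelu ν ((∑ j, w l i j * h j) + b l i)) h j| ≤ Q ^ ls.length * H) ∧
      (∀ j, |ls.foldl (fun h l => fun i => lrelu ν ((∑ j, w' l i j * h j) + b' l i)) h' j -
        ls.foldl (fun h l => fun i => lrelu ν ((∑ j, w l i j * h j) + b l i)) h j| ≤ Q ^ ls.length * (D + ls.length * ρ * H)) := by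
  induction ls with
  | nil => intro h h' H D hh hD hH hD0; simp; exact ⟨hh, hD⟩
  | cons l ls ih =>
    intro h h' H D hh hD hH hD0
    simp only [List.foldl_cons, List.length_cons]
    have g1 : ∀ i, |lrelu ν ((∑ j, w l i j * h j) + b l i)| ≤ Q * H := by
      intro i
      refine (lrelu_abs h0 h1 _).trans ((affine_bound _ _ _ κ H (hw l i) (hb l i) hh hH).trans ?_)
      gcongr
    have g2 : ∀ i, |lrelu ν ((∑ j, w' l i j * h' j) + b' l i) - lrelu ν ((∑ j, w l i j * h j) + b l i)| ≤ Q * (D + ρ * H) := by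
      intro i
      refine (lrelu_lip h0 h1 _ _).trans ((affine_diff _ _ _ _ _ _ κ H D ρ (hw' l i) (hww l i) (hbb l i) hh hD hH hκ hD0).trans ?_)
      have : 0 ≤ D + ρ * H := by positivity
      gcongr
    obtain ⟨i1, i2⟩ := ih (fun i => lrelu ν ((∑ j, w l i j * h j) + b l i)) (fun i => lrelu ν ((∑ j, w' l i j * h' j) + b' l i))
      (Q * H) (Q * (D + ρ * H)) g1 g2 (by nlinarith) (by positivity)
    exact ⟨fun j => (i1 j).trans (le_of_eq (by ring)), fun j => (i2 j).trans (le_of_eq (by push_cast; ring))⟩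

theorem net_lip {ν : ℝ} (h0 : 0 ≤ ν) (h1 : ν < 1) (d r L : ℕ) (θ θ' : ParamIdx d r L → ℝ) (a κ ρ : ℝ) (ha : 1 ≤ a) (hκ : 1 ≤ κ)
    (hθ : ∀ i, |θ i| ≤ κ) (hθ' : ∀ i, |θ' i| ≤ κ) (hρ : ∀ i, |θ' i - θ i| ≤ ρ) (x : Fin d → ℝ) (hx : ∀ i, |x i| ≤ a) :
    |netOfParams ν d r L θ' x - netOfParams ν d r L θ x| ≤ (L + 2) * a * (κ * (r + d + 1)) ^ (L + 2) * ρ := by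
  have hρ0 : 0 ≤ ρ := (abs_nonneg _).trans (hρ (Sum.inr (Sum.inr (Sum.inr (Sum.inr (Sum.inr ()))))))
  set Q := κ * (r + d + 1) with hQ
  have hr0 : (0:ℝ) ≤ r := by positivity
  have hd0 : (0:ℝ) ≤ d := by positivity
  have hQ1 : 1 ≤ Q := by rw [hQ]; nlinarith
  have hQr : κ * (r + 1) ≤ Q := by rw [hQ]; gcongr; linarith
  have hQd : κ * (d + 1) ≤ Q := by rw [hQ]; gcongr; linarith
  unfold netOfParams
  simp only
  have b1 : ∀ i, |lrelu ν ((∑ j, θ (Sum.inl (i, j)) * x j) + θ (Sum.inr (Sum.inl i)))| ≤ Q * a := by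
    intro i
    refine (lrelu_abs h0 h1 _).trans ((affine_bound _ _ _ κ a (fun j => hθ _) (hθ _) hx ha).trans ?_)
    gcongr
  have b2 : ∀ i, |lrelu ν ((∑ j, θ' (Sum.inl (i, j)) * x j) + θ' (Sum.inr (Sum.inl i))) -
      lrelu ν ((∑ j, θ (Sum.inl (i, j)) * x j) + θ (Sum.inr (Sum.inl i)))| ≤ Q * (0 + ρ * a) := by
    intro i
    refine (lrelu_lip h0 h1 _ _).trans ((affine_diff _ _ _ _ _ _ κ a 0 ρ (fun j => hθ' _) (fun j => hρ _) (hρ _) hx (by simp) ha hκ le_rfl).trans ?_)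
    gcongr
  obtain ⟨c1, c2⟩ := foldl_lip h0 h1 (fun l i j => θ (Sum.inr (Sum.inr (Sum.inl (l, i, j))))) (fun l i j => θ' (Sum.inr (Sum.inr (Sum.inl (l, i, j)))))
    (fun l i => θ (Sum.inr (Sum.inr (Sum.inr (Sum.inl (l, i)))))) (fun l i => θ' (Sum.inr (Sum.inr (Sum.inr (Sum.inl (l, i))))))
    κ ρ Q hκ (fun _ _ _ => hθ _) (fun _ _ _ => hθ' _) (fun _ _ => hθ _) (fun _ _ _ => hρ _) (fun _ _ => hρ _) hρ0 hQr hQ1 (List.finRange (L - 1))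
    _ _ (Q * a) (Q * (0 + ρ * a)) b1 b2 (by nlinarith) (by positivity)
  rw [List.length_finRange] at c1 c2
  have hQp : 1 ≤ Q ^ (L - 1) := one_le_pow₀ hQ1
  refine (affine_diff _ _ _ _ _ _ κ _ _ ρ (fun j => hθ' _) (fun j => hρ _) (hρ _) c1 c2 (by nlinarith [mul_le_mul hQ1 ha (by norm_num) (by linarith)]) hκ (by positivity)).trans ?_
  have hL : ((L - 1 : ℕ) : ℝ) ≤ L := by exact_mod_cast Nat.sub_le _ _
  calc κ * (r + 1) * (Q ^ (L - 1) * (Q * (0 + ρ * a) + ((L - 1 : ℕ) : ℝ) * ρ * (Q * a)) + ρ * (Q ^ (L - 1) * (Q * a)))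
      ≤ Q * (Q ^ (L - 1) * (Q * (0 + ρ * a) + L * ρ * (Q * a)) + ρ * (Q ^ (L - 1) * (Q * a))) := by gcongr
    _ = (L + 2) * a * Q ^ (L - 1 + 2) * ρ := by ring
    _ ≤ _ := by
      have : Q ^ (L - 1 + 2) ≤ Q ^ (L + 2) := pow_le_pow_right₀ hQ1 (by omega)
      gcongr

theorem box_mass {ι : Type*} [Fintype ι] (Pr : Measure (ι → ℝ)) (π : (ι → ℝ) → ℝ) (hd : Pr = volume.withDensity fun θ => ENNReal.ofReal (π θ))
    (θ : ι → ℝ) (ρ δ : ℝ) (hρ : 0 ≤ ρ) (hδ : 0 ≤ δ) (h : ∀ θ', (∀ i, |θ' i - θ i| ≤ ρ) → δ ^ Fintype.card ι ≤ π θ') :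
    MeasurableSet {θ' : ι → ℝ | ∀ i, |θ' i - θ i| ≤ ρ} ∧
    ENNReal.ofReal ((2 * ρ * δ) ^ Fintype.card ι) ≤ Pr {θ' | ∀ i, |θ' i - θ i| ≤ ρ} := by
  have hs : {θ' : ι → ℝ | ∀ i, |θ' i - θ i| ≤ ρ} = Set.Icc (fun i => θ i - ρ) (fun i => θ i + ρ) := by
    ext θ'
    simp only [Set.mem_setOf_eq, Set.mem_Icc, Pi.le_def, ← forall_and, abs_le]
    refine forall_congr' fun i => ⟨fun h => ⟨by linarith, by linarith⟩, fun h => ⟨by linarith, by linarith⟩⟩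
  have hm : MeasurableSet {θ' : ι → ℝ | ∀ i, |θ' i - θ i| ≤ ρ} := by rw [hs]; exact measurableSet_Icc
  refine ⟨hm, ?_⟩
  rw [hd, withDensity_apply _ hm]
  calc _ = ENNReal.ofReal (δ ^ Fintype.card ι) * volume {θ' : ι → ℝ | ∀ i, |θ' i - θ i| ≤ ρ} := by
        rw [hs, Real.volume_Icc_pi, Finset.prod_congr rfl (fun i _ => by rw [show θ i + ρ - (θ i - ρ) = 2 * ρ by ring]), Finset.prod_const, Finset.card_univ,
          ← ENNReal.ofReal_pow (by positivity), ← ENNReal.ofReal_mul (by positivity)]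
        congr 1; ring
    _ ≤ _ := by
      rw [← setLIntegral_const]
      apply setLIntegral_mono' hm
      intro θ' hθ'
      exact ENNReal.ofReal_le_ofReal (h θ' hθ')


lemma maxRate_lower {P : Finset (ℝ × ℕ)} (hP : P.Nonempty) (hpos : ∀ p ∈ P, 0 < p.1) {n : ℕ} (hn : 1 ≤ n) :
    1 / (n:ℝ) ≤ maxRate P hP n ^ 2 ∧ 1 / (n:ℝ) ≤ maxRate P hP n := by
  have hn0 : (1:ℝ) ≤ n := by exact_mod_cast hn
  have h1 := maxRate_mul hP hpos hn
  have h2 := one_le_maxWidth hP hpos hn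
  have h0 := maxRate_nonneg hP n
  have h3 : 1 ≤ maxWidthExp P hP n ^ 2 := one_le_pow₀ h2
  have h4 : 1 / (n:ℝ) ≤ maxRate P hP n ^ 2 := by rw [div_le_iff₀ (by linarith)]; linarith
  refine ⟨h4, ?_⟩
  rw [div_le_iff₀ (by linarith)]
  have : 1 ≤ (maxRate P hP n * n) ^ 2 := by rw [mul_pow]; nlinarith
  have h5 : 0 ≤ maxRate P hP n * n := by positivity
  nlinarith

set_option maxHeartbeats 2000000 in
theorem l2_of_good {d : ℕ} (PX : Measure (Fin d → ℝ)) [IsProbabilityMeasure PX] (f₀ h : (Fin d → ℝ) → ℝ) (hf : Measurable f₀) (hh : Measurable h)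
    (F : ℝ) (hfF : ∀ x, |f₀ x| ≤ F) (hhF : ∀ x, |h x| ≤ F) (G : Set (Fin d → ℝ)) (hG : MeasurableSet G) (t u : ℝ) (ht : 0 ≤ t) (hu : 0 ≤ u)
    (hGu : PX Gᶜ ≤ ENNReal.ofReal u) (hb : ∀ᵐ x ∂PX, x ∈ G → |h x - f₀ x| ≤ t) :
    ∫ x, (h x - f₀ x) ^ 2 ∂PX ≤ t ^ 2 + 4 * F ^ 2 * u := by
  have hi : Integrable (Gᶜ.indicator (fun _ : Fin d → ℝ => 4 * F ^ 2)) PX := (integrable_const _).indicator hG.compl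
  have h1 : ∫ x, (h x - f₀ x) ^ 2 ∂PX ≤ ∫ x, (t ^ 2 + Gᶜ.indicator (fun _ => 4 * F ^ 2) x) ∂PX := by
    apply integral_mono_of_nonneg (Eventually.of_forall fun x => sq_nonneg _) ((integrable_const _).add hi)
    filter_upwards [hb] with x hx
    by_cases hxG : x ∈ G
    · have h2 := hx hxG
      have h3 : (h x - f₀ x) ^ 2 ≤ t ^ 2 := sq_le_sq' (by linarith [abs_le.1 h2]) (abs_le.1 h2).2
      simpa [hxG] using h3
    · have := abs_le.1 (hfF x); have := abs_le.1 (hhF x)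
      simp [hxG]
      nlinarith
  refine h1.trans ?_
  rw [integral_add (f := fun _ => t ^ 2) (integrable_const _) hi, integral_indicator hG.compl]
  simp only [integral_const, probReal_univ, smul_eq_mul, one_mul, MeasurableSet.univ, measureReal_restrict_apply, Set.univ_inter]
  have h4 : PX.real Gᶜ ≤ u := by
    rw [measureReal_def]
    exact ENNReal.toReal_le_of_le_ofReal hu hGu
  nlinarith [sq_nonneg F]

set_option maxHeartbeats 4000000 in
theorem prior_mass {a : ℝ} (ha : 1 ≤ a) {d q : ℕ} {N : ℕ → ℕ} {P : Finset (ℝ × ℕ)} (hP : P.Nonempty)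
    (hpos : ∀ p ∈ P, 0 < p.1 ∧ 1 ≤ p.2) {K F CLip : ℝ} (hF : 1 ≤ F) (hCLip : 1 ≤ CLip)
    {f₀ : (Fin d → ℝ) → ℝ} (hf₀ : followsHCS a d q N P K F CLip f₀)
    (PX : Measure (Fin d → ℝ)) [IsProbabilityMeasure PX] (hsupp : PX (cube a d) = 1)
    {ν : ℝ} (hν0 : 0 ≤ ν) (hν1 : ν < 1) {CL : ℝ} (hCL : 0 < CL)
    (Prθ : ∀ n r : ℕ, Measure (ParamIdx d r (Ldepth CL n) → ℝ))
    (πθ : ∀ n r : ℕ, (ParamIdx d r (Ldepth CL n) → ℝ) → ℝ)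
    (hπθdens : ∀ n r, Prθ n r = volume.withDensity fun θ => ENNReal.ofReal (πθ n r θ))
    (hπθlow : ∀ κ : ℝ, 0 < κ → ∃ δκ : ℝ, 0 < δκ ∧
      ∀ n r : ℕ, ∀ θ : ParamIdx d r (Ldepth CL n) → ℝ,
        (∀ i, |θ i| ≤ κ) →
          δκ ^ Fintype.card (ParamIdx d r (Ldepth CL n)) ≤ πθ n r θ)
    (γ : ℝ) (hγ : 5 / 2 < γ) :
    ∃ (C' : ℝ) (Cw : ℕ), 0 < C' ∧ 0 < Cw ∧ ∀ᶠ n : ℕ in atTop,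
      ∃ B : Set (ParamIdx d (Cw * ⌈maxWidthExp P hP n⌉₊) (Ldepth CL n) → ℝ), MeasurableSet B ∧
        (∀ θ ∈ B, ∫ x, (trunc F (netOfParams ν d (Cw * ⌈maxWidthExp P hP n⌉₊) (Ldepth CL n) θ x) - f₀ x) ^ 2 ∂PX ≤ C' * maxRate P hP n ^ 2) ∧
        ENNReal.ofReal (Real.exp (-(C' * (maxWidthExp P hP n ^ 2 * Real.log n ^ (2 * γ))))) ≤ Prθ n _ B := by
  obtain ⟨C, κ, Cw, hC, hκ, hCw, hap⟩ := approx_params ha hP hpos hF hCLip hf₀ PX hsupp hν0 hν1 hCL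
  obtain ⟨δ, hδ, hlow⟩ := hπθlow (κ + 1) (by linarith)
  obtain ⟨hfF, hfc⟩ := followsHCS_bound hf₀
  have hpos' : ∀ p ∈ P, 0 < p.1 := fun p hp => (hpos p hp).1
  set c3 := |Real.log (2 * δ)| + 2 * CL + 9 with hc3
  have hc3p : 0 < c3 := by positivity
  set CM := (d + 4 : ℝ) * (CL + 3) * (3 * Cw) ^ 2 * c3 with hCM
  have hCMp : 0 < CM := by positivity
  refine ⟨max CM ((1 + C) ^ 2 + 4 * F ^ 2 * C), Cw, lt_max_of_lt_left hCMp, hCw, ?_⟩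
  have hnt := tendsto_natCast_atTop_atTop (R := ℝ)
  have hlogn : ∀ᶠ n : ℕ in atTop, (CL + 3) * Real.log n ≤ n := by
    have h := (Real.isLittleO_log_id_atTop.bound (show (0:ℝ) < 1 / (CL + 3) by positivity))
    filter_upwards [hnt.eventually h, tendsto_log_nat.eventually_ge_atTop 0] with n hn hl
    simp only [id, Real.norm_eq_abs, abs_of_nonneg hl, Nat.abs_cast] at hn
    rw [div_mul_eq_mul_div, le_div_iff₀ (by positivity)] at hn
    linarith
  have hrate : ∀ᶠ n : ℕ in atTop, maxRate P hP n ≤ 1 := by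
    have := tendsto_rate hP hpos' 0
    simp only [Real.rpow_zero, mul_one] at this
    exact this.eventually_le_const one_pos
  filter_upwards [hap, hlogn, tendsto_log_nat.eventually_ge_atTop 1, hnt.eventually_ge_atTop (max (max 1 a) ((κ + 1) * (2 * Cw + d + 1))), hrate] with n hap hLn hl hn hmr
  obtain ⟨⟨hn1, hna⟩, hnk⟩ := (max_le_iff.1 hn).imp_left max_le_iff.1
  have hn1' : 1 ≤ n := by exact_mod_cast hn1
  have hW1 := one_le_maxWidth hP hpos' hn1'
  have hmul := maxRate_mul hP hpos' hn1'
  obtain ⟨hlow2, hlow1⟩ := maxRate_lower hP hpos' hn1'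
  have hmr0 := maxRate_nonneg hP n
  set W := maxWidthExp P hP n with hW
  set mR := maxRate P hP n with hmR
  have hr0' : ((Cw * ⌈W⌉₊ : ℕ):ℝ) ≤ 2 * Cw * W := by
    push_cast
    have : (⌈W⌉₊:ℝ) < W + 1 := Nat.ceil_lt_add_one (by linarith)
    have hc : (0:ℝ) < Cw := by exact_mod_cast hCw
    nlinarith
  generalize hr0 : Cw * ⌈W⌉₊ = r0 at hap hr0' ⊢
  obtain ⟨θ, G, hGm, hGp, hθ, hθG⟩ := hap
  have hL2 : (Ldepth CL n:ℝ) + 2 ≤ (CL + 3) * Real.log n := Ldepth_le hCL hl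
  have hn0 : (0:ℝ) < n := by linarith
  have hCw1 : (1:ℝ) ≤ Cw := by exact_mod_cast hCw
  have hWn : W ≤ n := by
    have : W ^ 2 ≤ (n:ℝ) := by
      have : mR ^ 2 ≤ 1 := pow_le_one₀ hmr0 hmr
      rw [← hmul]; nlinarith
    nlinarith
  set ρ := Real.exp (-((2 * CL + 9) * Real.log n ^ 2)) with hρ
  have hρ0 : 0 < ρ := Real.exp_pos _
  have hρ1 : ρ ≤ 1 := by rw [hρ, Real.exp_le_one_iff]; have : 0 ≤ (2 * CL + 9) * Real.log n ^ 2 := by positivity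
                         linarith
  have hnexp : (n:ℝ) = Real.exp (Real.log n) := (Real.exp_log hn0).symm
  have hQ : (κ + 1) * (r0 + d + 1) ≤ (n:ℝ) ^ 2 := by
    calc (κ + 1) * (r0 + d + 1) ≤ (κ + 1) * (2 * Cw * n + d * n + n) := by
          have h1 : (d:ℝ) ≤ d * n := by nlinarith [Nat.cast_nonneg (α := ℝ) d]
          have h2 : 2 * Cw * W ≤ 2 * Cw * n := by gcongr
          gcongr
          linarith
      _ = ((κ + 1) * (2 * Cw + d + 1)) * n := by ring
      _ ≤ n * n := by gcongr
      _ = _ := by ring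
  have hLip : ((Ldepth CL n) + 2) * a * ((κ + 1) * (r0 + d + 1)) ^ ((Ldepth CL n) + 2) * ρ ≤ mR := by
    refine le_trans ?_ hlow1
    calc ((Ldepth CL n) + 2) * a * ((κ + 1) * (r0 + d + 1)) ^ ((Ldepth CL n) + 2) * ρ ≤ n * n * ((n:ℝ) ^ 2) ^ ((Ldepth CL n) + 2) * ρ := by
          gcongr; linarith
      _ = Real.exp (2 * Real.log n + ((Ldepth CL n) + 2 : ℝ) * (2 * Real.log n) - (2 * CL + 9) * Real.log n ^ 2) := by
          rw [hρ, ← sq]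
          conv_lhs => rw [hnexp]
          rw [← Real.exp_nat_mul, ← Real.exp_nat_mul, Real.log_exp, ← Real.exp_add, ← Real.exp_add]
          congr 1; push_cast; ring
      _ ≤ Real.exp (-Real.log n) := by
          apply Real.exp_le_exp.2
          have h1 : ((Ldepth CL n) + 2 : ℝ) * (2 * Real.log n) ≤ (CL + 3) * Real.log n * (2 * Real.log n) := by gcongr
          nlinarith
      _ = 1 / n := by rw [Real.exp_neg, Real.exp_log hn0, one_div]
  obtain ⟨hBm, hBp⟩ := box_mass (Prθ n r0) (πθ n r0) (hπθdens n r0) θ ρ δ hρ0.le hδ.le (fun θ' h' => hlow n r0 θ' (fun i => by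
    have h1 := h' i
    have h2 := hθ i
    have : |θ' i| ≤ |θ' i - θ i| + |θ i| := by simpa using abs_add_le (θ' i - θ i) (θ i)
    linarith))
  refine ⟨_, hBm, ?_, ?_⟩
  · intro θ' hθ'
    have key := l2_of_good PX f₀ (fun x => trunc F (netOfParams ν d r0 (Ldepth CL n) θ' x)) hfc.measurable
      ((continuous_trunc F).measurable.comp (measurable_netOfParams_right ν d r0 (Ldepth CL n) θ')) F hfF (fun x => trunc_abs_le (by linarith)) G hGm
      ((1 + C) * mR) (C / n) (by positivity) (by positivity) hGp (by
        have hae : ∀ᵐ x ∂PX, x ∈ cube a d := by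
          rw [← prob_compl_eq_zero_iff (cube_measurable a d)] at hsupp
          exact hsupp
        filter_upwards [hae] with x hx hxG
        have h1 : |netOfParams ν d r0 (Ldepth CL n) θ' x - netOfParams ν d r0 (Ldepth CL n) θ x| ≤ mR :=
          (net_lip hν0 hν1 d r0 (Ldepth CL n) θ θ' a (κ + 1) ρ ha (by linarith) (fun i => by linarith [hθ i]) (fun i => by
            have h1 := hθ' i
            have h2 := hθ i
            have : |θ' i| ≤ |θ' i - θ i| + |θ i| := by simpa using abs_add_le (θ' i - θ i) (θ i)
            linarith) hθ' x (fun i => abs_le.2 (hx i))).trans hLip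
        have h2 := hθG x hxG
        calc |trunc F (netOfParams ν d r0 (Ldepth CL n) θ' x) - f₀ x| = |trunc F (netOfParams ν d r0 (Ldepth CL n) θ' x) - trunc F (f₀ x)| := by rw [trunc_eq (hfF x)]
          _ ≤ |netOfParams ν d r0 (Ldepth CL n) θ' x - f₀ x| := trunc_lip _ _ _
          _ ≤ |netOfParams ν d r0 (Ldepth CL n) θ' x - netOfParams ν d r0 (Ldepth CL n) θ x| + |netOfParams ν d r0 (Ldepth CL n) θ x - f₀ x| := abs_sub_le _ _ _
          _ ≤ _ := by linarith)
    refine key.trans ?_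
    calc ((1 + C) * mR) ^ 2 + 4 * F ^ 2 * (C / n) ≤ (1 + C) ^ 2 * mR ^ 2 + 4 * F ^ 2 * (C * mR ^ 2) := by
          rw [mul_pow]
          have : C / n ≤ C * mR ^ 2 := by rw [div_eq_mul_one_div]; gcongr
          gcongr
      _ = ((1 + C) ^ 2 + 4 * F ^ 2 * C) * mR ^ 2 := by ring
      _ ≤ _ := by gcongr; exact le_max_right _ _
  · refine le_trans ?_ hBp
    apply ENNReal.ofReal_le_ofReal
    set T := Fintype.card (ParamIdx d r0 (Ldepth CL n)) with hT
    have h1 : Real.exp (-(c3 * Real.log n ^ 2)) ≤ 2 * ρ * δ := by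
      calc Real.exp (-(c3 * Real.log n ^ 2)) ≤ Real.exp (Real.log (2 * δ) + -((2 * CL + 9) * Real.log n ^ 2)) := by
            apply Real.exp_le_exp.2
            have h2 : -Real.log (2 * δ) ≤ |Real.log (2 * δ)| := neg_le_abs _
            have h3 : |Real.log (2 * δ)| ≤ |Real.log (2 * δ)| * Real.log n ^ 2 := by
              have : 1 ≤ Real.log n ^ 2 := one_le_pow₀ hl
              nlinarith [abs_nonneg (Real.log (2 * δ))]
            rw [hc3]; nlinarith
        _ = 2 * ρ * δ := by rw [Real.exp_add, Real.exp_log (by positivity)]; ring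
    have hTb : (T : ℝ) ≤ (d + 4) * ((CL + 3) * Real.log n) * (3 * Cw * W) ^ 2 := by
      have h1 : (T : ℝ) ≤ ((d + 4) * ((Ldepth CL n) + 1) * (r0 + 1) ^ 2 : ℕ) := by exact_mod_cast card_ParamIdx d r0 (Ldepth CL n)
      push_cast at h1
      refine h1.trans ?_
      have h4 : (1:ℝ) ≤ Cw * W := by nlinarith
      have h3 : (r0:ℝ) + 1 ≤ 3 * Cw * W := by linarith
      gcongr
      linarith
    calc Real.exp (-(max CM ((1 + C) ^ 2 + 4 * F ^ 2 * C) * (W ^ 2 * Real.log n ^ (2 * γ)))) ≤ Real.exp (T * (-(c3 * Real.log n ^ 2))) := by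
          apply Real.exp_le_exp.2
          rw [mul_neg]
          apply neg_le_neg
          calc T * (c3 * Real.log n ^ 2) ≤ ((d + 4) * ((CL + 3) * Real.log n) * (3 * Cw * W) ^ 2) * (c3 * Real.log n ^ 2) := by gcongr
            _ = CM * (W ^ 2 * Real.log n ^ 3) := by rw [hCM]; ring
            _ ≤ max CM ((1 + C) ^ 2 + 4 * F ^ 2 * C) * (W ^ 2 * Real.log n ^ (2 * γ)) := by
              have h2 : Real.log n ^ 3 ≤ Real.log n ^ (2 * γ) := by
                rw [← Real.rpow_natCast]
                exact Real.rpow_le_rpow_of_exponent_le hl (by push_cast; linarith)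
              have h3 := le_max_left CM ((1 + C) ^ 2 + 4 * F ^ 2 * C)
              gcongr
      _ = (Real.exp (-(c3 * Real.log n ^ 2))) ^ T := by rw [Real.exp_nat_mul]
      _ ≤ (2 * ρ * δ) ^ T := by gcongr

theorem sigma_mass (Prσ : Measure ℝ) (qσ : ℝ → ℝ)
    (hqσdens : Prσ = volume.withDensity fun s => ENNReal.ofReal (qσ s)) (s : ℝ) (hs : 0 < s)
    (hqσcont : ContinuousOn qσ (Set.Ioo 0 (2 * s)))
    (hqσposOn : ∀ u ∈ Set.Ioo 0 (2 * s), 0 < qσ u) :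
    ∃ c t0 : ℝ, 0 < c ∧ 0 < t0 ∧ ∀ t, 0 < t → t ≤ t0 → ENNReal.ofReal (c * t) ≤ Prσ (Set.Icc s (s + t)) := by
  have hsm : s ∈ Set.Ioo 0 (2 * s) := ⟨hs, by linarith⟩
  have hc : ContinuousAt qσ s := hqσcont.continuousAt (isOpen_Ioo.mem_nhds hsm)
  have hp := hqσposOn s hsm
  have hev : ∀ᶠ u in nhds s, qσ s / 2 < qσ u := hc.eventually (lt_mem_nhds (by linarith))
  obtain ⟨e, he, hb⟩ := Metric.eventually_nhds_iff.1 hev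
  refine ⟨qσ s / 2, e / 2, by positivity, by positivity, fun t ht hte => ?_⟩
  rw [hqσdens, withDensity_apply _ measurableSet_Icc]
  calc ENNReal.ofReal (qσ s / 2 * t) = ENNReal.ofReal (qσ s / 2) * volume (Set.Icc s (s + t)) := by
        rw [Real.volume_Icc, add_sub_cancel_left, ENNReal.ofReal_mul (by positivity)]
    _ ≤ _ := by
      rw [← setLIntegral_const]
      apply setLIntegral_mono' measurableSet_Icc
      intro u hu
      apply ENNReal.ofReal_le_ofReal
      apply (hb _).le
      rw [Real.dist_eq, abs_of_nonneg (by linarith [hu.1])]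
      linarith [hu.2]


lemma cover_tests {A T : Type*} (J : Finset A) (good : T → Prop) (sep : A → Prop) (Φ : A → T → Prop)
    (h : ∀ a, sep a → ∃ t, good t ∧ Φ a t) :
    ∃ S : Finset T, S.card ≤ J.card ∧ (∀ t ∈ S, good t) ∧ ∀ a ∈ J, sep a → ∃ t ∈ S, Φ a t := by
  classical
  by_cases hT : ∃ a, sep a
  · obtain ⟨a0, ha0⟩ := hT
    have h' : ∀ a, ∃ t, good t ∧ (sep a → Φ a t) := by
      intro a
      by_cases hs : sep a
      · obtain ⟨t, h1, h2⟩ := h a hs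
        exact ⟨t, h1, fun _ => h2⟩
      · obtain ⟨t, h1, h2⟩ := h a0 ha0
        exact ⟨t, h1, fun h => absurd h hs⟩
    choose f hf using h'
    refine ⟨J.image f, Finset.card_image_le, ?_, fun a ha hs => ⟨f a, Finset.mem_image_of_mem f ha, (hf a).2 hs⟩⟩
    intro t ht
    obtain ⟨a, -, rfl⟩ := Finset.mem_image.1 ht
    exact (hf a).1
  · exact ⟨∅, by simp, by simp, fun a _ hs => absurd ⟨a, hs⟩ hT⟩

lemma union_tests {T : Type*} (n : ℕ) (x : ℝ) (hn : 1 ≤ n) (hx1 : 1 ≤ x) (hlog : Real.log n ≤ x) (good : T → Prop)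
    (S0 : Finset T) (h0 : S0.card ≤ 2) (hg0 : ∀ t ∈ S0, good t)
    (S : ℕ → Finset T) (hg : ∀ r, ∀ t ∈ S r, good t) (hS : ∀ r, ((S r).card : ℝ) ≤ Real.exp x) :
    ∃ J : Finset T, (∀ t ∈ J, good t) ∧ (J.card : ℝ) ≤ Real.exp (3 * x) ∧ S0 ⊆ J ∧ ∀ r < n, S r ⊆ J := by
  classical
  refine ⟨S0 ∪ (Finset.range n).biUnion S, ?_, ?_, Finset.subset_union_left, fun r hr => ?_⟩
  · intro t ht
    rcases Finset.mem_union.1 ht with ht | ht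
    · exact hg0 t ht
    · obtain ⟨r, -, hr⟩ := Finset.mem_biUnion.1 ht
      exact hg r t hr
  · have h1 : (((Finset.range n).biUnion S).card : ℝ) ≤ n * Real.exp x := by
      calc (((Finset.range n).biUnion S).card : ℝ) ≤ ∑ r ∈ Finset.range n, ((S r).card : ℝ) := by exact_mod_cast Finset.card_biUnion_le
        _ ≤ ∑ r ∈ Finset.range n, Real.exp x := Finset.sum_le_sum fun r _ => hS r
        _ = _ := by simp
    have h2 : ((S0 ∪ (Finset.range n).biUnion S).card : ℝ) ≤ 2 + n * Real.exp x := by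
      have : ((S0 ∪ (Finset.range n).biUnion S).card : ℝ) ≤ S0.card + ((Finset.range n).biUnion S).card := by exact_mod_cast Finset.card_union_le _ _
      have h0' : (S0.card : ℝ) ≤ 2 := by exact_mod_cast h0
      linarith
    have h3 : (n:ℝ) ≤ Real.exp x := by
      have hn' : (0:ℝ) < n := by exact_mod_cast hn
      rw [← Real.exp_log hn']; exact Real.exp_le_exp.2 hlog
    have h4 : 2 ≤ Real.exp x := by linarith [Real.add_one_le_exp x]
    have h5 : Real.exp (3 * x) = Real.exp x * Real.exp x * Real.exp x := by rw [← Real.exp_add, ← Real.exp_add]; ring_nf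
    rw [h5]
    have h6 := mul_le_mul_of_nonneg_right h3 (Real.exp_pos x).le
    have h7 : 4 ≤ Real.exp x * Real.exp x := by nlinarith
    nlinarith
  · exact (Finset.subset_biUnion_of_mem S (Finset.mem_range.2 hr)).trans Finset.subset_union_right

/-- the truncated blow-up sequence -/
lemma trunc_seq (ε M : ℕ → ℝ) (hε : Tendsto ε atTop (nhds 0)) (hpos : ∀ᶠ n in atTop, 0 < ε n) (hM : Tendsto M atTop atTop) :
    ∃ M' : ℕ → ℝ, Tendsto M' atTop atTop ∧ (∀ n, M' n ≤ M n) ∧ Tendsto (fun n => M' n * ε n) atTop (nhds 0) := by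
  have hinv : Tendsto (fun n => (ε n)⁻¹) atTop atTop := by
    apply Tendsto.inv_tendsto_nhdsGT_zero
    exact tendsto_nhdsWithin_iff.2 ⟨hε, hpos⟩
  have hsq : Tendsto (fun n => Real.sqrt ((ε n)⁻¹)) atTop atTop := Real.tendsto_sqrt_atTop.comp hinv
  refine ⟨fun n => min (M n) (Real.sqrt ((ε n)⁻¹)), tendsto_atTop.2 fun b => by
    filter_upwards [hM.eventually_ge_atTop b, hsq.eventually_ge_atTop b] with n h1 h2 using le_min h1 h2, fun n => min_le_left _ _, ?_⟩
  have hs0 : Tendsto (fun n => Real.sqrt (ε n)) atTop (nhds 0) := by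
    have := (Real.continuous_sqrt.tendsto 0).comp hε
    simpa [Function.comp_def] using this
  refine squeeze_zero' ?_ ?_ hs0
  · filter_upwards [hpos, hM.eventually_ge_atTop 0] with n h1 h2
    have : 0 ≤ min (M n) (Real.sqrt ((ε n)⁻¹)) := le_min h2 (Real.sqrt_nonneg _)
    positivity
  · filter_upwards [hpos] with n h1
    calc min (M n) (Real.sqrt ((ε n)⁻¹)) * ε n ≤ Real.sqrt ((ε n)⁻¹) * ε n := by gcongr; exact min_le_right _ _
      _ = Real.sqrt (ε n) := by
        rw [Real.sqrt_inv]
        have h := Real.mul_self_sqrt h1.le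
        have h2 := Real.sqrt_pos.2 h1
        nth_rw 2 [← h]
        field_simp

/-- asymptotic facts about the rate -/
lemma rate_facts {P : Finset (ℝ × ℕ)} (hP : P.Nonempty) (hpos : ∀ p ∈ P, 0 < p.1) (γ : ℝ) (hγ : 5 / 2 < γ) (ε : ℕ → ℝ)
    (hε : ∀ n : ℕ, ε n = maxRate P hP n * Real.log n ^ γ) :
    Tendsto ε atTop (nhds 0) ∧ ∀ᶠ n : ℕ in atTop, 0 < ε n ∧ 1 / (n:ℝ) ≤ ε n ∧
      n * ε n ^ 2 = maxWidthExp P hP n ^ 2 * Real.log n ^ (2 * γ) ∧ n * ε n ^ 2 ≤ n ∧ Real.log n ≤ n * ε n ^ 2 ∧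
      1 ≤ maxWidthExp P hP n ∧ 1 ≤ Real.log n ∧ 1 ≤ n := by
  have h0 : Tendsto ε atTop (nhds 0) := by
    have := tendsto_rate hP hpos γ
    exact this.congr fun n => (hε n).symm
  refine ⟨h0, ?_⟩
  filter_upwards [tendsto_log_nat.eventually_ge_atTop 1, eventually_ge_atTop 1, h0.eventually_le_const one_pos] with n hl hn hle
  have hn0 : (0:ℝ) < n := by exact_mod_cast hn
  obtain ⟨hlow2, hlow1⟩ := maxRate_lower hP hpos hn
  have hlg : 1 ≤ Real.log n ^ γ := Real.one_le_rpow hl (by linarith)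
  have hW1 := one_le_maxWidth hP hpos hn
  have hmul := maxRate_mul hP hpos hn
  have hm0 := maxRate_nonneg hP n
  have hge : 1 / (n:ℝ) ≤ ε n := by rw [hε]; nlinarith
  have he0 : 0 < ε n := lt_of_lt_of_le (by positivity) hge
  have hx : n * ε n ^ 2 = maxWidthExp P hP n ^ 2 * Real.log n ^ (2 * γ) := by
    rw [hε, mul_pow, ← mul_assoc, hmul, ← Real.rpow_natCast (Real.log n ^ γ), ← Real.rpow_mul (by linarith), mul_comm γ]; norm_num
  refine ⟨he0, hge, hx, ?_, ?_, hW1, hl, hn⟩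
  · have : ε n ^ 2 ≤ 1 := pow_le_one₀ he0.le hle
    nlinarith
  · rw [hx]
    have : Real.log n ≤ Real.log n ^ (2 * γ) := by
      conv_lhs => rw [← Real.rpow_one (Real.log n)]
      exact Real.rpow_le_rpow_of_exponent_le hl (by linarith)
    have hW2 : 1 ≤ maxWidthExp P hP n ^ 2 := one_le_pow₀ hW1
    nlinarith

/-- widths below the cut-off satisfy the covering condition -/
lemma width_cond {W l K γ : ℝ} {r : ℕ} {x : ℝ} (hl : 1 ≤ l) (hx : x = W ^ 2 * l ^ (2 * γ)) (hr : (r:ℝ) ≤ K * W * l ^ (γ - 5 / 2)) :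
    (r:ℝ) ^ 2 * l ^ 5 ≤ K ^ 2 * x := by
  have : l ^ (2 * γ) = l ^ 5 * (l ^ (γ - 5 / 2)) ^ 2 := by
    rw [← Real.rpow_natCast (l ^ (γ - 5 / 2)), ← Real.rpow_natCast, ← Real.rpow_mul (by linarith), ← Real.rpow_add (by linarith)]
    congr 1; push_cast; ring
  rw [hx, this]
  have h1 : (r:ℝ) ^ 2 ≤ (K * W * l ^ (γ - 5 / 2)) ^ 2 := by gcongr
  calc (r:ℝ) ^ 2 * l ^ 5 ≤ (K * W * l ^ (γ - 5 / 2)) ^ 2 * l ^ 5 := by gcongr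
    _ = _ := by ring

lemma exp_pow_n (c η : ℝ) (n : ℕ) (y : ℝ) (h : y = c * (n * η ^ 2)) :
    (ENNReal.ofReal (Real.exp (-(c * η ^ 2)))) ^ n ≤ ENNReal.ofReal (Real.exp (-y)) := by
  rw [← ENNReal.ofReal_pow (Real.exp_pos _).le, ← Real.exp_nat_mul, h]
  apply le_of_eq; congr 2; ring


lemma l2dist_sq (d : ℕ) (PX : Measure (Fin d → ℝ)) (g h : (Fin d → ℝ) → ℝ) : l2dist d PX g h ^ 2 = ∫ x, (g x - h x) ^ 2 ∂PX := by
  unfold l2dist; rw [Real.sq_sqrt (integral_nonneg fun x => sq_nonneg _)]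

lemma l2dist_nonneg' (d : ℕ) (PX : Measure (Fin d → ℝ)) (g h : (Fin d → ℝ) → ℝ) : 0 ≤ l2dist d PX g h := Real.sqrt_nonneg _

/-- goodness of a test -/
def goodT {Z : Type*} [MeasurableSpace Z] (μ : Measure Z) (e : ℝ≥0∞) (T : Z → ℝ≥0∞) : Prop :=
  Measurable T ∧ (∀ z, T z ≠ ∞) ∧ ∫⁻ z, T z ∂μ ≤ e

lemma goodT_exp {Z : Type*} [MeasurableSpace Z] (μ : Measure Z) (e : ℝ≥0∞) (T : Z → ℝ) (hT : Measurable T)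
    (h : ∫⁻ z, ENNReal.ofReal (Real.exp (T z)) ∂μ ≤ e) : goodT μ e (fun z => ENNReal.ofReal (Real.exp (T z))) :=
  ⟨by fun_prop, fun z => ENNReal.ofReal_ne_top, h⟩

theorem gauss_htest {d : ℕ} {P : Finset (ℝ × ℕ)} (hP : P.Nonempty) (hpos : ∀ p ∈ P, 0 < p.1) {F : ℝ} (hF : 1 ≤ F)
    (f₀ : (Fin d → ℝ) → ℝ) (hfm : Measurable f₀) (hfF : ∀ x, |f₀ x| ≤ F)
    (PX : Measure (Fin d → ℝ)) [IsProbabilityMeasure PX] {ν : ℝ} (hν1 : ν < 1) {CL : ℝ} (hCL : 0 < CL) (s : ℝ) (hs : 0 < s)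
    (γ : ℝ) (hγ : 5 / 2 < γ) (ε : ℕ → ℝ) (hε : ∀ n : ℕ, ε n = maxRate P hP n * Real.log n ^ γ)
    (M : ℕ → ℝ) (hM : Tendsto M atTop atTop) :
    ∃ m : ℕ → ℝ, Tendsto m atTop atTop ∧ ∀ K : ℝ, 0 < K → ∀ᶠ n : ℕ in atTop, ∃ (J : Finset ((Fin d → ℝ) × ℝ → ℝ≥0∞)) (e : ℝ≥0∞),
      (∀ T ∈ J, Measurable T) ∧ (∀ T ∈ J, ∀ z, T z ≠ ∞) ∧ (J.card : ℝ) ≤ Real.exp (3 * (n * ε n ^ 2)) ∧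
      e ^ n ≤ ENNReal.ofReal (Real.exp (-(m n * (n * ε n ^ 2)))) ∧ (∀ T ∈ J, ∫⁻ z, T z ∂(gaussRegLaw d PX f₀ (Real.toNNReal s)) ≤ e) ∧
      ∀ r : ℕ, r ≠ 0 → (r:ℝ) ≤ K * maxWidthExp P hP n * Real.log n ^ (γ - 5 / 2) →
        ∀ p : (ParamIdx d r (Ldepth CL n) → ℝ) × ℝ, M n * ε n < l2dist d PX
            (fun x => trunc F (netOfParams ν d r (Ldepth CL n) p.1 x)) f₀ + |p.2 - s| →
        (∃ T ∈ J, ∫⁻ z, gratio f₀ s (fun x => trunc F (netOfParams ν d r (Ldepth CL n) p.1 x)) p.2 z * (T z)⁻¹ ∂(gaussRegLaw d PX f₀ (Real.toNNReal s)) ≤ e) ∨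
          ∀ z, gratio f₀ s (fun x => trunc F (netOfParams ν d r (Ldepth CL n) p.1 x)) p.2 z = 0 := by
  classical
  obtain ⟨hε0, hev⟩ := rate_facts hP hpos γ hγ ε hε
  obtain ⟨M', hM', hMM, hMε⟩ := trunc_seq ε M hε0 (hev.mono fun n h => h.1) hM
  obtain ⟨c, η0, hc, hη0, hη01, htests⟩ := gauss_tests d PX f₀ hfm F hF hfF s hs
  refine ⟨fun n => c / 4 * M' n ^ 2, ?_, ?_⟩
  · exact ((tendsto_pow_atTop (by norm_num : (2:ℕ) ≠ 0)).comp hM').const_mul_atTop (by positivity)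
  intro K hK
  have hcov := cover_ev ν hν1 d hCL F hF PX (fun n => n * ε n ^ 2) (hev.mono fun n h => h.2.2.2.1) K hK
  filter_upwards [hev, hcov, hM'.eventually_ge_atTop 32, hMε.eventually_le_const hη0] with n ⟨he0, heL, hx, hxn, hxl, hW1, hl1, hn1⟩ hcov hM32 hMη
  have hMn := hMM n
  generalize hηd : M' n * ε n / 2 = η
  have hηp : 0 < η := by rw [← hηd]; have : 0 < M' n := by linarith
                         positivity
  have hηle : η ≤ η0 := by linarith
  have hη16 : 1 / (n:ℝ) ≤ η / 16 := by nlinarith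
  have hbad2 : 2 * η ≤ M n * ε n := by nlinarith
  obtain ⟨⟨T1, hT1m, hT1e, hT1⟩, ⟨T2, hT2m, hT2e, hT2⟩, htest3⟩ := htests η hηp hηle
  generalize hμ : gaussRegLaw d PX f₀ (Real.toNNReal s) = μ at *
  generalize hed : ENNReal.ofReal (Real.exp (-(c * η ^ 2))) = e at *
  have hmeasN : ∀ r (θ : ParamIdx d r (Ldepth CL n) → ℝ), Measurable (fun x => trunc F (netOfParams ν d r (Ldepth CL n) θ x)) :=
    fun r θ => (continuous_trunc F).measurable.comp (measurable_netOfParams_right ν d r _ θ)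
  have hbN : ∀ r (θ : ParamIdx d r (Ldepth CL n) → ℝ) x, |trunc F (netOfParams ν d r (Ldepth CL n) θ x)| ≤ F :=
    fun r θ x => trunc_abs_le (by linarith)
  have hS : ∀ r : ℕ, ∃ S : Finset ((Fin d → ℝ) × ℝ → ℝ≥0∞), (∀ T ∈ S, goodT μ e T) ∧ (S.card : ℝ) ≤ Real.exp (n * ε n ^ 2) ∧
      (r ≠ 0 → (r:ℝ) ≤ K * maxWidthExp P hP n * Real.log n ^ (γ - 5 / 2) → r < n ∧
        ∀ θ : ParamIdx d r (Ldepth CL n) → ℝ, η ^ 2 < ∫ x, (trunc F (netOfParams ν d r (Ldepth CL n) θ x) - f₀ x) ^ 2 ∂PX →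
          ∀ v, 0 < v → v ≤ s + 1 → ∃ T ∈ S, ∫⁻ z, gratio f₀ s (fun x => trunc F (netOfParams ν d r (Ldepth CL n) θ x)) v z * (T z)⁻¹ ∂μ ≤ e) := by
    intro r
    by_cases hr : r ≠ 0 ∧ (r:ℝ) ≤ K * maxWidthExp P hP n * Real.log n ^ (γ - 5 / 2)
    · obtain ⟨hr0, hrK⟩ := hr
      obtain ⟨hrn, Jc, hJc, hJ⟩ := hcov r hr0 (width_cond hl1 hx hrK) (η / 16) hη16
      obtain ⟨S, hSc, hSg, hSs⟩ := cover_tests Jc (goodT μ e)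
        (fun θ' => 3 / 4 * η ^ 2 ≤ ∫ x, (trunc F (netOfParams ν d r (Ldepth CL n) θ' x) - f₀ x) ^ 2 ∂PX)
        (fun θ' T => ∀ h : (Fin d → ℝ) → ℝ, Measurable h → (∀ x, |h x| ≤ F) → ∀ v, 0 < v → v ≤ s + 1 →
          ∫ x, (h x - trunc F (netOfParams ν d r (Ldepth CL n) θ' x)) ^ 2 ∂PX ≤ (η / 16) ^ 2 →
          ∫⁻ z, gratio f₀ s h v z * (T z)⁻¹ ∂μ ≤ e) (by
          intro θ' hθ'
          obtain ⟨T, hTm, hTe, hT⟩ := htest3 _ (hmeasN r θ') (hbN r θ') hθ'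
          exact ⟨_, goodT_exp μ e T hTm hTe, hT⟩)
      refine ⟨S, hSg, le_trans (by exact_mod_cast hSc) hJc, fun _ _ => ⟨by omega, ?_⟩⟩
      intro θ hθ v hv hvs
      obtain ⟨θ', hθ'J, hd⟩ := hJ θ
      have hd2 : ∫ x, (trunc F (netOfParams ν d r (Ldepth CL n) θ x) - trunc F (netOfParams ν d r (Ldepth CL n) θ' x)) ^ 2 ∂PX ≤ (η / 16) ^ 2 := by
        rw [← l2dist_sq d PX (fun x => trunc F (netOfParams ν d r (Ldepth CL n) θ x)) (fun x => trunc F (netOfParams ν d r (Ldepth CL n) θ' x))]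
        exact pow_le_pow_left₀ (l2dist_nonneg' _ _ _ _) hd 2
      have hsep := sq_dist_lower PX (fun x => trunc F (netOfParams ν d r (Ldepth CL n) θ x)) f₀ (fun x => trunc F (netOfParams ν d r (Ldepth CL n) θ' x))
        (hmeasN r θ) hfm (hmeasN r θ') F η (hbN r θ) hfF (hbN r θ') hθ hd2
      obtain ⟨T, hTS, hT⟩ := hSs θ' hθ'J hsep
      exact ⟨T, hTS, hT _ (hmeasN r θ) (hbN r θ) v hv hvs hd2⟩
    · exact ⟨∅, by simp, by simpa using (Real.exp_pos _).le, fun h1 h2 => absurd ⟨h1, h2⟩ hr⟩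
  choose S hSg hSc hSs using hS
  have g1 := goodT_exp μ e T1 hT1m hT1e
  have g2 := goodT_exp μ e T2 hT2m hT2e
  obtain ⟨J, hJg, hJc, hJ0, hJS⟩ := union_tests n (n * ε n ^ 2) hn1 (by linarith) hxl (goodT μ e)
    {fun z => ENNReal.ofReal (Real.exp (T1 z)), fun z => ENNReal.ofReal (Real.exp (T2 z))} Finset.card_le_two
    (by intro t ht; simp only [Finset.mem_insert, Finset.mem_singleton] at ht; rcases ht with rfl | rfl; exacts [g1, g2]) S hSg hSc
  refine ⟨J, e, fun T hT => (hJg T hT).1, fun T hT => (hJg T hT).2.1, hJc, ?_, fun T hT => (hJg T hT).2.2, ?_⟩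
  · rw [← hed]
    apply exp_pow_n
    rw [← hηd]; ring
  intro r hr0 hrK p hp
  obtain ⟨hrn, hSr⟩ := hSs r hr0 hrK
  rcases le_or_gt p.2 0 with hv | hv
  · right; intro z
    simp [gratio, gpdf_of_nonpos _ _ _ hv]
  left
  rcases le_or_gt (s + η) p.2 with hv1 | hv1
  · exact ⟨_, hJ0 (by simp), hT1 _ (hmeasN r p.1) (hbN r p.1) p.2 hv1⟩
  rcases lt_or_ge (η ^ 2) (∫ x, (trunc F (netOfParams ν d r (Ldepth CL n) p.1 x) - f₀ x) ^ 2 ∂PX) with hl | hl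
  · obtain ⟨T, hTS, hT⟩ := hSr p.1 hl p.2 hv (by linarith)
    exact ⟨T, hJS r hrn hTS, hT⟩
  · have h1 : l2dist d PX (fun x => trunc F (netOfParams ν d r (Ldepth CL n) p.1 x)) f₀ ≤ η := by
      apply abs_le_of_sq_le_sq' _ hηp.le |>.2
      rw [l2dist_sq]; exact hl
    have h2 : η < |p.2 - s| := by linarith
    have h3 : p.2 ≤ s - η := by
      rcases lt_abs.1 h2 with h | h <;> linarith
    exact ⟨_, hJ0 (by simp), hT2 _ (hmeasN r p.1) (hbN r p.1) p.2 hv h3 hl⟩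

theorem bern_htest {d : ℕ} {P : Finset (ℝ × ℕ)} (hP : P.Nonempty) (hpos : ∀ p ∈ P, 0 < p.1) {F : ℝ} (hF : 1 ≤ F)
    (f₀ : (Fin d → ℝ) → ℝ) (hfm : Measurable f₀) (hfF : ∀ x, |f₀ x| ≤ F)
    (PX : Measure (Fin d → ℝ)) [IsProbabilityMeasure PX] {ν : ℝ} (hν1 : ν < 1) {CL : ℝ} (hCL : 0 < CL)
    (γ : ℝ) (hγ : 5 / 2 < γ) (ε : ℕ → ℝ) (hε : ∀ n : ℕ, ε n = maxRate P hP n * Real.log n ^ γ)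
    (M : ℕ → ℝ) (hM : Tendsto M atTop atTop) :
    ∃ m : ℕ → ℝ, Tendsto m atTop atTop ∧ ∀ K : ℝ, 0 < K → ∀ᶠ n : ℕ in atTop, ∃ (J : Finset ((Fin d → ℝ) × ℝ → ℝ≥0∞)) (e : ℝ≥0∞),
      (∀ T ∈ J, Measurable T) ∧ (∀ T ∈ J, ∀ z, T z ≠ ∞) ∧ (J.card : ℝ) ≤ Real.exp (3 * (n * ε n ^ 2)) ∧
      e ^ n ≤ ENNReal.ofReal (Real.exp (-(m n * (n * ε n ^ 2)))) ∧ (∀ T ∈ J, ∫⁻ z, T z ∂(logisticLaw d PX f₀) ≤ e) ∧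
      ∀ r : ℕ, r ≠ 0 → (r:ℝ) ≤ K * maxWidthExp P hP n * Real.log n ^ (γ - 5 / 2) →
        ∀ θ : ParamIdx d r (Ldepth CL n) → ℝ, M n * ε n < l2dist d PX
            (fun x => sigmoid (trunc F (netOfParams ν d r (Ldepth CL n) θ x))) (fun x => sigmoid (f₀ x)) →
        (∃ T ∈ J, ∫⁻ z, bratio (fun x => sigmoid (f₀ x)) (fun x => sigmoid (trunc F (netOfParams ν d r (Ldepth CL n) θ x))) z * (T z)⁻¹ ∂(logisticLaw d PX f₀) ≤ e) ∨
          ∀ z, bratio (fun x => sigmoid (f₀ x)) (fun x => sigmoid (trunc F (netOfParams ν d r (Ldepth CL n) θ x))) z = 0 := by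
  classical
  obtain ⟨hε0, hev⟩ := rate_facts hP hpos γ hγ ε hε
  obtain ⟨M', hM', hMM, hMε⟩ := trunc_seq ε M hε0 (hev.mono fun n h => h.1) hM
  obtain ⟨c, hc, htests⟩ := bern_tests d PX f₀ hfm
  refine ⟨fun n => c * M' n ^ 2, ?_, ?_⟩
  · exact ((tendsto_pow_atTop (by norm_num : (2:ℕ) ≠ 0)).comp hM').const_mul_atTop (by positivity)
  intro K hK
  have hcov := cover_ev ν hν1 d hCL F hF PX (fun n => n * ε n ^ 2) (hev.mono fun n h => h.2.2.2.1) K hK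
  filter_upwards [hev, hcov, hM'.eventually_ge_atTop 32] with n ⟨he0, heL, hx, hxn, hxl, hW1, hl1, hn1⟩ hcov hM32
  have hMn := hMM n
  generalize hηd : M' n * ε n = η
  have hηp : 0 < η := by rw [← hηd]; have : 0 < M' n := by linarith
                         positivity
  have hη16 : 1 / (n:ℝ) ≤ η / 16 := by nlinarith
  have hbad2 : η ≤ M n * ε n := by nlinarith
  have htest3 := htests η hηp
  generalize hμ : logisticLaw d PX f₀ = μ at *
  generalize hed : ENNReal.ofReal (Real.exp (-(c * η ^ 2))) = e at *
  have hs0 : ∀ x, 0 ≤ sigmoid x := fun x => (sigmoid_pos' _).le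
  have hs1 : ∀ x, sigmoid x ≤ 1 := fun x => (sigmoid_lt_one' _).le
  have hsa : ∀ x, |sigmoid x| ≤ 1 := fun x => by rw [abs_of_nonneg (hs0 x)]; exact hs1 x
  have hsm := continuous_sigmoid'.measurable
  have hmeasN : ∀ r (θ : ParamIdx d r (Ldepth CL n) → ℝ), Measurable (fun x => trunc F (netOfParams ν d r (Ldepth CL n) θ x)) :=
    fun r θ => (continuous_trunc F).measurable.comp (measurable_netOfParams_right ν d r _ θ)
  have hmeasS : ∀ r (θ : ParamIdx d r (Ldepth CL n) → ℝ), Measurable (fun x => sigmoid (trunc F (netOfParams ν d r (Ldepth CL n) θ x))) :=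
    fun r θ => hsm.comp (hmeasN r θ)
  have hbN : ∀ r (θ : ParamIdx d r (Ldepth CL n) → ℝ) x, |trunc F (netOfParams ν d r (Ldepth CL n) θ x)| ≤ F :=
    fun r θ x => trunc_abs_le (by linarith)
  have hS : ∀ r : ℕ, ∃ S : Finset ((Fin d → ℝ) × ℝ → ℝ≥0∞), (∀ T ∈ S, goodT μ e T) ∧ (S.card : ℝ) ≤ Real.exp (n * ε n ^ 2) ∧
      (r ≠ 0 → (r:ℝ) ≤ K * maxWidthExp P hP n * Real.log n ^ (γ - 5 / 2) → r < n ∧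
        ∀ θ : ParamIdx d r (Ldepth CL n) → ℝ, η ^ 2 < ∫ x, (sigmoid (trunc F (netOfParams ν d r (Ldepth CL n) θ x)) - sigmoid (f₀ x)) ^ 2 ∂PX →
          ∃ T ∈ S, ∫⁻ z, bratio (fun x => sigmoid (f₀ x)) (fun x => sigmoid (trunc F (netOfParams ν d r (Ldepth CL n) θ x))) z * (T z)⁻¹ ∂μ ≤ e) := by
    intro r
    by_cases hr : r ≠ 0 ∧ (r:ℝ) ≤ K * maxWidthExp P hP n * Real.log n ^ (γ - 5 / 2)
    · obtain ⟨hr0, hrK⟩ := hr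
      obtain ⟨hrn, Jc, hJc, hJ⟩ := hcov r hr0 (width_cond hl1 hx hrK) (η / 16) hη16
      obtain ⟨S, hSc, hSg, hSs⟩ := cover_tests Jc (goodT μ e)
        (fun θ' => 3 / 4 * η ^ 2 ≤ ∫ x, (sigmoid (trunc F (netOfParams ν d r (Ldepth CL n) θ' x)) - sigmoid (f₀ x)) ^ 2 ∂PX)
        (fun θ' T => ∀ p1 : (Fin d → ℝ) → ℝ, Measurable p1 → (∀ x, 0 ≤ p1 x) → (∀ x, p1 x ≤ 1) →
          ∫ x, (p1 x - sigmoid (trunc F (netOfParams ν d r (Ldepth CL n) θ' x))) ^ 2 ∂PX ≤ (η / 16) ^ 2 →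
          ∫⁻ z, bratio (fun x => sigmoid (f₀ x)) p1 z * (T z)⁻¹ ∂μ ≤ e) (by
          intro θ' hθ'
          obtain ⟨T, hTm, hTe, hT⟩ := htest3 _ (hmeasS r θ') (fun x => hs0 _) (fun x => hs1 _) hθ'
          exact ⟨_, goodT_exp μ e T hTm hTe, hT⟩)
      refine ⟨S, hSg, le_trans (by exact_mod_cast hSc) hJc, fun _ _ => ⟨by omega, ?_⟩⟩
      intro θ hθ
      obtain ⟨θ', hθ'J, hd⟩ := hJ θ
      have hd2 : ∫ x, (trunc F (netOfParams ν d r (Ldepth CL n) θ x) - trunc F (netOfParams ν d r (Ldepth CL n) θ' x)) ^ 2 ∂PX ≤ (η / 16) ^ 2 := by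
        rw [← l2dist_sq d PX (fun x => trunc F (netOfParams ν d r (Ldepth CL n) θ x)) (fun x => trunc F (netOfParams ν d r (Ldepth CL n) θ' x))]
        exact pow_le_pow_left₀ (l2dist_nonneg' _ _ _ _) hd 2
      have hd3 : ∫ x, (sigmoid (trunc F (netOfParams ν d r (Ldepth CL n) θ x)) - sigmoid (trunc F (netOfParams ν d r (Ldepth CL n) θ' x))) ^ 2 ∂PX ≤ (η / 16) ^ 2 := by
        refine le_trans (integral_mono_of_nonneg (Eventually.of_forall fun x => sq_nonneg _) ?_ (Eventually.of_forall fun x => ?_)) hd2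
        · have m1 := hmeasN r θ
          have m2 := hmeasN r θ'
          apply Integrable.of_bound (by fun_prop) (4 * F ^ 2) (Eventually.of_forall fun x => ?_)
          rw [Real.norm_eq_abs, abs_of_nonneg (sq_nonneg _)]
          have h1 := abs_le.1 (hbN r θ x)
          have h2 := abs_le.1 (hbN r θ' x)
          nlinarith
        · exact sq_le_sq.2 (sigmoid_lip _ _)
      have hsep := sq_dist_lower PX (fun x => sigmoid (trunc F (netOfParams ν d r (Ldepth CL n) θ x))) (fun x => sigmoid (f₀ x)) (fun x => sigmoid (trunc F (netOfParams ν d r (Ldepth CL n) θ' x)))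
        (hmeasS r θ) (hsm.comp hfm) (hmeasS r θ') 1 η (fun x => hsa _) (fun x => hsa _) (fun x => hsa _) hθ hd3
      obtain ⟨T, hTS, hT⟩ := hSs θ' hθ'J hsep
      exact ⟨T, hTS, hT _ (hmeasS r θ) (fun x => hs0 _) (fun x => hs1 _) hd3⟩
    · exact ⟨∅, by simp, by simpa using (Real.exp_pos _).le, fun h1 h2 => absurd ⟨h1, h2⟩ hr⟩
  choose S hSg hSc hSs using hS
  obtain ⟨J, hJg, hJc, hJ0, hJS⟩ := union_tests n (n * ε n ^ 2) hn1 (by linarith) hxl (goodT μ e) ∅ (by simp) (by simp) S hSg hSc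
  refine ⟨J, e, fun T hT => (hJg T hT).1, fun T hT => (hJg T hT).2.1, hJc, ?_, fun T hT => (hJg T hT).2.2, ?_⟩
  · rw [← hed]
    apply exp_pow_n
    rw [← hηd]; ring
  intro r hr0 hrK θ hp
  obtain ⟨hrn, hSr⟩ := hSs r hr0 hrK
  left
  obtain ⟨T, hTS, hT⟩ := hSr θ (by
    rw [← l2dist_sq d PX (fun x => sigmoid (trunc F (netOfParams ν d r (Ldepth CL n) θ x))) (fun x => sigmoid (f₀ x))]
    exact pow_lt_pow_left₀ (by linarith) hηp.le (by norm_num))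
  exact ⟨T, hJS r hrn hTS, hT⟩


lemma ratio_cancel {A : ℕ → Type} [∀ r, MeasurableSpace (A r)] (w : ℕ → ℝ≥0∞) (Pr : ∀ r, Measure (A r)) (Bad : ∀ r, Set (A r))
    (k : ℝ≥0∞) (hk0 : k ≠ 0) (hk : k ≠ ∞) (l g : ∀ r, A r → ℝ≥0∞) (h : ∀ r p, l r p = k * g r p) :
    (∑' r, w r * ∫⁻ p in Bad r, l r p ∂(Pr r)) / (∑' r, w r * ∫⁻ p, l r p ∂(Pr r)) =
      (∑' r, w r * ∫⁻ p in Bad r, g r p ∂(Pr r)) / (∑' r, w r * ∫⁻ p, g r p ∂(Pr r)) := by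
  have h1 : ∀ (Q : ∀ r, Measure (A r)), (∑' r, w r * ∫⁻ p, l r p ∂(Q r)) = k * ∑' r, w r * ∫⁻ p, g r p ∂(Q r) := by
    intro Q
    rw [← ENNReal.tsum_mul_left]
    congr 1; ext r
    simp only [h]
    rw [lintegral_const_mul' _ _ hk]; ring
  rw [h1 Pr, h1 fun r => (Pr r).restrict (Bad r), ENNReal.mul_div_mul_left _ _ hk0 hk]

lemma gauss_lik_eq {d r L n : ℕ} (ν F : ℝ) (f₀ : (Fin d → ℝ) → ℝ) (s : ℝ) (hs : 0 < s) (D : Fin n → (Fin d → ℝ) × ℝ) (p : (ParamIdx d r L → ℝ) × ℝ) :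
    ENNReal.ofReal (gaussLik ν F d r L D p) = ENNReal.ofReal (∏ i, gpdf (f₀ (D i).1) s (D i).2) *
      ∏ i, gratio f₀ s (fun x => trunc F (netOfParams ν d r L p.1 x)) p.2 (D i) := by
  unfold gaussLik gratio
  rw [← ENNReal.ofReal_prod_of_nonneg (fun i _ => div_nonneg (gpdf_nonneg _ _ _) (gpdf_nonneg _ _ _)),
    ← ENNReal.ofReal_mul (Finset.prod_nonneg fun i _ => gpdf_nonneg _ _ _), ← Finset.prod_mul_distrib]
  congr 1
  apply Finset.prod_congr rfl
  intro i _
  rw [mul_div_cancel₀ _ (gpdf_pos _ _ _ hs).ne']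

lemma bern_lik_eq {d r L n : ℕ} (ν F : ℝ) (f₀ : (Fin d → ℝ) → ℝ) (D : Fin n → (Fin d → ℝ) × ℝ) (θ : ParamIdx d r L → ℝ) :
    ENNReal.ofReal (bernLik ν F d r L D θ) = ENNReal.ofReal (∏ i, bdens (sigmoid (f₀ (D i).1)) (D i).2) *
      ∏ i, bratio (fun x => sigmoid (f₀ x)) (fun x => sigmoid (trunc F (netOfParams ν d r L θ x))) (D i) := by
  have hb : ∀ u y, 0 < bdens (sigmoid u) y := fun u y => bdens_pos (sigmoid_pos' u) (sigmoid_lt_one' u) y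
  unfold bernLik bratio
  rw [← ENNReal.ofReal_prod_of_nonneg (fun i _ => div_nonneg (hb _ _).le (hb _ _).le),
    ← ENNReal.ofReal_mul (Finset.prod_nonneg fun i _ => (hb _ _).le), ← Finset.prod_mul_distrib]
  congr 1
  apply Finset.prod_congr rfl
  intro i _
  rw [mul_div_cancel₀ _ (hb _ _).ne']; rfl

lemma meas_joint (ν F : ℝ) (d r L : ℕ) : Measurable (fun q : (ParamIdx d r L → ℝ) × (Fin d → ℝ) => trunc F (netOfParams ν d r L q.1 q.2)) :=
  ((continuous_trunc F).comp (continuous_netOfParams ν d r L)).measurable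

lemma meas_rho_gauss (ν F : ℝ) (d r L : ℕ) (f₀ : (Fin d → ℝ) → ℝ) (hf : Measurable f₀) (s : ℝ) :
    Measurable (Function.uncurry fun (p : (ParamIdx d r L → ℝ) × ℝ) (z : (Fin d → ℝ) × ℝ) =>
      gratio f₀ s (fun x => trunc F (netOfParams ν d r L p.1 x)) p.2 z) := by
  have h1 := meas_joint ν F d r L
  have h2 : Measurable (fun q : ((ParamIdx d r L → ℝ) × ℝ) × ((Fin d → ℝ) × ℝ) => trunc F (netOfParams ν d r L q.1.1 q.2.1)) :=
    h1.comp (by fun_prop : Measurable fun q : ((ParamIdx d r L → ℝ) × ℝ) × ((Fin d → ℝ) × ℝ) => (q.1.1, q.2.1))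
  have h3 : Measurable (fun q : ((ParamIdx d r L → ℝ) × ℝ) × ((Fin d → ℝ) × ℝ) => gpdf (trunc F (netOfParams ν d r L q.1.1 q.2.1)) q.1.2 q.2.2) :=
    measurable_gpdf.comp (h2.prodMk (by fun_prop : Measurable fun q : ((ParamIdx d r L → ℝ) × ℝ) × ((Fin d → ℝ) × ℝ) => (q.1.2, q.2.2)))
  have h4 : Measurable (fun q : ((ParamIdx d r L → ℝ) × ℝ) × ((Fin d → ℝ) × ℝ) => gpdf (f₀ q.2.1) s q.2.2) :=
    measurable_gpdf.comp ((hf.comp (by fun_prop : Measurable fun q : ((ParamIdx d r L → ℝ) × ℝ) × ((Fin d → ℝ) × ℝ) => q.2.1)).prodMk (by fun_prop : Measurable fun q : ((ParamIdx d r L → ℝ) × ℝ) × ((Fin d → ℝ) × ℝ) => (s, q.2.2)))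
  exact (h3.div h4).ennreal_ofReal

lemma meas_rho_bern (ν F : ℝ) (d r L : ℕ) (f₀ : (Fin d → ℝ) → ℝ) (hf : Measurable f₀) :
    Measurable (Function.uncurry fun (θ : ParamIdx d r L → ℝ) (z : (Fin d → ℝ) × ℝ) =>
      bratio (fun x => sigmoid (f₀ x)) (fun x => sigmoid (trunc F (netOfParams ν d r L θ x))) z) := by
  have hsm := continuous_sigmoid'.measurable
  have h1 := meas_joint ν F d r L
  have h2 : Measurable (fun q : (ParamIdx d r L → ℝ) × ((Fin d → ℝ) × ℝ) => trunc F (netOfParams ν d r L q.1 q.2.1)) :=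
    h1.comp (by fun_prop : Measurable fun q : (ParamIdx d r L → ℝ) × ((Fin d → ℝ) × ℝ) => (q.1, q.2.1))
  have h3 : Measurable (fun q : (ParamIdx d r L → ℝ) × ((Fin d → ℝ) × ℝ) => bdens (sigmoid (trunc F (netOfParams ν d r L q.1 q.2.1))) q.2.2) :=
    measurable_bdens.comp ((hsm.comp h2).prodMk (by fun_prop))
  have h4 : Measurable (fun q : (ParamIdx d r L → ℝ) × ((Fin d → ℝ) × ℝ) => bdens (sigmoid (f₀ q.2.1)) q.2.2) :=
    measurable_bdens.comp ((hsm.comp (hf.comp (by fun_prop))).prodMk (by fun_prop))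
  exact (h3.div h4).ennreal_ofReal

lemma chi_pow (a y : ℝ) (n : ℕ) (h : n * a ≤ y) : (ENNReal.ofReal (Real.exp a)) ^ n ≤ ENNReal.ofReal (Real.exp y) := by
  rw [← ENNReal.ofReal_pow (Real.exp_pos _).le, ← Real.exp_nat_mul]
  exact ENNReal.ofReal_le_ofReal (Real.exp_le_exp.2 h)

/-- `n * maxRate² ≤ n ε²`, i.e. the squared width is at most the exponent. -/
lemma rate_le {P : Finset (ℝ × ℕ)} (hP : P.Nonempty) (hpos : ∀ p ∈ P, 0 < p.1) (γ : ℝ) (hγ : 5 / 2 < γ) {n : ℕ} (hn : 1 ≤ n) (hl : 1 ≤ Real.log n) {x : ℝ}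
    (hx : x = maxWidthExp P hP n ^ 2 * Real.log n ^ (2 * γ)) : n * maxRate P hP n ^ 2 ≤ x := by
  rw [maxRate_mul hP hpos hn, hx]
  have : 1 ≤ Real.log n ^ (2 * γ) := Real.one_le_rpow hl (by linarith)
  nlinarith [sq_nonneg (maxWidthExp P hP n)]


theorem gauss_part
    (a : ℝ) (ha : 1 ≤ a) (d : ℕ) (ν : ℝ) (hν0 : 0 ≤ ν) (hν1 : ν < 1)
    (q : ℕ) (N : ℕ → ℕ) (P : Finset (ℝ × ℕ)) (hP : P.Nonempty) (hpos : ∀ p ∈ P, 0 < p.1 ∧ 1 ≤ p.2)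
    (K F CLip : ℝ) (hF : 1 ≤ F) (hCLip : 1 ≤ CLip) (s : ℝ) (hs : 0 < s)
    (f₀ : (Fin d → ℝ) → ℝ) (hf₀ : followsHCS a d q N P K F CLip f₀)
    (PX : Measure (Fin d → ℝ)) [IsProbabilityMeasure PX] (hPXsupp : PX (cube a d) = 1)
    [hμ : IsProbabilityMeasure (gaussRegLaw d PX f₀ (Real.toNNReal s))]
    (CL : ℝ) (hCL : 0 < CL)
    (Prθ : ∀ n r : ℕ, Measure (ParamIdx d r (Ldepth CL n) → ℝ))
    [hPrθprob : ∀ n r, IsProbabilityMeasure (Prθ n r)]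
    (πθ : ∀ n r : ℕ, (ParamIdx d r (Ldepth CL n) → ℝ) → ℝ)
    (hπθdens : ∀ n r, Prθ n r = volume.withDensity fun θ => ENNReal.ofReal (πθ n r θ))
    (hπθlow : ∀ κ : ℝ, 0 < κ → ∃ δκ : ℝ, 0 < δκ ∧
      ∀ n r : ℕ, ∀ θ : ParamIdx d r (Ldepth CL n) → ℝ,
        (∀ i, |θ i| ≤ κ) →
          δκ ^ Fintype.card (ParamIdx d r (Ldepth CL n)) ≤ πθ n r θ)
    (Prσ : Measure ℝ) [hPrσprob : IsProbabilityMeasure Prσ]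
    (qσ : ℝ → ℝ) (hqσdens : Prσ = volume.withDensity fun s => ENNReal.ofReal (qσ s))
    (hqσcont : ContinuousOn qσ (Set.Ioo 0 (2 * s)))
    (hqσposOn : ∀ u ∈ Set.Ioo 0 (2 * s), 0 < qσ u)
    (γ : ℝ) (hγ : 5 / 2 < γ)
    (ε : ℕ → ℝ) (hε : ∀ n : ℕ, ε n = maxRate P hP n * Real.log n ^ γ)
    (M : ℕ → ℝ) (hM : Tendsto M atTop atTop) (δ : ℝ) (hδ : 0 < δ) :
      Tendsto
        (fun n : ℕ =>
          Measure.pi (fun _ : Fin n => gaussRegLaw d PX f₀ (Real.toNNReal s))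
            {D | ENNReal.ofReal δ <
              (∑' r : ℕ, widthWeight n r *
                ∫⁻ p in {p : (ParamIdx d r (Ldepth CL n) → ℝ) × ℝ | M n * ε n <
                    l2dist d PX
                      (fun x => trunc F (netOfParams ν d r (Ldepth CL n) p.1 x)) f₀ +
                    |p.2 - s|},
                  ENNReal.ofReal (gaussLik ν F d r (Ldepth CL n) D p)
                  ∂((Prθ n r).prod Prσ)) /
              (∑' r : ℕ, widthWeight n r *
                ∫⁻ p, ENNReal.ofReal (gaussLik ν F d r (Ldepth CL n) D p)
                  ∂((Prθ n r).prod Prσ))})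
        atTop (nhds 0) := by
  have hpos' : ∀ p ∈ P, 0 < p.1 := fun p hp => (hpos p hp).1
  obtain ⟨hfF, hfc⟩ := followsHCS_bound hf₀
  have hfm := hfc.measurable
  obtain ⟨hε0, hev⟩ := rate_facts hP hpos' γ hγ ε hε
  obtain ⟨m, hm, htest⟩ := gauss_htest hP hpos' hF f₀ hfm hfF PX hν1 hCL s hs γ hγ ε hε M hM
  obtain ⟨C', Cw, hC', hCw, hmass⟩ := prior_mass ha hP hpos hF hCLip hf₀ PX hPXsupp hν0 hν1 hCL Prθ πθ hπθdens hπθlow γ hγ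
  obtain ⟨c, t0, hc, ht0, hσ⟩ := sigma_mass Prσ qσ hqσdens s hs hqσcont hqσposOn
  obtain ⟨C0, hC0, hchi⟩ := gauss_chi d PX f₀ hfm F hF hfF s hs
  have hrate : ∀ᶠ n : ℕ in atTop, maxRate P hP n ≤ t0 := by
    have := tendsto_rate hP hpos' 0
    simp only [Real.rpow_zero, mul_one] at this
    exact this.eventually_le_const ht0
  have main := conc (gaussRegLaw d PX f₀ (Real.toNNReal s)) (fun n r => (ParamIdx d r (Ldepth CL n) → ℝ) × ℝ)
    (fun n r => (Prθ n r).prod Prσ)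
    (fun n r p z => gratio f₀ s (fun x => trunc F (netOfParams ν d r (Ldepth CL n) p.1 x)) p.2 z)
    (fun n r => meas_rho_gauss ν F d r _ f₀ hfm s)
    (fun n r p => lintegral_gratio_le PX f₀ hfm s hs _ ((continuous_trunc F).measurable.comp (measurable_netOfParams_right ν d r _ p.1)) p.2)
    (fun n r => {p | M n * ε n < l2dist d PX (fun x => trunc F (netOfParams ν d r (Ldepth CL n) p.1 x)) f₀ + |p.2 - s|})
    (fun n => maxWidthExp P hP n) (fun n => n * ε n ^ 2) m (hev.mono fun n h => h.2.2.2.2.2.1) γ hγ (hev.mono fun n h => h.2.2.1) hm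
    htest Cw hCw (C0 * (1 + C') + C' + |Real.log c| + 1) (by positivity) (by
      filter_upwards [hmass, hev, hrate] with n hB ⟨he0, heL, hx, hxn, hxl, hW1, hl1, hn1⟩ hrt
      obtain ⟨hlow2, hlow1⟩ := maxRate_lower hP hpos' hn1
      have hmx := rate_le hP hpos' γ hγ hn1 hl1 hx
      have hn0 : (0:ℝ) < n := by exact_mod_cast hn1
      generalize Cw * ⌈maxWidthExp P hP n⌉₊ = r0 at hB ⊢
      obtain ⟨B, hBm, hBd, hBp⟩ := hB
      rw [← hx] at hBp
      generalize hxd : (n:ℝ) * ε n ^ 2 = x at hBp hmx hxl hxn ⊢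
      generalize maxRate P hP n = mR at hBd hlow1 hlow2 hmx hrt ⊢
      have hmR : 0 < mR := lt_of_lt_of_le (by positivity) hlow1
      have hx1 : 1 ≤ x := by linarith
      refine ⟨B ×ˢ Set.Icc s (s + mR), ENNReal.ofReal (Real.exp (C0 * (mR ^ 2 + C' * mR ^ 2))), hBm.prod measurableSet_Icc, ?_, ?_, ?_, ENNReal.ofReal_ne_top, ?_, ?_⟩
      · rintro ⟨θ, v⟩ ⟨hθ, hv⟩ z
        refine ⟨?_, ENNReal.ofReal_ne_top⟩
        have : 0 < v := by linarith [hv.1]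
        simp only [gratio]
        rw [ne_eq, ENNReal.ofReal_eq_zero, not_le]
        exact div_pos (gpdf_pos _ _ _ this) (gpdf_pos _ _ _ hs)
      · rintro ⟨θ, v⟩ ⟨hθ, hv⟩
        refine (hchi _ ((continuous_trunc F).measurable.comp (measurable_netOfParams_right ν d r0 _ θ)) (fun x => trunc_abs_le (by linarith)) v mR hv.1 hv.2).trans ?_
        apply ENNReal.ofReal_le_ofReal
        apply Real.exp_le_exp.2
        have := hBd θ hθ
        simp only [Function.comp_apply]
        gcongr
      · rw [ne_eq, ENNReal.ofReal_eq_zero, not_le]; exact Real.exp_pos _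
      · apply chi_pow
        calc (n:ℝ) * (C0 * (mR ^ 2 + C' * mR ^ 2)) = C0 * (1 + C') * (n * mR ^ 2) := by ring
          _ ≤ C0 * (1 + C') * x := by gcongr
          _ ≤ _ := by
            have : 0 ≤ (C' + |Real.log c| + 1) * x := by positivity
            nlinarith
      · rw [Measure.prod_prod]
        refine le_trans ?_ (mul_le_mul' hBp (hσ mR hmR hrt))
        rw [← ENNReal.ofReal_mul (Real.exp_pos _).le]
        apply ENNReal.ofReal_le_ofReal
        calc Real.exp (-((C0 * (1 + C') + C' + |Real.log c| + 1) * x)) ≤ Real.exp (-(C' * x) + (Real.log c + - Real.log n)) := by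
              apply Real.exp_le_exp.2
              have h1 : - Real.log c ≤ |Real.log c| := neg_le_abs _
              have h2 : |Real.log c| ≤ |Real.log c| * x := le_mul_of_one_le_right (abs_nonneg _) hx1
              have h3 : 0 ≤ C0 * (1 + C') * x := by positivity
              linarith
          _ = Real.exp (-(C' * x)) * (c * (1 / n)) := by
              rw [Real.exp_add, Real.exp_add, Real.exp_neg (Real.log n), Real.exp_log hc, Real.exp_log hn0, one_div]
          _ ≤ _ := by gcongr) δ hδ
  refine main.congr fun n => ?_
  congr 1
  ext D
  simp only [Set.mem_setOf_eq]
  rw [ratio_cancel (A := fun r => (ParamIdx d r (Ldepth CL n) → ℝ) × ℝ) (widthWeight n) (fun r => (Prθ n r).prod Prσ)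
    (fun r => {p | M n * ε n < l2dist d PX (fun x => trunc F (netOfParams ν d r (Ldepth CL n) p.1 x)) f₀ + |p.2 - s|})
    (ENNReal.ofReal (∏ i, gpdf (f₀ (D i).1) s (D i).2))
    (by rw [ne_eq, ENNReal.ofReal_eq_zero, not_le]; exact Finset.prod_pos fun i _ => gpdf_pos _ _ _ hs) ENNReal.ofReal_ne_top
    (fun r p => ENNReal.ofReal (gaussLik ν F d r (Ldepth CL n) D p))
    (fun r p => ∏ i, gratio f₀ s (fun x => trunc F (netOfParams ν d r (Ldepth CL n) p.1 x)) p.2 (D i))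
    (fun r p => gauss_lik_eq ν F f₀ s hs D p)]

theorem bern_part
    (a : ℝ) (ha : 1 ≤ a) (d : ℕ) (ν : ℝ) (hν0 : 0 ≤ ν) (hν1 : ν < 1)
    (q : ℕ) (N : ℕ → ℕ) (P : Finset (ℝ × ℕ)) (hP : P.Nonempty) (hpos : ∀ p ∈ P, 0 < p.1 ∧ 1 ≤ p.2)
    (K F CLip : ℝ) (hF : 1 ≤ F) (hCLip : 1 ≤ CLip)
    (f₀ : (Fin d → ℝ) → ℝ) (hf₀ : followsHCS a d q N P K F CLip f₀)
    (PX : Measure (Fin d → ℝ)) [IsProbabilityMeasure PX] (hPXsupp : PX (cube a d) = 1)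
    [hμ : IsProbabilityMeasure (logisticLaw d PX f₀)]
    (CL : ℝ) (hCL : 0 < CL)
    (Prθ : ∀ n r : ℕ, Measure (ParamIdx d r (Ldepth CL n) → ℝ))
    [hPrθprob : ∀ n r, IsProbabilityMeasure (Prθ n r)]
    (πθ : ∀ n r : ℕ, (ParamIdx d r (Ldepth CL n) → ℝ) → ℝ)
    (hπθdens : ∀ n r, Prθ n r = volume.withDensity fun θ => ENNReal.ofReal (πθ n r θ))
    (hπθlow : ∀ κ : ℝ, 0 < κ → ∃ δκ : ℝ, 0 < δκ ∧
      ∀ n r : ℕ, ∀ θ : ParamIdx d r (Ldepth CL n) → ℝ,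
        (∀ i, |θ i| ≤ κ) →
          δκ ^ Fintype.card (ParamIdx d r (Ldepth CL n)) ≤ πθ n r θ)
    (γ : ℝ) (hγ : 5 / 2 < γ)
    (ε : ℕ → ℝ) (hε : ∀ n : ℕ, ε n = maxRate P hP n * Real.log n ^ γ)
    (M : ℕ → ℝ) (hM : Tendsto M atTop atTop) (δ : ℝ) (hδ : 0 < δ) :
      Tendsto
        (fun n : ℕ =>
          Measure.pi (fun _ : Fin n => logisticLaw d PX f₀)
            {D | ENNReal.ofReal δ <
              (∑' r : ℕ, widthWeight n r *
                ∫⁻ θ in {θ : ParamIdx d r (Ldepth CL n) → ℝ | M n * ε n <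
                    l2dist d PX
                      (fun x => sigmoid (trunc F (netOfParams ν d r (Ldepth CL n) θ x)))
                      (fun x => sigmoid (f₀ x))},
                  ENNReal.ofReal (bernLik ν F d r (Ldepth CL n) D θ) ∂(Prθ n r)) /
              (∑' r : ℕ, widthWeight n r *
                ∫⁻ θ, ENNReal.ofReal (bernLik ν F d r (Ldepth CL n) D θ)
                  ∂(Prθ n r))})
        atTop (nhds 0) := by
  have hpos' : ∀ p ∈ P, 0 < p.1 := fun p hp => (hpos p hp).1
  obtain ⟨hfF, hfc⟩ := followsHCS_bound hf₀
  have hfm := hfc.measurable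
  have hsm := continuous_sigmoid'.measurable
  have hb : ∀ u y, 0 < bdens (sigmoid u) y := fun u y => bdens_pos (sigmoid_pos' u) (sigmoid_lt_one' u) y
  have hmeasN : ∀ n r (θ : ParamIdx d r (Ldepth CL n) → ℝ), Measurable (fun x => trunc F (netOfParams ν d r (Ldepth CL n) θ x)) :=
    fun n r θ => (continuous_trunc F).measurable.comp (measurable_netOfParams_right ν d r _ θ)
  obtain ⟨hε0, hev⟩ := rate_facts hP hpos' γ hγ ε hε
  obtain ⟨m, hm, htest⟩ := bern_htest hP hpos' hF f₀ hfm hfF PX hν1 hCL γ hγ ε hε M hM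
  obtain ⟨C', Cw, hC', hCw, hmass⟩ := prior_mass ha hP hpos hF hCLip hf₀ PX hPXsupp hν0 hν1 hCL Prθ πθ hπθdens hπθlow γ hγ
  obtain ⟨C0, hC0, hchi⟩ := bern_chi d PX f₀ hfm F hF hfF
  have main := conc (logisticLaw d PX f₀) (fun n r => ParamIdx d r (Ldepth CL n) → ℝ) Prθ
    (fun n r θ z => bratio (fun x => sigmoid (f₀ x)) (fun x => sigmoid (trunc F (netOfParams ν d r (Ldepth CL n) θ x))) z)
    (fun n r => meas_rho_bern ν F d r _ f₀ hfm)
    (fun n r θ => lintegral_bratio_le PX f₀ hfm _ (hsm.comp (hmeasN n r θ)) (fun x => (sigmoid_pos' _).le) (fun x => (sigmoid_lt_one' _).le))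
    (fun n r => {θ | M n * ε n < l2dist d PX (fun x => sigmoid (trunc F (netOfParams ν d r (Ldepth CL n) θ x))) (fun x => sigmoid (f₀ x))})
    (fun n => maxWidthExp P hP n) (fun n => n * ε n ^ 2) m (hev.mono fun n h => h.2.2.2.2.2.1) γ hγ (hev.mono fun n h => h.2.2.1) hm
    htest Cw hCw (C0 * C' + C') (by positivity) (by
      filter_upwards [hmass, hev] with n hB ⟨he0, heL, hx, hxn, hxl, hW1, hl1, hn1⟩
      have hmx := rate_le hP hpos' γ hγ hn1 hl1 hx
      have hn0 : (0:ℝ) < n := by exact_mod_cast hn1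
      generalize Cw * ⌈maxWidthExp P hP n⌉₊ = r0 at hB ⊢
      obtain ⟨B, hBm, hBd, hBp⟩ := hB
      rw [← hx] at hBp
      generalize hxd : (n:ℝ) * ε n ^ 2 = x at hBp hmx hxl hxn ⊢
      generalize maxRate P hP n = mR at hBd hmx ⊢
      have hx1 : 1 ≤ x := by linarith
      refine ⟨B, ENNReal.ofReal (Real.exp (C0 * (C' * mR ^ 2))), hBm, ?_, ?_, ?_, ENNReal.ofReal_ne_top, ?_, ?_⟩
      · intro θ hθ z
        refine ⟨?_, ENNReal.ofReal_ne_top⟩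
        simp only [bratio]
        rw [ne_eq, ENNReal.ofReal_eq_zero, not_le]
        exact div_pos (hb _ _) (hb _ _)
      · intro θ hθ
        refine (hchi _ (hmeasN n r0 θ) (fun x => trunc_abs_le (by linarith))).trans ?_
        apply ENNReal.ofReal_le_ofReal
        apply Real.exp_le_exp.2
        have := hBd θ hθ
        gcongr
      · rw [ne_eq, ENNReal.ofReal_eq_zero, not_le]; exact Real.exp_pos _
      · apply chi_pow
        calc (n:ℝ) * (C0 * (C' * mR ^ 2)) = C0 * C' * (n * mR ^ 2) := by ring
          _ ≤ C0 * C' * x := by gcongr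
          _ ≤ _ := by
            have : 0 ≤ C' * x := by positivity
            nlinarith
      · refine le_trans ?_ hBp
        apply ENNReal.ofReal_le_ofReal
        apply Real.exp_le_exp.2
        have h3 : 0 ≤ C0 * C' * x := by positivity
        linarith) δ hδ
  refine main.congr fun n => ?_
  congr 1
  ext D
  simp only [Set.mem_setOf_eq]
  rw [ratio_cancel (A := fun r => ParamIdx d r (Ldepth CL n) → ℝ) (widthWeight n) (fun r => Prθ n r)
    (fun r => {θ | M n * ε n < l2dist d PX (fun x => sigmoid (trunc F (netOfParams ν d r (Ldepth CL n) θ x))) (fun x => sigmoid (f₀ x))})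
    (ENNReal.ofReal (∏ i, bdens (sigmoid (f₀ (D i).1)) (D i).2))
    (by rw [ne_eq, ENNReal.ofReal_eq_zero, not_le]; exact Finset.prod_pos fun i _ => hb _ _) ENNReal.ofReal_ne_top
    (fun r θ => ENNReal.ofReal (bernLik ν F d r (Ldepth CL n) D θ))
    (fun r θ => ∏ i, bratio (fun x => sigmoid (f₀ x)) (fun x => sigmoid (trunc F (netOfParams ν d r (Ldepth CL n) θ x))) (D i))
    (fun r θ => bern_lik_eq ν F f₀ D θ)]

/-- adaptive posterior concentration with a prior
`Π_r(r) ∝ exp(−(log n)^5 r²)` on the network width.  If the true function follows the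
hierarchical composition structure `H(N, P)`, the depth is `L_n = ⌈C̃_L log n⌉` with `C̃_L`
the depth constant of the hierarchical approximation lemma, and, conditionally on each
width `r`, the priors satisfy Assumption 1 (and Assumption 2 for the noise variance in the
Gaussian case), then for `ε_n = max_{(β',d') ∈ P} n^{−β'/(2β'+d')} (log n)^γ`, `γ > 5/2`,
and any `M_n → ∞`, the posterior mass of the bad set converges to `0` in
`P₀ⁿ`-probability, in both the Gaussian and the logistic regression models; the width
prior does not depend on `P`, so the rate is attained adaptively. -/
theorem adaptive_posterior_concentration_width_prior
    (a : ℝ) (ha : 1 ≤ a) (d : ℕ) (hd : 0 < d) (ν : ℝ) (hν0 : 0 ≤ ν) (hν1 : ν < 1)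
    (q : ℕ) (N : ℕ → ℕ) (P : Finset (ℝ × ℕ)) (hP : P.Nonempty)
    (βmin βmax : ℝ) (dmax : ℕ) (hβmin : 0 < βmin)
    (hPsub : ∀ p ∈ P, βmin ≤ p.1 ∧ p.1 ≤ βmax ∧ 1 ≤ p.2 ∧ p.2 ≤ dmax)
    (K F CLip : ℝ) (hK : 1 ≤ K) (hF : 1 ≤ F) (hCLip : 1 ≤ CLip)
    (σ₀ : ℝ) (hσ₀ : 0 < σ₀)
    -- the true function follows the hierarchical composition structure
    (f₀ : (Fin d → ℝ) → ℝ) (hf₀ : followsHCS a d q N P K F CLip f₀)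
    -- the covariate distribution, supported in the cube `[−a,a]^d`
    (PX : Measure (Fin d → ℝ)) (hPXprob : IsProbabilityMeasure PX)
    (hPXsupp : PX (cube a d) = 1)
    -- the law of one observation in the Gaussian regression model
    (μG : Measure ((Fin d → ℝ) × ℝ)) (hμGprob : IsProbabilityMeasure μG)
    (hμG : μG = gaussRegLaw d PX f₀ (Real.toNNReal (σ₀ ^ 2)))
    -- the law of one observation in the logistic regression model
    (μB : Measure ((Fin d → ℝ) × ℝ)) (hμBprob : IsProbabilityMeasure μB)
    (hμB : μB = logisticLaw d PX f₀)
    -- `C̃_L` is the depth constant from the hierarchical approximation lemma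
    (CL : ℝ) (hCL : 0 < CL)
    (happrox : ∃ Cr CB c₂ : ℝ, 0 < Cr ∧ 0 < CB ∧ 0 < c₂ ∧
      ∀ f : (Fin d → ℝ) → ℝ, followsHCS a d q N P K F CLip f →
        ∃ n₀ : ℕ, ∀ n : ℕ, n₀ ≤ n →
          ∃ g : (Fin d → ℝ) → ℝ,
            memDNN ν d ⌈CL * Real.logb 2 n⌉₊ (rwidthH Cr P hP n) CB g ∧
            ∀ x ∈ cube a d, |g x - f x| ≤ c₂ * maxRate P hP n)
    -- given the width `r`, the prior on the network parameters satisfies Assumption 1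
    (Prθ : ∀ n r : ℕ, Measure (ParamIdx d r (Ldepth CL n) → ℝ))
    (hPrθprob : ∀ n r, IsProbabilityMeasure (Prθ n r))
    (πθ : ∀ n r : ℕ, (ParamIdx d r (Ldepth CL n) → ℝ) → ℝ)
    (hπθmeas : ∀ n r, Measurable (πθ n r)) (hπθnn : ∀ n r θ, 0 ≤ πθ n r θ)
    (hπθdens : ∀ n r, Prθ n r = volume.withDensity fun θ => ENNReal.ofReal (πθ n r θ))
    (hπθlow : ∀ κ : ℝ, 0 < κ → ∃ δκ : ℝ, 0 < δκ ∧
      ∀ n r : ℕ, ∀ θ : ParamIdx d r (Ldepth CL n) → ℝ,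
        (∀ i, |θ i| ≤ κ) →
          δκ ^ Fintype.card (ParamIdx d r (Ldepth CL n)) ≤ πθ n r θ)
    -- the prior on the noise variance, satisfying Assumption 2
    (Prσ : Measure ℝ) (hPrσprob : IsProbabilityMeasure Prσ)
    (qσ : ℝ → ℝ) (hqσmeas : Measurable qσ) (hqσnn : ∀ s, 0 ≤ qσ s)
    (hqσdens : Prσ = volume.withDensity fun s => ENNReal.ofReal (qσ s))
    (hqσpos : Prσ {s | s ≤ 0} = 0)
    (hqσcont : ContinuousOn qσ (Set.Ioo 0 (2 * σ₀ ^ 2)))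
    (hqσposOn : ∀ s ∈ Set.Ioo 0 (2 * σ₀ ^ 2), 0 < qσ s)
    (hqσtail : ∃ C : ℝ, 0 < C ∧ ∃ K₀ : ℝ, ∀ K' : ℝ, K₀ ≤ K' →
      Prσ {s | K' < s} ≤ ENNReal.ofReal (C / K'))
    -- the rate `ε_n = max_{(β',d') ∈ P} n^{−β'/(2β'+d')} (log n)^γ` with `γ > 5/2`
    (γ : ℝ) (hγ : 5 / 2 < γ)
    (ε : ℕ → ℝ) (hε : ∀ n : ℕ, ε n = maxRate P hP n * Real.log n ^ γ)
    (M : ℕ → ℝ) (hM : Tendsto M atTop atTop) :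
    -- Gaussian regression case
    (∀ δ : ℝ, 0 < δ →
      Tendsto
        (fun n : ℕ =>
          Measure.pi (fun _ : Fin n => μG)
            {D | ENNReal.ofReal δ <
              (∑' r : ℕ, widthWeight n r *
                ∫⁻ p in {p : (ParamIdx d r (Ldepth CL n) → ℝ) × ℝ | M n * ε n <
                    l2dist d PX
                      (fun x => trunc F (netOfParams ν d r (Ldepth CL n) p.1 x)) f₀ +
                    |p.2 - σ₀ ^ 2|},
                  ENNReal.ofReal (gaussLik ν F d r (Ldepth CL n) D p)
                  ∂((Prθ n r).prod Prσ)) /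
              (∑' r : ℕ, widthWeight n r *
                ∫⁻ p, ENNReal.ofReal (gaussLik ν F d r (Ldepth CL n) D p)
                  ∂((Prθ n r).prod Prσ))})
        atTop (nhds 0)) ∧
    -- logistic regression case
    (∀ δ : ℝ, 0 < δ →
      Tendsto
        (fun n : ℕ =>
          Measure.pi (fun _ : Fin n => μB)
            {D | ENNReal.ofReal δ <
              (∑' r : ℕ, widthWeight n r *
                ∫⁻ θ in {θ : ParamIdx d r (Ldepth CL n) → ℝ | M n * ε n <
                    l2dist d PX
                      (fun x => sigmoid (trunc F (netOfParams ν d r (Ldepth CL n) θ x)))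
                      (fun x => sigmoid (f₀ x))},
                  ENNReal.ofReal (bernLik ν F d r (Ldepth CL n) D θ) ∂(Prθ n r)) /
              (∑' r : ℕ, widthWeight n r *
                ∫⁻ θ, ENNReal.ofReal (bernLik ν F d r (Ldepth CL n) D θ)
                  ∂(Prθ n r))})
        atTop (nhds 0)) := by
  have hpos : ∀ p ∈ P, 0 < p.1 ∧ 1 ≤ p.2 := fun p hp => ⟨lt_of_lt_of_le hβmin (hPsub p hp).1, (hPsub p hp).2.2.1⟩
  subst hμG hμB
  refine ⟨fun δ hδ => ?_, fun δ hδ => ?_⟩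
  · exact gauss_part a ha d ν hν0 hν1 q N P hP hpos K F CLip hF hCLip (σ₀ ^ 2) (by positivity) f₀ hf₀ PX hPXsupp CL hCL Prθ πθ
      hπθdens hπθlow Prσ qσ hqσdens hqσcont hqσposOn γ hγ ε hε M hM δ hδ
  · exact bern_part a ha d ν hν0 hν1 q N P hP hpos K F CLip hF hCLip f₀ hf₀ PX hPXsupp CL hCL Prθ πθ
      hπθdens hπθlow γ hγ ε hε M hM δ hδ
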